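/- Let k be a number field, let r ≥ 5 be an integer, let a₁,…,a_r ∈ k^×, and let f ∈ k[t] be a separable polynomial. Then the following three assertions are equivalent. (A) There exist g₁,…,g_r ∈ k[t] with f = a₁·g₁² + ⋯ + a_r·g_r². (A') There exist g₁,…,g_r ∈ k(t) with f = a₁·g₁² + ⋯ + a_r·g_r². (B) Either (i) for every ring homomorphism σ : k → ℝ there exist indices i and j with σ(a_i) > 0 and σ(a_j) < 0; or (ii) for every ring homomorphism σ : k → ℝ with σ(a_i) > 0 for all i (resp. with σ(a_i) < 0 for all i), the real polynomial σ(f), obtained by applying σ to the coefficients of f, satisfies σ(f)(x) ≥ 0 for all x ∈ ℝ (resp. σ(f)(x) ≤ 0 for all x ∈ ℝ), and moreover either (a) the degree of f is divisible by 4, or (b) for every ring homomorphism σ : k → ℝ such that exactly one index i satisfies σ(a_i) < 0 (resp. exactly one index i satisfies σ(a_i) > 0), there exists x ∈ ℝ with σ(f)(x) > 0 (resp. with σ(f)(x) < 0). -/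

import Mathlib

set_option linter.unusedSectionVars false

namespace Pourchet

open QuadraticAlgebra

section QuadraticIndex

variable {F : Type*} [Field F]

/-- Squaring on a commutative group. -/
abbrev sq (G : Type*) [CommGroup G] : G →* G := powMonoidHom 2

lemma mem_map_sq {G : Type*} [CommGroup G] {H : Subgroup G} {x : G} :
    x ∈ H.map (sq G) ↔ ∃ y ∈ H, y ^ 2 = x := by simp [Subgroup.mem_map]

/-- The embedding of unit groups for a quadratic extension. -/
abbrev unitsIncl (a : F) : Fˣ →* (QuadraticAlgebra F a 0)ˣ :=
  Units.map (algebraMap F (QuadraticAlgebra F a 0)).toMonoidHom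

/-- The norm map on unit groups for a quadratic extension. -/
abbrev unitsNorm (a : F) : (QuadraticAlgebra F a 0)ˣ →* Fˣ := Units.map QuadraticAlgebra.norm

lemma coe_unitsNorm {a : F} (x : (QuadraticAlgebra F a 0)ˣ) :
    ((unitsNorm a x : Fˣ) : F) = (x : QuadraticAlgebra F a 0).re ^ 2
      - a * (x : QuadraticAlgebra F a 0).im ^ 2 := by
  simp [norm_def]; ring

lemma coe_unitsIncl_unitsNorm {a : F} (x : (QuadraticAlgebra F a 0)ˣ) :
    ((unitsIncl a (unitsNorm a x) : (QuadraticAlgebra F a 0)ˣ) : QuadraticAlgebra F a 0) =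
      x * star (x : QuadraticAlgebra F a 0) := by
  simp [algebraMap_norm_eq_mul_star]

lemma unitsNorm_unitsIncl {a : F} (x : Fˣ) : unitsNorm a (unitsIncl a x) = x ^ 2 := by
  ext; simp

theorem quadratic_index [NeZero (2 : F)] (a : F) [Fact (∀ r : F, r ^ 2 ≠ a + 0 * r)]
    (E : Subgroup (QuadraticAlgebra F a 0)ˣ) (E0 : Subgroup Fˣ) (h1 : E.comap (unitsIncl a) = E0)
    (h2 : E.map (unitsNorm a) ≤ E0)
    (hω : ∃ w ∈ E, (w : QuadraticAlgebra F a 0) = ⟨0, 1⟩)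
    (h90 : ∀ e ∈ E, unitsNorm a e = 1 → ∃ y ∈ E, e * unitsIncl a (unitsNorm a y) = y ^ 2) :
    2 * (E.map (unitsNorm a)).relIndex E0 * (E.map (sq _)).relIndex E =
      ((E0.map (sq _)).relIndex E0) ^ 2 := by
  have hsq : ∀ r : F, r ^ 2 ≠ a := fun r h ↦ (Fact.out : ∀ r : F, r ^ 2 ≠ a + 0 * r) r (by simpa)
  have ha : a ≠ 0 := fun h ↦ hsq 0 (by simp [h])
  have h1' : ∀ x, unitsIncl a x ∈ E ↔ x ∈ E0 := fun x ↦ by rw [← h1]; rfl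
  have hle : E0.map (sq _) ≤ E.map (unitsNorm a) := by
    rintro _ ⟨x, hx, rfl⟩
    exact ⟨unitsIncl a x, (h1' x).2 hx, unitsNorm_unitsIncl x⟩
  have hle2 : E0.map (unitsIncl a) ⊔ E.map (sq _) ≤ E := by
    refine sup_le ?_ ?_
    · rintro _ ⟨x, hx, rfl⟩; exact (h1' x).2 hx
    · rintro _ ⟨x, hx, rfl⟩; exact E.pow_mem hx 2
  have e1 := Subgroup.relIndex_mul_relIndex _ _ _ hle h2
  have e2 := Subgroup.relIndex_mul_relIndex _ _ _
    (le_sup_right : E.map (sq _) ≤ E0.map (unitsIncl a) ⊔ E.map (sq _)) hle2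
  have e3 : ((E0.map (sq _)).comap (unitsNorm a)) ⊓ E = E0.map (unitsIncl a) ⊔ E.map (sq _) := by
    apply le_antisymm
    · rintro x ⟨⟨y, hy, hxy⟩, hx⟩
      have hx' : x * (unitsIncl a y)⁻¹ ∈ E := E.mul_mem hx (E.inv_mem ((h1' y).2 hy))
      obtain ⟨z, hz, hz'⟩ := h90 _ hx' (by
        rw [map_mul, map_inv, unitsNorm_unitsIncl, ← hxy]; simp)
      rw [Subgroup.mem_sup]
      refine ⟨unitsIncl a (y * (unitsNorm a z)⁻¹), ⟨_, E0.mul_mem hy (E0.inv_mem (h2 ⟨z, hz, rfl⟩)),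
        rfl⟩, z ^ 2, ⟨z, hz, rfl⟩, ?_⟩
      rw [← hz', map_mul, map_inv]
      generalize unitsIncl a y = u, unitsIncl a (unitsNorm a z) = v
      rw [mul_comm x, mul_assoc, mul_assoc, mul_comm v⁻¹, mul_assoc, mul_assoc, mul_inv_cancel,
        mul_one, mul_inv_cancel_left]
    · refine sup_le ?_ ?_
      · rintro _ ⟨x, hx, rfl⟩
        exact ⟨⟨x, hx, (unitsNorm_unitsIncl x).symm⟩, (h1' x).2 hx⟩
      · rintro _ ⟨x, hx, rfl⟩
        exact ⟨⟨unitsNorm a x, h2 ⟨x, hx, rfl⟩, (map_pow _ _ _).symm⟩, E.pow_mem hx 2⟩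
  have e4 : (E0.map (sq _)).relIndex (E.map (unitsNorm a)) =
      (E0.map (unitsIncl a) ⊔ E.map (sq _)).relIndex E := by
    rw [← e3, Subgroup.inf_relIndex_right, Subgroup.relIndex_comap]
  have e5 : (E.map (sq _)).relIndex (E0.map (unitsIncl a) ⊔ E.map (sq _)) =
      ((E.map (sq _)).comap (unitsIncl a) ⊓ E0).relIndex E0 := by
    rw [Subgroup.relIndex_sup_right, Subgroup.inf_relIndex_right, Subgroup.relIndex_comap]
  obtain ⟨w, hw, hw'⟩ := hω
  have hw2 : w ^ 2 = unitsIncl a (Units.mk0 a ha) := by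
    ext <;> simp [hw', pow_two]
  have haE : Units.mk0 a ha ∈ E0 := (h1' _).1 (hw2 ▸ E.pow_mem hw 2)
  have e6 : (E0.map (sq _)).relIndex ((E.map (sq _)).comap (unitsIncl a) ⊓ E0) = 2 := by
    rw [Subgroup.relIndex_eq_two_iff]
    refine ⟨Units.mk0 a ha, ⟨⟨w, hw, hw2⟩, haE⟩, ?_⟩
    rintro b ⟨⟨e, he, heb⟩, hb⟩
    have heb' : (e : QuadraticAlgebra F a 0) ^ 2 = algebraMap F _ (b : F) := congrArg Units.val heb
    have hre : ((e : QuadraticAlgebra F a 0).re) ^ 2 + a * (e : QuadraticAlgebra F a 0).im ^ 2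
        = b := by
      have := congrArg QuadraticAlgebra.re heb'
      simp [pow_two] at this; rw [← this]; ring
    have him : (e : QuadraticAlgebra F a 0).re * (e : QuadraticAlgebra F a 0).im = 0 := by
      have := congrArg QuadraticAlgebra.im heb'
      simp [pow_two] at this
      have h2 : (2 : F) * ((e : QuadraticAlgebra F a 0).re * (e : QuadraticAlgebra F a 0).im) = 0 := by
        linear_combination this
      exact (mul_eq_zero.1 h2).resolve_left (NeZero.ne 2)
    have hnot : ¬ (b * Units.mk0 a ha ∈ E0.map (sq _) ∧ b ∈ E0.map (sq _)) := by
      rintro ⟨h, h'⟩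
      rw [Subgroup.mul_mem_cancel_left _ h'] at h
      obtain ⟨y, -, hy⟩ := h
      exact hsq y (by simpa using congrArg Units.val hy)
    rcases mul_eq_zero.1 him with h | h
    · left
      have : b * Units.mk0 a ha ∈ E0.map (sq _) := by
        have hne : (e : QuadraticAlgebra F a 0).im ≠ 0 := by
          rintro h0; apply b.ne_zero; rw [← hre, h, h0]; simp
        refine ⟨Units.mk0 (a * (e : QuadraticAlgebra F a 0).im) (mul_ne_zero ha hne), ?_, ?_⟩
        · refine (h1' _).1 ?_
          have : unitsIncl a (Units.mk0 (a * (e : QuadraticAlgebra F a 0).im) (mul_ne_zero ha hne))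
              = w * e := by
            ext <;> simp [hw', h]
          rw [this]; exact E.mul_mem hw he
        · ext; simp [← hre, h]; ring
      exact ⟨this, fun h' ↦ hnot ⟨this, h'⟩⟩
    · right
      have : b ∈ E0.map (sq _) := by
        have hne : (e : QuadraticAlgebra F a 0).re ≠ 0 := by
          rintro h0; apply b.ne_zero; rw [← hre, h, h0]; simp
        refine ⟨Units.mk0 ((e : QuadraticAlgebra F a 0).re) hne, ?_, ?_⟩
        · refine (h1' _).1 ?_
          have : unitsIncl a (Units.mk0 ((e : QuadraticAlgebra F a 0).re) hne) = e := by
            ext <;> simp [h]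
          rw [this]; exact he
        · ext; simp [← hre, h]
      exact ⟨this, fun h' ↦ hnot ⟨h', this⟩⟩
  have e7 := Subgroup.relIndex_mul_relIndex (E0.map (sq _))
    ((E.map (sq _)).comap (unitsIncl a) ⊓ E0) E0 (by
      rintro _ ⟨x, hx, rfl⟩
      exact ⟨⟨unitsIncl a x, (h1' x).2 hx, (map_pow _ _ _).symm⟩, E0.pow_mem hx 2⟩) inf_le_right
  rw [e6] at e7
  rw [← e2, e5, ← e4]
  conv_rhs => rw [pow_two]; enter [1]; rw [← e7]
  rw [← e1]; ring

/-- Hilbert 90 for the quadratic algebra. -/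
lemma hilbert90 [NeZero (2 : F)] {a : F} [Fact (∀ r : F, r ^ 2 ≠ a + 0 * r)]
    (e : (QuadraticAlgebra F a 0)ˣ) (he : unitsNorm a e = 1) :
    ∃ y : (QuadraticAlgebra F a 0)ˣ, e * unitsIncl a (unitsNorm a y) = y ^ 2 := by
  have he' : (e : QuadraticAlgebra F a 0) * star (e : QuadraticAlgebra F a 0) = 1 := by
    rw [← coe_unitsIncl_unitsNorm, he]; simp
  by_cases h : (1 : QuadraticAlgebra F a 0) + e = 0
  · have ha : a ≠ 0 := fun h ↦ (Fact.out : ∀ r : F, r ^ 2 ≠ a + 0 * r) 0 (by simp [h])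
    refine ⟨Units.mk0 ⟨0, 1⟩ (by simp [QuadraticAlgebra.ext_iff]), ?_⟩
    have : (e : QuadraticAlgebra F a 0) = -1 := by rw [← add_eq_zero_iff_eq_neg, add_comm]; exact h
    apply Units.ext
    rw [Units.val_mul, coe_unitsIncl_unitsNorm, this]
    ext <;> simp [pow_two]
  · refine ⟨Units.mk0 _ h, ?_⟩
    apply Units.ext
    rw [Units.val_mul, coe_unitsIncl_unitsNorm]
    have : star (1 + (e : QuadraticAlgebra F a 0)) = 1 + star (e : QuadraticAlgebra F a 0) := by
      simp
    simp only [Units.val_mk0, Units.val_pow_eq_pow_val, this]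
    linear_combination (1 + (e : QuadraticAlgebra F a 0)) * he'

end QuadraticIndex

end Pourchet

namespace Pourchet

section LocalBasics

variable {F : Type*} [NontriviallyNormedField F] [IsUltrametricDist F]

lemma norm_sub_le_max' (x y : F) : ‖x - y‖ ≤ max ‖x‖ ‖y‖ := by
  simpa [sub_eq_add_neg] using IsUltrametricDist.norm_add_le_max x (-y)

lemma norm_two_le_one : ‖(2 : F)‖ ≤ 1 := by
  simpa using IsUltrametricDist.norm_natCast_le_one F 2

lemma norm_eq_of_sub_lt {x y : F} (h : ‖x - y‖ < ‖y‖) : ‖x‖ = ‖y‖ := by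
  have := IsUltrametricDist.norm_add_eq_max_of_norm_ne_norm h.ne
  rwa [sub_add_cancel, max_eq_right h.le] at this

variable [ProperSpace F]

variable (F) in
lemma exists_uniformizer :
    ∃ p : F, p ≠ 0 ∧ ‖p‖ < 1 ∧ ∀ x : F, ‖x‖ < 1 → ‖x‖ ≤ ‖p‖ := by
  have hc : IsCompact (Metric.ball (0 : F) 1) :=
    (isCompact_closedBall 0 1).of_isClosed_subset (IsUltrametricDist.isClosed_ball 0 1)
      Metric.ball_subset_closedBall
  obtain ⟨p, hp, hmax⟩ := hc.exists_isMaxOn ⟨0, by simp⟩ continuous_norm.continuousOn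
  obtain ⟨y, hy0, hy1⟩ := NormedField.exists_norm_lt_one F
  refine ⟨p, ?_, by simpa using hp, fun x hx ↦ hmax (by simpa using hx)⟩
  rintro rfl
  have : ‖y‖ ≤ ‖(0 : F)‖ := hmax (show y ∈ Metric.ball (0 : F) 1 by simpa using hy1)
  simp at this; simp [this] at hy0

lemma exists_artin_root {t : F} (ht : ‖t‖ < 1) : ∃ z : F, ‖z‖ ≤ ‖t‖ ∧ z ^ 2 + z = t := by
  obtain ⟨z, hz, hmin⟩ := (isCompact_closedBall (0 : F) ‖t‖).exists_isMinOn ⟨0, by simp⟩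
    (f := fun z ↦ ‖z ^ 2 + z - t‖) (by fun_prop)
  have hz : ‖z‖ ≤ ‖t‖ := by simpa using hz
  refine ⟨z, hz, ?_⟩
  by_contra hne
  set r := z ^ 2 + z - t with hr
  have hr0 : r ≠ 0 := sub_ne_zero.2 hne
  have hrt : ‖r‖ ≤ ‖t‖ := by
    refine (norm_sub_le_max' _ _).trans (max_le ((IsUltrametricDist.norm_add_le_max _ _).trans
      (max_le ?_ hz)) le_rfl)
    rw [norm_pow]; nlinarith [norm_nonneg z, norm_nonneg t]
  have h1 : ‖r‖ ≤ ‖(z - r) ^ 2 + (z - r) - t‖ :=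
    hmin (show z - r ∈ Metric.closedBall (0 : F) ‖t‖ by
      simpa using (norm_sub_le_max' _ _).trans (max_le hz hrt))
  have h2 : (z - r) ^ 2 + (z - r) - t = r * (r - 2 * z) := by rw [hr]; ring
  have h3 : ‖r - 2 * z‖ ≤ ‖t‖ := by
    refine (norm_sub_le_max' _ _).trans (max_le hrt ?_)
    rw [norm_mul]; nlinarith [norm_nonneg z, norm_two_le_one (F := F)]
  rw [h2, norm_mul] at h1
  have : 0 < ‖r‖ := norm_pos_iff.2 hr0
  nlinarith

/-- Hensel's lemma for squares. -/
lemma isSquare_of_norm_sub_one_lt {u : F} (hu : ‖u - 1‖ < ‖(4 : F)‖) : IsSquare u := by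
  have h4 : (4 : F) ≠ 0 := norm_pos_iff.1 ((norm_nonneg _).trans_lt hu)
  obtain ⟨z, -, hz⟩ := exists_artin_root (t := (u - 1) / 4) (by
    rw [norm_div, div_lt_one (norm_pos_iff.2 h4)]; exact hu)
  refine ⟨1 + 2 * z, ?_⟩
  have : z ^ 2 + z = (u - 1) / 4 := hz
  field_simp at this
  linear_combination -this

lemma norm_four : ‖(4 : F)‖ = ‖(2 : F)‖ ^ 2 := by rw [← norm_pow]; norm_num

lemma isSquare_of_norm_sub_lt {u v : F} (hv : IsSquare v) (h : ‖u - v‖ < ‖(4 : F)‖ * ‖v‖) :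
    IsSquare u := by
  have hv0 : v ≠ 0 := by
    rintro rfl
    simp only [norm_zero, mul_zero] at h
    exact absurd h (not_lt.2 (norm_nonneg _))
  have : IsSquare (u / v) := isSquare_of_norm_sub_one_lt (by
    rw [div_sub_one hv0, norm_div, div_lt_iff₀ (norm_pos_iff.2 hv0)]; exact h)
  simpa [hv0] using this.mul hv

lemma exists_norm_eq_zpow {p : F} (hp0 : p ≠ 0) (hp : ‖p‖ < 1)
    (hmax : ∀ x : F, ‖x‖ < 1 → ‖x‖ ≤ ‖p‖) {x : F} (hx : x ≠ 0) : ∃ n : ℤ, ‖x‖ = ‖p‖ ^ n := by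
  obtain ⟨n, hn1, hn2⟩ := exists_mem_Ioc_zpow (norm_pos_iff.2 hx)
    ((one_lt_inv₀ (norm_pos_iff.2 hp0)).2 hp)
  refine ⟨-(n + 1), ?_⟩
  rw [zpow_neg, ← inv_zpow]
  refine le_antisymm hn2 ?_
  by_contra! hlt
  have h1 : ‖x * p ^ (n + 1)‖ < 1 := by
    rw [norm_mul, norm_zpow]
    calc _ < ‖p‖⁻¹ ^ (n + 1) * ‖p‖ ^ (n + 1) := by
          gcongr
      _ = 1 := by rw [← mul_zpow, inv_mul_cancel₀ (by simpa), one_zpow]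
  have h2 := hmax _ h1
  rw [norm_mul, norm_zpow, zpow_add_one₀ (by simpa), ← mul_assoc] at h2
  have h3 : ‖x‖ * ‖p‖ ^ n ≤ 1 := by
    by_contra! h
    nlinarith [norm_pos_iff.2 hp0]
  rw [inv_zpow] at hn1
  have := zpow_pos (norm_pos_iff.2 hp0) n
  rw [inv_lt_iff_one_lt_mul₀ this] at hn1
  linarith [mul_comm ‖x‖ (‖p‖ ^ n)]

/-- The closed ball of radius `‖c‖` as an additive subgroup. -/
def ballA (c : F) : AddSubgroup F where
  carrier := {x | ‖x‖ ≤ ‖c‖}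
  zero_mem' := by simp
  add_mem' hx hy := (IsUltrametricDist.norm_add_le_max _ _).trans (max_le hx hy)
  neg_mem' := by simp

lemma mem_ballA {c x : F} : x ∈ ballA c ↔ ‖x‖ ≤ ‖c‖ := Iff.rfl

/-- The subgroup of units of norm one congruent to `1` modulo `c`. -/
def prU (c : F) : Subgroup Fˣ where
  carrier := {u | ‖(u : F)‖ = 1 ∧ ‖(u : F) - 1‖ ≤ ‖c‖}
  one_mem' := by simp
  mul_mem' {u v} hu hv := by
    refine ⟨by simp [hu.1, hv.1], ?_⟩
    have : ((u * v : Fˣ) : F) - 1 = u * (v - 1) + (u - 1) := by push_cast; ring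
    rw [this]
    refine (IsUltrametricDist.norm_add_le_max _ _).trans (max_le ?_ hu.2)
    rw [norm_mul, hu.1, one_mul]; exact hv.2
  inv_mem' {u} hu := by
    refine ⟨by simp [hu.1], ?_⟩
    have : ((u⁻¹ : Fˣ) : F) - 1 = -(((u⁻¹ : Fˣ) : F) * (u - 1)) := by
      rw [mul_sub]; simp
    rw [this, norm_neg, norm_mul]; simpa [hu.1] using hu.2

lemma mem_prU {c : F} {u : Fˣ} : u ∈ prU c ↔ ‖(u : F)‖ = 1 ∧ ‖(u : F) - 1‖ ≤ ‖c‖ := Iff.rfl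

lemma mem_prU_one {u : Fˣ} : u ∈ prU (1 : F) ↔ ‖(u : F)‖ = 1 := by
  refine ⟨fun h ↦ h.1, fun h ↦ ⟨h, (norm_sub_le_max' _ _).trans ?_⟩⟩
  simp [h]

lemma mem_prU_of_lt {c : F} (hc : ‖c‖ < 1) {u : Fˣ} (h : ‖(u : F) - 1‖ ≤ ‖c‖) : u ∈ prU c := by
  refine ⟨?_, h⟩
  have := norm_eq_of_sub_lt (x := (u : F)) (y := 1) (by simpa using h.trans_lt hc)
  simpa using this

lemma exists_finite_approx {c : F} (hc : c ≠ 0) (d : F) :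
    ∃ t : Finset F, ∀ x : F, ‖x‖ ≤ ‖d‖ → ∃ y ∈ t, ‖x - y‖ ≤ ‖c‖ := by
  obtain ⟨t, -, hfin, ht⟩ := (isCompact_closedBall (0 : F) ‖d‖).finite_cover_balls
    (norm_pos_iff.2 hc)
  refine ⟨hfin.toFinset, fun x hx ↦ ?_⟩
  have := ht (show x ∈ Metric.closedBall (0 : F) ‖d‖ by simpa using hx)
  simp only [Set.mem_iUnion, Metric.mem_ball, dist_eq_norm] at this
  obtain ⟨y, hy, hxy⟩ := this
  exact ⟨y, by simpa using hy, hxy.le⟩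

lemma relIndex_prU_ne_zero {c : F} (hc : c ≠ 0) : (prU c).relIndex (prU 1) ≠ 0 := by
  obtain ⟨t, ht⟩ := exists_finite_approx hc (1 : F)
  have hex : ∀ q : (prU (1 : F)) ⧸ (prU c).subgroupOf (prU 1), ∃ y ∈ t, ‖((q.out : Fˣ) : F) - y‖ ≤ ‖c‖ :=
    fun q ↦ ht _ (by simpa using q.out.2.1.le)
  choose f hf hfc using hex
  have hinj : Function.Injective (fun q ↦ (⟨f q, hf q⟩ : t)) := by
    intro q q' h
    have h : f q = f q' := congrArg Subtype.val h
    rw [← q.out_eq', ← q'.out_eq', QuotientGroup.eq, Subgroup.mem_subgroupOf]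
    have h1 : ‖((q.out : Fˣ) : F)‖ = 1 := q.out.2.1
    have h2 : ‖((q'.out : Fˣ) : F)‖ = 1 := q'.out.2.1
    refine ⟨by simp [h1, h2], ?_⟩
    have h3 : ‖((q'.out : Fˣ) : F) - ((q.out : Fˣ) : F)‖ ≤ ‖c‖ := by
      have : ((q'.out : Fˣ) : F) - ((q.out : Fˣ) : F) =
        (((q'.out : Fˣ) : F) - f q') - (((q.out : Fˣ) : F) - f q) := by rw [h]; ring
      rw [this]
      exact (norm_sub_le_max' _ _).trans (max_le (hfc q') (hfc q))
    have h4 : (((q.out⁻¹ * q'.out : prU (1 : F)) : Fˣ) : F) - 1 =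
        ((q.out : Fˣ) : F)⁻¹ * (((q'.out : Fˣ) : F) - ((q.out : Fˣ) : F)) := by
      rw [mul_sub, inv_mul_cancel₀ (Units.ne_zero _)]; simp
    rw [h4, norm_mul, norm_inv, h1]; simpa using h3
  have : Finite ((prU (1 : F)) ⧸ (prU c).subgroupOf (prU 1)) := Finite.of_injective _ hinj
  exact Subgroup.index_ne_zero_of_finite

lemma relIndex_ballA_ne_zero {c d : F} (hc : c ≠ 0) : (ballA c).relIndex (ballA d) ≠ 0 := by
  obtain ⟨t, ht⟩ := exists_finite_approx hc d
  have hex : ∀ q : (ballA d) ⧸ (ballA c).addSubgroupOf (ballA d), ∃ y ∈ t, ‖(q.out : F) - y‖ ≤ ‖c‖ :=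
    fun q ↦ ht _ q.out.2
  choose f hf hfc using hex
  have hinj : Function.Injective (fun q ↦ (⟨f q, hf q⟩ : t)) := by
    intro q q' h
    have h : f q = f q' := congrArg Subtype.val h
    rw [← q.out_eq', ← q'.out_eq', QuotientAddGroup.eq, AddSubgroup.mem_addSubgroupOf]
    have : ((-q.out + q'.out : ballA d) : F) = (((q'.out : F) - f q') - ((q.out : F) - f q)) := by
      push_cast; rw [h]; ring
    rw [this]
    exact (norm_sub_le_max' _ _).trans (max_le (hfc q') (hfc q))
  have : Finite ((ballA d) ⧸ (ballA c).addSubgroupOf (ballA d)) := Finite.of_injective _ hinj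
  exact AddSubgroup.index_ne_zero_of_finite

end LocalBasics

end Pourchet

namespace Pourchet

section SquareCount

variable {F : Type*} [NontriviallyNormedField F] [IsUltrametricDist F] [ProperSpace F] [CharZero F]

lemma norm_two_pos : 0 < ‖(2 : F)‖ := norm_pos_iff.2 two_ne_zero

lemma relIndex_prU_four {p : F} (hp0 : p ≠ 0) (hp : ‖p‖ < 1) :
    (prU (4 * p)).relIndex (prU (2 * p)) = (ballA (2 : F)).relIndex (ballA 1) := by
  have h2 := norm_two_pos (F := F)
  have h2' := norm_two_le_one (F := F)
  have hpp := norm_pos_iff.2 hp0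
  let f : prU (2 * p) →* Multiplicative (F ⧸ ballA (2 : F)) :=
    { toFun := fun u ↦ Multiplicative.ofAdd
        (QuotientAddGroup.mk ((((u : Fˣ) : F) - 1) / (2 * p)) : F ⧸ ballA (2 : F))
      map_one' := by simp
      map_mul' := fun u v ↦ by
        rw [← ofAdd_add, ← QuotientAddGroup.mk_add]
        congr 1
        rw [QuotientAddGroup.eq, mem_ballA]
        have : -((((u * v : prU (2 * p)) : Fˣ) : F) - 1) / (2 * p) +
            ((((u : Fˣ) : F) - 1) / (2 * p) + (((v : Fˣ) : F) - 1) / (2 * p)) =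
            -((((u : Fˣ) : F) - 1) * (((v : Fˣ) : F) - 1) / (2 * p)) := by
          push_cast; field_simp; ring
        rw [← neg_div, this, norm_neg, norm_div, norm_mul, div_le_iff₀ (by simp [hp0])]
        calc _ ≤ ‖2 * p‖ * ‖2 * p‖ := by gcongr; exacts [u.2.2, v.2.2]
          _ ≤ _ := by
            gcongr
            rw [norm_mul]; nlinarith }
  have hker : (prU (4 * p)).subgroupOf (prU (2 * p)) = f.ker := by
    ext u
    rw [Subgroup.mem_subgroupOf, MonoidHom.mem_ker]
    change _ ↔ (QuotientAddGroup.mk ((((u : Fˣ) : F) - 1) / (2 * p)) : F ⧸ ballA (2 : F)) = 0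
    rw [QuotientAddGroup.eq_zero_iff, mem_ballA, mem_prU, norm_div, div_le_iff₀ (by simp [hp0]),
      ← norm_mul, show (2 : F) * (2 * p) = 4 * p by ring]
    exact and_iff_right u.2.1
  let g : ballA (1 : F) →+ F ⧸ ballA (2 : F) :=
    (QuotientAddGroup.mk' (ballA (2 : F))).comp (ballA (1 : F)).subtype
  have hker' : (ballA (2 : F)).addSubgroupOf (ballA 1) = g.ker := by
    ext u
    rw [AddSubgroup.mem_addSubgroupOf, AddMonoidHom.mem_ker]
    exact (QuotientAddGroup.eq_zero_iff _).symm
  rw [Subgroup.relIndex, AddSubgroup.relIndex, hker, hker', Subgroup.index_ker,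
    AddSubgroup.index_ker]
  have : (f.range : Set (Multiplicative (F ⧸ ballA (2 : F)))) = (g.range : Set (F ⧸ ballA (2 : F))) := by
    ext x
    constructor
    · rintro ⟨u, rfl⟩
      refine ⟨⟨(((u : Fˣ) : F) - 1) / (2 * p), ?_⟩, rfl⟩
      rw [mem_ballA, norm_div, div_le_iff₀ (by simp [hp0])]
      simpa using u.2.2
    · rintro ⟨⟨y, hy⟩, rfl⟩
      rw [mem_ballA, norm_one] at hy
      have hlt : ‖2 * p‖ < 1 := by rw [norm_mul]; nlinarith
      have hy' : ‖2 * p * y‖ ≤ ‖2 * p‖ := by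
        rw [norm_mul]; exact mul_le_of_le_one_right (norm_nonneg _) hy
      have hne : 1 + 2 * p * y ≠ 0 := by
        intro h
        rw [eq_neg_of_add_eq_zero_right h] at hy'
        simp only [norm_neg, norm_one] at hy'
        linarith
      refine ⟨⟨Units.mk0 _ hne, mem_prU_of_lt hlt (by simpa using hy')⟩, ?_⟩
      change (QuotientAddGroup.mk _ : F ⧸ ballA (2 : F)) = QuotientAddGroup.mk _
      congr 1
      simp; field_simp
  exact congrArg (fun s : Set (F ⧸ ballA (2 : F)) ↦ Nat.card s) this

lemma relIndex_units_sq :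
    ((prU (1 : F)).map (sq _)).relIndex (prU 1) = 2 * (ballA (2 : F)).relIndex (ballA 1) := by
  obtain ⟨p, hp0, hp, -⟩ := exists_uniformizer F
  have h2 := norm_two_pos (F := F)
  have h2' := norm_two_le_one (F := F)
  have hpp := norm_pos_iff.2 hp0
  have h4 := norm_four (F := F)
  set U := prU (1 : F)
  set V := prU (4 * p)
  set W := prU (2 * p)
  set W' := V.comap (sq Fˣ) with hW'
  have hmW' : ∀ u : Fˣ, u ∈ W' ↔ ‖((u : F)) ^ 2‖ = 1 ∧ ‖(u : F) ^ 2 - 1‖ ≤ ‖4 * p‖ := by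
    intro u; rw [hW', Subgroup.mem_comap, mem_prU]; simp
  have hW'U : W' ≤ U := fun u hu ↦ by
    rw [mem_prU_one]
    have := ((hmW' u).1 hu).1
    rw [norm_pow] at this
    exact (pow_eq_one_iff_of_nonneg (norm_nonneg _) two_ne_zero).1 this
  have hlt4 : ‖4 * p‖ < ‖(4 : F)‖ := by
    rw [norm_mul, h4]; exact mul_lt_of_lt_one_right (pow_pos h2 2) hp
  have hle2 : ‖2 * p‖ < ‖(2 : F)‖ := by rw [norm_mul]; nlinarith
  have hVU : V ≤ U.map (sq _) := by
    intro v hv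
    obtain ⟨y, hy⟩ := isSquare_of_norm_sub_one_lt (hv.2.trans_lt hlt4)
    have hy0 : y ≠ 0 := by rintro rfl; simp at hy
    refine mem_map_sq.2 ⟨Units.mk0 y hy0, mem_prU_one.2 ?_, by ext; simp [hy, pow_two]⟩
    have := hv.1
    rw [hy, norm_mul, ← pow_two] at this
    exact (pow_eq_one_iff_of_nonneg (norm_nonneg _) two_ne_zero).1 this
  have hUU : U.map (sq _) ≤ U := by
    rintro _ ⟨x, hx, rfl⟩; exact U.pow_mem hx 2
  have hWW' : W ≤ W' := by
    intro u hu
    rw [hmW', norm_pow, hu.1]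
    refine ⟨one_pow _, ?_⟩
    rw [show (u : F) ^ 2 - 1 = (u - 1) * ((u - 1) + 2) by ring, norm_mul]
    have : ‖(u : F) - 1 + 2‖ ≤ ‖(2 : F)‖ := (IsUltrametricDist.norm_add_le_max _ _).trans
      (max_le (hu.2.trans hle2.le) le_rfl)
    calc _ ≤ ‖2 * p‖ * ‖(2 : F)‖ := by gcongr; exact hu.2
      _ = ‖4 * p‖ := by rw [← norm_mul]; congr 1; ring
  have hVW : V ≤ W := fun u hu ↦ ⟨hu.1, hu.2.trans (by
    rw [norm_mul, norm_mul, h4, pow_two]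
    exact mul_le_mul_of_nonneg_right (mul_le_of_le_one_left h2.le h2') hpp.le)⟩
  have e1 := Subgroup.relIndex_mul_relIndex _ _ _ hVU hUU
  have e2 := Subgroup.relIndex_mul_relIndex _ _ _ hVW hWW'
  have e3 := Subgroup.relIndex_mul_relIndex _ _ _ (hVW.trans hWW') hW'U
  have e4 : W'.relIndex U = V.relIndex (U.map (sq _)) := Subgroup.relIndex_comap _ _ _
  have e5 : W.relIndex W' = 2 := by
    rw [Subgroup.relIndex_eq_two_iff]
    refine ⟨-1, (hmW' _).2 (by simp), fun b hb ↦ ?_⟩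
    have hbU := mem_prU_one.1 (hW'U hb)
    have hb := ((hmW' b).1 hb).2
    have i1 : b * -1 ∈ W ↔ ‖(b : F) + 1‖ ≤ ‖2 * p‖ := by
      rw [mem_prU, ← norm_neg ((b : F) + 1)]; simp [hbU, sub_eq_add_neg, add_comm]
    have i2 : b ∈ W ↔ ‖(b : F) - 1‖ ≤ ‖2 * p‖ := by
      rw [mem_prU]; simp [hbU]
    have h3 : ‖(2 : F)‖ ≤ max ‖(b : F) + 1‖ ‖(b : F) - 1‖ := by
      have := norm_sub_le_max' ((b : F) + 1) (b - 1)
      rwa [show ((b : F) + 1) - (b - 1) = 2 by ring] at this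
    rw [i1, i2]
    have h5 : ‖(b : F) + 1‖ * ‖(b : F) - 1‖ ≤ ‖2 * p‖ * ‖(2 : F)‖ := by
      rw [← norm_mul, ← norm_mul]
      convert hb using 2 <;> ring
    by_cases hc : ‖(b : F) - 1‖ ≤ ‖2 * p‖
    · refine Or.inr ⟨hc, fun h ↦ ?_⟩
      have := h3.trans (max_le h hc); linarith
    · refine Or.inl ⟨?_, hc⟩
      by_contra h
      rw [not_le] at h hc
      have hp2 : 0 ≤ ‖2 * p‖ := norm_nonneg _
      rcases le_max_iff.1 h3 with h' | h' <;> nlinarith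
  have e6 : W'.relIndex U ≠ 0 := by
    intro h
    have h4p : (4 * p : F) ≠ 0 := by simp [hp0]
    exact relIndex_prU_ne_zero h4p (by rw [← e3, h, mul_zero])
  rw [← e3, e4, ← e2, e5, relIndex_prU_four hp0 hp, mul_comm] at e1
  rw [e4] at e6
  linarith [Nat.eq_of_mul_eq_mul_right (Nat.pos_of_ne_zero e6) e1]

lemma norm_pow_two_inj {p x : F} (hp0 : p ≠ 0) (hp : ‖p‖ < 1) {n : ℤ} (hx : ‖x‖ = ‖p‖ ^ n)
    {m : ℤ} (h : ‖x‖ = ‖p‖ ^ m) : n = m :=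
  zpow_right_injective₀ (norm_pos_iff.2 hp0) hp.ne (hx.symm.trans h)

/-- The number of square classes of a local field. -/
theorem relIndex_sq : ((⊤ : Subgroup Fˣ).map (sq _)).relIndex ⊤ =
    4 * (ballA (2 : F)).relIndex (ballA 1) := by
  obtain ⟨p, hp0, hp, hmax⟩ := exists_uniformizer F
  set T := (⊤ : Subgroup Fˣ).map (sq _)
  set U := prU (1 : F)
  have hTU : T ⊓ U = U.map (sq _) := by
    ext x
    constructor
    · rintro ⟨hx, hxU⟩
      obtain ⟨y, -, rfl⟩ := mem_map_sq.1 hx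
      refine mem_map_sq.2 ⟨y, mem_prU_one.2 ?_, rfl⟩
      have := mem_prU_one.1 hxU
      rw [Units.val_pow_eq_pow_val, norm_pow] at this
      exact (pow_eq_one_iff_of_nonneg (norm_nonneg _) two_ne_zero).1 this
    · intro hx
      obtain ⟨y, hy, rfl⟩ := mem_map_sq.1 hx
      exact ⟨mem_map_sq.2 ⟨y, trivial, rfl⟩, U.pow_mem hy 2⟩
  have e1 : T.relIndex (T ⊔ U) = 2 * (ballA (2 : F)).relIndex (ballA 1) := by
    rw [sup_comm, Subgroup.relIndex_sup_right, ← Subgroup.inf_relIndex_right, hTU, relIndex_units_sq]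
  have hev : ∀ x : Fˣ, x ∈ T ⊔ U ↔ ∃ n : ℤ, ‖(x : F)‖ = ‖p‖ ^ (2 * n) := by
    intro x
    rw [Subgroup.mem_sup]
    constructor
    · rintro ⟨y, hy, z, hz, rfl⟩
      obtain ⟨y, -, rfl⟩ := mem_map_sq.1 hy
      obtain ⟨n, hn⟩ := exists_norm_eq_zpow hp0 hp hmax y.ne_zero
      refine ⟨n, ?_⟩
      rw [Units.val_mul, norm_mul, mem_prU_one.1 hz, mul_one, Units.val_pow_eq_pow_val, norm_pow, hn,
        ← zpow_natCast, ← zpow_mul, mul_comm]; rfl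
    · rintro ⟨n, hn⟩
      set y := (Units.mk0 p hp0) ^ n
      refine ⟨y ^ 2, mem_map_sq.2 ⟨y, trivial, rfl⟩, (y ^ 2)⁻¹ * x, mem_prU_one.2 ?_, by simp⟩
      rw [Units.val_mul, norm_mul, hn, Units.val_inv_eq_inv_val, norm_inv, Units.val_pow_eq_pow_val,
        Units.val_zpow_eq_zpow_val, norm_pow, norm_zpow, Units.val_mk0, ← zpow_natCast, ← zpow_mul,
        mul_comm n]
      exact inv_mul_cancel₀ (zpow_ne_zero _ (by simpa))
  have e2 : (T ⊔ U).relIndex ⊤ = 2 := by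
    rw [Subgroup.relIndex_top_right, Subgroup.index_eq_two_iff]
    refine ⟨Units.mk0 p hp0, fun b ↦ ?_⟩
    obtain ⟨n, hn⟩ := exists_norm_eq_zpow hp0 hp hmax b.ne_zero
    have hn1 : ‖((b * Units.mk0 p hp0 : Fˣ) : F)‖ = ‖p‖ ^ (n + 1) := by
      rw [Units.val_mul, norm_mul, hn, zpow_add_one₀ (by simpa)]; rfl
    rw [hev, hev]
    rcases Int.even_or_odd' n with ⟨m, rfl | rfl⟩
    · refine Or.inr ⟨⟨m, hn⟩, fun ⟨l, hl⟩ ↦ ?_⟩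
      have := norm_pow_two_inj hp0 hp hn1 hl; omega
    · refine Or.inl ⟨⟨m + 1, by rw [hn1]; congr 1; ring⟩, fun ⟨l, hl⟩ ↦ ?_⟩
      have := norm_pow_two_inj hp0 hp hn hl; omega
  rw [← Subgroup.relIndex_mul_relIndex _ _ _ (le_sup_left : T ≤ T ⊔ U) le_top, e1, e2]
  ring

end SquareCount

end Pourchet

namespace Pourchet

section Lattice

lemma relIndex_prod_self {A : Type*} [AddCommGroup A] {H' H : AddSubgroup A} (h : H' ≤ H) :
    (H'.prod H').relIndex (H.prod H) = H'.relIndex H ^ 2 := by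
  have e1 : (H'.prod H).relIndex (H.prod H) = H'.relIndex H := by
    have h1 : H'.prod H = H'.comap (AddMonoidHom.fst A A) ⊓ H.prod H := by
      ext ⟨x, y⟩
      simp only [AddSubgroup.mem_prod, AddSubgroup.mem_inf, AddSubgroup.mem_comap, AddMonoidHom.coe_fst]
      exact ⟨fun hx ↦ ⟨hx.1, h hx.1, hx.2⟩, fun hx ↦ ⟨hx.1, hx.2.2⟩⟩
    rw [h1, AddSubgroup.inf_relIndex_right, AddSubgroup.relIndex_comap]
    congr 1
    ext x
    simp only [AddSubgroup.mem_map, AddSubgroup.mem_prod, AddMonoidHom.coe_fst]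
    exact ⟨by rintro ⟨y, hy, rfl⟩; exact hy.1, fun hx ↦ ⟨(x, 0), ⟨hx, H.zero_mem⟩, rfl⟩⟩
  have e2 : (H'.prod H').relIndex (H'.prod H) = H'.relIndex H := by
    have h1 : H'.prod H' = H'.comap (AddMonoidHom.snd A A) ⊓ H'.prod H := by
      ext ⟨x, y⟩
      simp only [AddSubgroup.mem_prod, AddSubgroup.mem_inf, AddSubgroup.mem_comap, AddMonoidHom.coe_snd]
      exact ⟨fun hx ↦ ⟨hx.2, hx.1, h hx.2⟩, fun hx ↦ ⟨hx.2.1, hx.1⟩⟩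
    rw [h1, AddSubgroup.inf_relIndex_right, AddSubgroup.relIndex_comap]
    congr 1
    ext x
    simp only [AddSubgroup.mem_map, AddSubgroup.mem_prod, AddMonoidHom.coe_snd]
    exact ⟨by rintro ⟨y, hy, rfl⟩; exact hy.2, fun hx ↦ ⟨(0, x), ⟨H'.zero_mem, hx⟩, rfl⟩⟩
  rw [← AddSubgroup.relIndex_mul_relIndex _ _ _ (AddSubgroup.prod_mono le_rfl h)
    (AddSubgroup.prod_mono h le_rfl), e1, e2, pow_two]

variable {F : Type*} [NontriviallyNormedField F] [IsUltrametricDist F] [ProperSpace F] [CharZero F]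

lemma relIndex_ballA_mul {c : F} (hc : c ≠ 0) (x y : F) :
    (ballA (c * x)).relIndex (ballA (c * y)) = (ballA x).relIndex (ballA y) := by
  have : ∀ z : F, ballA (c * z) = (ballA z).map (AddMonoidHom.mulLeft c) := by
    intro z
    ext w
    simp only [AddSubgroup.mem_map, mem_ballA, AddMonoidHom.coe_mulLeft]
    constructor
    · intro h
      refine ⟨w / c, ?_, mul_div_cancel₀ _ hc⟩
      rwa [norm_div, div_le_iff₀ (by simpa), mul_comm, ← norm_mul]
    · rintro ⟨v, hv, rfl⟩
      rw [norm_mul, norm_mul]; gcongr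
  rw [this, this, AddSubgroup.relIndex_map_map_of_injective _ _ (mul_right_injective₀ hc)]

lemma ballA_mono {x y : F} (h : ‖x‖ ≤ ‖y‖) : ballA x ≤ ballA y := fun _ hz ↦ le_trans hz h

lemma relIndex_ball_two_ext {M : Type*} [NontriviallyNormedField M] [IsUltrametricDist M]
    [ProperSpace M] [CharZero M] [NormedAlgebra F M] (e : M ≃ₗ[F] F × F) :
    (ballA (2 : M)).relIndex (ballA 1) = (ballA (2 : F)).relIndex (ballA 1) ^ 2 := by
  have : FiniteDimensional F M := .of_injective e.toLinearMap e.injective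
  let lat : F → AddSubgroup M := fun c ↦ ((ballA c).prod (ballA c)).comap e.toLinearMap.toAddMonoidHom
  have hlat : ∀ c x, x ∈ lat c ↔ ‖(e x).1‖ ≤ ‖c‖ ∧ ‖(e x).2‖ ≤ ‖c‖ := fun c x ↦ by
    simp only [lat, AddSubgroup.mem_comap, AddSubgroup.mem_prod, mem_ballA]; rfl
  -- small multiples of the lattice are integral
  obtain ⟨c, hc0, hc⟩ : ∃ c : F, c ≠ 0 ∧ lat c ≤ ballA (1 : M) := by
    have h1 : Continuous e.symm.toLinearMap := LinearMap.continuous_of_finiteDimensional _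
    have h2 : ∀ᶠ x in nhds (0 : F × F), ‖e.symm x‖ < 1 :=
      (h1.norm.tendsto' 0 0 (by simp)).eventually_lt_const one_pos
    obtain ⟨ε, hε, hb⟩ := Metric.eventually_nhds_iff.1 h2
    obtain ⟨c, hc0, hc⟩ := NormedField.exists_norm_lt F hε
    refine ⟨c, norm_pos_iff.1 hc0, fun x hx ↦ ?_⟩
    have hx := (hlat _ _).1 hx
    have := hb (y := e x) (by
      rw [dist_zero_right, Prod.norm_def]; exact max_lt (hx.1.trans_lt hc) (hx.2.trans_lt hc))
    rw [mem_ballA, norm_one]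
    simpa using this.le
  obtain ⟨d, hd0, hd⟩ : ∃ d : M, d ≠ 0 ∧ ballA d ≤ lat c := by
    have h1 : Continuous e.toLinearMap := LinearMap.continuous_of_finiteDimensional _
    have h2 : ∀ᶠ x in nhds (0 : M), ‖e x‖ < ‖c‖ :=
      (h1.norm.tendsto' 0 0 (by simp)).eventually_lt_const (norm_pos_iff.2 hc0)
    obtain ⟨ε, hε, hb⟩ := Metric.eventually_nhds_iff.1 h2
    obtain ⟨d, hd0, hd⟩ := NormedField.exists_norm_lt M hε
    refine ⟨d, norm_pos_iff.1 hd0, fun x hx ↦ (hlat _ _).2 ?_⟩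
    have := hb (y := x) (by rw [dist_zero_right]; exact (mem_ballA.1 hx).trans_lt hd)
    rw [Prod.norm_def, max_lt_iff] at this
    exact ⟨this.1.le, this.2.le⟩
  have h2 : (2 : M) ≠ 0 := two_ne_zero
  have e0 : (lat c).relIndex (ballA 1) ≠ 0 := fun h ↦
    relIndex_ballA_ne_zero hd0 (d := (1 : M)) (by
      rw [← AddSubgroup.relIndex_mul_relIndex _ _ _ hd hc, h, mul_zero])
  have map2 : (lat c).map (AddMonoidHom.mulLeft (2 : M)) = lat (2 * c) := by
    ext x
    simp only [AddSubgroup.mem_map, hlat, AddMonoidHom.coe_mulLeft]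
    have hs : ∀ y : M, e (2 * y) = (2 : F) • e y := fun y ↦ by
      rw [← map_smul, two_smul, two_mul]
    constructor
    · rintro ⟨y, ⟨hy1, hy2⟩, rfl⟩
      rw [hs]
      simp only [Prod.smul_fst, Prod.smul_snd, norm_smul, norm_mul]
      constructor <;> gcongr
    · rintro ⟨hx1, hx2⟩
      have hx : x = 2 * (x / 2) := by field_simp
      refine ⟨x / 2, ?_, hx.symm⟩
      rw [hx, hs] at hx1 hx2
      simp only [Prod.smul_fst, Prod.smul_snd, norm_smul, norm_mul] at hx1 hx2
      exact ⟨le_of_mul_le_mul_left hx1 norm_two_pos, le_of_mul_le_mul_left hx2 norm_two_pos⟩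
  have map2' : (ballA (1 : M)).map (AddMonoidHom.mulLeft (2 : M)) = ballA 2 := by
    ext w
    simp only [AddSubgroup.mem_map, mem_ballA, AddMonoidHom.coe_mulLeft]
    constructor
    · rintro ⟨v, hv, rfl⟩
      rw [norm_mul]; exact mul_le_of_le_one_right (norm_nonneg _) (by simpa using hv)
    · intro h
      exact ⟨w / 2, by rw [norm_div, norm_one, div_le_one norm_two_pos]; exact h, by field_simp⟩
  have e1 : (lat (2 * c)).relIndex (ballA 2) = (lat c).relIndex (ballA 1) := by
    rw [← map2, ← map2', AddSubgroup.relIndex_map_map_of_injective _ _ (mul_right_injective₀ h2)]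
  have hb2 : ballA (2 : M) ≤ ballA 1 := ballA_mono (by simpa using norm_two_le_one)
  have hc2 : ‖2 * c‖ ≤ ‖c‖ := by
    rw [norm_mul]; exact mul_le_of_le_one_left (norm_nonneg _) norm_two_le_one
  have hl2 : lat (2 * c) ≤ ballA 2 := by
    rw [← map2, ← map2']; exact AddSubgroup.map_mono hc
  have hl1 : lat (2 * c) ≤ lat c := fun x hx ↦
    (hlat _ _).2 ⟨((hlat _ _).1 hx).1.trans hc2, ((hlat _ _).1 hx).2.trans hc2⟩
  have e2 := AddSubgroup.relIndex_mul_relIndex _ _ _ hl2 hb2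
  have e3 := AddSubgroup.relIndex_mul_relIndex _ _ _ hl1 hc
  have e4 : (lat (2 * c)).relIndex (lat c) = (ballA (2 : F)).relIndex (ballA 1) ^ 2 := by
    simp only [lat]
    rw [AddSubgroup.relIndex_comap, AddSubgroup.map_comap_eq_self_of_surjective,
      relIndex_prod_self (ballA_mono hc2)]
    · congr 1
      conv_lhs => rw [mul_comm, ← mul_one c, mul_assoc, one_mul]
      exact relIndex_ballA_mul hc0 2 1
    · exact e.surjective
  rw [e1, ← e3, e4, mul_comm] at e2
  exact Nat.eq_of_mul_eq_mul_right (Nat.pos_of_ne_zero e0) e2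

end Lattice

end Pourchet

namespace Pourchet

/-- The group of nonzero values of the form `⟨1, -a⟩`. -/
def nrm {F : Type*} [Field F] (a : F) : Subgroup Fˣ where
  carrier := {x | ∃ p q : F, (x : F) = p ^ 2 - a * q ^ 2}
  one_mem' := ⟨1, 0, by simp⟩
  mul_mem' := by
    rintro x y ⟨p, q, h⟩ ⟨r, s, h'⟩
    exact ⟨p * r + a * q * s, p * s + q * r, by push_cast; rw [h, h']; ring⟩
  inv_mem' := by
    rintro x ⟨p, q, h⟩
    refine ⟨p * (x⁻¹ : Fˣ), q * (x⁻¹ : Fˣ), ?_⟩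
    rw [mul_pow, mul_pow, ← mul_assoc, ← sub_mul, ← h, pow_two, ← mul_assoc, Units.mul_inv, one_mul]

section
variable {F : Type*} [Field F]

lemma mem_nrm {a : F} {x : Fˣ} : x ∈ nrm a ↔ ∃ p q : F, (x : F) = p ^ 2 - a * q ^ 2 := Iff.rfl

lemma map_sq_le_nrm (a : F) : (⊤ : Subgroup Fˣ).map (sq _) ≤ nrm a := by
  rintro _ ⟨x, -, rfl⟩
  exact ⟨x, 0, by simp⟩

lemma nsq_fact {a : F} (ha : ¬ IsSquare a) : Fact (∀ r : F, r ^ 2 ≠ a + 0 * r) :=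
  ⟨fun r h ↦ ha ⟨r, by rw [← pow_two, h]; ring⟩⟩

lemma map_unitsNorm_top {a : F} [Fact (∀ r : F, r ^ 2 ≠ a + 0 * r)] :
    (⊤ : Subgroup (QuadraticAlgebra F a 0)ˣ).map (unitsNorm a) = nrm a := by
  ext x
  simp only [Subgroup.mem_map, Subgroup.mem_top, true_and, mem_nrm]
  constructor
  · rintro ⟨y, rfl⟩
    exact ⟨_, _, coe_unitsNorm y⟩
  · rintro ⟨p, q, h⟩
    have hne : (⟨p, q⟩ : QuadraticAlgebra F a 0) ≠ 0 := by
      intro h0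
      rw [QuadraticAlgebra.ext_iff] at h0
      simp only [QuadraticAlgebra.re_zero, QuadraticAlgebra.im_zero] at h0
      rw [h0.1, h0.2] at h
      simp at h
    exact ⟨Units.mk0 _ hne, by ext; rw [coe_unitsNorm, h]; rfl⟩

end

/-- A finite extension of a local field, with the spectral norm. -/
def Spec (F L : Type*) [Field F] := L

namespace Spec

variable (F L : Type*) [NontriviallyNormedField F] [IsUltrametricDist F] [ProperSpace F] [Field L]
  [Algebra F L] [FiniteDimensional F L]

noncomputable instance : NontriviallyNormedField (Spec F L) := spectralNorm.nontriviallyNormedField F L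

noncomputable instance : NormedAlgebra F (Spec F L) := spectralNorm.normedAlgebra F L

instance : FiniteDimensional F (Spec F L) := inferInstanceAs (FiniteDimensional F L)

instance : IsUltrametricDist (Spec F L) :=
  IsUltrametricDist.isUltrametricDist_of_isNonarchimedean_norm
    (isNonarchimedean_spectralNorm (K := F) (L := L))

instance : ProperSpace (Spec F L) := FiniteDimensional.proper F _

instance [CharZero F] : CharZero (Spec F L) :=
  charZero_of_injective_algebraMap (algebraMap F (Spec F L)).injective

end Spec

section

variable {F : Type*} [NontriviallyNormedField F] [IsUltrametricDist F] [ProperSpace F] [CharZero F]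

theorem relIndex_sq_quadratic (a : F) [Fact (∀ r : F, r ^ 2 ≠ a + 0 * r)] :
    ((⊤ : Subgroup (QuadraticAlgebra F a 0)ˣ).map (sq _)).relIndex ⊤ =
      4 * (ballA (2 : F)).relIndex (ballA 1) ^ 2 := by
  let e : Spec F (QuadraticAlgebra F a 0) ≃ₗ[F] F × F :=
    { toFun := fun x ↦ (QuadraticAlgebra.re x, QuadraticAlgebra.im x)
      invFun := fun x ↦ (⟨x.1, x.2⟩ : QuadraticAlgebra F a 0)
      map_add' := fun x y ↦ rfl
      map_smul' := fun c x ↦ by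
        have : c • x = (c • (show QuadraticAlgebra F a 0 from x) : QuadraticAlgebra F a 0) := rfl
        rw [this]; rfl
      left_inv := fun x ↦ rfl
      right_inv := fun x ↦ rfl }
  have h := relIndex_sq (F := Spec F (QuadraticAlgebra F a 0))
  rw [relIndex_ball_two_ext e] at h
  exact h

/-- The norm group of a quadratic extension of a local field has index two. -/
theorem index_nrm {a : F} (ha : ¬ IsSquare a) : (nrm a).index = 2 := by
  have := nsq_fact ha
  have ha0 : a ≠ 0 := by rintro rfl; exact ha ⟨0, by simp⟩
  have h := quadratic_index a (⊤ : Subgroup (QuadraticAlgebra F a 0)ˣ) ⊤ rfl le_top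
    ⟨Units.mk0 ⟨0, 1⟩ (by simp [QuadraticAlgebra.ext_iff]), trivial, rfl⟩
    (fun e _ he ↦ by simpa using hilbert90 e he)
  rw [relIndex_sq_quadratic, relIndex_sq, map_unitsNorm_top, Subgroup.relIndex_top_right] at h
  have h0 : (ballA (2 : F)).relIndex (ballA 1) ≠ 0 := relIndex_ballA_ne_zero two_ne_zero
  have h1 : (nrm a).index * (8 * (ballA (2 : F)).relIndex (ballA 1) ^ 2) =
      2 * (8 * (ballA (2 : F)).relIndex (ballA 1) ^ 2) := by
    linarith
  exact Nat.eq_of_mul_eq_mul_right (by positivity) h1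

end

end Pourchet

namespace Pourchet

section Field

variable {F : Type*} [Field F]

lemma nrm_eq_top {a : F} [NeZero (2 : F)] (ha : IsSquare a) (ha0 : a ≠ 0) : nrm a = ⊤ := by
  obtain ⟨s, rfl⟩ := ha
  have hs : s ≠ 0 := by rintro rfl; simp at ha0
  have h2 : (2 : F) ≠ 0 := NeZero.ne _
  refine eq_top_iff.2 fun x _ ↦ ⟨(x + 1) / 2, (x - 1) / (2 * s), ?_⟩
  field_simp; ring

lemma mem_nrm_symm [NeZero (2 : F)] {a b : Fˣ} (h : b ∈ nrm (a : F)) : a ∈ nrm (b : F) := by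
  obtain ⟨p, q, h⟩ := h
  by_cases hq : q = 0
  · rw [nrm_eq_top ⟨p, by rw [h, hq]; ring⟩ b.ne_zero]; trivial
  · refine ⟨p / q, 1 / q, ?_⟩
    rw [h]; field_simp; ring

/-- `⟨a, b⟩` represents `a x` for `x` in the norm group of `-ab`. -/
lemma exists_of_mem_nrm {a b : F} {x : Fˣ} (h : x ∈ nrm (-(a * b))) :
    ∃ p q : F, a * x = a * p ^ 2 + b * q ^ 2 := by
  obtain ⟨p, q, h⟩ := h
  exact ⟨p, a * q, by rw [h]; ring⟩

end Field

section Local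

variable {F : Type*} [NontriviallyNormedField F] [IsUltrametricDist F] [ProperSpace F] [CharZero F]

lemma exists_mem_nrm_nonsquare (a b : F) (ha : a ≠ 0) (hb : b ≠ 0) :
    ∃ x ∈ nrm a, ¬ IsSquare (b * (x : F)) := by
  by_contra! hcon
  have h1 : nrm a ≤ (⊤ : Subgroup Fˣ).map (sq _) := by
    intro x hx
    obtain ⟨s, hs⟩ := hcon x hx
    obtain ⟨t, ht⟩ := hcon 1 (one_mem _)
    have ht' : b = t * t := by simpa using ht
    have ht0 : t ≠ 0 := by rintro rfl; simp at ht'; exact hb ht'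
    have hx' : (x : F) = (s / t) ^ 2 := by
      rw [div_pow, eq_div_iff (pow_ne_zero _ ht0), pow_two s, ← hs, ht']; ring
    refine mem_map_sq.2 ⟨Units.mk0 (s / t) fun h ↦ ?_, trivial, by ext; simp [hx']⟩
    rw [h] at hx'; simp at hx'
  have h2 := le_antisymm h1 (map_sq_le_nrm a)
  have h3 := relIndex_sq (F := F)
  have h0 : (ballA (2 : F)).relIndex (ballA 1) ≠ 0 := relIndex_ballA_ne_zero two_ne_zero
  rw [← h2, Subgroup.relIndex_top_right] at h3
  by_cases hs : IsSquare a
  · rw [nrm_eq_top hs ha, Subgroup.index_top] at h3; omega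
  · rw [index_nrm hs] at h3; omega

lemma isSquare_mul_of_nrm_eq {a b : F} (ha0 : a ≠ 0) (hb0 : b ≠ 0) (h : nrm a = nrm b) :
    IsSquare (a * b) := by
  by_contra hns
  have h2 := index_nrm hns
  have : nrm (a * b) = ⊤ := by
    refine eq_top_iff.2 fun x _ ↦ ?_
    have hmem : Units.mk0 a ha0 * Units.mk0 b hb0 ∈ nrm (x : F) := by
      by_cases hx : IsSquare (x : F)
      · rw [nrm_eq_top hx x.ne_zero]; trivial
      · rw [Subgroup.mul_mem_iff_of_index_two (index_nrm hx)]
        have key : ∀ c : Fˣ, c ∈ nrm (x : F) ↔ x ∈ nrm (c : F) :=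
          fun c ↦ ⟨mem_nrm_symm, mem_nrm_symm⟩
        rw [key, key, Units.val_mk0, Units.val_mk0, h]
    simpa using mem_nrm_symm hmem
  rw [this, Subgroup.index_top] at h2
  omega

/-- A quaternary form of nonsquare discriminant over a local field is isotropic. -/
theorem exists_isotropic_of_disc {a b c d : F} (ha : a ≠ 0) (hb : b ≠ 0) (hc : c ≠ 0) (hd : d ≠ 0)
    (h : ¬ IsSquare (a * b * c * d)) :
    ∃ x y z w : F, (x ≠ 0 ∨ y ≠ 0) ∧ a * x ^ 2 + b * y ^ 2 + c * z ^ 2 + d * w ^ 2 = 0 := by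
  have hab : -(a * b) ≠ 0 := by simp [ha, hb]
  have hcd : -(c * d) ≠ 0 := by simp [hc, hd]
  have key : ∃ x y z w : F, (x ∈ (Set.univ : Set F)) ∧ (a * x ^ 2 + b * y ^ 2 ≠ 0) ∧
      a * x ^ 2 + b * y ^ 2 = -(c * z ^ 2 + d * w ^ 2) := by
    suffices H : ∃ u v : Fˣ, u ∈ nrm (-(a * b)) ∧ v ∈ nrm (-(c * d)) ∧ a * (u : F) = -(c * v) by
      obtain ⟨u, v, hu, hv, huv⟩ := H
      obtain ⟨x, y, hxy⟩ := exists_of_mem_nrm hu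
      obtain ⟨z, w, hzw⟩ := exists_of_mem_nrm hv
      exact ⟨x, y, z, w, trivial, by rw [← hxy]; simp [ha], by rw [← hxy, ← hzw, huv]⟩
    set t : Fˣ := Units.mk0 (-(c / a)) (by simp [ha, hc]) with ht
    suffices H : ∃ v ∈ nrm (-(c * d)), v * t ∈ nrm (-(a * b)) by
      obtain ⟨v, hv, hvt⟩ := H
      exact ⟨v * t, v, hvt, hv, by simp [ht]; field_simp⟩
    by_cases h1 : IsSquare (-(a * b))
    · exact ⟨1, one_mem _, by rw [nrm_eq_top h1 hab]; trivial⟩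
    by_cases h2 : IsSquare (-(c * d))
    · exact ⟨t⁻¹, by rw [nrm_eq_top h2 hcd]; trivial, by simp⟩
    have i1 := index_nrm h1
    have i2 := index_nrm h2
    by_contra! hcon
    have h3 : nrm (-(c * d)) ≤ nrm (-(a * b)) := by
      intro v hv
      have n1 := hcon v hv
      have n2 := hcon 1 (one_mem _)
      rw [Subgroup.mul_mem_iff_of_index_two i1] at n1 n2
      by_contra hv'
      exact n1 (iff_of_false hv' fun ht ↦ n2 (iff_of_true (one_mem _) ht))
    have h4 : nrm (-(c * d)) = nrm (-(a * b)) := by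
      have := Subgroup.relIndex_mul_index h3
      rw [i1, i2] at this
      exact le_antisymm h3 (Subgroup.relIndex_eq_one.1 (by omega))
    have := isSquare_mul_of_nrm_eq hcd hab h4
    exact h (by rwa [show a * b * c * d = -(c * d) * -(a * b) by ring])
  obtain ⟨x, y, z, w, -, hne, he⟩ := key
  refine ⟨x, y, z, w, ?_, by rw [he]; ring⟩
  by_contra! h0
  exact hne (by simp [h0.1, h0.2])

lemma exists_natCast_add_one_lt : ∃ n : ℕ, ‖(n : F) + 1‖ < 1 := by
  obtain ⟨y, hy0, hy1⟩ := NormedField.exists_norm_lt_one F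
  obtain ⟨t, ht⟩ := exists_finite_approx (norm_pos_iff.1 hy0) (1 : F)
  choose f hf hfc using fun n : ℕ ↦ ht (n : F) (by
    simpa using IsUltrametricDist.norm_natCast_le_one F n)
  obtain ⟨m, n, hmn, h⟩ := Finite.exists_ne_map_eq_of_infinite (fun n ↦ (⟨f n, hf n⟩ : t))
  replace h : f m = f n := congrArg Subtype.val h
  wlog hlt : n < m generalizing m n
  · exact this n m hmn.symm h.symm (lt_of_le_of_ne (not_lt.1 hlt) hmn)
  refine ⟨m - n - 1, ?_⟩
  have : (((m - n - 1 : ℕ) : F)) + 1 = ((m : F) - f m) - ((n : F) - f n) := by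
    rw [h, Nat.cast_sub (by omega), Nat.cast_sub hlt.le]; push_cast; ring
  rw [this]
  exact (norm_sub_le_max' _ _).trans_lt (max_lt ((hfc m).trans_lt hy1) ((hfc n).trans_lt hy1))

/-- In a nondyadic local field, units are norms from unramified quadratic extensions. -/
theorem mem_nrm_of_norm_eq_one (h2 : ‖(2 : F)‖ = 1) {a : F} (ha : ‖a‖ = 1) {b : Fˣ}
    (hb : ‖(b : F)‖ = 1) : b ∈ nrm a := by
  have h4 : ‖(4 : F)‖ = 1 := by rw [norm_four, h2, one_pow]
  have ha0 : a ≠ 0 := norm_pos_iff.1 (by rw [ha]; exact one_pos)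
  by_cases hsa : IsSquare a
  · rw [nrm_eq_top hsa ha0]; trivial
  set U := prU (1 : F)
  have hU2 : (U.map (sq _)).relIndex U = 2 := by
    rw [relIndex_units_sq]
    have : ballA (2 : F) = ballA 1 := by ext; simp [mem_ballA, h2]
    rw [this, AddSubgroup.relIndex_self]
  have hle : U.map (sq _) ≤ nrm a ⊓ U := by
    intro x hx
    obtain ⟨y, hy, rfl⟩ := mem_map_sq.1 hx
    exact ⟨map_sq_le_nrm a (mem_map_sq.2 ⟨y, trivial, rfl⟩), U.pow_mem hy 2⟩
  have hmul := Subgroup.relIndex_mul_relIndex _ _ _ hle inf_le_right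
  rw [hU2] at hmul
  by_cases h1 : (nrm a ⊓ U).relIndex U = 1
  · exact ((Subgroup.relIndex_eq_one.1 h1) (mem_prU_one.2 hb)).1
  exfalso
  have h3 : (U.map (sq _)).relIndex (nrm a ⊓ U) = 1 := by
    have := Nat.dvd_of_mod_eq_zero (show 2 % (nrm a ⊓ U).relIndex U = 0 by rw [← hmul]; simp)
    rcases (Nat.dvd_prime Nat.prime_two).1 this with h | h
    · exact absurd h h1
    · rw [h] at hmul; omega
  have hsq : ∀ p q : F, IsSquare (p ^ 2 - a * q ^ 2) := by
    have aux : ∀ q : F, ‖q‖ ≤ 1 → IsSquare (1 - a * q ^ 2) := by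
      intro q hq
      have hn : ‖1 - a * q ^ 2‖ = 1 := by
        refine le_antisymm ((norm_sub_le_max' _ _).trans (max_le (by simp) ?_)) ?_
        · rw [norm_mul, norm_pow, ha, one_mul]; exact pow_le_one₀ (norm_nonneg _) hq
        · by_contra! hlt
          have h5 : IsSquare (a * q ^ 2) := isSquare_of_norm_sub_one_lt (by
            rw [h4, ← norm_neg]; simpa using hlt)
          have hq0 : q ≠ 0 := by rintro rfl; simp at hlt
          refine hsa ?_
          obtain ⟨s, hs⟩ := h5
          exact ⟨s / q, by field_simp; rw [hs]; ring⟩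
      have hne : 1 - a * q ^ 2 ≠ 0 := norm_pos_iff.1 (by rw [hn]; exact one_pos)
      obtain ⟨y, -, hy⟩ := mem_map_sq.1 (Subgroup.relIndex_eq_one.1 h3
        (show Units.mk0 _ hne ∈ nrm a ⊓ U from ⟨⟨1, q, by simp⟩, mem_prU_one.2 hn⟩))
      exact ⟨y, by simpa [pow_two] using (congrArg Units.val hy).symm⟩
    have auxa : IsSquare (-a) := by
      have hne : -a ≠ 0 := by simpa
      obtain ⟨y, -, hy⟩ := mem_map_sq.1 (Subgroup.relIndex_eq_one.1 h3
        (show Units.mk0 _ hne ∈ nrm a ⊓ U from ⟨⟨0, 1, by simp⟩, mem_prU_one.2 (by simpa)⟩))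
      exact ⟨y, by simpa [pow_two] using (congrArg Units.val hy).symm⟩
    obtain ⟨s, hs⟩ := auxa
    have hns : ‖s‖ = 1 := by
      have : ‖s‖ ^ 2 = 1 := by rw [pow_two, ← norm_mul, ← hs, norm_neg, ha]
      exact (pow_eq_one_iff_of_nonneg (norm_nonneg _) two_ne_zero).1 this
    have hs0 : s ≠ 0 := norm_pos_iff.1 (by rw [hns]; exact one_pos)
    intro p q
    by_cases hpq : p = 0 ∧ q = 0
    · simp [hpq.1, hpq.2]
    rcases le_total ‖q‖ ‖p‖ with hle | hle
    · have hp : p ≠ 0 := by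
        rintro rfl; simp at hle; exact hpq ⟨rfl, hle⟩
      have := aux (q / p) (by rw [norm_div]; exact div_le_one_of_le₀ hle (norm_nonneg _))
      obtain ⟨w, hw⟩ := this
      refine ⟨w * p, ?_⟩
      rw [show w * p * (w * p) = (w * w) * p ^ 2 by ring, ← hw]
      field_simp
    · have hq : q ≠ 0 := by
        rintro rfl; simp at hle; exact hpq ⟨hle, rfl⟩
      obtain ⟨w, hw⟩ := aux (p / (q * s ^ 2)) (by
        rw [norm_div, norm_mul, norm_pow, hns, one_pow, mul_one]; exact div_le_one_of_le₀ hle (norm_nonneg _))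
      refine ⟨w * q * s, ?_⟩
      have ha' : a = -(s * s) := by rw [← hs, neg_neg]
      rw [ha'] at hw ⊢
      have : w * q * s * (w * q * s) = (w * w) * (q * s) ^ 2 := by ring
      rw [this, ← hw]
      field_simp; ring
  have hma : IsSquare (-a) := by simpa using hsq 0 1
  obtain ⟨s, hs⟩ := hma
  have hs0 : s ≠ 0 := by rintro rfl; simp at hs; exact ha0 hs
  have hnat : ∀ n : ℕ, IsSquare (n : F) := by
    intro n
    induction n with
    | zero => simp
    | succ n ih =>
      obtain ⟨w, hw⟩ := ih
      have := hsq w (1 / s)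
      convert this using 1
      have ha' : a = -(s * s) := by rw [← hs, neg_neg]
      push_cast
      rw [ha', hw]; field_simp; ring
  obtain ⟨n, hn⟩ := exists_natCast_add_one_lt (F := F)
  have hn1 : ‖(n : F)‖ = 1 := by
    have := norm_eq_of_sub_lt (x := (n : F)) (y := -1) (by simpa using hn)
    simpa using this
  have hm1 : IsSquare (-1 : F) := isSquare_of_norm_sub_lt (hnat n) (by
    rw [h4, hn1, ← norm_neg]; simpa [add_comm] using hn)
  exact hsa (by simpa using hm1.mul ⟨s, hs⟩)

end Local

end Pourchet

namespace Pourchet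
open IsDedekindDomain NumberField
variable {k : Type*} [Field k] [NumberField k] (v : HeightOneSpectrum (𝓞 k))

/-- The normalized absolute value attached to a maximal ideal. -/
noncomputable abbrev fabs : AbsoluteValue k ℝ := NumberField.HeightOneSpectrum.adicAbv k v

/-- The embedding of a number field into one of its completions. -/
noncomputable abbrev toComp : k →+* v.adicCompletion k := algebraMap k (v.adicCompletion k)

lemma norm_toComp (x : k) : ‖toComp v x‖ = fabs v x := FinitePlace.norm_embedding v x

lemma fabs_int_le (x : 𝓞 k) : fabs v (x : k) ≤ 1 := by
  rw [← norm_toComp]; exact FinitePlace.norm_le_one k v x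

lemma fabs_int_lt {x : 𝓞 k} : fabs v (x : k) < 1 ↔ x ∈ v.asIdeal := by
  rw [← norm_toComp]; exact FinitePlace.norm_lt_one_iff_mem k v x

lemma fabs_int_eq {x : 𝓞 k} : fabs v (x : k) = 1 ↔ x ∉ v.asIdeal := by
  rw [← norm_toComp]; exact FinitePlace.norm_eq_one_iff_notMem k v x

lemma fabs_add_le (x y : k) : fabs v (x + y) ≤ max (fabs v x) (fabs v y) :=
  NumberField.HeightOneSpectrum.adicAbv_add_le_max k v x y

lemma denseRange_toComp : DenseRange (toComp v) :=
  HeightOneSpectrum.denseRange_algebraMap k v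

lemma exists_int_fabs_lt : ∃ p : 𝓞 k, (p : k) ≠ 0 ∧ fabs v (p : k) < 1 := by
  obtain ⟨p, hp, hp0⟩ := Submodule.exists_mem_ne_zero_of_ne_bot v.ne_bot
  exact ⟨p, by simpa using hp0, (fabs_int_lt v).2 hp⟩

lemma fabs_lt_of_valuation_lt {x y : k} (h : v.valuation k x < v.valuation k y) :
    fabs v x < fabs v y := by
  have := WithZeroMulInt.toNNReal_strictMono
    (NumberField.HeightOneSpectrum.one_lt_absNorm_nnreal v) h
  rw [NumberField.HeightOneSpectrum.adicAbv_def, NumberField.HeightOneSpectrum.adicAbv_def]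
  exact_mod_cast this

lemma fabs_le_of_valuation_le {x y : k} (h : v.valuation k x ≤ v.valuation k y) :
    fabs v x ≤ fabs v y := by
  have := (WithZeroMulInt.toNNReal_strictMono
    (NumberField.HeightOneSpectrum.one_lt_absNorm_nnreal v)).monotone h
  rw [NumberField.HeightOneSpectrum.adicAbv_def, NumberField.HeightOneSpectrum.adicAbv_def]
  exact_mod_cast this

lemma valuation_le_one_of_fabs {x : k} (h : fabs v x ≤ 1) : v.valuation k x ≤ 1 := by
  by_contra! hc
  have := fabs_lt_of_valuation_lt v (x := 1) (y := x) (by simpa using hc)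
  simp at this
  linarith

lemma exists_int_approx {x : k} (hx : fabs v x ≤ 1) {d : ℝ} (hd : 0 < d) :
    ∃ y : 𝓞 k, fabs v ((y : k) - x) < d := by
  obtain ⟨p, hp0, hp⟩ := exists_int_fabs_lt v
  obtain ⟨n, hn⟩ := exists_pow_lt_of_lt_one hd hp
  have h0 : v.valuation k ((p : k) ^ n) ≠ 0 := by
    rw [Ne, map_eq_zero]; exact pow_ne_zero _ hp0
  obtain ⟨y, hy⟩ := v.exists_valuation_sub_lt_of_integer (valuation_le_one_of_fabs v hx)
    (Units.mk0 _ h0)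
  refine ⟨y, lt_trans (fabs_lt_of_valuation_lt v (y := (p : k) ^ n) hy) ?_⟩
  rwa [map_pow]

noncomputable instance instNontriviallyNormedFieldComp :
    NontriviallyNormedField (v.adicCompletion k) where
  toNormedField := inferInstance
  non_trivial := by
    obtain ⟨p, hp0, hp⟩ := exists_int_fabs_lt v
    refine ⟨(toComp v p)⁻¹, ?_⟩
    rw [norm_inv, norm_toComp]
    exact (one_lt_inv₀ ((fabs v).pos hp0)).2 hp

instance instCharZeroComp : CharZero (v.adicCompletion k) :=
  charZero_of_injective_algebraMap (toComp v).injective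

lemma totallyBounded_closedBall :
    TotallyBounded (Metric.closedBall (0 : v.adicCompletion k) 1) := by
  rw [Metric.totallyBounded_iff]
  intro e he
  obtain ⟨p, hp0, hp⟩ := exists_int_fabs_lt v
  obtain ⟨n, hn⟩ := exists_pow_lt_of_lt_one he hp
  have hp0' : p ≠ 0 := by simpa using hp0
  have hfin : Finite (𝓞 k ⧸ Ideal.span {p ^ n}) :=
    Ideal.finiteQuotientOfFreeOfNeBot _ (by simp [hp0'])
  refine ⟨Set.range fun q : 𝓞 k ⧸ Ideal.span {p ^ n} => toComp v (Quotient.out q : 𝓞 k),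
    Set.finite_range _, ?_⟩
  intro x hx
  rw [mem_closedBall_zero_iff] at hx
  obtain ⟨y, hy⟩ := (denseRange_toComp v).exists_dist_lt x (lt_min he one_pos)
  rw [dist_eq_norm] at hy
  have hy1 : fabs v y ≤ 1 := by
    rw [← norm_toComp]
    have := norm_sub_le_max' x (x - toComp v y)
    rw [sub_sub_cancel] at this
    exact this.trans (max_le hx (hy.le.trans (min_le_right _ _)))
  obtain ⟨z, hz⟩ := exists_int_approx v hy1 he
  rw [Set.mem_iUnion₂]
  refine ⟨_, ⟨Ideal.Quotient.mk _ z, rfl⟩, ?_⟩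
  rw [mem_ball_iff_norm]
  set r := Quotient.out (Ideal.Quotient.mk (Ideal.span {p ^ n}) z)
  have hr : r - z ∈ Ideal.span {p ^ n} := by
    rw [← Ideal.Quotient.eq]; exact Quotient.out_eq _
  obtain ⟨c, hc⟩ := Ideal.mem_span_singleton'.1 hr
  have h1 : ‖toComp v y - toComp v z‖ < e := by
    rw [← map_sub, norm_toComp, (fabs v).map_sub]; exact hz
  have h2 : ‖toComp v z - toComp v r‖ < e := by
    rw [← map_sub, norm_toComp, (fabs v).map_sub, ← map_sub, ← hc, map_mul, map_mul, map_pow,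
      map_pow]
    exact (mul_le_of_le_one_left (by positivity) (fabs_int_le v c)).trans_lt hn
  have e1 : x - toComp v r = (x - toComp v y) +
    ((toComp v y - toComp v z) + (toComp v z - toComp v r)) := by ring
  rw [e1]
  exact (IsUltrametricDist.norm_add_le_max _ _).trans_lt (max_lt (hy.trans_le (min_le_left _ _))
    ((IsUltrametricDist.norm_add_le_max _ _).trans_lt (max_lt h1 h2)))

instance instProperSpaceComp : ProperSpace (v.adicCompletion k) := by
  have hc : IsCompact (Metric.closedBall (0 : v.adicCompletion k) 1) :=
    isCompact_iff_totallyBounded_isComplete.2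
      ⟨totallyBounded_closedBall v, Metric.isClosed_closedBall.isComplete⟩
  have : LocallyCompactSpace (v.adicCompletion k) :=
    IsCompact.locallyCompactSpace_of_mem_nhds_of_addGroup hc
      (Metric.closedBall_mem_nhds 0 zero_lt_one)
  exact .of_nontriviallyNormedField_of_weaklyLocallyCompactSpace (v.adicCompletion k)

lemma exists_frac {x : k} (hx : fabs v x ≤ 1) :
    ∃ n d : 𝓞 k, d ∉ v.asIdeal ∧ x * d = n := by
  obtain ⟨n, ⟨d, hd⟩, hnd⟩ :=
    v.exists_primeCompl_mul_eq_of_integer x (valuation_le_one_of_fabs v hx)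
  exact ⟨n, d, hd, hnd⟩

lemma exists_global_uniformizer : ∃ p : k, p ≠ 0 ∧ fabs v p < 1 ∧
    ∀ x : k, x ≠ 0 → ∃ n : ℤ, fabs v x = fabs v p ^ n := by
  obtain ⟨q, hq0, hq1, hq⟩ := exists_uniformizer (F := v.adicCompletion k)
  obtain ⟨p, hp⟩ := (denseRange_toComp v).exists_dist_lt q (norm_pos_iff.2 hq0)
  rw [dist_eq_norm, norm_sub_rev] at hp
  have h := norm_eq_of_sub_lt hp
  rw [norm_toComp] at h
  refine ⟨p, ?_, h ▸ hq1, fun x hx => ?_⟩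
  · rintro rfl
    rw [map_zero] at h
    exact hq0 (norm_eq_zero.1 h.symm)
  · obtain ⟨n, hn⟩ := exists_norm_eq_zpow hq0 hq1 hq (x := toComp v x) (by simpa using hx)
    exact ⟨n, by rw [← norm_toComp, hn, h]⟩

lemma finite_fabs_ne_one {x : k} (hx : x ≠ 0) :
    {v : HeightOneSpectrum (𝓞 k) | fabs v x ≠ 1}.Finite := by
  have h := FinitePlace.hasFiniteMulSupport hx
  have := (Set.Finite.image FinitePlace.maximalIdeal h)
  refine this.subset fun v hv => ⟨FinitePlace.mk v, ?_, FinitePlace.maximalIdeal_mk v⟩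
  simpa [Function.mem_mulSupport, FinitePlace.mk_apply, FinitePlace.norm_embedding] using hv
end Pourchet

namespace Pourchet
open IsDedekindDomain NumberField
variable {k : Type*} [Field k] [NumberField k]

/-- The finite and the real places of a number field. -/
abbrev Pl (k : Type*) [Field k] [NumberField k] := HeightOneSpectrum (𝓞 k) ⊕ (k →+* ℝ)

/-- The absolute value attached to a real embedding. -/
noncomputable def rabs (s : k →+* ℝ) : AbsoluteValue k ℝ :=
  AbsoluteValue.comp (AbsoluteValue.abs (S := ℝ)) s.injective

@[simp] lemma rabs_apply (s : k →+* ℝ) (x : k) : rabs s x = |s x| := rfl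

/-- The absolute value attached to a place. -/
noncomputable def pabs : Pl k → AbsoluteValue k ℝ
  | .inl v => fabs v
  | .inr s => rabs s

lemma real_ne_aux {s t : k →+* ℝ} (h : s ≠ t) : ¬ (rabs s).IsEquiv (rabs t) := by
  intro he
  obtain ⟨x, hx⟩ := DFunLike.ne_iff.1 h
  obtain ⟨n, hn⟩ := exists_nat_gt (2 / |s x - t x|)
  have hd : 0 < |s x - t x| := abs_pos.2 (sub_ne_zero.2 hx)
  rw [div_lt_iff₀ hd] at hn
  set y : k := n * x
  have hs : s y = n * s x := by simp [y]
  have ht : t y = n * t x := by simp [y]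
  have hst : 2 < |s y - t y| := by
    rw [hs, ht, ← mul_sub, abs_mul, Nat.abs_cast]; exact hn
  set q : ℤ := ⌊s y⌋
  have h1 : rabs s (y - q) < 1 := by
    simp only [rabs_apply, map_sub, map_intCast]
    rw [abs_lt]
    constructor <;> linarith [Int.floor_le (s y), Int.lt_floor_add_one (s y)]
  have h2 := he.lt_one_iff.1 h1
  simp only [rabs_apply, map_sub, map_intCast] at h1 h2
  have := abs_sub_le (s y) q (t y)
  rw [abs_sub_comm (q : ℝ)] at this
  linarith

lemma finite_ne_aux {v w : HeightOneSpectrum (𝓞 k)} (h : v ≠ w) :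
    ¬ (fabs (k := k) v).IsEquiv (fabs w) := by
  intro he
  apply h
  ext x
  rw [← fabs_int_lt, ← fabs_int_lt]
  exact he.lt_one_iff

lemma finite_real_ne_aux (v : HeightOneSpectrum (𝓞 k)) (s : k →+* ℝ) :
    ¬ (fabs (k := k) v).IsEquiv (rabs s) := by
  intro he
  have h := (he.le_one_iff (x := (2 : k))).1
    (by simpa using NumberField.HeightOneSpectrum.adicAbv_natCast_le_one k v 2)
  rw [rabs_apply, map_ofNat] at h
  norm_num at h

lemma pabs_isNontrivial (p : Pl k) : (pabs p).IsNontrivial := by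
  rcases p with v | s
  · obtain ⟨p, hp0, hp⟩ := exists_int_fabs_lt v
    exact ⟨p, hp0, hp.ne⟩
  · exact ⟨2, two_ne_zero, by rw [pabs, rabs_apply, map_ofNat]; norm_num⟩

lemma pabs_not_isEquiv {p q : Pl k} (h : p ≠ q) : ¬ (pabs p).IsEquiv (pabs q) := by
  rcases p with v | s <;> rcases q with w | t
  · exact finite_ne_aux (by rintro rfl; exact h rfl)
  · exact finite_real_ne_aux v t
  · exact fun he => finite_real_ne_aux w s he.symm
  · exact real_ne_aux (by rintro rfl; exact h rfl)

lemma weak_approx (P : Finset (Pl k)) (y : Pl k → k) {e : ℝ} (he : 0 < e) :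
    ∃ x : k, ∀ p ∈ P, pabs p (x - y p) < e := by
  have hd := AbsoluteValue.denseRange_algebraMap_pi (F := k) (ι := P)
    (v := fun p => pabs p.1) (fun p => pabs_isNontrivial p.1)
    (fun p q hpq => pabs_not_isEquiv fun h => hpq (Subtype.ext h))
  obtain ⟨x, hx⟩ := Metric.denseRange_iff.1 hd
    (fun p => (WithAbs.equiv (pabs p.1)).symm (y p.1)) e he
  refine ⟨x, fun p hp => ?_⟩
  have := (dist_pi_lt_iff he).1 hx ⟨p, hp⟩
  rw [dist_comm, dist_eq_norm] at this
  exact this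

/-- Weak approximation with targets in the completions. -/
lemma weak_approx_comp (S : Finset (HeightOneSpectrum (𝓞 k))) (R : Finset (k →+* ℝ))
    (y : ∀ v : HeightOneSpectrum (𝓞 k), v.adicCompletion k) (z : (k →+* ℝ) → ℝ)
    {e : ℝ} (he : 0 < e) :
    ∃ x : k, (∀ v ∈ S, ‖toComp v x - y v‖ < e) ∧ ∀ s ∈ R, |s x - z s| < e := by
  classical
  choose a ha using fun v => (denseRange_toComp (k := k) v).exists_dist_lt (y v) (half_pos he)
  choose b hb1 hb2 using fun s => exists_rat_btwn (show z s < z s + e / 2 by linarith)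
  obtain ⟨x, hx⟩ := weak_approx (S.map Function.Embedding.inl ∪ R.map Function.Embedding.inr)
    (Sum.elim a fun s => ((b s : ℚ) : k)) (half_pos he)
  refine ⟨x, fun v hv => ?_, fun s hs => ?_⟩
  · have h1 := hx (.inl v) (by simp [hv])
    simp only [pabs, Sum.elim_inl] at h1
    rw [← norm_toComp, map_sub] at h1
    have h2 := ha v
    rw [dist_eq_norm, norm_sub_rev] at h2
    calc _ = ‖(toComp v x - toComp v (a v)) + (toComp v (a v) - y v)‖ := by congr 1; ring
      _ ≤ _ := norm_add_le _ _
      _ < e := by linarith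
  · have h1 := hx (.inr s) (by simp [hs])
    simp only [pabs, Sum.elim_inr, rabs_apply, map_sub, map_ratCast] at h1
    have := hb1 s; have := hb2 s
    rw [abs_lt] at h1 ⊢
    constructor <;> linarith

/-- The subgroup of elements becoming squares under a field embedding. -/
def lsq {F : Type*} [Field F] (i : k →+* F) : Subgroup kˣ :=
  ((⊤ : Subgroup Fˣ).map (sq Fˣ)).comap (Units.map (i : k →* F))

/-- The subgroup of elements becoming values of `X ^ 2 - a * Y ^ 2` under a field embedding. -/
def lnm {F : Type*} [Field F] (i : k →+* F) (a : k) : Subgroup kˣ :=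
  (nrm (i a)).comap (Units.map (i : k →* F))

lemma isSquare_unit_iff {F : Type*} [Field F] (x : Fˣ) :
    x ∈ (⊤ : Subgroup Fˣ).map (sq Fˣ) ↔ IsSquare (x : F) := by
  rw [mem_map_sq]
  constructor
  · rintro ⟨y, -, rfl⟩
    exact ⟨y, by rw [Units.val_pow_eq_pow_val, pow_two]⟩
  · rintro ⟨y, hy⟩
    have : y ≠ 0 := by rintro rfl; exact x.ne_zero (by simp at hy)
    exact ⟨Units.mk0 y this, trivial, by ext; simp [hy, pow_two]⟩

lemma mem_lsq {F : Type*} [Field F] {i : k →+* F} {x : kˣ} :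
    x ∈ lsq i ↔ IsSquare (i x) := by
  rw [lsq, Subgroup.mem_comap, isSquare_unit_iff]; rfl

lemma mem_lnm {F : Type*} [Field F] {i : k →+* F} {a : k} {x : kˣ} :
    x ∈ lnm i a ↔ ∃ p q : F, i x = p ^ 2 - i a * q ^ 2 := by
  rw [lnm, Subgroup.mem_comap, mem_nrm]; rfl

lemma lsq_le_lnm {F : Type*} [Field F] (i : k →+* F) (a : k) : lsq i ≤ lnm i a :=
  Subgroup.comap_mono (map_sq_le_nrm _)

/-- The local squares at a place. -/
noncomputable def psq : Pl k → Subgroup kˣ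
  | .inl v => lsq (toComp v)
  | .inr s => lsq s

/-- The local norms at a place. -/
noncomputable def pnm (a : k) : Pl k → Subgroup kˣ
  | .inl v => lnm (toComp v) a
  | .inr s => lnm s a

lemma psq_le_pnm (a : k) (p : Pl k) : psq p ≤ pnm a p := by
  rcases p with v | s <;> exact lsq_le_lnm _ _

lemma lsq_real {s : k →+* ℝ} {x : kˣ} : x ∈ lsq s ↔ 0 < s x := by
  rw [mem_lsq]
  have : s x ≠ 0 := by simp
  exact ⟨fun h => lt_of_le_of_ne h.nonneg this.symm, fun h => ⟨√(s x), (Real.mul_self_sqrt h.le).symm⟩⟩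

lemma exists_div_mem_psq (P : Finset (Pl k)) (y : Pl k → kˣ) :
    ∃ x : kˣ, ∀ p ∈ P, x * (y p)⁻¹ ∈ psq p := by
  classical
  by_cases hP : P = ∅
  · exact ⟨1, by simp [hP]⟩
  obtain ⟨p0, hp0⟩ := Finset.nonempty_iff_ne_empty.2 hP
  have h4 : ∀ p : Pl k, 0 < min (pabs p 4 * pabs p (y p)) (pabs p (y p)) := by
    intro p
    have h1 : 0 < pabs p (y p) := (pabs p).pos (y p).ne_zero
    have h2 : 0 < pabs p 4 := (pabs p).pos (by norm_num)
    positivity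
  obtain ⟨x, hx⟩ := weak_approx P (fun p => (y p : k))
    (e := P.inf' ⟨p0, hp0⟩ fun p => min (pabs p 4 * pabs p (y p)) (pabs p (y p)))
    ((Finset.lt_inf'_iff _).2 fun p _ => h4 p)
  have hx' : ∀ p ∈ P, pabs p (x - y p) < min (pabs p 4 * pabs p (y p)) (pabs p (y p)) :=
    fun p hp => (hx p hp).trans_le (Finset.inf'_le _ hp)
  have hx0 : x ≠ 0 := by
    rintro rfl
    have := (hx' p0 hp0).trans_le (min_le_right _ _)
    rw [zero_sub, (pabs p0).map_neg] at this
    exact lt_irrefl _ this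
  refine ⟨Units.mk0 x hx0, fun p hp => ?_⟩
  have h := hx' p hp
  rcases p with v | s
  · have h1 := h.trans_le (min_le_left _ _)
    simp only [pabs] at h1
    change _ ∈ lsq _
    rw [mem_lsq]
    have hy0 : toComp v (y (.inl v)) ≠ 0 := by simp
    have := isSquare_of_norm_sub_lt (u := toComp v x * (toComp v (y (.inl v)))⁻¹) (v := 1)
      ⟨1, by simp⟩ (by
        rw [norm_one, mul_one, show toComp v x * (toComp v (y (.inl v)))⁻¹ - 1 =
          toComp v (x - y (.inl v)) * (toComp v (y (.inl v)))⁻¹ by rw [map_sub]; field_simp,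
          norm_mul, norm_inv, norm_toComp, norm_toComp, ← div_eq_mul_inv,
          div_lt_iff₀ ((fabs v).pos (by simp))]
        have e4 : ‖(4 : v.adicCompletion k)‖ = fabs v 4 := by rw [← norm_toComp, map_ofNat]
        rw [e4]; exact h1)
    simpa using this
  · have h1 := h.trans_le (min_le_right _ _)
    simp only [pabs, rabs_apply, map_sub] at h1
    change _ ∈ lsq _
    rw [lsq_real]
    have hy0 : s (y (.inr s)) ≠ 0 := by simp
    simp only [Units.val_mul, Units.val_mk0, map_mul, Units.val_inv_eq_inv_val, map_inv₀]
    rw [← div_eq_mul_inv]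
    rcases lt_or_gt_of_ne hy0 with h0 | h0
    · rw [abs_of_neg h0, abs_lt] at h1
      exact div_pos_of_neg_of_neg (by linarith) h0
    · rw [abs_of_pos h0, abs_lt] at h1
      exact div_pos (by linarith) h0
end Pourchet

namespace Pourchet
open IsDedekindDomain NumberField

lemma index_iInf_of_approx {G I : Type*} [CommGroup G] (P : Finset I) (M : I → Subgroup G)
    (h : ∀ y : I → G, ∃ x : G, ∀ p ∈ P, x * (y p)⁻¹ ∈ M p) :
    (⨅ p ∈ P, M p).index = ∏ p ∈ P, (M p).index := by
  classical
  let f : G →* (∀ p : P, G ⧸ M p.1) := MonoidHom.pi fun p => QuotientGroup.mk' (M p.1)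
  have hker : f.ker = ⨅ p ∈ P, M p := by
    ext x
    simp only [MonoidHom.mem_ker, funext_iff, Subgroup.mem_iInf, Subtype.forall]
    exact forall₂_congr fun p _ => QuotientGroup.eq_one_iff (N := M p) x
  have hsurj : Function.Surjective f := by
    intro z
    obtain ⟨x, hx⟩ := h fun p => if hp : p ∈ P then Quotient.out (z ⟨p, hp⟩) else 1
    refine ⟨x, funext fun p => ?_⟩
    have := hx p.1 p.2
    rw [dif_pos p.2] at this
    have h2 : QuotientGroup.mk (s := M p.1) x = QuotientGroup.mk (Quotient.out (z p)) := by
      rw [← div_eq_mul_inv] at this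
      rw [← div_eq_one, ← QuotientGroup.mk_div]
      exact (QuotientGroup.eq_one_iff _).2 this
    change QuotientGroup.mk (s := M p.1) x = z p
    rw [h2]; exact Quotient.out_eq _
  rw [← hker, Subgroup.index_ker, MonoidHom.range_eq_top.2 hsurj, ← Finset.prod_coe_sort P]
  rw [Nat.card_congr (Subgroup.topEquiv (G := ∀ p : P, G ⧸ M p.1)).toEquiv, Nat.card_pi]
  rfl

lemma index_comap_of_sup {G H : Type*} [CommGroup G] [CommGroup H] (f : G →* H)
    (M : Subgroup H) (h : ∀ u : H, ∃ x, f x * u⁻¹ ∈ M) : (M.comap f).index = M.index := by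
  rw [Subgroup.index_comap]
  have : M ⊔ f.range = ⊤ := by
    rw [eq_top_iff]
    intro u _
    obtain ⟨x, hx⟩ := h u
    have : u = f x * (f x * u⁻¹)⁻¹ := by rw [mul_inv, inv_inv, mul_inv_cancel_left]
    rw [this]
    rw [sup_comm]; exact Subgroup.mul_mem_sup ⟨x, rfl⟩ (inv_mem hx)
  rw [← Subgroup.relIndex_sup_left, this, Subgroup.relIndex_top_right]

variable {k : Type*} [Field k] [NumberField k]

lemma exists_toComp_div (v : HeightOneSpectrum (𝓞 k)) (u : (v.adicCompletion k)ˣ) :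
    ∃ x : kˣ, Units.map (toComp v : k →* v.adicCompletion k) x * u⁻¹ ∈
      (⊤ : Subgroup (v.adicCompletion k)ˣ).map (sq _) := by
  have hu : 0 < ‖(u : v.adicCompletion k)‖ := norm_pos_iff.2 u.ne_zero
  have h4 : 0 < ‖(4 : v.adicCompletion k)‖ := norm_pos_iff.2 (by norm_num)
  obtain ⟨x, hx⟩ := (denseRange_toComp v).exists_dist_lt (u : v.adicCompletion k)
    (ε := min (‖(4 : v.adicCompletion k)‖ * ‖(u : v.adicCompletion k)‖)
      ‖(u : v.adicCompletion k)‖) (by positivity)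
  rw [dist_eq_norm, norm_sub_rev] at hx
  have hx0 : x ≠ 0 := by
    rintro rfl
    have := hx.trans_le (min_le_right _ _)
    simp at this
  refine ⟨Units.mk0 x hx0, ?_⟩
  rw [isSquare_unit_iff]
  refine isSquare_of_norm_sub_lt (v := 1) ⟨1, by simp⟩ ?_
  have e : ((Units.map (toComp v : k →* v.adicCompletion k) (Units.mk0 x hx0) * u⁻¹ :
    (v.adicCompletion k)ˣ) : v.adicCompletion k) - 1 = (toComp v x - u) * (u : v.adicCompletion k)⁻¹ := by
    rw [sub_mul, mul_inv_cancel₀ u.ne_zero]; simp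
  rw [e, norm_mul, norm_inv, ← div_eq_mul_inv, div_lt_iff₀ hu, norm_one, mul_one]
  exact hx.trans_le (min_le_left _ _)

lemma index_lsq_toComp (v : HeightOneSpectrum (𝓞 k)) : (lsq (toComp v)).index =
    4 * (ballA (2 : v.adicCompletion k)).relIndex (ballA 1) := by
  rw [lsq, index_comap_of_sup _ _ (exists_toComp_div v), ← Subgroup.relIndex_top_right, relIndex_sq]

lemma index_lnm_toComp (v : HeightOneSpectrum (𝓞 k)) {a : k} (ha : ¬ IsSquare (toComp v a)) :
    (lnm (toComp v) a).index = 2 := by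
  rw [lnm, index_comap_of_sup, index_nrm ha]
  intro u
  obtain ⟨x, hx⟩ := exists_toComp_div v u
  exact ⟨x, map_sq_le_nrm _ hx⟩

lemma index_lsq_real (s : k →+* ℝ) : (lsq s).index = 2 := by
  rw [Subgroup.index_eq_two_iff]
  refine ⟨-1, fun b => ?_⟩
  rw [lsq_real, lsq_real]
  have : s b ≠ 0 := by simp
  rcases lt_or_gt_of_ne this with h | h
  · exact Or.inl ⟨by simpa using h, by linarith⟩
  · exact Or.inr ⟨h, by simpa using h.le⟩

lemma lnm_real_of_neg {s : k →+* ℝ} {a : k} (ha : s a < 0) : lnm s a = lsq s := by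
  refine le_antisymm (fun x hx => ?_) (lsq_le_lnm s a)
  obtain ⟨p, q, h⟩ := mem_lnm.1 hx
  rw [lsq_real]
  have : s x ≠ 0 := by simp
  exact lt_of_le_of_ne (by rw [h]; nlinarith [sq_nonneg p, sq_nonneg q]) this.symm

lemma lnm_eq_top {F : Type*} [Field F] [NeZero (2 : F)] {i : k →+* F} {a : k} (h0 : a ≠ 0)
    (h : IsSquare (i a)) : lnm i a = ⊤ := by
  rw [lnm, nrm_eq_top h (by simpa using h0), Subgroup.comap_top]

lemma pnm_eq_top {a : kˣ} {p : Pl k} (h : a ∈ psq p) : pnm (a : k) p = ⊤ := by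
  rcases p with v | s
  · exact lnm_eq_top a.ne_zero (mem_lsq.1 h)
  · exact lnm_eq_top a.ne_zero (mem_lsq.1 h)

lemma index_pnm {a : kˣ} {p : Pl k} (h : a ∉ psq p) : (pnm (a : k) p).index = 2 := by
  rcases p with v | s
  · exact index_lnm_toComp v fun hh => h (mem_lsq.2 hh)
  · have h' : ¬ 0 < s a := fun hh => h (lsq_real.2 hh)
    have h0 : s a ≠ 0 := by simp
    change (lnm s a).index = 2
    rw [lnm_real_of_neg (lt_of_le_of_ne (not_lt.1 h') h0), index_lsq_real]

open Classical in
/-- The number of places in a finite set at which an element is not a square. -/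
noncomputable def nonsplit (P : Finset (Pl k)) (a : kˣ) : ℕ := (P.filter fun p => a ∉ psq p).card

lemma index_iInf_pnm (P : Finset (Pl k)) (a : kˣ) :
    (⨅ p ∈ P, pnm (a : k) p).index = 2 ^ nonsplit P a := by
  classical
  rw [index_iInf_of_approx, nonsplit, ← Finset.prod_const, Finset.prod_filter]
  · refine Finset.prod_congr rfl fun p _ => ?_
    split_ifs with h
    · rw [pnm_eq_top h, Subgroup.index_top]
    · exact index_pnm h
  · intro y
    obtain ⟨x, hx⟩ := exists_div_mem_psq P y
    exact ⟨x, fun p hp => psq_le_pnm _ _ (hx p hp)⟩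

lemma index_iInf_psq (P : Finset (Pl k)) :
    (⨅ p ∈ P, psq p).index = ∏ p ∈ P, (psq p).index :=
  index_iInf_of_approx P psq (exists_div_mem_psq P)
end Pourchet

namespace Pourchet
open IsDedekindDomain NumberField

/-- The index of the subgroup of squares. -/
noncomputable def sqx (G : Type*) [CommGroup G] : ℕ := (sq G).range.index

lemma relIndex_map_sq {A : Type*} [CommGroup A] (H : Subgroup A) :
    (H.map (sq A)).relIndex H = sqx H := by
  rw [Subgroup.relIndex, sqx]
  congr 1
  ext x
  simp only [Subgroup.mem_subgroupOf, Subgroup.mem_map, MonoidHom.mem_range,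
    powMonoidHom_apply, Subtype.ext_iff, Subgroup.coe_pow, Subtype.exists, exists_prop]

lemma sqx_congr {G H : Type*} [CommGroup G] [CommGroup H] (f : G →* H)
    (hf : Function.Bijective f) : sqx G = sqx H := by
  rw [sqx, sqx, ← Subgroup.index_comap_of_surjective _ hf.2]
  congr 1
  ext x
  simp only [MonoidHom.mem_range, Subgroup.mem_comap, powMonoidHom_apply]
  constructor
  · rintro ⟨y, rfl⟩; exact ⟨f y, by simp⟩
  · rintro ⟨y, hy⟩
    obtain ⟨z, rfl⟩ := hf.2 y
    exact ⟨z, hf.1 (by simpa using hy)⟩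

lemma sqx_ext {G Q : Type*} [CommGroup G] [CommGroup Q] (f : G →* Q)
    (hf : Function.Surjective f) (hQ : ∀ q : Q, q ^ 2 = 1 → q = 1) :
    sqx G = sqx f.ker * sqx Q := by
  have h1 : (sq G).range ≤ (sq Q).range.comap f := by
    rintro _ ⟨y, rfl⟩
    exact ⟨f y, by simp⟩
  rw [sqx, sqx, sqx, ← Subgroup.relIndex_mul_index h1, Subgroup.index_comap_of_surjective _ hf]
  congr 1
  have h2 : (sq Q).range.comap f = (sq G).range ⊔ f.ker := by
    refine le_antisymm ?_ (sup_le h1 fun x hx => ?_)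
    · rintro x ⟨q, hq⟩
      obtain ⟨y, rfl⟩ := hf q
      have : x = y ^ 2 * ((y ^ 2)⁻¹ * x) := by rw [mul_inv_cancel_left]
      rw [this]
      refine Subgroup.mul_mem_sup ⟨y, rfl⟩ ?_
      rw [MonoidHom.mem_ker, map_mul, ← hq]
      simp
    · rw [MonoidHom.mem_ker] at hx
      rw [Subgroup.mem_comap, hx]
      exact one_mem _
  rw [h2, sup_comm, Subgroup.relIndex_sup_right, Subgroup.relIndex]
  congr 1
  ext ⟨x, hx⟩
  simp only [Subgroup.mem_subgroupOf, MonoidHom.mem_range, powMonoidHom_apply, Subtype.ext_iff,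
    Subgroup.coe_pow, Subtype.exists, exists_prop]
  refine exists_congr fun y => ⟨fun h => ⟨?_, h⟩, fun h => h.2⟩
  apply hQ
  rw [← map_pow, h]; exact hx

lemma sqx_free {Q : Type*} [CommGroup Q] [Module.Free ℤ (Additive Q)]
    [Module.Finite ℤ (Additive Q)] : sqx Q = 2 ^ Module.finrank ℤ (Additive Q) := by
  rw [← ModN.natCard_eq, sqx, ← Subgroup.index_toAddSubgroup]
  have : Subgroup.toAddSubgroup (sq Q).range =
      (LinearMap.range (LinearMap.lsmul ℤ (Additive Q) (2 : ℕ))).toAddSubgroup := by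
    ext x
    simp only [Submodule.mem_toAddSubgroup, LinearMap.mem_range, LinearMap.lsmul_apply]
    constructor
    · rintro ⟨y, hy⟩
      refine ⟨Additive.ofMul y, ?_⟩
      apply Additive.toMul.injective
      rw [← hy]
      simp
    · rintro ⟨y, rfl⟩
      exact ⟨y.toMul, by simp⟩
  rw [this]
  rfl

lemma sqx_int : sqx (Multiplicative ℤ) = 2 := by
  have : sqx (Multiplicative ℤ) = 2 ^ Module.finrank ℤ ℤ := sqx_free
  simpa using this

lemma sqx_subgroup_int (H : Subgroup (Multiplicative ℤ)) (hH : H ≠ ⊥) : sqx H = 2 := by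
  obtain ⟨g, hg⟩ := IsCyclic.exists_generator (α := H)
  rw [← sqx_int]
  refine (sqx_congr (zpowersHom H g) ⟨?_, fun x => ?_⟩).symm
  · rw [injective_iff_map_eq_one]
    intro n hn
    have hg1 : g ≠ 1 := by
      rintro rfl
      apply hH
      rw [Subgroup.eq_bot_iff_forall]
      intro x hx
      obtain ⟨m, hm⟩ := hg ⟨x, hx⟩
      simpa using (Subtype.ext_iff.1 hm).symm
    rw [zpowersHom_apply] at hn
    have h2 : (g : Multiplicative ℤ) ^ n.toAdd = 1 := by exact_mod_cast hn
    have h3 : n.toAdd * (g : Multiplicative ℤ).toAdd = 0 := by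
      have := congrArg Multiplicative.toAdd h2
      simpa using this
    rcases mul_eq_zero.1 h3 with h | h
    · exact h
    · exact (hg1 (Subtype.ext h)).elim
  · obtain ⟨m, hm⟩ := hg x
    exact ⟨Multiplicative.ofAdd m, by simpa using hm⟩

variable {k : Type*} [Field k] [NumberField k]

lemma sqx_torsion : sqx (Units.torsion k) = 2 := by
  have h1 := Subgroup.card_mul_index (sq (Units.torsion k)).range
  have h2 := Subgroup.card_mul_index (sq (Units.torsion k)).ker
  rw [Subgroup.index_ker] at h2
  have h3 : Nat.card (sq (Units.torsion k)).ker = 2 := by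
    have hm : (-1 : (𝓞 k)ˣ) ∈ Units.torsion k := by
      refine (CommGroup.mem_torsion _).2 (isOfFinOrder_iff_pow_eq_one.2 ?_)
      refine ⟨2, by norm_num, by simp⟩
    have hne : (⟨-1, hm⟩ : Units.torsion k) ≠ 1 := by
      intro h
      have h1 := congrArg (fun u : Units.torsion k => ((u : (𝓞 k)ˣ) : 𝓞 k)) h
      simp only [Units.val_neg, Units.val_one, OneMemClass.coe_one] at h1
      norm_num at h1
    have e : ((sq (Units.torsion k)).ker : Set (Units.torsion k)) = {1, ⟨-1, hm⟩} := by
      ext ⟨u, hu⟩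
      simp only [SetLike.mem_coe, MonoidHom.mem_ker, powMonoidHom_apply, Set.mem_insert_iff,
        Set.mem_singleton_iff, Subtype.ext_iff, Subgroup.coe_pow, OneMemClass.coe_one, Units.ext_iff,
        Units.val_pow_eq_pow_val, Units.val_one, Units.val_neg]
      exact sq_eq_one_iff
    rw [← Set.ncard_pair hne.symm, ← e]
    rfl
  rw [h3] at h2
  rw [sqx]
  have hp : 0 < Nat.card (sq (Units.torsion k)).range := Nat.card_pos
  rw [← h2, mul_comm] at h1
  exact Nat.eq_of_mul_eq_mul_right hp h1

lemma sqx_units : sqx (𝓞 k)ˣ = 2 ^ Fintype.card (InfinitePlace k) := by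
  have h := sqx_ext (G := (𝓞 k)ˣ) (Q := (𝓞 k)ˣ ⧸ Units.torsion k)
    (QuotientGroup.mk' (Units.torsion k)) (QuotientGroup.mk'_surjective (Units.torsion k)) ?_
  · rw [h, sqx_free (Q := (𝓞 k)ˣ ⧸ Units.torsion k), Units.finrank_modTorsion, QuotientGroup.ker_mk', sqx_torsion, ← pow_succ',
      Units.rank, Nat.sub_add_cancel Fintype.card_pos]
  · intro q hq
    obtain ⟨x, rfl⟩ := QuotientGroup.mk'_surjective _ q
    rw [← map_pow, QuotientGroup.mk'_apply, QuotientGroup.eq_one_iff] at hq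
    rw [QuotientGroup.mk'_apply, QuotientGroup.eq_one_iff]
    exact (CommGroup.mem_torsion _).2
      ((isOfFinOrder_pow.1 ((CommGroup.mem_torsion _).1 hq)).resolve_right (by norm_num))
end Pourchet

namespace Pourchet
open IsDedekindDomain NumberField
variable {k : Type*} [Field k] [NumberField k]

lemma fabs_eq_one_iff (v : HeightOneSpectrum (𝓞 k)) (x : kˣ) :
    fabs v (x : k) = 1 ↔ v.valuationOfNeZero x = 1 := by
  have h := v.valuationOfNeZero_eq (K := k) x
  constructor
  · intro h1
    have h2 : v.valuation k (x : k) = 1 := by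
      apply le_antisymm (valuation_le_one_of_fabs v h1.le)
      have : v.valuation k ((x : k)⁻¹) ≤ 1 := valuation_le_one_of_fabs v (by rw [map_inv₀, h1]; simp)
      rw [map_inv₀] at this
      have h0 : v.valuation k (x : k) ≠ 0 := by simp
      exact (inv_le_one₀ (zero_lt_iff.2 h0)).1 this
    rw [h2] at h
    exact_mod_cast h
  · intro h1
    rw [h1] at h
    have h2 : v.valuation k (x : k) = v.valuation k 1 := by rw [← h]; simp
    exact le_antisymm (by simpa using fabs_le_of_valuation_le v h2.le)
      (by simpa using fabs_le_of_valuation_le v h2.ge)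

/-- The group of `S`-units. -/
def SU (S : Set (HeightOneSpectrum (𝓞 k))) : Subgroup kˣ where
  carrier := {x | ∀ v, v ∉ S → fabs v (x : k) = 1}
  one_mem' := by simp
  mul_mem' := by
    intro x y hx hy v hv
    rw [Units.val_mul, map_mul, hx v hv, hy v hv, one_mul]
  inv_mem' := by
    intro x hx v hv
    rw [Units.val_inv_eq_inv_val, map_inv₀, hx v hv, inv_one]

lemma mem_SU {S : Set (HeightOneSpectrum (𝓞 k))} {x : kˣ} :
    x ∈ SU S ↔ ∀ v, v ∉ S → fabs v (x : k) = 1 := Iff.rfl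

lemma SU_mono {S T : Set (HeightOneSpectrum (𝓞 k))} (h : S ⊆ T) : SU S ≤ SU T :=
  fun _ hx v hv => hx v fun hs => hv (h hs)

lemma exists_int_of_fabs_le {x : k} (h : ∀ v : HeightOneSpectrum (𝓞 k), fabs v x ≤ 1) :
    ∃ y : 𝓞 k, (y : k) = x := by
  obtain ⟨y, hy⟩ := HeightOneSpectrum.mem_integers_of_valuation_le_one k x
    fun v => valuation_le_one_of_fabs v (h v)
  exact ⟨y, hy⟩

lemma sqx_SU_empty : sqx (SU (∅ : Set (HeightOneSpectrum (𝓞 k)))) =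
    2 ^ Fintype.card (InfinitePlace k) := by
  rw [← sqx_units]
  have hm (u : (𝓞 k)ˣ) : Units.map (algebraMap (𝓞 k) k : 𝓞 k →* k) u ∈
      SU (∅ : Set (HeightOneSpectrum (𝓞 k))) := by
    intro v _
    refine (fabs_int_eq v).2 fun h => v.isPrime.ne_top ?_
    exact Ideal.eq_top_of_isUnit_mem _ h u.isUnit
  refine (sqx_congr ((Units.map (algebraMap (𝓞 k) k : 𝓞 k →* k)).codRestrict _ hm)
    ⟨fun x y h => ?_, ?_⟩).symm
  · have := congrArg (fun z : SU (∅ : Set (HeightOneSpectrum (𝓞 k))) => ((z : kˣ) : k)) h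
    exact Units.ext (RingOfIntegers.ext this)
  · rintro ⟨x, hx⟩
    obtain ⟨y, hy⟩ := exists_int_of_fabs_le (x := (x : k)) fun v => (hx v (by simp)).le
    obtain ⟨z, hz⟩ := exists_int_of_fabs_le (x := ((x⁻¹ : kˣ) : k))
      fun v => ((SU (∅ : Set (HeightOneSpectrum (𝓞 k)))).inv_mem hx v (by simp)).le
    have h1 : y * z = 1 := by
      apply RingOfIntegers.coe_injective
      rw [map_mul, map_one]
      exact (congrArg₂ (· * ·) hy hz).trans x.mul_inv
    refine ⟨⟨y, z, h1, by rw [mul_comm, h1]⟩, ?_⟩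
    exact Subtype.ext (Units.ext hy)

lemma exists_pow_principal (v : HeightOneSpectrum (𝓞 k)) : ∃ x : 𝓞 k, (x : k) ≠ 0 ∧
    fabs v (x : k) < 1 ∧ ∀ w, w ≠ v → fabs w (x : k) = 1 := by
  have hv : v.asIdeal ∈ nonZeroDivisors (Ideal (𝓞 k)) := mem_nonZeroDivisors_of_ne_zero v.ne_bot
  have h1 := pow_card_eq_one' (x := ClassGroup.mk0 ⟨v.asIdeal, hv⟩)
  set h := Nat.card (ClassGroup (𝓞 k))
  have h0 : h ≠ 0 := Nat.card_pos.ne'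
  rw [← map_pow, ClassGroup.mk0_eq_one_iff] at h1
  obtain ⟨x, hx⟩ := h1
  have hx' : v.asIdeal ^ h = Ideal.span {x} := hx
  have hxm : x ∈ v.asIdeal ^ h := by rw [hx']; exact Ideal.mem_span_singleton_self x
  refine ⟨x, ?_, (fabs_int_lt v).2 (Ideal.pow_le_self h0 hxm), fun w hw => ?_⟩
  · intro hx0
    have : x = 0 := by simpa using hx0
    rw [this, Ideal.span_singleton_eq_bot.2 rfl] at hx'
    exact v.ne_bot (pow_eq_zero_iff h0 |>.1 hx')
  · rw [fabs_int_eq]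
    intro hw1
    have h2 : v.asIdeal ^ h ≤ w.asIdeal := by
      rw [hx', Ideal.span_singleton_le_iff_mem]; exact hw1
    have h3 := Ideal.IsPrime.le_of_pow_le h2
    exact hw (HeightOneSpectrum.ext ((v.isMaximal.eq_of_le w.isPrime.ne_top h3).symm))

lemma sqx_of_hom_int {G : Type*} [CommGroup G] (f : G →* Multiplicative ℤ) (hf : ∃ x, f x ≠ 1) :
    sqx G = sqx f.ker * 2 := by
  have h := sqx_ext f.rangeRestrict f.rangeRestrict_surjective (fun q hq => ?_)
  · rw [h, sqx_subgroup_int, MonoidHom.ker_rangeRestrict]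
    intro hb
    obtain ⟨x, hx⟩ := hf
    have : f x ∈ f.range := ⟨x, rfl⟩
    rw [hb, Subgroup.mem_bot] at this
    exact hx this
  · have h1 : (q : Multiplicative ℤ) ^ 2 = 1 := congrArg Subtype.val hq
    have h2 := congrArg Multiplicative.toAdd h1
    have h3 : Multiplicative.toAdd (q : Multiplicative ℤ) = 0 := by simpa using h2
    exact Subtype.ext h3

lemma exists_val_hom (v : HeightOneSpectrum (𝓞 k)) :
    ∃ g : kˣ →* Multiplicative ℤ, ∀ x : kˣ, g x = 1 ↔ fabs v (x : k) = 1 :=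
  ⟨v.valuationOfNeZero, fun x => (fabs_eq_one_iff v x).symm⟩

lemma sqx_SU_insert (S : Set (HeightOneSpectrum (𝓞 k))) (v : HeightOneSpectrum (𝓞 k))
    (hv : v ∉ S) : sqx (SU (insert v S)) = sqx (SU S) * 2 := by
  obtain ⟨g, hg⟩ := exists_val_hom v
  obtain ⟨f, hf⟩ : ∃ f : SU (insert v S) →* Multiplicative ℤ,
      ∀ x, f x = 1 ↔ fabs v ((x : kˣ) : k) = 1 :=
    ⟨g.comp (Subgroup.subtype _), fun x => hg x⟩
  rw [sqx_of_hom_int f]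
  · congr 1
    refine sqx_congr (((SU (insert v S)).subtype.comp f.ker.subtype).codRestrict _ ?_) ⟨?_, ?_⟩
    · rintro ⟨x, hx⟩ w hw
      by_cases hwv : w = v
      · subst hwv; exact (hf x).1 hx
      · exact x.2 w (by simpa [hwv] using hw)
    · intro x y hxy
      exact Subtype.ext (Subtype.ext (congrArg (fun z : SU S => (z : kˣ)) hxy))
    · rintro ⟨x, hx⟩
      exact ⟨⟨⟨x, SU_mono (Set.subset_insert _ _) hx⟩, (hf _).2 (hx v hv)⟩, rfl⟩
  · obtain ⟨x, hx0, hx1, hx⟩ := exists_pow_principal v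
    refine ⟨⟨Units.mk0 (x : k) hx0, fun w hw => hx w fun h => hw (by simp [h])⟩, ?_⟩
    rw [Ne, hf]
    exact hx1.ne

lemma sqx_SU (S : Finset (HeightOneSpectrum (𝓞 k))) :
    sqx (SU (S : Set (HeightOneSpectrum (𝓞 k)))) =
      2 ^ (S.card + Fintype.card (InfinitePlace k)) := by
  classical
  induction S using Finset.induction_on with
  | empty => rw [Finset.coe_empty, sqx_SU_empty, Finset.card_empty, zero_add]
  | insert v S hv ih =>
    rw [Finset.coe_insert, sqx_SU_insert _ v hv, ih, Finset.card_insert_of_notMem hv]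
    ring

/-- Outside `S`, the content of every nonzero ideal is the absolute value of an element. -/
def PrincipalOutside (S : Set (HeightOneSpectrum (𝓞 k))) : Prop :=
  ∀ J : Ideal (𝓞 k), J ≠ ⊥ → ∃ c : kˣ, ∀ v, v ∉ S →
    (∀ x ∈ J, fabs v (x : k) ≤ fabs v (c : k)) ∧ ∃ x ∈ J, fabs v (x : k) = fabs v (c : k)

lemma exists_principalOutside : ∃ S0 : Finset (HeightOneSpectrum (𝓞 k)),
    ∀ S : Set (HeightOneSpectrum (𝓞 k)), (S0 : Set _) ⊆ S → PrincipalOutside S := by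
  classical
  choose I hI using ClassGroup.mk0_surjective (R := 𝓞 k)
  have he (C) : ∃ e ∈ (I C : Ideal (𝓞 k)), (e : k) ≠ 0 := by
    obtain ⟨p, hp, hp0⟩ := Submodule.exists_mem_ne_zero_of_ne_bot
      (nonZeroDivisors.ne_zero (I C).2)
    exact ⟨p, hp, by simpa using hp0⟩
  choose e heI he0 using he
  refine ⟨Finset.univ.biUnion fun C => (finite_fabs_ne_one (he0 C)).toFinset, ?_⟩
  intro S hS J hJ
  obtain ⟨x, y, hx, hy, hxy⟩ := ClassGroup.mk0_eq_mk0_iff.1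
    (hI (ClassGroup.mk0 ⟨J, mem_nonZeroDivisors_of_ne_zero hJ⟩)).symm
  set C := ClassGroup.mk0 ⟨J, mem_nonZeroDivisors_of_ne_zero hJ⟩
  replace hxy : Ideal.span {x} * J = Ideal.span {y} * I C := hxy
  have hx' : (x : k) ≠ 0 := by simpa using hx
  have hy' : (y : k) ≠ 0 := by simpa using hy
  refine ⟨Units.mk0 (y / x : k) (div_ne_zero hy' hx'), fun v hv => ⟨fun z hz => ?_, ?_⟩⟩
  · have h1 : x * z ∈ Ideal.span {y} * I C := by
      rw [← hxy]; exact Ideal.mul_mem_mul (Ideal.mem_span_singleton_self x) hz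
    obtain ⟨i, hi, h2⟩ := Ideal.mem_span_singleton_mul.1 h1
    have h3 : (z : k) = y / x * i := by
      field_simp
      have := congrArg (algebraMap (𝓞 k) k) h2.symm
      rw [mul_comm]; exact_mod_cast this
    rw [h3, map_mul, Units.val_mk0]
    exact mul_le_of_le_one_right (apply_nonneg _ _) (fabs_int_le v i)
  · have h1 : y * e C ∈ Ideal.span {x} * J := by
      rw [hxy]; exact Ideal.mul_mem_mul (Ideal.mem_span_singleton_self y) (heI C)
    obtain ⟨z, hz, h2⟩ := Ideal.mem_span_singleton_mul.1 h1
    refine ⟨z, hz, ?_⟩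
    have h3 : (z : k) = y / x * e C := by
      field_simp
      have := congrArg (algebraMap (𝓞 k) k) h2
      rw [mul_comm]; exact_mod_cast this
    have h4 : fabs v (e C : k) = 1 := by
      by_contra hne
      exact hv (hS (by simpa using ⟨C, hne⟩))
    rw [h3, map_mul, h4, mul_one, Units.val_mk0]

variable {S : Set (HeightOneSpectrum (𝓞 k))}

lemma PrincipalOutside.exists_max (hS : PrincipalOutside S) (p q : k) (h : p ≠ 0 ∨ q ≠ 0) :
    ∃ c : kˣ, ∀ v, v ∉ S → fabs v (c : k) = max (fabs v p) (fabs v q) := by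
  obtain ⟨p', q', d, hd, hp, hq⟩ : ∃ p' q' d : 𝓞 k, d ≠ 0 ∧ p * d = p' ∧ q * d = q' := by
    obtain ⟨a, b, hb, rfl⟩ := IsFractionRing.div_surjective (A := 𝓞 k) p
    obtain ⟨a', b', hb', rfl⟩ := IsFractionRing.div_surjective (A := 𝓞 k) q
    have h1 : (b : k) ≠ 0 := by simpa using nonZeroDivisors.ne_zero hb
    have h2 : (b' : k) ≠ 0 := by simpa using nonZeroDivisors.ne_zero hb'
    refine ⟨a * b', a' * b, b * b', mul_ne_zero (nonZeroDivisors.ne_zero hb)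
      (nonZeroDivisors.ne_zero hb'), ?_, ?_⟩
    · push_cast; field_simp
    · push_cast; field_simp
  have hd' : (d : k) ≠ 0 := by simpa using hd
  obtain ⟨c, hc⟩ := hS (Ideal.span {p', q'}) (by
    rw [Ne, Ideal.span_eq_bot]
    intro h0
    have h1 : p' = 0 := h0 p' (by simp)
    have h2 : q' = 0 := h0 q' (by simp)
    rw [h1] at hp; rw [h2] at hq
    rcases h with h | h
    · exact mul_ne_zero h hd' (by rw [hp]; simp)
    · exact mul_ne_zero h hd' (by rw [hq]; simp))
  refine ⟨c / Units.mk0 (d : k) hd', fun v hv => ?_⟩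
  have hdv : 0 < fabs v (d : k) := (fabs v).pos hd'
  rw [Units.val_div_eq_div_val, map_div₀, Units.val_mk0, div_eq_iff hdv.ne',
    max_mul_of_nonneg _ _ hdv.le, ← map_mul, ← map_mul, hp, hq]
  obtain ⟨h1, x, hx, h2⟩ := hc v hv
  apply le_antisymm
  · obtain ⟨r, s, rfl⟩ := Ideal.mem_span_pair.1 hx
    rw [← h2]
    push_cast
    refine (fabs_add_le v _ _).trans (max_le_max ?_ ?_)
    · rw [map_mul]; exact mul_le_of_le_one_left (apply_nonneg _ _) (fabs_int_le v r)
    · rw [map_mul]; exact mul_le_of_le_one_left (apply_nonneg _ _) (fabs_int_le v s)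
  · exact max_le (h1 _ (Ideal.subset_span (by simp))) (h1 _ (Ideal.subset_span (by simp)))

lemma PrincipalOutside.exists_uniformizer (hS : PrincipalOutside S)
    (v : HeightOneSpectrum (𝓞 k)) (hv : v ∉ S) :
    ∃ c : kˣ, c ∈ SU (insert v S) ∧ fabs v (c : k) < 1 ∧
      ∀ x : k, x ≠ 0 → ∃ n : ℤ, fabs v x = fabs v (c : k) ^ n := by
  obtain ⟨c, hc⟩ := hS v.asIdeal v.ne_bot
  have hlt : fabs v (c : k) < 1 := by
    obtain ⟨x, hx, h⟩ := (hc v hv).2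
    rw [← h]; exact (fabs_int_lt v).2 hx
  refine ⟨c, fun w hw => ?_, hlt, ?_⟩
  · rw [Set.mem_insert_iff, not_or] at hw
    obtain ⟨h1, x, hx, h2⟩ := hc w hw.2
    apply le_antisymm
    · rw [← h2]; exact fabs_int_le w x
    · obtain ⟨y, hy, hyw⟩ := Set.not_subset.1 fun h : (v.asIdeal : Set (𝓞 k)) ⊆ w.asIdeal =>
        hw.1 (HeightOneSpectrum.ext (v.isMaximal.eq_of_le w.isPrime.ne_top h).symm)
      rw [← (fabs_int_eq w).2 hyw]
      exact h1 y hy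
  · obtain ⟨p, hp0, hp1, hp⟩ := exists_global_uniformizer v
    obtain ⟨n, d, hd, hnd⟩ := exists_frac v hp1.le
    have hpn : fabs v p = fabs v (n : k) := by
      rw [← hnd, map_mul, (fabs_int_eq v).2 hd, mul_one]
    have h1 : fabs v p ≤ fabs v (c : k) := by
      rw [hpn]; exact (hc v hv).1 n ((fabs_int_lt v).1 (hpn ▸ hp1))
    obtain ⟨m, hm⟩ := hp c c.ne_zero
    have hp0' : 0 < fabs v p := (fabs v).pos hp0
    have h2 : fabs v (c : k) = fabs v p := by
      rw [hm]
      have hm1 : m = 1 := by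
        rw [hm] at hlt h1
        have h3 : 0 < m := by
          by_contra hle
          exact hlt.not_ge (one_le_zpow_of_nonpos₀ hp0' hp1.le (not_lt.1 hle))
        have h4 : m ≤ 1 := by
          by_contra hgt
          have := zpow_lt_zpow_right_of_lt_one₀ hp0' hp1 (not_le.1 hgt)
          rw [zpow_one] at this
          linarith
        omega
      rw [hm1, zpow_one]
    rw [h2]
    exact hp
end Pourchet

namespace Pourchet
open IsDedekindDomain NumberField
section under
variable {A B : Type*} [Field A] [NumberField A] [Field B] [NumberField B]

/-- The prime below a prime with respect to an embedding of number fields. -/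
noncomputable def under (i : A →+* B) (w : HeightOneSpectrum (𝓞 B)) : HeightOneSpectrum (𝓞 A) where
  asIdeal := w.asIdeal.comap (RingOfIntegers.mapRingHom i)
  isPrime := inferInstance
  ne_bot := by
    intro h
    have h1 : ((Ideal.absNorm w.asIdeal : ℕ) : 𝓞 A) ∈
        w.asIdeal.comap (RingOfIntegers.mapRingHom i) := by
      rw [Ideal.mem_comap, map_natCast]
      exact Ideal.absNorm_mem _
    rw [h, Ideal.mem_bot, Nat.cast_eq_zero, Ideal.absNorm_eq_zero_iff] at h1
    exact w.ne_bot h1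

variable (i : A →+* B) (w : HeightOneSpectrum (𝓞 B))

lemma mem_under (x : 𝓞 A) :
    x ∈ (under i w).asIdeal ↔ RingOfIntegers.mapRingHom i x ∈ w.asIdeal := Iff.rfl

lemma fabs_int_under (x : 𝓞 A) : fabs w (i x) ≤ 1 :=
  fabs_int_le w (RingOfIntegers.mapRingHom i x)

lemma fabs_int_under_eq {x : 𝓞 A} : fabs w (i x) = 1 ↔ x ∉ (under i w).asIdeal :=
  fabs_int_eq w (x := RingOfIntegers.mapRingHom i x)

lemma fabs_int_under_lt {x : 𝓞 A} : fabs w (i x) < 1 ↔ x ∈ (under i w).asIdeal :=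
  fabs_int_lt w (x := RingOfIntegers.mapRingHom i x)

lemma fabs_under_lt_of {x : A} (h : fabs (under i w) x < 1) : fabs w (i x) < 1 := by
  obtain ⟨n, d, hd, hnd⟩ := exists_frac _ h.le
  have h1 : fabs w (i d) = 1 := (fabs_int_under_eq i w).2 hd
  have h2 : fabs w (i x) = fabs w (i n) := by rw [← hnd, map_mul, map_mul, h1, mul_one]
  rw [h2, fabs_int_under_lt, ← fabs_int_lt, ← hnd, map_mul, (fabs_int_eq _).2 hd, mul_one]
  exact h

lemma fabs_under_lt {x : A} : fabs w (i x) < 1 ↔ fabs (under i w) x < 1 := by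
  refine ⟨fun h => ?_, fabs_under_lt_of i w⟩
  by_contra! hc
  obtain ⟨n, d, hd, hnd⟩ := exists_frac (under i w) (x := x⁻¹) (by rw [map_inv₀]; exact inv_le_one_of_one_le₀ hc)
  have hx : x ≠ 0 := by rintro rfl; rw [map_zero] at hc; linarith
  have h1 : fabs w (i d) = 1 := (fabs_int_under_eq i w).2 hd
  have h2 : (d : A) = x * n := by rw [← hnd, mul_inv_cancel_left₀ hx]
  rw [h2, map_mul, map_mul] at h1
  have := fabs_int_under i w n
  nlinarith [apply_nonneg (fabs w) (i n), apply_nonneg (fabs w) (i x)]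

lemma fabs_under_gt {x : A} : 1 < fabs w (i x) ↔ 1 < fabs (under i w) x := by
  by_cases hx : x = 0
  · subst hx; simp
  have h := fabs_under_lt i w (x := x⁻¹)
  rwa [map_inv₀, map_inv₀, map_inv₀, inv_lt_one₀ ((fabs w).pos (by simpa using hx)),
    inv_lt_one₀ ((fabs _).pos hx)] at h

lemma fabs_under_eq {x : A} : fabs w (i x) = 1 ↔ fabs (under i w) x = 1 := by
  have h1 := fabs_under_lt i w (x := x)
  have h2 := fabs_under_gt i w (x := x)
  rw [← not_iff_not, ← Ne, ← Ne, ne_iff_lt_or_gt, ne_iff_lt_or_gt, h1, h2]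

lemma fabs_under_le {x : A} : fabs w (i x) ≤ 1 ↔ fabs (under i w) x ≤ 1 := by
  rw [← not_lt, ← not_lt, fabs_under_gt]

lemma under_surjective (v : HeightOneSpectrum (𝓞 A)) : ∃ w, under i w = v := by
  let _ := i.toAlgebra
  have : IsScalarTower ℚ A B := IsScalarTower.of_algebraMap_eq fun q => by simp
  have : Algebra.IsIntegral (𝓞 A) (𝓞 B) := inferInstance
  obtain ⟨Q, hQ, h⟩ := Ideal.exists_ideal_over_prime_of_isIntegral_of_isDomain
    (R := 𝓞 A) (S := 𝓞 B) v.asIdeal (by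
      rw [(RingHom.injective_iff_ker_eq_bot (algebraMap (𝓞 A) (𝓞 B))).1
        (FaithfulSMul.algebraMap_injective _ _)]
      exact bot_le)
  refine ⟨⟨Q, hQ, ?_⟩, HeightOneSpectrum.ext h⟩
  rintro rfl
  rw [Ideal.comap_bot_of_injective _ (FaithfulSMul.algebraMap_injective _ _)] at h
  exact v.ne_bot h.symm

lemma finite_under (v : HeightOneSpectrum (𝓞 A)) : {w | under i w = v}.Finite := by
  obtain ⟨p, hp0, hp⟩ := exists_int_fabs_lt v
  refine (finite_fabs_ne_one (x := i p) (by simpa using hp0)).subset ?_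
  rintro w rfl
  exact ((fabs_under_lt i w).2 hp).ne

/-- The primes above a finite set of primes. -/
noncomputable def above (S : Finset (HeightOneSpectrum (𝓞 A))) :
    Finset (HeightOneSpectrum (𝓞 B)) := by
  classical
  exact S.biUnion fun v => (finite_under i v).toFinset

lemma mem_above {S : Finset (HeightOneSpectrum (𝓞 A))} {w : HeightOneSpectrum (𝓞 B)} :
    w ∈ above i S ↔ under i w ∈ S := by
  classical
  simp [above]

end under

section real
variable {A B : Type*} [Field A] [NumberField A] [Field B] [NumberField B]

noncomputable instance instFintypeReal : Fintype (A →+* ℝ) :=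
  Fintype.ofInjective (fun s : A →+* ℝ => Complex.ofRealHom.comp s) fun s t h => by
    ext x
    have := RingHom.congr_fun h x
    simpa using this

lemma card_real : Fintype.card (A →+* ℝ) = InfinitePlace.nrRealPlaces A := by
  classical
  rw [← InfinitePlace.card_real_embeddings]
  refine Fintype.card_congr (Equiv.ofBijective
    (fun s => ⟨Complex.ofRealHom.comp s, by
      rw [ComplexEmbedding.isReal_iff]; ext x; simp⟩) ⟨fun s t h => ?_, ?_⟩)
  · ext x
    have := RingHom.congr_fun (congrArg Subtype.val h) x
    simpa using this
  · rintro ⟨f, hf⟩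
    refine ⟨hf.embedding, Subtype.ext ?_⟩
    ext x
    simp

lemma two_mul_card_infinitePlace : 2 * Fintype.card (InfinitePlace A) =
    Module.finrank ℚ A + Fintype.card (A →+* ℝ) := by
  have h1 := InfinitePlace.card_eq_nrRealPlaces_add_nrComplexPlaces A
  have h2 := InfinitePlace.card_add_two_mul_card_eq_rank A
  rw [card_real]
  omega
end real
end Pourchet

namespace Pourchet
open IsDedekindDomain NumberField QuadraticAlgebra
variable {k : Type*} [Field k] [NumberField k]

section
variable {a : k} [Fact (∀ r : k, r ^ 2 ≠ a + 0 * r)]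

lemma finrank_rat_quadraticAlgebra :
    Module.finrank ℚ (QuadraticAlgebra k a 0) = 2 * Module.finrank ℚ k := by
  rw [← Module.finrank_mul_finrank ℚ k (QuadraticAlgebra k a 0), QuadraticAlgebra.finrank_eq_two,
    mul_comm]

instance instNumberFieldQuadraticAlgebra : NumberField (QuadraticAlgebra k a 0) where
  to_charZero := inferInstance
  to_finiteDimensional := Module.Finite.trans k _

/-- The embedding into a quadratic extension. -/
abbrev qincl (a : k) : k →+* QuadraticAlgebra k a 0 := algebraMap k _

/-- The conjugation of a quadratic extension. -/
abbrev qconj (a : k) : QuadraticAlgebra k a 0 →+* QuadraticAlgebra k a 0 :=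
  starRingEnd (QuadraticAlgebra k a 0)

@[simp] lemma qconj_re (x : QuadraticAlgebra k a 0) : (qconj a x).re = x.re := by
  simp [starRingEnd_apply]

@[simp] lemma qconj_im (x : QuadraticAlgebra k a 0) : (qconj a x).im = -x.im := by
  simp [starRingEnd_apply]

lemma qconj_qincl (x : k) : qconj a (qincl a x) = qincl a x := by
  ext <;> simp

lemma qconj_qconj (x : QuadraticAlgebra k a 0) : qconj a (qconj a x) = x := star_star x

lemma under_qconj (w : HeightOneSpectrum (𝓞 (QuadraticAlgebra k a 0))) :
    under (qincl a) (under (qconj a) w) = under (qincl a) w := by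
  ext x
  rw [mem_under, mem_under, mem_under]
  have : RingOfIntegers.mapRingHom (qconj a) (RingOfIntegers.mapRingHom (qincl a) x) =
      RingOfIntegers.mapRingHom (qincl a) x := RingOfIntegers.ext (qconj_qincl (x : k))
  rw [this]

lemma fabs_sub_eq_of_under_qconj {w : HeightOneSpectrum (𝓞 (QuadraticAlgebra k a 0))}
    (hw : under (qconj a) w = w) (y : QuadraticAlgebra k a 0) :
    fabs w (qconj a y) = fabs w y := by
  by_cases hy : y = 0
  · simp [hy]
  have hy' : qconj a y ≠ 0 := by simpa using hy
  have h := fabs_under_le (qconj a) w (x := qconj a y / y)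
  rw [hw, map_div₀, qconj_qconj, map_div₀, map_div₀, div_le_one ((fabs w).pos hy'),
    div_le_one ((fabs w).pos hy)] at h
  rcases le_total (fabs w y) (fabs w (qconj a y)) with h1 | h1
  · exact le_antisymm (h.1 h1) h1
  · exact le_antisymm h1 (h.2 h1)

lemma exists_under_qconj_ne (v : HeightOneSpectrum (𝓞 k)) (h : IsSquare (toComp v a)) :
    ∃ w, under (qincl a) w = v ∧ under (qconj a) w ≠ w := by
  obtain ⟨w, rfl⟩ := under_surjective (qincl a) v
  set v := under (qincl a) w
  refine ⟨w, rfl, fun hw => ?_⟩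
  have hsq (x : k) : x ^ 2 - a ≠ 0 := by
    have := Fact.out (p := ∀ r : k, r ^ 2 ≠ a + 0 * r) x
    rw [zero_mul, add_zero] at this
    exact sub_ne_zero.2 this
  have key (x : k) : fabs v (4 * x ^ 2) ≤ fabs v (x ^ 2 - a) := by
    have h0 := (fabs v).pos (hsq x)
    suffices hh : fabs v (4 * x ^ 2 / (x ^ 2 - a)) ≤ 1 by
      rwa [map_div₀, div_le_one h0] at hh
    have h0' : 0 < fabs w (qincl a (x ^ 2 - a)) := (fabs w).pos ((map_ne_zero _).2 (hsq x))
    rw [← fabs_under_le, map_div₀, map_div₀, div_le_one h0']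
    set y : QuadraticAlgebra k a 0 := qincl a x - ⟨0, 1⟩
    have e1 : qincl a (4 * x ^ 2) = (y + qconj a y) ^ 2 := by
      ext <;> simp [y, pow_two] <;> ring
    have e2 : qincl a (x ^ 2 - a) = y * qconj a y := by
      ext <;> simp [y, pow_two] <;> ring
    have h3 : fabs w (y + qconj a y) ≤ fabs w y :=
      (fabs_add_le w _ _).trans (by rw [fabs_sub_eq_of_under_qconj hw, max_self])
    rw [e1, e2, map_pow, map_mul, fabs_sub_eq_of_under_qconj hw, ← pow_two]
    exact pow_le_pow_left₀ (apply_nonneg _ _) h3 2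
  obtain ⟨α, hα⟩ := h
  have ha0 : a ≠ 0 := by simpa using hsq 0
  have hα0 : α ≠ 0 := by
    rintro rfl
    simp [ha0] at hα
  have hαp : 0 < ‖α‖ := norm_pos_iff.2 hα0
  have h4 : 0 < ‖(4 : v.adicCompletion k)‖ := norm_pos_iff.2 (by norm_num)
  obtain ⟨x, hx⟩ := (denseRange_toComp v).exists_dist_lt α
    (lt_min (mul_pos h4 hαp) hαp)
  rw [dist_eq_norm, lt_min_iff, norm_sub_rev] at hx
  have hxα : ‖toComp v x‖ = ‖α‖ := norm_eq_of_sub_lt hx.2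
  have := key x
  rw [← norm_toComp, ← norm_toComp] at this
  have e : toComp v (x ^ 2 - a) = (toComp v x - α) * (toComp v x + α) := by
    rw [map_sub, map_pow, hα]; ring
  have hle : ‖toComp v x + α‖ ≤ ‖α‖ := by
    refine (IsUltrametricDist.norm_add_le_max _ _).trans ?_
    rw [hxα, max_self]
  rw [e, map_mul, map_pow, norm_mul, norm_mul, norm_pow, hxα, map_ofNat] at this
  have h5 := mul_le_mul_of_nonneg_left hle (norm_nonneg (toComp v x - α))
  nlinarith [mul_lt_mul_of_pos_right hx.1 hαp]

lemma card_above_ge (S : Finset (HeightOneSpectrum (𝓞 k))) [DecidablePred fun v =>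
    ¬ IsSquare (toComp (k := k) v a)] :
    2 * S.card ≤ (above (qincl a) S).card + (S.filter fun v => ¬ IsSquare (toComp v a)).card := by
  classical
  rw [Finset.card_eq_sum_card_fiberwise (f := under (qincl a)) (t := S)
    (fun w hw => (mem_above _).1 hw), Finset.card_filter, ← Finset.sum_add_distrib,
    mul_comm, ← smul_eq_mul]
  refine Finset.card_nsmul_le_sum _ _ _ fun v hv => ?_
  split_ifs with h
  swap
  · obtain ⟨w, hw⟩ := under_surjective (qincl a) v
    have : 0 < (Finset.filter (fun w => under (qincl a) w = v) (above (qincl a) S)).card :=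
      Finset.card_pos.2 ⟨w, Finset.mem_filter.2 ⟨(mem_above _).2 (hw ▸ hv), hw⟩⟩
    omega
  · obtain ⟨w, hw, hne⟩ := exists_under_qconj_ne v h
    have h2 : 1 < (Finset.filter (fun w => under (qincl a) w = v) (above (qincl a) S)).card := by
      rw [Finset.one_lt_card]
      refine ⟨w, Finset.mem_filter.2 ⟨(mem_above _).2 (hw ▸ hv), hw⟩, under (qconj a) w,
        Finset.mem_filter.2 ⟨(mem_above _).2 ?_, ?_⟩, hne.symm⟩
      · rw [under_qconj, hw]; exact hv
      · rw [under_qconj, hw]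
    omega

lemma card_real_ge :
    2 * Fintype.card (k →+* ℝ) ≤ Fintype.card (QuadraticAlgebra k a 0 →+* ℝ) +
      2 * (Finset.univ.filter fun s : k →+* ℝ => ¬ 0 < s a).card := by
  classical
  have h : ∀ s : k →+* ℝ, 0 < s a → 2 ≤ (Finset.univ.filter
      fun t : QuadraticAlgebra k a 0 →+* ℝ => t.comp (qincl a) = s).card := by
    intro s hs
    let _ := s.toAlgebra
    have hu (e : ℝ) (he : e * e = 1) : e * √(s a) * (e * √(s a)) = a • (1 : ℝ) + (0 : k) • (e * √(s a)) := by
      rw [Algebra.smul_def, Algebra.smul_def, map_zero, zero_mul, mul_one, add_zero]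
      change _ = s a
      rw [mul_mul_mul_comm, he, one_mul, Real.mul_self_sqrt hs.le]
    let f (e : ℝ) (he : e * e = 1) : QuadraticAlgebra k a 0 →+* ℝ :=
      (QuadraticAlgebra.lift ⟨e * √(s a), hu e he⟩ : QuadraticAlgebra k a 0 →ₐ[k] ℝ)
    have hf (e : ℝ) (he : e * e = 1) : f e he ⟨0, 1⟩ = e * √(s a) := by
      simp [f, QuadraticAlgebra.lift]
    have hf' (e : ℝ) (he : e * e = 1) : (f e he).comp (qincl a) = s := by
      ext x
      exact (QuadraticAlgebra.lift ⟨e * √(s a), hu e he⟩ : QuadraticAlgebra k a 0 →ₐ[k] ℝ).commutes x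
    refine Finset.one_lt_card.2 ⟨f 1 (by norm_num), by simp [hf'], f (-1) (by norm_num),
      by simp [hf'], fun h => ?_⟩
    have h1 := RingHom.congr_fun h ⟨0, 1⟩
    rw [hf 1 (by norm_num), hf (-1) (by norm_num)] at h1
    have := Real.sqrt_pos.2 hs
    linarith
  rw [← Finset.card_univ (α := QuadraticAlgebra k a 0 →+* ℝ),
    Finset.card_eq_sum_card_fiberwise (f := fun t : QuadraticAlgebra k a 0 →+* ℝ =>
      t.comp (qincl a)) (t := Finset.univ) (fun w hw => by simp), Finset.card_filter,
    Finset.mul_sum, ← Finset.sum_add_distrib, mul_comm, ← smul_eq_mul, ← Finset.card_univ]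
  refine Finset.card_nsmul_le_sum _ _ _ fun s _ => ?_
  split_ifs with hs
  swap
  · omega
  · have := h s hs
    omega
end
end Pourchet

namespace Pourchet
open IsDedekindDomain NumberField QuadraticAlgebra
variable {k : Type*} [Field k] [NumberField k]

/-- All places in a finite set of primes together with all real places. -/
noncomputable def allPl (S : Finset (HeightOneSpectrum (𝓞 k))) : Finset (Pl k) :=
  S.disjSum Finset.univ

lemma nonsplit_allPl (S : Finset (HeightOneSpectrum (𝓞 k))) (a : kˣ)
    [DecidablePred fun v => ¬ IsSquare (toComp (k := k) v a)] :
    nonsplit (allPl S) a = (S.filter fun v => ¬ IsSquare (toComp v (a : k))).card +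
      (Finset.univ.filter fun s : k →+* ℝ => ¬ 0 < s a).card := by
  classical
  rw [nonsplit, Finset.card_filter, allPl, Finset.sum_disjSum, Finset.card_filter,
    Finset.card_filter]
  congr 1
  · refine Finset.sum_congr rfl fun v _ => ?_
    have : a ∉ psq (Sum.inl v) ↔ ¬ IsSquare (toComp v (a : k)) := not_congr mem_lsq
    simp only [this]
  · refine Finset.sum_congr rfl fun v _ => ?_
    have : a ∉ psq (Sum.inr v) ↔ ¬ 0 < v (a : k) := not_congr lsq_real
    simp only [this]

section
variable {a : k} [Fact (∀ r : k, r ^ 2 ≠ a + 0 * r)]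
  {S : Finset (HeightOneSpectrum (𝓞 k))}

lemma SU_above_unitsNorm {y : (QuadraticAlgebra k a 0)ˣ} (hy : y ∈ SU (above (qincl a) S : Set _)) :
    unitsNorm a y ∈ SU (S : Set (HeightOneSpectrum (𝓞 k))) := by
  intro v hv
  obtain ⟨w, rfl⟩ := under_surjective (qincl a) v
  rw [← fabs_under_eq]
  have h := coe_unitsIncl_unitsNorm y
  have h1 : fabs w (y : QuadraticAlgebra k a 0) = 1 := hy w (by simpa [mem_above] using hv)
  have h2 : fabs w (qconj a (y : QuadraticAlgebra k a 0)) = 1 :=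
    (fabs_under_eq (qconj a) w).2 (hy _ (by simpa [mem_above, under_qconj] using hv))
  have h3 : qincl a (unitsNorm a y : kˣ) = y * qconj a y := h
  rw [h3, map_mul, h1, h2, one_mul]

lemma SU_above_comap : (SU (above (qincl a) S : Set _)).comap (unitsIncl a) = SU (S : Set _) := by
  ext x
  constructor
  · intro hx v hv
    obtain ⟨w, rfl⟩ := under_surjective (qincl a) v
    rw [← fabs_under_eq]
    exact hx w (by simpa [mem_above] using hv)
  · intro hx w hw
    exact (fabs_under_eq (qincl a) w).2 (hx _ (by simpa [mem_above] using hw))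

lemma SU_above_hilbert90 (hP : PrincipalOutside (S : Set (HeightOneSpectrum (𝓞 k))))
    (h2 : ∀ v, v ∉ S → fabs v (2 : k) = 1) (ha : ∀ v, v ∉ S → fabs v a = 1)
    {e : (QuadraticAlgebra k a 0)ˣ} (he : e ∈ SU (above (qincl a) S : Set _))
    (hn : unitsNorm a e = 1) :
    ∃ y ∈ SU (above (qincl a) S : Set _), e * unitsIncl a (unitsNorm a y) = y ^ 2 := by
  obtain ⟨y, hy⟩ := hilbert90 e hn
  obtain ⟨c, hc⟩ := hP.exists_max (y : QuadraticAlgebra k a 0).re (y : QuadraticAlgebra k a 0).im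
    (by
      by_contra! h
      exact y.ne_zero (QuadraticAlgebra.ext h.1 h.2))
  have hyz : e * unitsIncl a (unitsNorm a (y * unitsIncl a c⁻¹)) = (y * unitsIncl a c⁻¹) ^ 2 := by
    rw [map_mul, unitsNorm_unitsIncl, map_mul, ← mul_assoc, hy, mul_pow, map_pow]
  refine ⟨y * unitsIncl a c⁻¹, fun w hw => ?_, hyz⟩
  have hv : under (qincl a) w ∉ S := by simpa [mem_above] using hw
  set z := y * unitsIncl a c⁻¹
  set v := under (qincl a) w
  set p := (y : QuadraticAlgebra k a 0).re / c
  set q := (y : QuadraticAlgebra k a 0).im / c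
  have hcv : 0 < fabs v (c : k) := (fabs v).pos c.ne_zero
  have hz : (z : QuadraticAlgebra k a 0) = qincl a p + qincl a q * ⟨0, 1⟩ := by
    ext <;> simp [z, p, q, div_eq_mul_inv]
  have hcz : qconj a (z : QuadraticAlgebra k a 0) = qincl a p - qincl a q * ⟨0, 1⟩ := by
    rw [hz]
    ext <;> simp
  have hp : fabs w (qincl a p) ≤ 1 := by
    rw [fabs_under_le, map_div₀, div_le_one hcv, hc v hv]; exact le_max_left _ _
  have hq : fabs w (qincl a q) ≤ 1 := by
    rw [fabs_under_le, map_div₀, div_le_one hcv, hc v hv]; exact le_max_right _ _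
  have hω : fabs w (⟨0, 1⟩ : QuadraticAlgebra k a 0) = 1 := by
    have h1 : (⟨0, 1⟩ : QuadraticAlgebra k a 0) ^ 2 = qincl a a := by
      ext <;> simp [pow_two]
    have h3 : fabs w (qincl a a) = 1 := (fabs_under_eq _ w).2 (ha v hv)
    rw [← h1, map_pow] at h3
    exact (pow_eq_one_iff_of_nonneg (apply_nonneg _ _) two_ne_zero).1 h3
  have h2w : fabs w (2 : QuadraticAlgebra k a 0) = 1 := by
    have := (fabs_under_eq (qincl a) w).2 (h2 v hv)
    rwa [map_ofNat] at this
  have hneg : fabs w (-(qincl a q * ⟨0, 1⟩)) ≤ 1 := by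
    rw [map_neg_eq_map, map_mul, hω, mul_one]; exact hq
  have hqω : fabs w (qincl a q * ⟨0, 1⟩) ≤ 1 := by
    rw [map_mul, hω, mul_one]; exact hq
  have hconj : fabs w (qconj a z) = fabs w (z : QuadraticAlgebra k a 0) := by
    have h1 := congrArg (fun u : (QuadraticAlgebra k a 0)ˣ => (u : QuadraticAlgebra k a 0)) hyz
    simp only [Units.val_mul, Units.val_pow_eq_pow_val] at h1
    rw [coe_unitsIncl_unitsNorm] at h1
    have h4 : (e : QuadraticAlgebra k a 0) * qconj a z = z :=
      mul_left_cancel₀ z.ne_zero (by rw [← pow_two, ← h1]; change _ = _ * (_ * qconj a z); ring)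
    have h5 := congrArg (fabs w) h4
    rwa [map_mul, he w hw, one_mul] at h5
  apply le_antisymm
  · rw [hz]
    exact (fabs_add_le w _ _).trans (max_le hp hqω)
  · have e1 : qincl a p * 2 = z + qconj a z := by rw [hcz, hz]; ring
    have e2 : qincl a q * ⟨0, 1⟩ * 2 = z + -qconj a z := by rw [hcz, hz]; ring
    have f1 : fabs w (qincl a p) ≤ fabs w (z : QuadraticAlgebra k a 0) := by
      rw [← mul_one (fabs w (qincl a p)), ← h2w, ← map_mul, e1]
      exact (fabs_add_le w _ _).trans (by rw [hconj, max_self])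
    have f2 : fabs w (qincl a q) ≤ fabs w (z : QuadraticAlgebra k a 0) := by
      rw [← mul_one (fabs w (qincl a q)), ← hω, ← map_mul, ← mul_one (fabs w (qincl a q * _)),
        ← h2w, ← map_mul, e2]
      exact (fabs_add_le w _ _).trans (by rw [map_neg_eq_map, hconj, max_self])
    rcases max_choice (fabs v (y : QuadraticAlgebra k a 0).re)
      (fabs v (y : QuadraticAlgebra k a 0).im) with h | h
    · rw [← (fabs_under_eq (qincl a) w (x := p)).2 (by
        rw [map_div₀, hc _ hv, h, div_self]; rw [← h, ← hc _ hv]; exact hcv.ne')]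
      exact f1
    · rw [← (fabs_under_eq (qincl a) w (x := q)).2 (by
        rw [map_div₀, hc _ hv, h, div_self]; rw [← h, ← hc _ hv]; exact hcv.ne')]
      exact f2
end

/-- The global first inequality for quadratic extensions, in terms of `S`-units. -/
theorem relIndex_nrm_SU {a : kˣ} (hsq : ¬ IsSquare (a : k))
    {S : Finset (HeightOneSpectrum (𝓞 k))} (hP : PrincipalOutside (S : Set (HeightOneSpectrum (𝓞 k))))
    (h2 : ∀ v, v ∉ S → fabs v (2 : k) = 1) (ha : a ∈ SU (S : Set (HeightOneSpectrum (𝓞 k)))) :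
    (nrm (a : k)).relIndex (SU (S : Set _)) ≠ 0 ∧
    2 * (nrm (a : k)).relIndex (SU (S : Set _)) ≤ 2 ^ nonsplit (allPl S) a := by
  classical
  have := nsq_fact hsq
  set E := SU (k := QuadraticAlgebra k (a : k) 0) (above (qincl (a : k)) S)
  have hω : ∃ w ∈ E, (w : QuadraticAlgebra k a 0) = ⟨0, 1⟩ := by
    have h0 : (⟨0, 1⟩ : QuadraticAlgebra k a 0) ≠ 0 := fun h => by
      have := congrArg QuadraticAlgebra.im h
      simp at this
    refine ⟨Units.mk0 _ h0, fun w hw => ?_, rfl⟩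
    have h1 : (⟨0, 1⟩ : QuadraticAlgebra k a 0) ^ 2 = qincl (a : k) a := by
      ext <;> simp [pow_two]
    have h3 : fabs w (qincl (a : k) a) = 1 :=
      (fabs_under_eq _ w).2 (ha _ (by simpa [mem_above] using hw))
    rw [← h1, map_pow] at h3
    exact (pow_eq_one_iff_of_nonneg (apply_nonneg _ _) two_ne_zero).1 h3
  have hE2 : E.map (unitsNorm (a : k)) ≤ SU (S : Set _) := by
    rintro _ ⟨y, hy, rfl⟩
    exact SU_above_unitsNorm hy
  have key := quadratic_index (a : k) E (SU (S : Set _)) SU_above_comap hE2 hω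
    fun e he hn => SU_above_hilbert90 hP h2 ha he hn
  rw [relIndex_map_sq, relIndex_map_sq, sqx_SU, sqx_SU] at key
  have hle : E.map (unitsNorm (a : k)) ≤ nrm (a : k) := by
    rw [← map_unitsNorm_top]; exact Subgroup.map_mono le_top
  have hdvd := Subgroup.relIndex_dvd_of_le_left (SU (S : Set (HeightOneSpectrum (𝓞 k)))) hle
  have hne : (E.map (unitsNorm (a : k))).relIndex (SU (S : Set _)) ≠ 0 := by
    intro h
    rw [h, mul_zero, zero_mul] at key
    exact (pow_pos (pow_pos two_pos _) _).ne key
  refine ⟨fun h => hne (by simpa [h] using hdvd), ?_⟩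
  refine (Nat.mul_le_mul_left 2 (Nat.le_of_dvd (Nat.pos_of_ne_zero hne) hdvd)).trans ?_
  have c1 := card_above_ge (a := (a : k)) S
  have c2 := card_real_ge (a := (a : k))
  have c3 := two_mul_card_infinitePlace (A := k)
  have c4 := two_mul_card_infinitePlace (A := QuadraticAlgebra k a 0)
  rw [finrank_rat_quadraticAlgebra] at c4
  rw [nonsplit_allPl]
  set X := (above (qincl (a : k)) S).card + Fintype.card (InfinitePlace (QuadraticAlgebra k a 0))
  refine Nat.le_of_mul_le_mul_right (c := 2 ^ X) ?_ (by positivity)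
  rw [key, ← pow_mul, ← pow_add]
  exact Nat.pow_le_pow_right (by norm_num) (by omega)
end Pourchet

namespace Pourchet
open IsDedekindDomain NumberField QuadraticAlgebra
variable {k : Type*} [Field k] [NumberField k]

lemma mem_psq_of_fabs {v : HeightOneSpectrum (𝓞 k)} (h2 : fabs v (2 : k) = 1) {x : kˣ}
    (hx : fabs v (x : k) = 1) {y : k} (h : fabs v (y ^ 2 - x) < 1) : x ∈ psq (Sum.inl v) := by
  have h4 : ‖(4 : v.adicCompletion k)‖ = 1 := by
    have : (4 : v.adicCompletion k) = toComp v (2 ^ 2) := by rw [map_pow, map_ofNat]; norm_num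
    rw [this, norm_toComp, map_pow, h2, one_pow]
  refine mem_lsq.2 (isSquare_of_norm_sub_lt (v := toComp v (y ^ 2)) ⟨toComp v y, by rw [pow_two, map_mul]⟩ ?_)
  have hy : fabs v (y ^ 2) = 1 := by
    rw [← norm_toComp, norm_eq_of_sub_lt (y := toComp v x), norm_toComp, hx]
    rw [← map_sub, norm_toComp, norm_toComp, hx]; exact h
  rw [h4, one_mul, norm_toComp, hy, ← map_sub, norm_toComp, AbsoluteValue.map_sub]
  exact h

lemma exists_fabs_of_mem_psq {v : HeightOneSpectrum (𝓞 k)} {x : kˣ}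
    (hx : fabs v (x : k) = 1) (h : x ∈ psq (Sum.inl v)) : ∃ y : k, fabs v (y ^ 2 - x) < 1 := by
  obtain ⟨α, hα⟩ := mem_lsq.1 h
  have h1 : ‖α‖ = 1 := by
    rw [← norm_toComp, hα, norm_mul, ← pow_two] at hx
    exact (pow_eq_one_iff_of_nonneg (norm_nonneg _) two_ne_zero).1 hx
  obtain ⟨y, hy⟩ := (denseRange_toComp v).exists_dist_lt α one_pos
  rw [dist_eq_norm, norm_sub_rev] at hy
  refine ⟨y, ?_⟩
  have hy1 : ‖toComp v y + α‖ ≤ 1 := by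
    refine (IsUltrametricDist.norm_add_le_max _ _).trans ?_
    rw [norm_eq_of_sub_lt (y := α) (by rw [h1]; exact hy), h1, max_self]
  have e : toComp v (y ^ 2 - x) = (toComp v y - α) * (toComp v y + α) := by
    rw [map_sub, map_pow, hα]; ring
  rw [← norm_toComp, e, norm_mul]
  exact (mul_le_of_le_one_right (norm_nonneg _) hy1).trans_lt hy

lemma mul_mem_psq {v : HeightOneSpectrum (𝓞 k)} (h2 : fabs v (2 : k) = 1) {x y : kˣ}
    (hx : fabs v (x : k) = 1) (hy : fabs v (y : k) = 1) (hx' : x ∉ psq (Sum.inl v))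
    (hy' : y ∉ psq (Sum.inl v)) : x * y ∈ psq (Sum.inl v) := by
  classical
  have : v.asIdeal.IsMaximal := v.isMaximal
  let _ := Ideal.Quotient.field v.asIdeal
  have : Finite (𝓞 k ⧸ v.asIdeal) := Ideal.finiteQuotientOfFreeOfNeBot v.asIdeal v.ne_bot
  let _ := Fintype.ofFinite (𝓞 k ⧸ v.asIdeal)
  have h0 {n : 𝓞 k} : Ideal.Quotient.mk v.asIdeal n = 0 ↔ fabs v (n : k) < 1 := by
    rw [Ideal.Quotient.eq_zero_iff_mem, fabs_int_lt]
  have hchar : ringChar (𝓞 k ⧸ v.asIdeal) ≠ 2 := by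
    intro hc
    have h3 : ((2 : ℕ) : 𝓞 k ⧸ v.asIdeal) = 0 := by rw [← hc]; exact ringChar.Nat.cast_ringChar
    have h4 := (h0 (n := 2)).1 (by rw [map_ofNat]; exact_mod_cast h3)
    exact h4.ne ((congrArg (fabs v) (map_ofNat (algebraMap (𝓞 k) k) 2)).trans h2)
  have key (z : kˣ) (hz : fabs v (z : k) = 1) (n : 𝓞 k) (hn : fabs v ((n : k) - z) < 1) :
      Ideal.Quotient.mk v.asIdeal n ≠ 0 ∧ (IsSquare (Ideal.Quotient.mk v.asIdeal n) →
        z ∈ psq (Sum.inl v)) := by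
    constructor
    · rw [Ne, h0]
      intro h
      have h5 : (z : k) = n + -(n - z) := by ring
      have h6 := fabs_add_le v (n : k) (-(n - z))
      rw [← h5, hz, map_neg_eq_map] at h6
      exact (max_lt h hn).not_ge h6
    · rintro ⟨r, hr⟩
      obtain ⟨m, rfl⟩ := Ideal.Quotient.mk_surjective r
      rw [← sub_eq_zero, ← map_mul, ← map_sub, h0] at hr
      refine mem_psq_of_fabs h2 hz (y := m) ?_
      have h5 : (m : k) ^ 2 - z = (n - z) + -((n - m * m : 𝓞 k) : k) := by push_cast; ring
      rw [h5]
      refine (fabs_add_le v _ _).trans_lt (max_lt hn ?_)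
      rw [map_neg_eq_map]; exact hr
  obtain ⟨n, hn⟩ := exists_int_approx v hx.le one_pos
  obtain ⟨m, hm⟩ := exists_int_approx v hy.le one_pos
  obtain ⟨hn0, hns⟩ := key x hx n hn
  obtain ⟨hm0, hms⟩ := key y hy m hm
  have hxy : fabs v ((x * y : kˣ) : k) = 1 := by rw [Units.val_mul, map_mul, hx, hy, one_mul]
  refine (key (x * y) hxy (n * m) ?_).2 ?_
  · have h5 : ((n * m : 𝓞 k) : k) - (x * y : kˣ) = (n - x) * m + x * (m - y) := by
      push_cast; ring
    rw [h5]
    refine (fabs_add_le v _ _).trans_lt (max_lt ?_ ?_)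
    · rw [map_mul]
      exact (mul_le_of_le_one_right (apply_nonneg _ _) (fabs_int_le v m)).trans_lt hn
    · rw [map_mul, hx, one_mul]; exact hm
  · have a1 := (FiniteField.pow_dichotomy hchar hn0).resolve_left
      fun h => hx' (hns ((FiniteField.isSquare_iff hchar hn0).2 h))
    have a2 := (FiniteField.pow_dichotomy hchar hm0).resolve_left
      fun h => hy' (hms ((FiniteField.isSquare_iff hchar hm0).2 h))
    rw [map_mul, FiniteField.isSquare_iff hchar (mul_ne_zero hn0 hm0), mul_pow, a1, a2]
    norm_num

/-- Sets of primes that are large enough for class group and dyadic considerations. -/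
structure Large (S : Finset (HeightOneSpectrum (𝓞 k))) : Prop where
  principal : PrincipalOutside (S : Set (HeightOneSpectrum (𝓞 k)))
  two : ∀ v, v ∉ S → fabs v (2 : k) = 1

lemma exists_large (S : Finset (HeightOneSpectrum (𝓞 k))) (X : Finset kˣ) :
    ∃ S1 : Finset (HeightOneSpectrum (𝓞 k)), S ⊆ S1 ∧ (∀ T, S1 ⊆ T → Large T) ∧
      ∀ x ∈ X, x ∈ SU (S1 : Set (HeightOneSpectrum (𝓞 k))) := by
  classical
  obtain ⟨S0, hS0⟩ := exists_principalOutside (k := k)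
  have hf (x : kˣ) := finite_fabs_ne_one x.ne_zero
  have h2 := finite_fabs_ne_one (k := k) two_ne_zero
  refine ⟨S ∪ S0 ∪ h2.toFinset ∪ X.biUnion fun x => (hf x).toFinset, fun v hv => by simp [hv],
    fun T hT => ⟨hS0 _ fun v hv => hT ?_, fun v hv => ?_⟩, fun x hx v hv => ?_⟩
  · simp [Finset.mem_coe.1 hv]
  · by_contra h
    exact hv (hT (by simp [h]))
  · by_contra h
    refine hv ?_
    simp only [Finset.coe_union, Set.mem_union, Finset.mem_coe, Finset.mem_biUnion]
    exact Or.inr ⟨x, hx, by simpa using h⟩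

lemma exists_reps {G : Type*} [CommGroup G] (M : Subgroup G) (hM : M.index ≠ 0) :
    ∃ X : Finset G, ∀ x : G, ∃ y ∈ X, x * y⁻¹ ∈ M := by
  classical
  have : M.FiniteIndex := ⟨hM⟩
  have : Finite (G ⧸ M) := inferInstance
  let _ := Fintype.ofFinite (G ⧸ M)
  refine ⟨Finset.univ.image fun q : G ⧸ M => q.out, fun x => ⟨(x : G ⧸ M).out, by simp, ?_⟩⟩
  rw [mul_comm]
  exact QuotientGroup.eq.1 (QuotientGroup.out_eq' (x : G ⧸ M))

lemma relIndex_of_sup {G : Type*} [CommGroup G] (M H : Subgroup G)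
    (h : ∀ x : G, ∃ y ∈ H, x * y⁻¹ ∈ M) : M.relIndex H = M.index := by
  rw [← Subgroup.relIndex_sup_right, ← Subgroup.relIndex_top_right]
  congr 1
  rw [eq_top_iff]
  intro x _
  obtain ⟨y, hy, hxy⟩ := h x
  have : x = y * (x * y⁻¹) := by rw [mul_comm x, mul_inv_cancel_left]
  rw [this]
  exact Subgroup.mul_mem_sup hy hxy

lemma nrm_le_pnm (a : k) (p : Pl k) : nrm a ≤ pnm a p := by
  rintro x ⟨r, s, h⟩
  rcases p with v | t
  · exact mem_lnm.2 ⟨toComp v r, toComp v s, by rw [h]; simp⟩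
  · exact mem_lnm.2 ⟨t r, t s, by rw [h]; simp⟩

lemma nonsplit_mono_eq {P Q : Finset (Pl k)} (h : P ⊆ Q) (a : kˣ) (hq : ∀ q ∈ Q, q ∉ P → a ∈ psq q) :
    nonsplit Q a = nonsplit P a := by
  classical
  unfold nonsplit
  congr 1
  ext q
  simp only [Finset.mem_filter]
  exact ⟨fun h1 => ⟨by_contra fun h2 => h1.2 (hq q h1.1 h2), h1.2⟩, fun h1 => ⟨h h1.1, h1.2⟩⟩

lemma mem_allPl_inl {S : Finset (HeightOneSpectrum (𝓞 k))} {v} :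
    (Sum.inl v : Pl k) ∈ allPl S ↔ v ∈ S := by simp [allPl]

lemma mem_allPl_inr {S : Finset (HeightOneSpectrum (𝓞 k))} {s} :
    (Sum.inr s : Pl k) ∈ allPl S := by simp [allPl]

lemma allPl_mono {S T : Finset (HeightOneSpectrum (𝓞 k))} (h : S ⊆ T) : allPl S ⊆ allPl T := by
  rintro (v | s) hv
  · exact mem_allPl_inl.2 (h (mem_allPl_inl.1 hv))
  · exact mem_allPl_inr

theorem exists_not_mem_psq {u : kˣ} (hu : ¬ IsSquare (u : k))
    (S : Finset (HeightOneSpectrum (𝓞 k))) : ∃ v, v ∉ S ∧ u ∉ psq (Sum.inl v) := by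
  classical
  by_contra! hc
  set M := ⨅ p ∈ allPl S, pnm (u : k) p
  have hM : M.index = 2 ^ nonsplit (allPl S) u := index_iInf_pnm _ _
  obtain ⟨X, hX⟩ := exists_reps M (by rw [hM]; positivity)
  obtain ⟨S1, hS, hL, hXS⟩ := exists_large S (insert u X)
  have hL1 := hL S1 subset_rfl
  obtain ⟨h0, h⟩ := relIndex_nrm_SU hu hL1.principal hL1.two (hXS u (by simp))
  rw [nonsplit_mono_eq (allPl_mono hS), ← hM, ← relIndex_of_sup M (SU (S1 : Set _))] at h
  · have hle : nrm (u : k) ≤ M := le_iInf₂ fun p _ => nrm_le_pnm _ p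
    have := Subgroup.relIndex_dvd_of_le_left (SU (S1 : Set (HeightOneSpectrum (𝓞 k)))) hle
    have := Nat.le_of_dvd (Nat.pos_of_ne_zero h0) this
    omega
  · intro x
    obtain ⟨y, hy, hxy⟩ := hX x
    exact ⟨y, hXS y (by simp [hy]), hxy⟩
  · rintro (v | s) hq hq'
    · exact hc v fun h => hq' (mem_allPl_inl.2 h)
    · exact (hq' mem_allPl_inr).elim
end Pourchet

namespace Pourchet
open IsDedekindDomain NumberField QuadraticAlgebra
variable {k : Type*} [Field k] [NumberField k]

lemma relIndex_le_two {G : Type*} [CommGroup G] {A B : Subgroup G} (a : G) (ha : a ∈ B)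
    (h : ∀ x ∈ B, x ∈ A ∨ x * a ∈ A) : A.relIndex B ≤ 2 := by
  by_cases haA : a ∈ A
  · have : B ≤ A := fun x hx => (h x hx).elim id fun h1 => by
      simpa using A.mul_mem h1 (A.inv_mem haA)
    rw [Subgroup.relIndex_eq_one.2 this]; norm_num
  · refine (Subgroup.relIndex_eq_two_iff.2 ⟨a, ha, fun x hx => ?_⟩).le
    rcases h x hx with h1 | h1
    · exact Or.inr ⟨h1, fun h2 => haA (by simpa using A.mul_mem (A.inv_mem h1) h2)⟩
    · exact Or.inl ⟨h1, fun h2 => haA (by simpa using A.mul_mem (A.inv_mem h2) h1)⟩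

lemma relIndex_psq_eq_two {v : HeightOneSpectrum (𝓞 k)} (h2 : fabs v (2 : k) = 1)
    {B : Subgroup kˣ} (hB : ∀ x ∈ B, fabs v (x : k) = 1) {x : kˣ} (hx : x ∈ B)
    (hx' : x ∉ psq (Sum.inl v)) : (psq (Sum.inl v)).relIndex B = 2 := by
  refine Subgroup.relIndex_eq_two_iff.2 ⟨x, hx, fun y hy => ?_⟩
  by_cases h : y ∈ psq (Sum.inl v)
  · exact Or.inr ⟨h, fun h3 => hx' (by simpa using Subgroup.mul_mem _ (Subgroup.inv_mem _ h) h3)⟩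
  · exact Or.inl ⟨mul_mem_psq h2 (hB y hy) (hB x hx) h hx', h⟩

lemma mem_map_sq_SU {S : Set (HeightOneSpectrum (𝓞 k))} {x : kˣ} (hx : x ∈ SU S)
    (h : IsSquare (x : k)) : x ∈ (SU S).map (sq kˣ) := by
  obtain ⟨y, hy⟩ := h
  have hy0 : y ≠ 0 := by rintro rfl; exact x.ne_zero (by simp at hy)
  refine mem_map_sq.2 ⟨Units.mk0 y hy0, fun v hv => ?_, by ext; simp [hy, pow_two]⟩
  have := hx v hv
  rw [hy, map_mul, ← pow_two] at this
  exact (pow_eq_one_iff_of_nonneg (apply_nonneg _ _) two_ne_zero).1 this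

lemma isSquare_qincl {a x : k} (h : IsSquare (qincl a x)) :
    IsSquare x ∨ IsSquare (x * a) := by
  obtain ⟨y, hy⟩ := h
  have h1 := congrArg QuadraticAlgebra.re hy
  have h2 := congrArg QuadraticAlgebra.im hy
  simp only [QuadraticAlgebra.re_mul, QuadraticAlgebra.im_mul] at h1 h2
  have e1 : (qincl a x).re = x := by simp
  have e2 : (qincl a x).im = 0 := by simp
  rw [e1] at h1
  rw [e2] at h2
  have h3 : y.re * y.im = 0 := by linear_combination -h2 / 2
  rcases mul_eq_zero.1 h3 with h0 | h0
  · exact Or.inr ⟨a * y.im, by rw [h1, h0]; ring⟩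
  · exact Or.inl ⟨y.re, by rw [h1, h0]; ring⟩

lemma exists_split_not_mem_psq {a x : kˣ} (ha : ¬ IsSquare (a : k)) (hx : ¬ IsSquare (x : k))
    (hxa : ¬ IsSquare (x * a : k)) {S : Finset (HeightOneSpectrum (𝓞 k))} (hS : Large S)
    (haS : a ∈ SU (S : Set (HeightOneSpectrum (𝓞 k))))
    (hxS : x ∈ SU (S : Set (HeightOneSpectrum (𝓞 k)))) (T : Finset (HeightOneSpectrum (𝓞 k)))
    (hT : S ⊆ T) : ∃ v, v ∉ T ∧ a ∈ psq (Sum.inl v) ∧ x ∉ psq (Sum.inl v) := by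
  have := nsq_fact ha
  set i := qincl (a : k)
  obtain ⟨w, hw, hxw⟩ := exists_not_mem_psq (k := QuadraticAlgebra k (a : k) 0)
    (u := Units.map (i : k →* QuadraticAlgebra k (a : k) 0) x)
    (fun h => (isSquare_qincl h).elim hx hxa) (above i T)
  rw [mem_above] at hw
  set v := under i w
  have hvS : v ∉ S := fun h => hw (hT h)
  have h2 := hS.two v hvS
  have h2w : fabs w (2 : QuadraticAlgebra k (a : k) 0) = 1 := by
    rw [← map_ofNat i 2]; exact (fabs_under_eq i w).2 h2
  have key (z : kˣ) (hz : z ∈ SU (S : Set (HeightOneSpectrum (𝓞 k)))) (h : z ∈ psq (Sum.inl v)) :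
      Units.map (i : k →* QuadraticAlgebra k (a : k) 0) z ∈ psq (Sum.inl w) := by
    obtain ⟨y, hy⟩ := exists_fabs_of_mem_psq (hz v hvS) h
    refine mem_psq_of_fabs h2w ((fabs_under_eq i w).2 (hz v hvS)) (y := i y) ?_
    have := (fabs_under_lt i w).2 hy
    rwa [map_sub, map_pow] at this
  have hxv : x ∉ psq (Sum.inl v) := fun h => hxw (key x hxS h)
  refine ⟨v, hw, by_contra fun hav => hxw ?_, hxv⟩
  have h3 := key _ (Subgroup.mul_mem _ hxS haS)
    (mul_mem_psq h2 (hxS v hvS) (haS v hvS) hxv hav)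
  rw [map_mul] at h3
  have h4 : Units.map (i : k →* QuadraticAlgebra k (a : k) 0) a ∈ psq (Sum.inl w) := by
    refine mem_lsq.2 ⟨toComp w ⟨0, 1⟩, ?_⟩
    rw [← map_mul]
    congr 1
    ext <;> simp [i]
  simpa using Subgroup.mul_mem _ h3 (Subgroup.inv_mem _ h4)

theorem exists_test_primes {a : kˣ} (ha : ¬ IsSquare (a : k))
    {S : Finset (HeightOneSpectrum (𝓞 k))} (hS : Large S)
    (haS : a ∈ SU (S : Set (HeightOneSpectrum (𝓞 k)))) (n : ℕ)
    (hn : n + 1 ≤ S.card + Fintype.card (InfinitePlace k)) :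
    ∃ T : Finset (HeightOneSpectrum (𝓞 k)), T.card = n ∧ (∀ v ∈ T, v ∉ S ∧ a ∈ psq (Sum.inl v)) ∧
      (⨅ v ∈ T, psq (Sum.inl v)).relIndex (SU (S : Set (HeightOneSpectrum (𝓞 k)))) = 2 ^ n := by
  classical
  induction n with
  | zero => exact ⟨∅, rfl, by simp, by simp⟩
  | succ n ih =>
    obtain ⟨T, hTn, hT, hi⟩ := ih (by omega)
    set G := SU (S : Set (HeightOneSpectrum (𝓞 k)))
    set M := ⨅ v ∈ T, psq (k := k) (Sum.inl v)
    have hsqM : G.map (sq kˣ) ≤ M := by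
      rintro _ ⟨y, -, rfl⟩
      refine Subgroup.mem_iInf.2 fun v => Subgroup.mem_iInf.2 fun _ => mem_lsq.2 ⟨toComp v y, ?_⟩
      simp [pow_two]
    have hsqG : G.map (sq kˣ) ≤ G := by
      rintro _ ⟨y, hy, rfl⟩
      exact G.pow_mem hy 2
    have haM : a ∈ M := Subgroup.mem_iInf.2 fun v => Subgroup.mem_iInf.2 fun hv => (hT v hv).2
    obtain ⟨x, hxM, hxG, hx, hxa⟩ : ∃ x, x ∈ M ∧ x ∈ G ∧ ¬ IsSquare (x : k) ∧
        ¬ IsSquare (x * a : k) := by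
      by_contra! hc
      have h1 : (G.map (sq kˣ)).relIndex (M ⊓ G) ≤ 2 := by
        refine relIndex_le_two a ⟨haM, haS⟩ fun x hx => ?_
        by_cases h : IsSquare (x : k)
        · exact Or.inl (mem_map_sq_SU hx.2 h)
        · exact Or.inr (mem_map_sq_SU (G.mul_mem hx.2 haS) (hc x hx.1 hx.2 h))
      have h2 := Subgroup.relIndex_mul_relIndex _ _ _ (le_inf hsqM hsqG) (inf_le_right : M ⊓ G ≤ G)
      rw [relIndex_map_sq, sqx_SU, Subgroup.inf_relIndex_right, hi] at h2
      have h3 : 2 ^ (S.card + Fintype.card (InfinitePlace k)) ≤ 2 ^ (n + 1) := by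
        rw [← h2, pow_succ']; gcongr
      have := (Nat.pow_le_pow_iff_right (by norm_num : 1 < 2)).1 h3
      omega
    obtain ⟨v, hvT, hav, hxv⟩ := exists_split_not_mem_psq ha hx hxa hS haS hxG (S ∪ T)
      Finset.subset_union_left
    have hvT' : v ∉ T := fun h => hvT (Finset.mem_union_right _ h)
    have hvS' : v ∉ S := fun h => hvT (Finset.mem_union_left _ h)
    refine ⟨insert v T, by rw [Finset.card_insert_of_notMem hvT', hTn], ?_, ?_⟩
    · intro w hw
      rcases Finset.mem_insert.1 hw with rfl | hw
      · exact ⟨hvS', hav⟩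
      · exact hT w hw
    · rw [Finset.iInf_insert, ← Subgroup.relIndex_inf_mul_relIndex, hi, pow_succ',
        relIndex_psq_eq_two (hS.two v hvS') (B := M ⊓ G)
          (fun y hy => hy.2 v hvS') ⟨hxM, hxG⟩ hxv]
end Pourchet

namespace Pourchet
open IsDedekindDomain NumberField QuadraticAlgebra
variable {k : Type*} [Field k] [NumberField k]

lemma Large.mono {S T : Finset (HeightOneSpectrum (𝓞 k))} (hS : Large S) (h : S ⊆ T) : Large T where
  principal J hJ := by
    obtain ⟨c, hc⟩ := hS.principal J hJ
    exact ⟨c, fun v hv => hc v fun h1 => hv (h h1)⟩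
  two v hv := hS.two v fun h1 => hv (h h1)

lemma relIndex_iInf_psq (T : Finset (HeightOneSpectrum (𝓞 k)))
    (h2 : ∀ v ∈ T, fabs v (2 : k) = 1) {B : Subgroup kˣ}
    (hB : ∀ x ∈ B, ∀ v ∈ T, fabs v (x : k) = 1) :
    ∃ e, e ≤ T.card ∧ (⨅ v ∈ T, psq (k := k) (Sum.inl v)).relIndex B = 2 ^ e := by
  classical
  induction T using Finset.induction_on with
  | empty => exact ⟨0, by simp⟩
  | insert v T hv ih =>
    obtain ⟨e, he, hi⟩ := ih (fun w hw => h2 w (by simp [hw])) fun x hx w hw => hB x hx w (by simp [hw])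
    rw [Finset.iInf_insert, ← Subgroup.relIndex_inf_mul_relIndex, hi,
      Finset.card_insert_of_notMem hv]
    set B' := (⨅ v ∈ T, psq (k := k) (Sum.inl v)) ⊓ B
    by_cases h : B' ≤ psq (Sum.inl v)
    · exact ⟨e, by omega, by rw [Subgroup.relIndex_eq_one.2 h, one_mul]⟩
    · obtain ⟨x, hx, hx'⟩ := SetLike.not_le_iff_exists.1 h
      refine ⟨e + 1, by omega, ?_⟩
      rw [relIndex_psq_eq_two (B := B') (h2 v (by simp)) (fun y hy => hB y hy.2 v (by simp)) hx hx', pow_succ']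

lemma exists_div_mem_iInf_psq {S T : Finset (HeightOneSpectrum (𝓞 k))} (hS : Large S)
    (hT : ∀ v ∈ T, v ∉ S)
    (hi : (⨅ v ∈ T, psq (Sum.inl v)).relIndex (SU (S : Set (HeightOneSpectrum (𝓞 k)))) = 2 ^ T.card)
    (R : Finset (HeightOneSpectrum (𝓞 k))) (hSR : S ⊆ R) (hTR : T ⊆ R) (x : kˣ) :
    ∃ y ∈ SU (R : Set (HeightOneSpectrum (𝓞 k))), x * y⁻¹ ∈ ⨅ v ∈ T, psq (k := k) (Sum.inl v) := by
  classical
  set M := ⨅ v ∈ T, psq (k := k) (Sum.inl v)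
  let U : Subgroup kˣ :=
    { carrier := {x | ∀ v ∈ T, fabs v (x : k) = 1}
      one_mem' := by simp
      mul_mem' := by
        intro x y hx hy v hv
        rw [Units.val_mul, map_mul, hx v hv, hy v hv, one_mul]
      inv_mem' := by
        intro x hx v hv
        rw [Units.val_inv_eq_inv_val, map_inv₀, hx v hv, inv_one] }
  have hSU : SU (S : Set (HeightOneSpectrum (𝓞 k))) ≤ U := fun x hx v hv => hx v (hT v hv)
  have hU : U ≤ SU (S : Set (HeightOneSpectrum (𝓞 k))) ⊔ M ⊓ U := by
    obtain ⟨e, he, h⟩ := relIndex_iInf_psq (B := U) T (fun v hv => hS.two v (hT v hv)) fun x hx => hx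
    have h1 := Subgroup.relIndex_mul_relIndex (M ⊓ U) (SU (S : Set (HeightOneSpectrum (𝓞 k))) ⊔ M ⊓ U) U
      le_sup_right (sup_le hSU inf_le_right)
    rw [Subgroup.relIndex_sup_right, Subgroup.inf_relIndex_right, h] at h1
    have h3 : (M ⊓ U).relIndex (SU (S : Set (HeightOneSpectrum (𝓞 k)))) = 2 ^ T.card := by
      rw [← hi, ← Subgroup.inf_relIndex_right, inf_assoc, inf_eq_right.2 hSU,
        Subgroup.inf_relIndex_right]
    rw [h3] at h1
    have h2 : (2 : ℕ) ^ e ≤ 2 ^ T.card := Nat.pow_le_pow_right (by norm_num) he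
    refine Subgroup.relIndex_eq_one.1 ?_
    rw [← h1] at h2
    have h4 : (2 : ℕ) ^ T.card > 0 := by positivity
    have h5 : (2 : ℕ) ^ e > 0 := by positivity
    have h6 : (SU (S : Set (HeightOneSpectrum (𝓞 k))) ⊔ M ⊓ U).relIndex U ≤ 1 :=
      Nat.le_of_mul_le_mul_left (h2.trans (mul_one _).ge) h4
    have h7 : (SU (S : Set (HeightOneSpectrum (𝓞 k))) ⊔ M ⊓ U).relIndex U ≠ 0 := by
      intro h0
      rw [h0] at h1; omega
    omega
  choose! c hc hc1 hcn using fun v (hv : v ∈ T) => hS.principal.exists_uniformizer v (hT v hv)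
  have hn (v) (hv : v ∈ T) := hcn v hv x x.ne_zero
  choose! n hn using hn
  have hcR (v) (hv : v ∈ T) : c v ∈ SU (R : Set (HeightOneSpectrum (𝓞 k))) := by
    refine SU_mono ?_ (hc v hv)
    intro w hw
    rcases hw with rfl | hw
    · exact hTR hv
    · exact hSR hw
  set y := ∏ v ∈ T, c v ^ n v
  have hy : y ∈ SU (R : Set (HeightOneSpectrum (𝓞 k))) :=
    Subgroup.prod_mem _ fun v hv => Subgroup.zpow_mem _ (hcR v hv) _
  have hxy : x * y⁻¹ ∈ U := by
    intro v hv
    have : fabs v ((y : kˣ) : k) = fabs v x := by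
      rw [hn v hv, Units.coe_prod, map_prod, Finset.prod_eq_single v]
      · rw [Units.val_zpow_eq_zpow_val, map_zpow₀]
      · intro w hw hwv
        rw [Units.val_zpow_eq_zpow_val, map_zpow₀, hc w hw v, one_zpow]
        rintro (h | h)
        · exact hwv h.symm
        · exact hT v hv h
      · exact fun h => absurd hv h
    rw [Units.val_mul, map_mul, Units.val_inv_eq_inv_val, map_inv₀, this, mul_inv_cancel₀]
    simp
  obtain ⟨g, hg, m, hm, hgm⟩ := Subgroup.mem_sup.1 (hU hxy)
  refine ⟨g * y, Subgroup.mul_mem _ (SU_mono (by exact_mod_cast hSR) hg) hy, ?_⟩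
  have : x * (g * y)⁻¹ = m := by
    rw [mul_inv, mul_left_comm, ← hgm, inv_mul_cancel_left]
  rw [this]; exact hm.1

theorem isSquare_of_mem_psq {S T : Finset (HeightOneSpectrum (𝓞 k))} (hS : Large S)
    (hT : ∀ v ∈ T, v ∉ S)
    (hi : (⨅ v ∈ T, psq (Sum.inl v)).relIndex (SU (S : Set (HeightOneSpectrum (𝓞 k)))) = 2 ^ T.card)
    {R : Finset (HeightOneSpectrum (𝓞 k))} (hSR : S ⊆ R) (hTR : T ⊆ R) (hR : ∀ v ∈ R, v ∈ S ∨ v ∈ T)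
    {b : kˣ} (hb : b ∈ SU (R : Set (HeightOneSpectrum (𝓞 k)))) (hbS : ∀ p ∈ allPl S, b ∈ psq p) :
    IsSquare (b : k) := by
  classical
  by_contra hns
  have hL := hS.mono hSR
  obtain ⟨h0, h⟩ := relIndex_nrm_SU hns hL.principal hL.two hb
  set P : Finset (Pl k) := T.map ⟨Sum.inl, Sum.inl_injective⟩
  rw [nonsplit_mono_eq (P := P)] at h
  · set M := ⨅ p ∈ P, pnm (b : k) p
    have hM : M.index = _ := index_iInf_pnm P b
    rw [← hM, ← relIndex_of_sup M (SU (R : Set (HeightOneSpectrum (𝓞 k))))] at h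
    · have hle : nrm (b : k) ≤ M := le_iInf₂ fun p _ => nrm_le_pnm _ p
      have := Subgroup.relIndex_dvd_of_le_left (SU (R : Set (HeightOneSpectrum (𝓞 k)))) hle
      have := Nat.le_of_dvd (Nat.pos_of_ne_zero h0) this
      omega
    · intro x
      obtain ⟨y, hy, hxy⟩ := exists_div_mem_iInf_psq hS hT hi R hSR hTR x
      refine ⟨y, hy, ?_⟩
      refine Subgroup.mem_iInf.2 fun p => Subgroup.mem_iInf.2 fun hp => ?_
      obtain ⟨v, hv, rfl⟩ := Finset.mem_map.1 hp
      exact psq_le_pnm _ _ (Subgroup.mem_iInf.1 (Subgroup.mem_iInf.1 hxy v) hv)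
  · intro p hp
    obtain ⟨v, hv, rfl⟩ := Finset.mem_map.1 hp
    exact mem_allPl_inl.2 (hTR hv)
  · rintro (v | s) hq hq'
    · refine hbS _ (mem_allPl_inl.2 ?_)
      refine (hR v (mem_allPl_inl.1 hq)).resolve_right fun h => hq' (Finset.mem_map.2 ⟨v, h, rfl⟩)
    · exact hbS _ mem_allPl_inr
end Pourchet

namespace Pourchet
open IsDedekindDomain NumberField
variable {k : Type*} [Field k] [NumberField k]

lemma exists_pow_asIdeal_le (v : HeightOneSpectrum (𝓞 k)) {d : ℝ} (hd : 0 < d) :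
    ∃ e : ℕ, ∀ x ∈ v.asIdeal ^ e, fabs v (x : k) ≤ d := by
  obtain ⟨p, hp0, hp1, hp⟩ := exists_global_uniformizer v
  have hpos : 0 < fabs v p := (fabs v).pos hp0
  obtain ⟨e, he⟩ := exists_pow_lt_of_lt_one hd hp1
  refine ⟨e, fun x hx => le_trans ?_ he.le⟩
  have h1 (x : 𝓞 k) (hx : x ∈ v.asIdeal) : fabs v (x : k) ≤ fabs v p := by
    by_cases hx0 : (x : k) = 0
    · rw [hx0, map_zero]; exact hpos.le
    obtain ⟨n, hn⟩ := hp x hx0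
    have h2 := (fabs_int_lt v).2 hx
    rw [hn] at h2 ⊢
    have h3 : 0 < n := by
      by_contra! h
      exact h2.not_ge (one_le_zpow_of_nonpos₀ hpos hp1.le h)
    calc fabs v p ^ n ≤ fabs v p ^ (1 : ℤ) := zpow_le_zpow_right_of_le_one₀ hpos hp1.le h3
      _ = fabs v p := zpow_one _
  clear he
  induction e generalizing x with
  | zero => rw [pow_zero]; exact fabs_int_le v x
  | succ e ih =>
    rw [pow_succ] at hx ⊢
    refine Submodule.mul_induction_on hx (fun y hy z hz => ?_) fun y z hy hz => ?_
    · rw [show ((y * z : 𝓞 k) : k) = y * z by push_cast; rfl, map_mul]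
      exact mul_le_mul (ih y hy) (h1 z hz) (apply_nonneg _ _) (by positivity)
    · rw [show ((y + z : 𝓞 k) : k) = y + z by push_cast; rfl]
      exact (fabs_add_le v _ _).trans (max_le hy hz)

/-- The integers that are divisible by two locally. -/
noncomputable def twoA (v : HeightOneSpectrum (𝓞 k)) : AddSubgroup (𝓞 k) :=
  (ballA (2 : v.adicCompletion k)).comap ((toComp v).comp (algebraMap (𝓞 k) k)).toAddMonoidHom

lemma mem_twoA {v : HeightOneSpectrum (𝓞 k)} {x : 𝓞 k} :
    x ∈ twoA v ↔ fabs v (x : k) ≤ ‖(2 : v.adicCompletion k)‖ := by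
  rw [← norm_toComp]; rfl

lemma add_self_mem_twoA (v : HeightOneSpectrum (𝓞 k)) (x : 𝓞 k) : x + x ∈ twoA v := by
  have : fabs v (2 : k) = ‖(2 : v.adicCompletion k)‖ := by rw [← norm_toComp, map_ofNat]
  rw [mem_twoA, show ((x + x : 𝓞 k) : k) = 2 * x by push_cast; ring, map_mul, this]
  exact mul_le_of_le_one_right (norm_nonneg _) (fabs_int_le v _)

lemma index_twoA (v : HeightOneSpectrum (𝓞 k)) :
    (twoA v).index = (ballA (2 : v.adicCompletion k)).relIndex (ballA 1) := by
  rw [twoA, AddSubgroup.index_comap, ← AddSubgroup.relIndex_sup_right]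
  have h2 : 0 < ‖(2 : v.adicCompletion k)‖ := norm_pos_iff.2 (by norm_num)
  congr 1
  apply le_antisymm
  · refine sup_le ?_ ?_
    · rintro _ ⟨x, rfl⟩
      rw [mem_ballA, norm_one]
      exact (norm_toComp v x).le.trans (fabs_int_le v x)
    · intro x hx
      rw [mem_ballA, norm_one]
      exact (mem_ballA.1 hx).trans norm_two_le_one
  · intro x hx
    rw [mem_ballA, norm_one] at hx
    obtain ⟨y, hy⟩ := (denseRange_toComp v).exists_dist_lt x (lt_min h2 one_pos)
    rw [dist_eq_norm, lt_min_iff] at hy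
    have hy1 : fabs v y ≤ 1 := by
      rw [← norm_toComp]
      have : toComp v y = x - (x - toComp v y) := by ring
      rw [this]
      exact (norm_sub_le_max' _ _).trans (max_le hx hy.2.le)
    obtain ⟨z, hz⟩ := exists_int_approx v hy1 h2
    have : x = toComp v z + (x - toComp v z) := by ring
    rw [this]
    refine AddSubgroup.add_mem_sup ⟨z, rfl⟩ (mem_ballA.2 ?_)
    have h3 : x - toComp v z = (x - toComp v y) - toComp v (z - y) := by rw [map_sub]; ring
    rw [h3]
    refine (norm_sub_le_max' _ _).trans (max_le hy.1.le ?_)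
    rw [norm_toComp]; exact hz.le

lemma prod_relIndex_ballA_le (S : Finset (HeightOneSpectrum (𝓞 k))) :
    ∏ v ∈ S, (ballA (2 : v.adicCompletion k)).relIndex (ballA 1) ≤ 2 ^ Module.finrank ℚ k := by
  have hq : sqx (Multiplicative (𝓞 k)) = 2 ^ Module.finrank ℚ k := by
    have : Module.Free ℤ (Additive (Multiplicative (𝓞 k))) := inferInstanceAs (Module.Free ℤ (𝓞 k))
    have : Module.Finite ℤ (Additive (Multiplicative (𝓞 k))) :=
      inferInstanceAs (Module.Finite ℤ (𝓞 k))
    rw [sqx_free, ← RingOfIntegers.rank]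
    rfl
  rw [← hq]
  have h := index_iInf_of_approx S (fun v => AddSubgroup.toSubgroup (twoA (k := k) v)) (fun y => ?_)
  · have h1 : ∏ v ∈ S, (ballA (2 : v.adicCompletion k)).relIndex (ballA 1) =
        ∏ v ∈ S, (AddSubgroup.toSubgroup (twoA (k := k) v)).index :=
      Finset.prod_congr rfl fun v _ => by rw [AddSubgroup.index_toSubgroup, index_twoA]
    rw [h1, ← h, sqx]
    refine Nat.le_of_dvd (Nat.pos_of_ne_zero ?_) (Subgroup.index_dvd_of_le ?_)
    · change sqx _ ≠ 0
      rw [hq]; positivity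
    · rintro _ ⟨x, rfl⟩
      refine Subgroup.mem_iInf.2 fun v => Subgroup.mem_iInf.2 fun _ => ?_
      rw [powMonoidHom_apply, pow_two]
      exact add_self_mem_twoA v x.toAdd
  · choose e he using fun v : HeightOneSpectrum (𝓞 k) =>
      exists_pow_asIdeal_le v (d := ‖(2 : v.adicCompletion k)‖) (norm_pos_iff.2 (by norm_num))
    obtain ⟨x, hx⟩ := IsDedekindDomain.exists_forall_sub_mem_ideal (s := S)
      (fun v => v.asIdeal) e (fun v _ => v.prime) (fun v _ w _ hvw h => hvw (HeightOneSpectrum.ext h))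
      fun v => (y v).toAdd
    refine ⟨Multiplicative.ofAdd x, fun v hv => ?_⟩
    have := he v _ (hx v hv)
    change x + -(y v).toAdd ∈ twoA v
    rw [← sub_eq_add_neg]
    exact mem_twoA.2 this

lemma index_iInf_psq_le (S : Finset (HeightOneSpectrum (𝓞 k))) :
    (⨅ p ∈ allPl S, psq (k := k) p).index ≤ 2 ^ (2 * (S.card + Fintype.card (InfinitePlace k))) := by
  have e1 (v : HeightOneSpectrum (𝓞 k)) : (psq (Sum.inl v)).index =
      4 * (ballA (2 : v.adicCompletion k)).relIndex (ballA 1) := index_lsq_toComp v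
  have e2 (t : k →+* ℝ) : (psq (Sum.inr t)).index = 2 := index_lsq_real t
  rw [index_iInf_psq, allPl, Finset.prod_disjSum, mul_add, two_mul_card_infinitePlace,
    Finset.prod_congr rfl fun v _ => e1 v, Finset.prod_congr rfl fun t _ => e2 t, Finset.prod_mul_distrib, Finset.prod_const,
    Finset.prod_const, Finset.card_univ, pow_add, pow_add, pow_mul, ← mul_assoc]
  gcongr
  · norm_num
  · exact prod_relIndex_ballA_le S

lemma index_iInf_psq_ne_zero (S : Finset (HeightOneSpectrum (𝓞 k))) :
    (⨅ p ∈ allPl S, psq (k := k) p).index ≠ 0 := by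
  rw [index_iInf_psq, Finset.prod_ne_zero_iff]
  rintro (v | s) _
  · change (lsq (toComp v)).index ≠ 0
    rw [index_lsq_toComp]
    exact mul_ne_zero (by norm_num) (relIndex_ballA_ne_zero (by norm_num))
  · change (lsq s).index ≠ 0
    rw [index_lsq_real]; norm_num

theorem mem_nrm_of_pnm {a b : kˣ} (ha : ¬ IsSquare (a : k))
    {S : Finset (HeightOneSpectrum (𝓞 k))} (hS : Large S)
    (haS : a ∈ SU (S : Set (HeightOneSpectrum (𝓞 k))))
    (hbS : b ∈ SU (S : Set (HeightOneSpectrum (𝓞 k))))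
    (h : ∀ p ∈ allPl S, b ∈ pnm (a : k) p) : b ∈ nrm (a : k) := by
  classical
  set s := S.card + Fintype.card (InfinitePlace k) with hs
  have hs0 : 1 ≤ s := le_add_left Fintype.card_pos
  obtain ⟨T, hTc, hT, hi⟩ := exists_test_primes ha hS haS (s - 1) (by omega)
  rw [← hTc] at hi
  set R := S ∪ T
  have hSR : S ⊆ R := Finset.subset_union_left
  set G := SU (R : Set (HeightOneSpectrum (𝓞 k)))
  set H := ⨅ p ∈ allPl S, psq (k := k) p
  have hRc : R.card = S.card + T.card := Finset.card_union_of_disjoint <|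
    Finset.disjoint_left.2 fun v h1 h2 => (hT v h2).1 h1
  have hSG : SU (S : Set (HeightOneSpectrum (𝓞 k))) ≤ G := SU_mono (by exact_mod_cast hSR)
  have hHG : H ⊓ G = G.map (sq kˣ) := by
    apply le_antisymm
    · intro x hx
      refine mem_map_sq_SU hx.2 (isSquare_of_mem_psq hS (fun v hv => (hT v hv).1) hi hSR
        Finset.subset_union_right (fun v hv => Finset.mem_union.1 hv) hx.2 fun p hp =>
          Subgroup.mem_iInf.1 (Subgroup.mem_iInf.1 hx.1 p) hp)
    · rintro _ ⟨y, hy, rfl⟩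
      refine ⟨Subgroup.mem_iInf.2 fun p => Subgroup.mem_iInf.2 fun _ => ?_, G.pow_mem hy 2⟩
      rcases p with v | t
      · exact mem_lsq.2 ⟨toComp v y, by simp [pow_two]⟩
      · exact mem_lsq.2 ⟨t y, by simp [pow_two]⟩
  have h1 : H.relIndex G = 2 ^ (s + T.card) := by
    rw [← Subgroup.inf_relIndex_right, hHG, relIndex_map_sq, sqx_SU, hRc]
    congr 1; omega
  have h2 : (H ⊔ G).index ≤ 2 := by
    have h3 := Subgroup.relIndex_mul_index (le_sup_left : H ≤ H ⊔ G)
    rw [sup_comm, Subgroup.relIndex_sup_right, h1] at h3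
    have h4 := index_iInf_psq_le S
    rw [← hs] at h4
    change H.index ≤ _ at h4
    rw [← h3] at h4
    have h5 : 2 ^ (2 * s) = 2 ^ (s + T.card) * 2 := by rw [← pow_succ]; congr 1; omega
    rw [h5] at h4
    rw [sup_comm]
    exact Nat.le_of_mul_le_mul_left h4 (by positivity)
  set N := ⨅ p ∈ allPl S, pnm (a : k) p
  have hHN : H ≤ N := iInf₂_mono fun p _ => psq_le_pnm _ _
  have hN : N.index = 2 ^ nonsplit (allPl S) a := index_iInf_pnm _ _
  have h3 : 2 ^ nonsplit (allPl S) a ≤ N.relIndex G * 2 := by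
    have h5 := Subgroup.relIndex_mul_index (le_sup_left : N ≤ N ⊔ G)
    rw [sup_comm, Subgroup.relIndex_sup_right, hN, sup_comm] at h5
    rw [← h5]
    refine Nat.mul_le_mul_left _ (le_trans (Nat.le_of_dvd (Nat.pos_of_ne_zero fun h6 => ?_)
      (Subgroup.index_dvd_of_le (sup_le_sup_right hHN G))) h2)
    have h7 := Subgroup.relIndex_mul_index (le_sup_left : H ≤ H ⊔ G)
    rw [h6, mul_zero] at h7
    exact index_iInf_psq_ne_zero S h7.symm
  obtain ⟨h0, h4⟩ := relIndex_nrm_SU ha (hS.mono hSR).principal (hS.mono hSR).two (hSG haS)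
  rw [nonsplit_mono_eq (allPl_mono hSR)] at h4
  · have hle : nrm (a : k) ≤ N := le_iInf₂ fun p _ => nrm_le_pnm _ p
    have h5 := Subgroup.relIndex_mul_relIndex (nrm (a : k) ⊓ G) (N ⊓ G) G
      (inf_le_inf_right _ hle) inf_le_right
    rw [Subgroup.inf_relIndex_right, Subgroup.inf_relIndex_right] at h5
    have hpos : 0 < N.relIndex G := Nat.pos_of_ne_zero fun h6 => h0 (by rw [← h5, h6, mul_zero])
    have h6 : (nrm (a : k) ⊓ G).relIndex (N ⊓ G) = 1 := by
      have h7 : (nrm (a : k) ⊓ G).relIndex (N ⊓ G) ≠ 0 := fun h6 => h0 (by rw [← h5, h6, zero_mul])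
      change 2 * (nrm (a : k)).relIndex G ≤ _ at h4
      rw [← h5] at h4
      have h8 : (nrm (a : k) ⊓ G).relIndex (N ⊓ G) ≤ 1 :=
        Nat.le_of_mul_le_mul_right (c := N.relIndex G) (by linarith) hpos
      omega
    have h9 : b ∈ N ⊓ G := ⟨Subgroup.mem_iInf.2 fun p => Subgroup.mem_iInf.2 fun hp => h p hp, hSG hbS⟩
    exact (Subgroup.relIndex_eq_one.1 h6 h9).1
  · rintro (v | t) hq hq'
    · have hv := mem_allPl_inl.1 hq
      have hv' : v ∉ S := fun hh => hq' (mem_allPl_inl.2 hh)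
      exact (hT v ((Finset.mem_union.1 hv).resolve_left hv')).2
    · exact (hq' mem_allPl_inr).elim
end Pourchet

namespace Pourchet
open IsDedekindDomain NumberField

section Generic
variable {F : Type*} [Field F]

/-- Isotropy of a diagonal form. -/
def Iso {ι F : Type*} [Fintype ι] [Field F] (a : ι → F) : Prop :=
  ∃ x : ι → F, x ≠ 0 ∧ ∑ i, a i * x i ^ 2 = 0

lemma Iso.map {ι E : Type*} [Fintype ι] [Field E] {a : ι → F} (h : Iso a) (f : F →+* E) :
    Iso (f ∘ a) := by
  obtain ⟨x, hx, h⟩ := h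
  refine ⟨f ∘ x, fun h0 => hx ?_, ?_⟩
  · ext i
    exact (map_eq_zero f).1 (congrFun h0 i)
  · simpa using congrArg f h

/-- `b` is a value of `X ^ 2 - a * Y ^ 2`. -/
def Nm (a b : F) : Prop := ∃ p q : F, b = p ^ 2 - a * q ^ 2

lemma nm_of_isSquare (h2 : (2 : F) ≠ 0) {a : F} (ha : a ≠ 0) (h : IsSquare a) (b : F) : Nm a b := by
  obtain ⟨s, rfl⟩ := h
  have hs : s ≠ 0 := by rintro rfl; simp at ha
  refine ⟨(b + 1) / 2, (b - 1) / (2 * s), ?_⟩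
  field_simp
  ring

lemma isSquare_of_sq_eq {a x y : F} (hy : y ≠ 0) (h : x ^ 2 = a * y ^ 2) : IsSquare a :=
  ⟨x / y, by field_simp; rw [h]⟩

/-- A quaternion norm form which is isotropic is split. -/
lemma nm_of_iso4 (h2 : (2 : F) ≠ 0) {a b : F} (ha : a ≠ 0) {x y z w : F}
    (h0 : x ≠ 0 ∨ y ≠ 0 ∨ z ≠ 0 ∨ w ≠ 0)
    (h : x ^ 2 - a * y ^ 2 - b * (z ^ 2 - a * w ^ 2) = 0) : Nm a b := by
  by_cases hs : IsSquare a
  · exact nm_of_isSquare h2 ha hs b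
  have aux : ∀ {p q : F}, p ^ 2 - a * q ^ 2 = 0 → p = 0 ∧ q = 0 := by
    intro p q hpq
    have hq : q = 0 := by
      by_contra hq
      exact hs (isSquare_of_sq_eq hq (sub_eq_zero.1 hpq))
    subst hq
    simpa using hpq
  have hz : z ^ 2 - a * w ^ 2 ≠ 0 := by
    intro hz
    rw [hz, mul_zero, sub_zero] at h
    obtain ⟨rfl, rfl⟩ := aux hz
    obtain ⟨rfl, rfl⟩ := aux h
    simp at h0
  have hb : b = (x ^ 2 - a * y ^ 2) / (z ^ 2 - a * w ^ 2) := by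
    rw [eq_div_iff hz]; linear_combination -h
  refine ⟨(x * z + a * y * w) / (z ^ 2 - a * w ^ 2), (x * w + y * z) / (z ^ 2 - a * w ^ 2), ?_⟩
  rw [hb]
  field_simp
  ring

lemma nm_of_iso3 (h2 : (2 : F) ≠ 0) {a1 a2 a3 : F} (h1 : a1 ≠ 0) (h3 : a2 ≠ 0)
    (h : Iso ![a1, a2, a3]) : Nm (-(a1 * a2)) (-(a1 * a3)) := by
  obtain ⟨x, hx, h⟩ := h
  simp only [Fin.sum_univ_three, Matrix.cons_val] at h
  refine nm_of_iso4 h2 (neg_ne_zero.2 (mul_ne_zero h1 h3)) (x := a1 * x 0) (y := x 1) (z := x 2)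
    (w := 0) ?_ (by linear_combination a1 * h)
  by_contra! hc
  apply hx
  ext i
  fin_cases i
  · simpa [h1] using hc.1
  · exact hc.2.1
  · exact hc.2.2.1

lemma iso3_of_nm {a1 a2 a3 : F} (h1 : a1 ≠ 0)
    (h : Nm (-(a1 * a2)) (-(a1 * a3))) : Iso ![a1, a2, a3] := by
  obtain ⟨p, q, h⟩ := h
  refine ⟨![p / a1, q, 1], fun h0 => ?_, ?_⟩
  · simpa using congrFun h0 2
  · simp only [Fin.sum_univ_three, Matrix.cons_val]
    field_simp
    linear_combination -h

lemma nm_of_iso4_disc (h2 : (2 : F) ≠ 0) {a1 a2 a3 x : F} (h1 : a1 ≠ 0) (h3 : a2 ≠ 0)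
    (h4 : a3 ≠ 0) (hs : IsSquare (a1 * a2 * a3 * x)) (hx : x ≠ 0) (h : Iso ![a1, a2, a3, x]) :
    Nm (-(a1 * a2)) (-(a1 * a3)) := by
  obtain ⟨y, hy, h⟩ := h
  obtain ⟨s, hs⟩ := hs
  have hs0 : s ≠ 0 := by
    rintro rfl
    simp [h1, h3, h4, hx] at hs
  simp only [Fin.sum_univ_four, Matrix.cons_val] at h
  refine nm_of_iso4 h2 (neg_ne_zero.2 (mul_ne_zero h1 h3)) (x := a1 * y 0) (y := y 1) (z := y 2)
    (w := s * y 3 / (a2 * a3) / a1) ?_ ?_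
  · by_contra! hc
    apply hy
    have := hc.2.2.2
    simp only [div_eq_zero_iff, mul_eq_zero, hs0, h1, h3, h4, or_false, false_or] at this
    ext i
    fin_cases i
    · simpa [h1] using hc.1
    · exact hc.2.1
    · exact hc.2.2.1
    · exact this
  · field_simp
    linear_combination (a1 * a2 * a3 : F) * h - y 3 ^ 2 * hs

lemma Iso.mono {ι κ : Type*} [Fintype ι] [Fintype κ] {a : ι → F} {b : κ → F} (h : Iso a)
    (f : ι → κ) (hf : Function.Injective f) (hab : ∀ i, b (f i) = a i) : Iso b := by
  classical
  obtain ⟨x, hx, h⟩ := h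
  refine ⟨Function.extend f x 0, fun h0 => hx ?_, ?_⟩
  · ext i
    have := congrFun h0 (f i)
    rwa [hf.extend_apply] at this
  · rw [← h, ← Finset.sum_subset (Finset.subset_univ (Finset.univ.map ⟨f, hf⟩)), Finset.sum_map]
    · simp [hf.extend_apply, hab]
    · intro i _ hi
      rw [Function.extend_apply', Pi.zero_apply]
      · ring
      · rintro ⟨j, rfl⟩
        exact hi (by simp)

end Generic

variable {k : Type*} [Field k] [NumberField k]

theorem hasse_norm {a b : k} (ha : a ≠ 0) (hb : b ≠ 0)
    (hf : ∀ v : HeightOneSpectrum (𝓞 k), Nm (toComp v a) (toComp v b))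
    (hr : ∀ s : k →+* ℝ, Nm (s a) (s b)) : Nm a b := by
  classical
  by_cases hs : IsSquare a
  · exact nm_of_isSquare two_ne_zero ha hs b
  obtain ⟨S, -, hS, hX⟩ := exists_large (k := k) ∅ {Units.mk0 a ha, Units.mk0 b hb}
  refine mem_nrm.1 (mem_nrm_of_pnm (a := Units.mk0 a ha) (b := Units.mk0 b hb) hs (hS S subset_rfl)
    (hX _ (by simp)) (hX _ (by simp)) fun p _ => ?_)
  rcases p with v | s
  · exact mem_lnm.2 (hf v)
  · exact mem_lnm.2 (hr s)

/-- Approximate local isotropy of a diagonal form at a finite place. -/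
def LocIso {ι : Type*} [Fintype ι] (v : HeightOneSpectrum (𝓞 k)) (a : ι → k) : Prop :=
  ∃ (x : ι → k) (j : ι), fabs v (∑ i, a i * x i ^ 2) < fabs v (4 * a j * x j ^ 2)

lemma Iso.locIso {ι : Type*} [Fintype ι] {v : HeightOneSpectrum (𝓞 k)} {a : ι → k}
    (ha : ∀ i, a i ≠ 0) (h : Iso (toComp v ∘ a)) : LocIso v a := by
  obtain ⟨y, hy, h⟩ := h
  obtain ⟨j, hj⟩ := Function.ne_iff.1 hy
  have ho : IsOpen {z : ι → v.adicCompletion k |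
      ‖∑ i, toComp v (a i) * z i ^ 2‖ < ‖4 * toComp v (a j) * z j ^ 2‖} :=
    isOpen_lt (by fun_prop) (by fun_prop)
  have hd : DenseRange (Pi.map fun (_ : ι) => (toComp v : k → v.adicCompletion k)) :=
    DenseRange.piMap fun _ => denseRange_toComp v
  obtain ⟨x, hx⟩ := hd.exists_mem_open ho ⟨y, by
    have h' : ∑ i, toComp v (a i) * y i ^ 2 = 0 := h
    rw [Set.mem_ofPred_eq, h', norm_zero, norm_pos_iff]
    simpa [ha] using hj⟩
  refine ⟨x, j, ?_⟩
  rw [← norm_toComp, ← norm_toComp]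
  have h4 : toComp v 4 = 4 := map_ofNat _ _
  simpa [h4] using hx

lemma LocIso.iso {ι : Type*} [Fintype ι] {v : HeightOneSpectrum (𝓞 k)} {a : ι → k}
    (h : LocIso v a) : Iso (toComp v ∘ a) := by
  classical
  obtain ⟨x, j, h⟩ := h
  rw [← norm_toComp, ← norm_toComp] at h
  set q := ∑ i, a i * x i ^ 2
  have h0 : toComp v (4 * a j * x j ^ 2) ≠ 0 := by
    rw [← norm_pos_iff]; exact (norm_nonneg _).trans_lt h
  have h0' : 4 * a j * x j ^ 2 ≠ 0 := (map_ne_zero _).1 h0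
  have haj : a j ≠ 0 := by rintro h; simp [h] at h0'
  have hxj : x j ≠ 0 := by rintro h; simp [h] at h0'
  have hsq : IsSquare (toComp v (1 - q / (a j * x j ^ 2))) := by
    refine isSquare_of_norm_sub_lt (v := 1) (IsSquare.one) ?_
    have : toComp v (1 - q / (a j * x j ^ 2)) - 1 = - toComp v (q / (a j * x j ^ 2)) := by
      rw [map_sub, map_one]; ring
    rw [this, norm_neg, map_div₀, norm_div, norm_one, mul_one, div_lt_iff₀ (norm_pos_iff.2
      ((map_ne_zero _).2 (mul_ne_zero haj (pow_ne_zero 2 hxj)))), ← map_ofNat (toComp v) 4,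
      ← norm_mul, ← map_mul, ← mul_assoc]
    exact h
  obtain ⟨s, hs⟩ := hsq
  by_cases hs0 : s = 0
  · exfalso
    have h1 : (1 - q / (a j * x j ^ 2)) = 0 := by
      have : toComp v (1 - q / (a j * x j ^ 2)) = 0 := by rw [hs, hs0, mul_zero]
      exact (map_eq_zero _).1 this
    have h2 : q = a j * x j ^ 2 := by
      field_simp at h1
      linear_combination -h1
    rw [h2, mul_assoc, map_mul _ 4, norm_mul, map_ofNat] at h
    have h3 : ‖(4 : v.adicCompletion k)‖ ≤ 1 := by
      rw [show (4 : v.adicCompletion k) = 2 * 2 by norm_num, norm_mul]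
      exact mul_le_one₀ norm_two_le_one (norm_nonneg _) norm_two_le_one
    exact absurd h (not_lt.2 (mul_le_of_le_one_left (norm_nonneg _) h3))
  refine ⟨Function.update (toComp v ∘ x) j (s * toComp v (x j)), fun h0 => ?_, ?_⟩
  · have := congrFun h0 j
    simp [hs0, hxj] at this
  · rw [← Finset.add_sum_erase _ _ (Finset.mem_univ j), Function.update_self]
    have h1 : ∑ i ∈ Finset.univ.erase j, (toComp v ∘ a) i *
        (Function.update (toComp v ∘ x) j (s * toComp v (x j)) i) ^ 2 =
        toComp v (∑ i ∈ Finset.univ.erase j, a i * x i ^ 2) := by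
      rw [map_sum]
      refine Finset.sum_congr rfl fun i hi => ?_
      rw [Function.update_of_ne (Finset.ne_of_mem_erase hi)]
      simp
    have h2 : ∑ i ∈ Finset.univ.erase j, a i * x i ^ 2 = q - a j * x j ^ 2 := by
      simp only [q]
      rw [← Finset.add_sum_erase _ _ (Finset.mem_univ j)]
      ring
    rw [h1, h2, mul_pow, pow_two s, ← hs]
    simp only [Function.comp]
    rw [← map_pow, ← map_mul, ← map_mul, ← map_add]
    have h3 : a j * ((1 - q / (a j * x j ^ 2)) * x j ^ 2) + (q - a j * x j ^ 2) = 0 := by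
      field_simp
      ring
    rw [h3, map_zero]

lemma LocIso.above {ι L : Type*} [Fintype ι] [Field L] [NumberField L] (i : k →+* L)
    {w : HeightOneSpectrum (𝓞 L)} {a : ι → k} (h : LocIso (under i w) a) :
    LocIso w (i ∘ a) := by
  obtain ⟨x, j, h⟩ := h
  refine ⟨i ∘ x, j, ?_⟩
  have h0 : 0 < fabs (under i w) (4 * a j * x j ^ 2) := (AbsoluteValue.nonneg _ _).trans_lt h
  have h0' : 4 * a j * x j ^ 2 ≠ 0 := (AbsoluteValue.pos_iff _).1 h0
  have h1 : fabs (under i w) ((∑ l, a l * x l ^ 2) / (4 * a j * x j ^ 2)) < 1 := by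
    rwa [map_div₀, div_lt_one h0]
  rw [← fabs_under_lt, map_div₀, map_div₀, div_lt_one] at h1
  · have h4 : i 4 = 4 := map_ofNat _ _
    simpa [h4] using h1
  · exact (AbsoluteValue.pos_iff _).2 ((map_ne_zero i).2 h0')

end Pourchet

namespace Pourchet
open IsDedekindDomain NumberField
variable {k : Type*} [Field k] [NumberField k]

lemma comp_vec4 {A E : Type*} (f : A → E) (a b c x : A) :
    f ∘ ![a, b, c, x] = ![f a, f b, f c, f x] := by
  ext i; fin_cases i <;> rfl

lemma nm_of_iso4_hom {A E : Type*} [Field A] [Field E] [CharZero E] {a b c x : A} (ha : a ≠ 0)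
    (hb : b ≠ 0) (hc : c ≠ 0) (hx : x ≠ 0) (f : A →+* E) (hs : IsSquare (f (a * b * c * x)))
    (h : Iso (f ∘ ![a, b, c, x])) : Nm (f (-(a * b))) (f (-(a * c))) := by
  rw [comp_vec4] at h
  rw [map_mul, map_mul, map_mul] at hs
  have := nm_of_iso4_disc two_ne_zero ((map_ne_zero f).2 ha) ((map_ne_zero f).2 hb)
    ((map_ne_zero f).2 hc) hs ((map_ne_zero f).2 hx) h
  rwa [map_neg, map_neg, map_mul, map_mul]

/-- The Hasse principle for quadratic forms in four variables. -/
theorem hasse_four {a b c x : k} (ha : a ≠ 0) (hb : b ≠ 0) (hc : c ≠ 0) (hx : x ≠ 0)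
    (hf : ∀ v : HeightOneSpectrum (𝓞 k), Iso (toComp v ∘ ![a, b, c, x]))
    (hr : ∀ s : k →+* ℝ, Iso (s ∘ ![a, b, c, x])) : Iso ![a, b, c, x] := by
  by_cases hs : IsSquare (a * b * c * x)
  · have h3 : Nm (-(a * b)) (-(a * c)) := hasse_norm (by simp [ha, hb]) (by simp [ha, hc])
      (fun v => nm_of_iso4_hom ha hb hc hx _ (hs.map _) (hf v))
      (fun s => nm_of_iso4_hom ha hb hc hx _ (hs.map _) (hr s))
    refine (iso3_of_nm ha h3).mono Fin.castSucc (Fin.castSucc_injective 3) ?_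
    intro i; fin_cases i <;> rfl
  set d := a * b * c * x with hd
  have := nsq_fact hs
  set i := qincl d with hi
  have hdK : IsSquare (i d) := by
    refine ⟨⟨0, 1⟩, ?_⟩
    ext <;> simp [i]
  have h3 : Nm (i (-(a * b))) (i (-(a * c))) := by
    refine hasse_norm ((map_ne_zero i).2 (by simp [ha, hb])) ((map_ne_zero i).2 (by simp [ha, hc]))
      (fun w => ?_) (fun s => nm_of_iso4_hom ha hb hc hx (s.comp i) (hdK.map s)
        (hr (s.comp i)))
    refine nm_of_iso4_hom ha hb hc hx ((toComp w).comp i) (hd ▸ hdK.map (toComp w))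
      (LocIso.iso (LocIso.above i (Iso.locIso ?_ (hf _))))
    intro j; fin_cases j <;> assumption
  have h4 : Iso ![i a, i b, i c] := iso3_of_nm ((map_ne_zero i).2 ha) (by simpa using h3)
  obtain ⟨y, hy, h⟩ := h4
  simp only [Fin.sum_univ_three, Matrix.cons_val] at h
  have hre := congrArg QuadraticAlgebra.re h
  have him := congrArg QuadraticAlgebra.im h
  simp [i, pow_two] at hre him
  set u := fun j => (y j).re
  set w := fun j => (y j).im
  change a * (u 0 * u 0 + d * w 0 * w 0) + b * (u 1 * u 1 + d * w 1 * w 1)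
    + c * (u 2 * u 2 + d * w 2 * w 2) = 0 at hre
  change a * (u 0 * w 0 + w 0 * u 0) + b * (u 1 * w 1 + w 1 * u 1)
    + c * (u 2 * w 2 + w 2 * u 2) = 0 at him
  have hB : a * (u 0 * w 0) + b * (u 1 * w 1) + c * (u 2 * w 2) = 0 := by
    have : (2 : k) * (a * (u 0 * w 0) + b * (u 1 * w 1) + c * (u 2 * w 2)) = 0 := by
      linear_combination him
    simpa using this
  have hu : a * u 0 ^ 2 + b * u 1 ^ 2 + c * u 2 ^ 2 =
      - d * (a * w 0 ^ 2 + b * w 1 ^ 2 + c * w 2 ^ 2) := by linear_combination hre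
  by_cases hw : a * w 0 ^ 2 + b * w 1 ^ 2 + c * w 2 ^ 2 = 0
  · rw [hw, mul_zero] at hu
    have h3 : Iso ![a, b, c] := by
      by_cases hw0 : w = 0
      · refine ⟨u, fun hu0 => hy ?_, by simpa [Fin.sum_univ_three] using hu⟩
        ext j
        · exact congrFun hu0 j
        · exact congrFun hw0 j
      · exact ⟨w, hw0, by simpa [Fin.sum_univ_three] using hw⟩
    refine h3.mono Fin.castSucc (Fin.castSucc_injective 3) ?_
    intro i; fin_cases i <;> rfl
  · refine ⟨![b * c * (u 1 * w 2 - u 2 * w 1), a * c * (u 2 * w 0 - u 0 * w 2),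
      a * b * (u 0 * w 1 - u 1 * w 0), a * b * c * (a * w 0 ^ 2 + b * w 1 ^ 2 + c * w 2 ^ 2)],
      fun h0 => ?_, ?_⟩
    · have := congrFun h0 3
      simp only [Matrix.cons_val, Pi.zero_apply, mul_eq_zero, ha, hb, hc, hw, or_self] at this
    · simp only [Fin.sum_univ_four, Matrix.cons_val]
      have hd' : d = a * b * c * x := hd
      set Q := a * w 0 ^ 2 + b * w 1 ^ 2 + c * w 2 ^ 2 with hQ
      have e1 : a * (b * c * (u 1 * w 2 - u 2 * w 1)) ^ 2 + b * (a * c * (u 2 * w 0 - u 0 * w 2)) ^ 2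
          + c * (a * b * (u 0 * w 1 - u 1 * w 0)) ^ 2 = a * b * c *
          ((a * u 0 ^ 2 + b * u 1 ^ 2 + c * u 2 ^ 2) * Q -
            (a * (u 0 * w 0) + b * (u 1 * w 1) + c * (u 2 * w 2)) ^ 2) := by rw [hQ]; ring
      rw [e1, hB, hu]
      have : x * (a * b * c * Q) ^ 2 = a * b * c * d * Q ^ 2 := by
        rw [hd']; ring
      rw [this]
      ring

lemma weak_approx_open {ι : Type*} [Fintype ι] (S : Finset (HeightOneSpectrum (𝓞 k)))
    (U : ∀ v : HeightOneSpectrum (𝓞 k), Set (ι → v.adicCompletion k)) (hU : ∀ v, IsOpen (U v))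
    (hne : ∀ v, (U v).Nonempty) (V : (k →+* ℝ) → Set (ι → ℝ)) (hV : ∀ s, IsOpen (V s))
    (hneV : ∀ s, (V s).Nonempty) :
    ∃ x : ι → k, (∀ v ∈ S, toComp v ∘ x ∈ U v) ∧ ∀ s : k →+* ℝ, s ∘ x ∈ V s := by
  classical
  choose y hy using hne
  choose z hz using hneV
  choose e he0 he using fun v => Metric.isOpen_iff.1 (hU v) _ (hy v)
  choose d hd0 hd using fun s => Metric.isOpen_iff.1 (hV s) _ (hz s)
  obtain ⟨r, ⟨h1, h2⟩, hr0⟩ : ∃ r : ℝ, ((∀ v ∈ S, r < e v) ∧ ∀ s ∈ Finset.univ, r < d s) ∧ 0 < r := by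
    refine Filter.Eventually.exists (f := nhdsWithin (0 : ℝ) (Set.Ioi 0)) ?_
    refine Filter.Eventually.and (Filter.Eventually.and ?_ ?_) self_mem_nhdsWithin
    · exact (Filter.eventually_all_finset S).2 fun v _ =>
        nhdsWithin_le_nhds (Iio_mem_nhds (he0 v))
    · exact (Filter.eventually_all_finset _).2 fun v _ =>
        nhdsWithin_le_nhds (Iio_mem_nhds (hd0 v))
  choose x hx1 hx2 using fun i => weak_approx_comp S Finset.univ (fun v => y v i) (fun s => z s i) hr0
  refine ⟨x, fun v hv => he v ?_, fun s => hd s ?_⟩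
  · rw [Metric.mem_ball, dist_pi_lt_iff (he0 v)]
    intro i
    rw [dist_eq_norm]
    exact (hx1 i v hv).trans (h1 v hv)
  · rw [Metric.mem_ball, dist_pi_lt_iff (hd0 s)]
    intro i
    rw [Real.dist_eq]
    exact (hx2 i s (Finset.mem_univ s)).trans (h2 s (Finset.mem_univ s))

lemma iso_real {ι : Type*} [Fintype ι] {a : ι → ℝ} {i j : ι} (hi : 0 < a i) (hj : a j < 0) :
    Iso a := by
  have hij : i ≠ j := by rintro rfl; exact lt_asymm hi hj
  refine Iso.mono (a := ![a i, a j]) ⟨![√(-a j), √(a i)], fun h => ?_, ?_⟩ ![i, j] ?_ ?_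
  · have := congrFun h 0
    simp only [Matrix.cons_val, Pi.zero_apply] at this
    exact (Real.sqrt_pos.2 (neg_pos.2 hj)).ne' this
  · simp only [Fin.sum_univ_two, Matrix.cons_val]
    rw [Real.sq_sqrt (neg_pos.2 hj).le, Real.sq_sqrt hi.le]
    ring
  · intro p q
    fin_cases p <;> fin_cases q <;> simp [hij, hij.symm]
  · intro p
    fin_cases p <;> rfl

lemma isOpen_not_isSquare (F : Type*) [NontriviallyNormedField F] [IsUltrametricDist F] [ProperSpace F]
    [CharZero F] : IsOpen {u : F | ¬ IsSquare u} := by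
  rw [Metric.isOpen_iff]
  intro u hu
  have hu0 : u ≠ 0 := by rintro rfl; exact hu IsSquare.zero
  have h4 : ‖(4 : F)‖ ≤ 1 := by
    rw [show (4 : F) = 2 * 2 by norm_num, norm_mul]
    exact mul_le_one₀ norm_two_le_one (norm_nonneg _) norm_two_le_one
  refine ⟨‖(4 : F)‖ * ‖u‖, mul_pos (norm_pos_iff.2 (by norm_num)) (norm_pos_iff.2 hu0), ?_⟩
  intro w hw hsq
  rw [Metric.mem_ball, dist_eq_norm] at hw
  have hn : ‖w‖ = ‖u‖ := norm_eq_of_sub_lt (hw.trans_le (mul_le_of_le_one_left (norm_nonneg _) h4))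
  refine hu (isSquare_of_norm_sub_lt hsq ?_)
  rwa [norm_sub_rev, hn]

end Pourchet

namespace Pourchet
open IsDedekindDomain NumberField
variable {k : Type*} [Field k] [NumberField k]

lemma exists_prime : Nonempty (HeightOneSpectrum (𝓞 k)) := by
  obtain ⟨M, hM⟩ := Ideal.exists_maximal (𝓞 k)
  exact ⟨⟨M, hM.isPrime, Ring.ne_bot_of_isMaximal_of_not_isField hM
    (RingOfIntegers.not_isField k)⟩⟩

lemma iso_sum_of_four {ι F : Type*} [Fintype ι] [Field F] {a b c : F} {d z : ι → F}
    (hz : ∑ i, d i * z i ^ 2 ≠ 0) (h : Iso ![a, b, c, ∑ i, d i * z i ^ 2]) :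
    Iso (Sum.elim ![a, b, c] d) := by
  obtain ⟨y, hy, h⟩ := h
  simp only [Fin.sum_univ_four, Matrix.cons_val] at h
  refine ⟨Sum.elim ![y 0, y 1, y 2] (y 3 • z), fun h0 => hy ?_, ?_⟩
  · have h1 := fun i => congrFun h0 (Sum.inl i)
    have h2 := fun i => congrFun h0 (Sum.inr i)
    simp only [Sum.elim_inr, Pi.smul_apply, smul_eq_mul, Pi.zero_apply, mul_eq_zero] at h2
    have h3 : y 3 = 0 := by
      by_contra h3
      exact hz (Finset.sum_eq_zero fun i _ => by
        rw [(h2 i).resolve_left h3]; ring)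
    ext i
    fin_cases i
    · exact h1 0
    · exact h1 1
    · exact h1 2
    · exact h3
  · rw [Fintype.sum_sum_type]
    simp only [Fin.sum_univ_three, Sum.elim_inl, Sum.elim_inr, Pi.smul_apply, smul_eq_mul,
      Matrix.cons_val]
    rw [← h, Finset.sum_mul]
    congr 1
    exact Finset.sum_congr rfl fun i _ => by ring

lemma iso_of_disc {F : Type*} [NontriviallyNormedField F] [IsUltrametricDist F] [ProperSpace F]
    [CharZero F] {a b c d : F} (ha : a ≠ 0) (hb : b ≠ 0) (hc : c ≠ 0)
    (h : ¬ IsSquare (a * b * c * d)) : Iso ![a, b, c, d] := by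
  have hd : d ≠ 0 := by rintro rfl; simp at h
  obtain ⟨x, y, z, w, h0, h⟩ := exists_isotropic_of_disc ha hb hc hd h
  refine ⟨![x, y, z, w], fun h1 => ?_, by simpa [Fin.sum_univ_four] using h⟩
  have h2 := congrFun h1 0
  have h3 := congrFun h1 1
  simp only [Matrix.cons_val, Pi.zero_apply] at h2 h3
  simp [h2, h3] at h0

lemma iso3_of_units {F : Type*} [NontriviallyNormedField F] [IsUltrametricDist F] [ProperSpace F]
    [CharZero F] (h2 : ‖(2 : F)‖ = 1) {a b c : F} (ha : ‖a‖ = 1) (hb : ‖b‖ = 1) (hc : ‖c‖ = 1) :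
    Iso ![a, b, c] := by
  have h : ∀ x : F, ‖x‖ = 1 → x ≠ 0 := fun x hx => norm_pos_iff.1 (by rw [hx]; exact one_pos)
  have hac : -(a * c) ≠ 0 := by simp [h a ha, h c hc]
  refine iso3_of_nm (h a ha) ?_
  exact mem_nrm.1 (mem_nrm_of_norm_eq_one h2 (a := -(a * b)) (b := Units.mk0 _ hac)
    (by rw [norm_neg, norm_mul, ha, hb, one_mul])
    (by rw [Units.val_mk0, norm_neg, norm_mul, ha, hc, one_mul]))

theorem meyer_aux {a b c : k} (ha : a ≠ 0) (hb : b ≠ 0) (hc : c ≠ 0) {n : ℕ} {d : Fin (n + 2) → k}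
    (hd : ∀ i, d i ≠ 0)
    (hr : ∀ s : k →+* ℝ, (∃ i, 0 < s (Sum.elim ![a, b, c] d i)) ∧
      ∃ i, s (Sum.elim ![a, b, c] d i) < 0) : Iso (Sum.elim ![a, b, c] d) := by
  classical
  obtain ⟨v0⟩ := exists_prime (k := k)
  obtain ⟨S, hS0, hS, hX⟩ := exists_large (k := k) {v0}
    {Units.mk0 a ha, Units.mk0 b hb, Units.mk0 c hc}
  have hS2 := (hS S subset_rfl).two
  let f : ∀ v : HeightOneSpectrum (𝓞 k), (Fin (n + 2) → v.adicCompletion k) →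
    v.adicCompletion k := fun v z => ∑ i, toComp v (d i) * z i ^ 2
  let g : (k →+* ℝ) → (Fin (n + 2) → ℝ) → ℝ := fun s z => ∑ i, s (d i) * z i ^ 2
  obtain ⟨z, hzS, hzR⟩ := weak_approx_open S
    (fun v => {z | ¬ IsSquare (toComp v (a * b * c) * f v z)})
    (fun v => (isOpen_not_isSquare (v.adicCompletion k)).preimage
      (f := fun z => toComp v (a * b * c) * f v z) (by fun_prop))
    (fun v => by
      obtain ⟨u, hu, hsq⟩ := exists_mem_nrm_nonsquare (toComp v (-(d 1 / d 0)))
        (toComp v (a * b * c * d 0)) ((map_ne_zero _).2 (by simp [hd]))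
        ((map_ne_zero _).2 (by simp [ha, hb, hc, hd]))
      obtain ⟨p, q, hpq⟩ := mem_nrm.1 hu
      refine ⟨Fin.cons p (Fin.cons q 0), fun h => hsq ?_⟩
      convert h using 1
      have hd0 : toComp v (d 0) ≠ 0 := (map_ne_zero _).2 (hd 0)
      simp only [f, Fin.sum_univ_succ, Fin.cons_zero, Fin.cons_succ, Pi.zero_apply]
      rw [hpq]
      simp only [map_neg, map_mul, map_div₀]
      simp
      field_simp)
    (fun s => {z | (0 < s a → 0 < s b → 0 < s c → g s z < 0) ∧
      (s a < 0 → s b < 0 → s c < 0 → 0 < g s z)})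
    (fun s => by
      have ho1 : IsOpen {z | g s z < 0} := isOpen_lt (by fun_prop) (by fun_prop)
      have ho2 : IsOpen {z | 0 < g s z} := isOpen_lt (by fun_prop) (by fun_prop)
      by_cases h1 : 0 < s a ∧ 0 < s b ∧ 0 < s c
      · simpa [h1.1, h1.2, h1.1.not_gt] using ho1
      · by_cases h2 : s a < 0 ∧ s b < 0 ∧ s c < 0
        · simpa [h2.1, h2.2, h2.1.not_gt] using ho2
        · convert isOpen_univ
          ext z
          simp only [Set.mem_ofPred_eq, Set.mem_univ, iff_true]
          exact ⟨fun a1 a2 a3 => (h1 ⟨a1, a2, a3⟩).elim, fun a1 a2 a3 => (h2 ⟨a1, a2, a3⟩).elim⟩)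
    (fun s => by
      have hval : ∀ j, g s (Pi.single j 1) = s (d j) := by
        intro j
        simp only [g]
        rw [Finset.sum_eq_single j]
        · simp
        · intro i _ hij; simp [hij]
        · simp
      obtain ⟨⟨i, hi⟩, j, hj⟩ := hr s
      by_cases h1 : 0 < s a ∧ 0 < s b ∧ 0 < s c
      · rcases j with j | j
        · exfalso
          fin_cases j
          · exact lt_asymm hj h1.1
          · exact lt_asymm hj h1.2.1
          · exact lt_asymm hj h1.2.2
        · exact ⟨Pi.single j 1, fun _ _ _ => by rw [hval]; exact hj,
            fun h => absurd h h1.1.not_gt⟩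
      · by_cases h2 : s a < 0 ∧ s b < 0 ∧ s c < 0
        · rcases i with i | i
          · exfalso
            fin_cases i
            · exact lt_asymm hi h2.1
            · exact lt_asymm hi h2.2.1
            · exact lt_asymm hi h2.2.2
          · exact ⟨Pi.single i 1, fun h => absurd h h2.1.not_gt, fun _ _ _ => by
              rw [hval]; exact hi⟩
        · exact ⟨0, fun a1 a2 a3 => (h1 ⟨a1, a2, a3⟩).elim,
            fun a1 a2 a3 => (h2 ⟨a1, a2, a3⟩).elim⟩)
  set x := ∑ i, d i * z i ^ 2 with hx
  have hfx : ∀ v, f v (toComp v ∘ z) = toComp v x := fun v => by simp [f, hx]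
  have hgx : ∀ s, g s (s ∘ z) = s x := fun v => by simp [g, hx]
  have hx0 : x ≠ 0 := by
    intro h
    have h1 := hzS v0 (hS0 (by simp))
    rw [Set.mem_ofPred_eq, hfx, h, map_zero, mul_zero] at h1
    exact h1 IsSquare.zero
  refine iso_sum_of_four (z := z) hx0 (hasse_four ha hb hc hx0 (fun v => ?_) fun s => ?_)
  · rw [comp_vec4]
    by_cases hv : v ∈ S
    · refine iso_of_disc ((map_ne_zero _).2 ha) ((map_ne_zero _).2 hb) ((map_ne_zero _).2 hc) ?_
      have h1 := hzS v hv
      rwa [Set.mem_ofPred_eq, hfx, map_mul, map_mul] at h1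
    · have hu : ∀ u : kˣ, u ∈ SU (S : Set (HeightOneSpectrum (𝓞 k))) → ‖toComp v u‖ = 1 := by
        intro u hu
        rw [norm_toComp]
        exact mem_SU.1 hu v hv
      refine (iso3_of_units (F := v.adicCompletion k) ?_ (hu _ (hX (Units.mk0 a ha) (by simp)))
        (hu _ (hX (Units.mk0 b hb) (by simp))) (hu _ (hX (Units.mk0 c hc) (by simp)))).mono
        Fin.castSucc (Fin.castSucc_injective 3) ?_
      · rw [← map_ofNat (toComp v) 2, norm_toComp]
        exact hS2 v hv
      · intro i; fin_cases i <;> rfl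
  · obtain ⟨h1, h2⟩ := hzR s
    rw [hgx] at h1 h2
    rw [comp_vec4]
    have ha' : s a ≠ 0 := (map_ne_zero _).2 ha
    have hb' : s b ≠ 0 := (map_ne_zero _).2 hb
    have hc' : s c ≠ 0 := (map_ne_zero _).2 hc
    rcases ha'.lt_or_gt with a1 | a1 <;> rcases hb'.lt_or_gt with b1 | b1
    · rcases hc'.lt_or_gt with c1 | c1
      · exact iso_real (i := 3) (j := 0) (h2 a1 b1 c1) a1
      · exact iso_real (i := 2) (j := 0) c1 a1
    · exact iso_real (i := 1) (j := 0) b1 a1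
    · exact iso_real (i := 0) (j := 1) a1 b1
    · rcases hc'.lt_or_gt with c1 | c1
      · exact iso_real (i := 0) (j := 2) a1 c1
      · exact iso_real (i := 0) (j := 3) a1 (h1 a1 b1 c1)

/-- A diagonal form in at least five variables over a number field which is indefinite at every
real place is isotropic. -/
theorem meyer {ι : Type*} [Fintype ι] (hι : 5 ≤ Fintype.card ι) {a : ι → k} (ha : ∀ i, a i ≠ 0)
    (hr : ∀ s : k →+* ℝ, (∃ i, 0 < s (a i)) ∧ ∃ i, s (a i) < 0) : Iso a := by
  obtain ⟨n, hn⟩ := Nat.exists_eq_add_of_le hι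
  let e : Fin 3 ⊕ Fin (n + 2) ≃ ι := Fintype.equivOfCardEq (by simp; omega)
  have he : ∀ i, Sum.elim ![a (e (.inl 0)), a (e (.inl 1)), a (e (.inl 2))]
      (fun j => a (e (.inr j))) i = a (e i) := by
    rintro (i | i)
    · fin_cases i <;> rfl
    · rfl
  refine (meyer_aux (ha (e (.inl 0))) (ha (e (.inl 1))) (ha (e (.inl 2)))
    (d := fun j => a (e (.inr j))) (fun _ => ha _) fun s => ?_).mono e e.injective
      fun i => (he i).symm
  obtain ⟨⟨i, hi⟩, j, hj⟩ := hr s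
  exact ⟨⟨e.symm i, by rwa [he, e.apply_symm_apply]⟩, e.symm j, by rwa [he, e.apply_symm_apply]⟩

end Pourchet

namespace Pourchet
open Polynomial

section
variable {F ι : Type*} [Field F] [Fintype ι]

/-- The value of a diagonal form at a vector of polynomials. -/
noncomputable def qf (a : ι → F) (g : ι → F[X]) : F[X] := ∑ i, C (a i) * g i ^ 2

lemma Iso.universal (h2 : (2 : F) ≠ 0) {R : Type*} [CommRing R] (f : F →+* R) {a : ι → F}
    (ha : ∀ i, a i ≠ 0) (h : Iso a) (r : R) : ∃ g : ι → R, r = ∑ i, f (a i) * g i ^ 2 := by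
  classical
  obtain ⟨v, hv, h⟩ := h
  obtain ⟨j, hj⟩ := Function.ne_iff.1 hv
  have hj : v j ≠ 0 := hj
  set s : R := (r - f (a j)) * f (2 * a j * v j)⁻¹
  refine ⟨fun i => f (v i) * s + if i = j then 1 else 0, ?_⟩
  have h1 : ∀ i, f (a i) * (f (v i) * s + if i = j then 1 else 0) ^ 2 =
      f (a i * v i ^ 2) * s ^ 2 + if i = j then f (2 * a j * v j) * s + f (a j) else 0 := by
    intro i
    split_ifs with hij
    · subst hij
      simp only [map_mul, map_pow, map_ofNat]
      ring
    · simp only [map_mul, map_pow]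
      ring
  simp_rw [h1]
  rw [Finset.sum_add_distrib, ← Finset.sum_mul, ← map_sum, h, map_zero, zero_mul, zero_add,
    Finset.sum_ite_eq' Finset.univ j]
  simp only [Finset.mem_univ, if_true, s]
  rw [mul_comm (r - f (a j)), ← mul_assoc, ← map_mul, mul_inv_cancel₀, map_one]
  · ring
  · simp [h2, ha, hj]

lemma natDegree_qf_le {a : ι → F} {g : ι → F[X]} {M : ℕ} (hM : ∀ i, (g i).natDegree ≤ M) :
    (qf a g).natDegree ≤ 2 * M := by
  refine natDegree_sum_le_of_forall_le _ _ fun i _ => (natDegree_C_mul_le _ _).trans ?_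
  exact natDegree_pow_le_of_le 2 (hM i)

lemma coeff_qf {a : ι → F} {g : ι → F[X]} {M : ℕ} (hM : ∀ i, (g i).natDegree ≤ M) :
    (qf a g).coeff (2 * M) = ∑ i, a i * (g i).coeff M ^ 2 := by
  rw [qf, finsetSum_coeff]
  refine Finset.sum_congr rfl fun i _ => ?_
  rw [coeff_C_mul, coeff_pow_of_natDegree_le (hM i)]

lemma exists_natDegree_qf {a : ι → F} (ha : ¬ Iso a) {g : ι → F[X]} (hg : g ≠ 0) :
    ∃ M, (∀ i, (g i).natDegree ≤ M) ∧ (∃ i, (g i).coeff M ≠ 0) ∧ (qf a g).natDegree = 2 * M ∧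
      qf a g ≠ 0 := by
  classical
  obtain ⟨j0, hj0⟩ := Function.ne_iff.1 hg
  obtain ⟨j, hjs, hj⟩ := Finset.exists_max_image (Finset.univ.filter fun i => g i ≠ 0)
    (fun i => (g i).natDegree) ⟨j0, by simpa using hj0⟩
  have hjs : g j ≠ 0 := by simpa using hjs
  have h1 : ∀ i, (g i).natDegree ≤ (g j).natDegree := by
    intro i
    by_cases hi : g i = 0
    · simp [hi]
    · exact hj i (by simp [hi])
  have h2 : (g j).coeff (g j).natDegree ≠ 0 := by simpa using hjs
  have h3 : (qf a g).coeff (2 * (g j).natDegree) ≠ 0 := by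
    rw [coeff_qf h1]
    intro h
    exact ha ⟨fun i => (g i).coeff (g j).natDegree, fun h0 => h2 (congrFun h0 j), h⟩
  refine ⟨(g j).natDegree, h1, ⟨j, h2⟩, le_antisymm (natDegree_qf_le h1) (le_natDegree_of_ne_zero h3),
    fun h => ?_⟩
  rw [h] at h3
  simp at h3

/-- The Cassels-Pfister theorem, with denominators cleared. -/
theorem cassels_pfister (h2 : (2 : F) ≠ 0) {a : ι → F} (ha : ∀ i, a i ≠ 0) {f d : F[X]}
    (hd : d ≠ 0) {n : ι → F[X]} (h : f * d ^ 2 = qf a n) : ∃ g, f = qf a g := by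
  by_cases hi : Iso a
  · exact hi.universal h2 C ha f
  induction hN : d.natDegree using Nat.strong_induction_on generalizing d n with
  | _ N ih =>
  set q := fun i => n i / d
  set r := fun i => n i % d
  have hn : ∀ i, n i = d * q i + r i := fun i => (EuclideanDomain.div_add_mod _ _).symm
  by_cases hr : r = 0
  · refine ⟨q, mul_right_cancel₀ (pow_ne_zero 2 hd) ?_⟩
    rw [h, qf, qf, Finset.sum_mul]
    refine Finset.sum_congr rfl fun i _ => ?_
    rw [hn i, congrFun hr i, Pi.zero_apply]
    ring
  obtain ⟨M, hM, ⟨j, hj⟩, hdeg, h0⟩ := exists_natDegree_qf hi hr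
  have hrj : r j ≠ 0 := by intro h; rw [h] at hj; simp at hj
  have hMj : M < d.natDegree := by
    have := natDegree_lt_natDegree hrj (degree_mod_lt (n j) hd)
    exact (le_natDegree_of_ne_zero hj).trans_lt this
  set B := ∑ i, C (a i) * (n i * q i)
  have hQr : qf a r = qf a n - 2 * d * B + d ^ 2 * qf a q := by
    simp only [qf, B, Finset.mul_sum]
    rw [← Finset.sum_sub_distrib, ← Finset.sum_add_distrib]
    refine Finset.sum_congr rfl fun i _ => ?_
    have : r i = n i - d * q i := by rw [hn i]; ring
    rw [this]
    ring
  set al := qf a q - f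
  set be := 2 * (f * d - B)
  set z0 := al * d + be
  have hz : d * z0 = qf a r := by
    rw [hQr, ← h]
    simp only [z0, al, be]
    ring
  have hz0 : z0 ≠ 0 := by rintro h; rw [h, mul_zero] at hz; exact h0 hz.symm
  have hdz : z0.natDegree < N := by
    have := congrArg natDegree hz
    rw [natDegree_mul hd hz0, hdeg] at this
    omega
  refine ih _ hdz hz0 (n := fun i => al * n i + be * q i) ?_ rfl
  have : qf a (fun i => al * n i + be * q i) =
      al ^ 2 * qf a n + 2 * al * be * B + be ^ 2 * qf a q := by
    simp only [qf, B, Finset.mul_sum]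
    rw [← Finset.sum_add_distrib, ← Finset.sum_add_distrib]
    exact Finset.sum_congr rfl fun i _ => by ring
  rw [this, ← h]
  simp only [z0, be, al]
  ring

theorem exists_qf_of_ratFunc (h2 : (2 : F) ≠ 0) {a : ι → F} (ha : ∀ i, a i ≠ 0) {f : F[X]}
    {g : ι → RatFunc F} (h : algebraMap F[X] (RatFunc F) f =
      ∑ i, algebraMap F[X] (RatFunc F) (C (a i)) * g i ^ 2) : ∃ g, f = qf a g := by
  obtain ⟨d, hd⟩ := IsLocalization.exist_integer_multiples_of_finite (nonZeroDivisors F[X]) g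
  choose n hn using hd
  have hd0 : (d : F[X]) ≠ 0 := nonZeroDivisors.ne_zero d.2
  refine cassels_pfister h2 ha hd0 (n := n) ?_
  apply IsFractionRing.injective F[X] (RatFunc F)
  rw [map_mul, map_pow, h, qf, map_sum, Finset.sum_mul]
  refine Finset.sum_congr rfl fun i _ => ?_
  rw [map_mul, map_pow, hn, Algebra.smul_def]
  ring

lemma qf_map {E : Type*} [Field E] (s : F →+* E) (a : ι → F) (g : ι → F[X]) :
    (qf a g).map s = qf (s ∘ a) fun i => (g i).map s := by
  simp [qf, Polynomial.map_sum]

lemma eval_qf (a : ι → F) (g : ι → F[X]) (x : F) :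
    (qf a g).eval x = ∑ i, a i * (g i).eval x ^ 2 := by
  simp [qf, eval_finsetSum]

end

lemma exists_pos_of_odd {p : ℝ[X]} (h : 0 < p.leadingCoeff) (hd : 0 < p.natDegree) :
    ∃ x, 0 < p.eval x :=
  ((p.tendsto_atTop_of_leadingCoeff_nonneg (natDegree_pos_iff_degree_pos.1 hd)
    h.le).eventually_gt_atTop 0).exists

lemma exists_root_of_odd {p : ℝ[X]} (ho : Odd p.natDegree) : ∃ x, p.eval x = 0 := by
  wlog hl : 0 < p.leadingCoeff generalizing p
  · obtain ⟨x, hx⟩ := this (p := -p) (by rwa [natDegree_neg]) (by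
      rw [leadingCoeff_neg, neg_pos]
      refine lt_of_le_of_ne (not_lt.1 hl) (leadingCoeff_ne_zero.2 ?_)
      rintro rfl
      simp at ho)
    exact ⟨x, by simpa using hx⟩
  obtain ⟨x, hx⟩ := exists_pos_of_odd hl ho.pos
  obtain ⟨y, hy⟩ := exists_pos_of_odd (p := -(p.comp (-X)))
    (by rw [leadingCoeff_neg, leadingCoeff_comp (by simp)]; simpa [ho.neg_one_pow])
    (by rw [natDegree_neg, natDegree_comp]; simpa using ho.pos)
  simp only [eval_neg, eval_comp, eval_X, neg_pos] at hy
  obtain ⟨z, -, hz⟩ := intermediate_value_uIcc (a := -y) (b := x) p.continuous.continuousOn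
    (Set.mem_uIcc_of_le hy.le hx.le)
  exact ⟨z, hz⟩

lemma even_natDegree_of_no_root {p : ℝ[X]} (h : ∀ x, p.eval x ≠ 0) : Even p.natDegree := by
  rw [← Nat.not_odd_iff_even]
  intro ho
  obtain ⟨x, hx⟩ := exists_root_of_odd ho
  exact h x hx

lemma not_iso_of_pos {ι : Type*} [Fintype ι] {a : ι → ℝ} (ha : ∀ i, 0 < a i) : ¬ Iso a := by
  rintro ⟨x, hx, h⟩
  rw [Finset.sum_eq_zero_iff_of_nonneg fun i _ => mul_nonneg (ha i).le (sq_nonneg _)] at h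
  refine hx (funext fun i => ?_)
  have := h i (Finset.mem_univ i)
  simpa [(ha i).ne'] using this

lemma not_iso_of_neg {ι : Type*} [Fintype ι] {a : ι → ℝ} (ha : ∀ i, a i < 0) : ¬ Iso a := by
  rintro ⟨x, hx, h⟩
  refine not_iso_of_pos (a := fun i => - a i) (fun i => neg_pos.2 (ha i)) ⟨x, hx, ?_⟩
  simpa using h

/-- The degree restriction coming from a real place of hyperbolic signature. -/
lemma four_dvd_of_nonpos {ι : Type*} [Fintype ι] {a : ι → ℝ} {g : ι → ℝ[X]} {M : ℕ}
    (hM : ∀ i, (g i).natDegree ≤ M) (hj : ∃ i, (g i).coeff M ≠ 0) {j : ι}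
    (ha : ∀ i, i ≠ j → 0 < a i) (hsep : (qf a g).Separable)
    (hneg : ∀ x, (qf a g).eval x ≤ 0) : Even M := by
  classical
  have hsplit : ∀ z : ι → ℝ, z j = 0 → ∑ i, a i * z i ^ 2 ≤ 0 → z = 0 := by
    intro z hz h
    have h1 : ∀ i, 0 ≤ a i * z i ^ 2 := by
      intro i
      by_cases hi : i = j
      · subst hi; simp [hz]
      · exact mul_nonneg (ha i hi).le (sq_nonneg _)
    have h2 := (Finset.sum_eq_zero_iff_of_nonneg fun i _ => h1 i).1
      (le_antisymm h (Finset.sum_nonneg fun i _ => h1 i))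
    funext i
    by_cases hi : i = j
    · subst hi; exact hz
    · simpa [(ha i hi).ne'] using h2 i (Finset.mem_univ i)
  have hroot : ∀ x, (g j).eval x ≠ 0 := by
    intro x hx
    have h1 := hneg x
    rw [eval_qf] at h1
    have h2 := hsplit (fun i => (g i).eval x) hx h1
    have h3 : (X - C x) * (X - C x) ∣ qf a g := by
      refine Finset.dvd_sum fun i _ => dvd_mul_of_dvd_right ?_ _
      rw [pow_two]
      have : X - C x ∣ g i := dvd_iff_isRoot.2 (congrFun h2 i)
      exact mul_dvd_mul this this
    exact not_isUnit_X_sub_C x (hsep.squarefree _ h3)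
  have hcoeff : (g j).coeff M ≠ 0 := by
    intro h0
    have h1 : 0 < (qf a g).coeff (2 * M) := by
      rw [coeff_qf hM]
      by_contra! hc
      have h2 := hsplit (fun i => (g i).coeff M) h0 hc
      obtain ⟨i, hi⟩ := hj
      exact hi (congrFun h2 i)
    have hd : (qf a g).natDegree = 2 * M :=
      le_antisymm (natDegree_qf_le hM) (le_natDegree_of_ne_zero h1.ne')
    have hlc : 0 < (qf a g).leadingCoeff := by rwa [leadingCoeff, hd]
    by_cases hM0 : M = 0
    · subst hM0
      have := hneg 0
      rw [← coeff_zero_eq_eval_zero] at this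
      exact absurd h1 (not_lt.2 this)
    · have ht := (qf a g).tendsto_atTop_of_leadingCoeff_nonneg
        (natDegree_pos_iff_degree_pos.1 (by omega)) hlc.le
      obtain ⟨x, hx⟩ := (ht.eventually_gt_atTop 0).exists
      exact absurd hx (not_lt.2 (hneg x))
  have : (g j).natDegree = M := le_antisymm (hM j) (le_natDegree_of_ne_zero hcoeff)
  rw [← this]
  exact even_natDegree_of_no_root hroot

lemma qf_neg {F ι : Type*} [Field F] [Fintype ι] (a : ι → F) (g : ι → F[X]) :
    qf (fun i => - a i) g = - qf a g := by
  simp [qf]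

lemma exists_eq_of_card_filter {ι : Type*} [Fintype ι] {p : ι → Prop} [DecidablePred p]
    (h : (Finset.univ.filter p).card = 1) : ∃ j, p j ∧ ∀ i, i ≠ j → ¬ p i := by
  obtain ⟨j, hj⟩ := Finset.card_eq_one.1 h
  refine ⟨j, ?_, fun i hi hp => hi ?_⟩
  · simpa using (Finset.ext_iff.1 hj j)
  · simpa [hp] using (Finset.ext_iff.1 hj i)

theorem conditions_of_rep {k : Type*} [Field k] {ι : Type*} [Fintype ι] {a : ι → k}
    (ha : ∀ i, a i ≠ 0) {f : k[X]} (hf : f.Separable) {g : ι → k[X]} (h : f = qf a g) :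
    (∀ σ : k →+* ℝ, (∃ i, 0 < σ (a i)) ∧ (∃ j, σ (a j) < 0)) ∨
        ((∀ σ : k →+* ℝ, (∀ i, 0 < σ (a i)) → ∀ x : ℝ, 0 ≤ (f.map σ).eval x) ∧
         (∀ σ : k →+* ℝ, (∀ i, σ (a i) < 0) → ∀ x : ℝ, (f.map σ).eval x ≤ 0) ∧
         ((4 ∣ f.natDegree) ∨
           ((∀ σ : k →+* ℝ, (Finset.univ.filter fun i => σ (a i) < 0).card = 1 →
               ∃ x : ℝ, 0 < (f.map σ).eval x) ∧
            (∀ σ : k →+* ℝ, (Finset.univ.filter fun i => 0 < σ (a i)).card = 1 →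
               ∃ x : ℝ, (f.map σ).eval x < 0)))) := by
  have hne : ∀ (σ : k →+* ℝ) i, σ (a i) ≠ 0 := fun σ i => (map_ne_zero σ).2 (ha i)
  have hev : ∀ (σ : k →+* ℝ) x, (f.map σ).eval x = ∑ i, σ (a i) * ((g i).map σ).eval x ^ 2 := by
    intro σ x
    rw [h, qf_map, eval_qf]
    rfl
  refine or_iff_not_imp_left.2 fun hi => ⟨fun σ hσ x => ?_, fun σ hσ x => ?_, ?_⟩
  · rw [hev]
    exact Finset.sum_nonneg fun i _ => mul_nonneg (hσ i).le (sq_nonneg _)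
  · rw [hev]
    exact Finset.sum_nonpos fun i _ => mul_nonpos_of_nonpos_of_nonneg (hσ i).le (sq_nonneg _)
  have hdef : ∃ σ : k →+* ℝ, ¬ Iso (σ ∘ a) := by
    push Not at hi
    obtain ⟨σ, hσ⟩ := hi
    refine ⟨σ, ?_⟩
    by_cases hp : ∃ i, 0 < σ (a i)
    · exact not_iso_of_pos fun i => lt_of_le_of_ne (hσ hp i) (hne σ i).symm
    · push Not at hp
      exact not_iso_of_neg fun i => lt_of_le_of_ne (hp i) (hne σ i)
  obtain ⟨σ1, hσ1⟩ := hdef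
  have hani : ¬ Iso a := fun h => hσ1 (h.map σ1)
  have hg : g ≠ 0 := by
    rintro rfl
    apply hf.ne_zero
    simp [h, qf]
  obtain ⟨M, hM, ⟨j, hj⟩, hdeg, -⟩ := exists_natDegree_qf hani hg
  rw [← h] at hdeg
  refine or_iff_not_imp_left.2 fun h4 => ?_
  have hMo : ¬ Even M := by
    rintro ⟨l, rfl⟩
    exact h4 ⟨l, by omega⟩
  have hM' : ∀ (σ : k →+* ℝ) i, ((g i).map σ).natDegree ≤ M := fun σ i => by
    rw [natDegree_map]; exact hM i
  have hj' : ∀ σ : k →+* ℝ, ∃ i, ((g i).map σ).coeff M ≠ 0 := fun σ =>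
    ⟨j, by rw [coeff_map]; exact (map_ne_zero σ).2 hj⟩
  constructor
  · intro σ hσ
    obtain ⟨l, hl, hl'⟩ := exists_eq_of_card_filter hσ
    by_contra! hc
    refine hMo (four_dvd_of_nonpos (a := σ ∘ a) (hM' σ) (hj' σ) (j := l) (fun i hi => ?_) ?_ ?_)
    · exact lt_of_le_of_ne (not_lt.1 (hl' i hi)) (hne σ i).symm
    · rw [← qf_map, ← h]; exact hf.map
    · intro x; rw [← qf_map, ← h]; exact hc x
  · intro σ hσ
    obtain ⟨l, hl, hl'⟩ := exists_eq_of_card_filter hσ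
    by_contra! hc
    refine hMo (four_dvd_of_nonpos (a := fun i => - (σ ∘ a) i) (hM' σ) (hj' σ) (j := l)
      (fun i hi => ?_) ?_ ?_)
    · exact neg_pos.2 (lt_of_le_of_ne (not_lt.1 (hl' i hi)) (hne σ i))
    · rw [qf_neg, ← qf_map, ← h]
      exact (separable_def _).2 (by simpa [derivative_neg] using (hf.map (f := σ)).neg_left.neg_right)
    · intro x; rw [qf_neg, ← qf_map, ← h, eval_neg, neg_nonpos]; exact hc x

end Pourchet

namespace Pourchet
open Polynomial

section
variable {K : Type*} [Field K]

/-- The coefficients of the norm form of a quaternion algebra. -/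
def quat {R : Type*} [CommRing R] (a b : R) : Fin 4 → R := ![1, -a, -b, a * b]

/-- The norm form of a quaternion algebra. -/
def nf {R : Type*} [CommRing R] (a b : R) (x : Fin 4 → R) : R :=
  x 0 ^ 2 - a * x 1 ^ 2 - b * x 2 ^ 2 + a * b * x 3 ^ 2

lemma qf_quat (a b : K) (x : Fin 4 → K[X]) : qf (quat a b) x = nf (C a) (C b) x := by
  simp only [qf, quat, nf, Fin.sum_univ_four, Matrix.cons_val, map_neg, map_mul, map_one]
  ring

lemma sum_quat (a b : K) (x : Fin 4 → K) : ∑ i, quat a b i * x i ^ 2 = nf a b x := by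
  simp only [quat, nf, Fin.sum_univ_four, Matrix.cons_val]
  ring

lemma exists_nf_mul {R : Type*} [CommRing R] (a b : R) (x y : Fin 4 → R) :
    ∃ z, nf a b x * nf a b y = nf a b z :=
  ⟨![x 0 * y 0 + a * x 1 * y 1 + b * x 2 * y 2 - a * b * x 3 * y 3,
    x 0 * y 1 + x 1 * y 0 - b * x 2 * y 3 + b * x 3 * y 2,
    x 0 * y 2 + x 2 * y 0 + a * x 1 * y 3 - a * x 3 * y 1,
    x 0 * y 3 + x 3 * y 0 + x 1 * y 2 - x 2 * y 1], by
    simp only [nf, Matrix.cons_val]; ring⟩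

lemma iso_quat_of_nm {a b : K} (h : Nm a b) : Iso (quat a b) := by
  obtain ⟨p, q, h⟩ := h
  refine ⟨![p, q, 1, 0], fun h0 => ?_, ?_⟩
  · simpa using congrFun h0 2
  · rw [sum_quat, nf]
    simp only [Matrix.cons_val]
    rw [h]; ring

lemma nm_of_iso_quat (h2 : (2 : K) ≠ 0) {a b : K} (ha : a ≠ 0) (h : Iso (quat a b)) : Nm a b := by
  obtain ⟨x, hx, h⟩ := h
  rw [sum_quat, nf] at h
  refine nm_of_iso4 h2 ha (x := x 0) (y := x 1) (z := x 2) (w := x 3) ?_ (by linear_combination h)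
  by_contra! hc
  exact hx (by ext i; fin_cases i <;> simp [hc])

lemma quat_ne_zero {a b : K} (ha : a ≠ 0) (hb : b ≠ 0) (i : Fin 4) : quat a b i ≠ 0 := by
  fin_cases i <;> simp [quat, ha, hb]

/-- The quaternion algebra splits modulo the polynomial `p`. -/
def SplitMod (a b : K) (p : K[X]) : Prop := ∃ s r : K[X], p ∣ s ^ 2 - C a * r ^ 2 - C b

lemma SplitMod.of_dvd {a b : K} {p q : K[X]} (h : SplitMod a b p) (hq : q ∣ p) :
    SplitMod a b q := by
  obtain ⟨s, r, h⟩ := h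
  exact ⟨s, r, hq.trans h⟩

lemma splitMod_of_nm {L : Type*} [Field L] [Algebra K L] {a b : K} {t : L}
    (ht : Algebra.adjoin K {t} = ⊤)
    (h : Nm (algebraMap K L a) (algebraMap K L b)) : SplitMod a b (minpoly K t) := by
  obtain ⟨p, q, h⟩ := h
  have hsurj : ∀ x : L, ∃ P : K[X], aeval t P = x := by
    intro x
    have : x ∈ Algebra.adjoin K {t} := by rw [ht]; trivial
    rwa [Algebra.adjoin_singleton_eq_range_aeval] at this
  obtain ⟨s, rfl⟩ := hsurj p
  obtain ⟨r, rfl⟩ := hsurj q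
  refine ⟨s, r, minpoly.dvd K t ?_⟩
  simp [h]

lemma SplitMod.exists_mod {a b : K} {p : K[X]} (h : SplitMod a b p) (hp : 0 < p.natDegree) :
    ∃ s r w : K[X], s.natDegree < p.natDegree ∧ r.natDegree < p.natDegree ∧
      nf (C a) (C b) ![s, r, 1, 0] = p * w := by
  obtain ⟨s, r, h⟩ := h
  have h1 : p ∣ (s % p) ^ 2 - C a * (r % p) ^ 2 - C b := by
    have h2 : p ∣ s - s % p := by
      exact ⟨s / p, by linear_combination -EuclideanDomain.mod_add_div s p⟩
    have h3 : p ∣ r - r % p := by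
      exact ⟨r / p, by linear_combination -EuclideanDomain.mod_add_div r p⟩
    have : (s % p) ^ 2 - C a * (r % p) ^ 2 - C b = (s ^ 2 - C a * r ^ 2 - C b)
      - (s - s % p) * (s + s % p) + C a * (r + r % p) * (r - r % p) := by ring
    rw [this]
    exact dvd_add (dvd_sub h (dvd_mul_of_dvd_left h2 _)) (dvd_mul_of_dvd_right h3 _)
  obtain ⟨w, hw⟩ := h1
  refine ⟨s % p, r % p, w, natDegree_mod_lt s hp.ne', natDegree_mod_lt r hp.ne', ?_⟩
  rw [← hw, nf]
  simp only [Matrix.cons_val]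
  ring

lemma exists_nf_data (h2 : (2 : K) ≠ 0) {a b : K} (ha : a ≠ 0) (hN : ¬ Nm a b) {p : K[X]}
    (h : SplitMod a b p) (hp : 0 < p.natDegree) :
    ∃ (x : Fin 4 → K[X]) (w : K[X]) (M : ℕ), nf (C a) (C b) x = p * w ∧ w ≠ 0 ∧ SplitMod a b w ∧
      p.natDegree + w.natDegree = 2 * M ∧ M < p.natDegree := by
  obtain ⟨s, r, w, hs, hr, h⟩ := h.exists_mod hp
  have hani : ¬ Iso (quat a b) := fun h => hN (nm_of_iso_quat h2 ha h)
  obtain ⟨M, hM, ⟨i, hi⟩, hd, h0⟩ := exists_natDegree_qf (a := quat a b) hani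
    (g := ![s, r, 1, 0]) (fun h => by simpa using congrFun h 2)
  rw [qf_quat, h] at hd h0
  have hp0 : p ≠ 0 := left_ne_zero_of_mul h0
  have hw0 : w ≠ 0 := right_ne_zero_of_mul h0
  rw [natDegree_mul hp0 hw0] at hd
  refine ⟨_, w, M, h, hw0, ⟨s, r, p, ?_⟩, hd, (le_natDegree_of_ne_zero hi).trans_lt ?_⟩
  · rw [mul_comm w, ← h, nf]
    simp only [Matrix.cons_val]
    ring
  · fin_cases i <;> simp [hs, hr, hp]

/-- A quaternion division algebra does not split modulo a polynomial of odd degree. -/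
theorem not_splitMod_of_odd (h2 : (2 : K) ≠ 0) {a b : K} (ha : a ≠ 0) (hN : ¬ Nm a b) {p : K[X]}
    (hp : Odd p.natDegree) : ¬ SplitMod a b p := by
  induction hn : p.natDegree using Nat.strong_induction_on generalizing p with
  | _ n ih =>
  intro h
  obtain ⟨x, w, M, -, -, hw, hd, hM⟩ := exists_nf_data h2 ha hN h hp.pos
  refine ih w.natDegree (by omega) (p := w) ?_ rfl hw
  obtain ⟨l, hl⟩ := hp
  exact ⟨M - l - 1, by omega⟩

theorem not_nm_of_odd_finrank [CharZero K] {L : Type*} [Field L] [Algebra K L]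
    [FiniteDimensional K L] (ho : Odd (Module.finrank K L)) {a b : K} (ha : a ≠ 0)
    (hN : ¬ Nm a b) : ¬ Nm (algebraMap K L a) (algebraMap K L b) := by
  intro h
  obtain ⟨t, ht⟩ := Field.exists_primitive_element K L
  have ht' : Algebra.adjoin K {t} = ⊤ := by
    rw [← IntermediateField.adjoin_simple_toSubalgebra_of_isAlgebraic
      (Algebra.IsAlgebraic.isAlgebraic t), ht]
    rfl
  refine not_splitMod_of_odd two_ne_zero ha hN (p := minpoly K t) ?_ (splitMod_of_nm ht' h)
  rw [← IntermediateField.adjoin.finrank (Algebra.IsIntegral.isIntegral t), ht,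
    IntermediateField.finrank_top']
  exact ho

/-- Up to a constant and a square, `h` is a value of the quaternion norm form. -/
def NormRep (a b : K) (h : K[X]) : Prop :=
  ∃ (c : K) (d : K[X]) (x : Fin 4 → K[X]), c ≠ 0 ∧ d ≠ 0 ∧ C c * h * d ^ 2 = nf (C a) (C b) x

lemma NormRep.mul {a b : K} {f g : K[X]} (hf : NormRep a b f) (hg : NormRep a b g) :
    NormRep a b (f * g) := by
  obtain ⟨c, d, x, hc, hd, hx⟩ := hf
  obtain ⟨c', d', x', hc', hd', hx'⟩ := hg
  obtain ⟨z, hz⟩ := exists_nf_mul (C a) (C b) x x'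
  refine ⟨c * c', d * d', z, mul_ne_zero hc hc', mul_ne_zero hd hd', ?_⟩
  rw [← hz, ← hx, ← hx', map_mul]
  ring

lemma NormRep.of_mul {a b : K} {f g : K[X]} (hfg : NormRep a b (f * g)) (hg : NormRep a b g)
    (h0 : g ≠ 0) : NormRep a b f := by
  obtain ⟨c, d, x, hc, hd, hx⟩ := hfg.mul hg
  exact ⟨c, d * g, x, hc, mul_ne_zero hd h0, by rw [← hx]; ring⟩

lemma normRep_C (a b : K) {c : K} (hc : c ≠ 0) : NormRep a b (C c) := by
  refine ⟨c⁻¹, 1, ![1, 0, 0, 0], inv_ne_zero hc, one_ne_zero, ?_⟩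
  rw [← map_mul, inv_mul_cancel₀ hc]
  simp [nf]

theorem normRep_of_splitMod (h2 : (2 : K) ≠ 0) {a b : K} (ha : a ≠ 0) (hN : ¬ Nm a b) {h : K[X]}
    (h0 : h ≠ 0) (hs : ∀ p, Irreducible p → p ∣ h → SplitMod a b p) : NormRep a b h := by
  induction hn : h.natDegree using Nat.strong_induction_on generalizing h with
  | _ n ih =>
  by_cases hd : h.natDegree = 0
  · rw [natDegree_eq_zero] at hd
    obtain ⟨c, rfl⟩ := hd
    exact normRep_C a b (by simpa using h0)
  obtain ⟨p, hp, q, rfl⟩ := WfDvdMonoid.exists_irreducible_factor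
    (mt natDegree_eq_zero_of_isUnit hd) h0
  have hp0 : p ≠ 0 := hp.ne_zero
  have hq0 : q ≠ 0 := right_ne_zero_of_mul h0
  have hpd := hp.natDegree_pos
  have hsq : ∀ r, Irreducible r → r ∣ q → SplitMod a b r := fun r hr hrq =>
    hs r hr (hrq.mul_left p)
  rw [natDegree_mul hp0 hq0] at hn
  refine NormRep.mul ?_ (ih q.natDegree (by omega) hq0 hsq rfl)
  obtain ⟨x, w, M, hx, hw0, hw, hd', hM⟩ := exists_nf_data h2 ha hN (hs p hp (dvd_mul_right _ _)) hpd
  refine NormRep.of_mul (g := w) ⟨1, 1, x, one_ne_zero, one_ne_zero, by simp [hx]⟩ ?_ hw0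
  exact ih w.natDegree (by omega) hw0 (fun r _ hrw => hw.of_dvd hrw) rfl

end
end Pourchet

namespace Pourchet
open Polynomial IntermediateField

section
variable {K : Type*} [NontriviallyNormedField K] [IsUltrametricDist K] [ProperSpace K] [CharZero K]

lemma iso_of_disc_ext {L : Type*} [Field L] [Algebra K L] [FiniteDimensional K L] {a b c d : L}
    (ha : a ≠ 0) (hb : b ≠ 0) (hc : c ≠ 0) (h : ¬ IsSquare (a * b * c * d)) :
    Iso ![a, b, c, d] :=
  iso_of_disc (F := Spec K L) ha hb hc h

/-- A quaternion algebra over a local field `K'` splits over any quadratic extension. -/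
lemma nm_of_sq {K' C : Type*} [Field K'] [Algebra K K'] [FiniteDimensional K K'] [Field C]
    (i : K' →+* C) {a b e : K'} (ha : a ≠ 0) (hb : b ≠ 0) (he : ¬ IsSquare e) {y : C}
    (hy : y ^ 2 = i e) : Nm (i a) (i b) := by
  have h2 : (2 : C) ≠ 0 := by
    have h2K : (2 : K) ≠ 0 := two_ne_zero
    have := (_root_.map_ne_zero (i.comp (algebraMap K K'))).2 h2K
    rwa [map_ofNat] at this
  have he0 : e ≠ 0 := by rintro rfl; exact he ⟨0, by simp⟩
  have hd : ¬ IsSquare (a * b * -(a * b) * -e) := by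
    rintro ⟨r, hr⟩
    exact he ⟨r / (a * b), by field_simp; linear_combination hr⟩
  obtain ⟨x, hx, h⟩ := iso_of_disc_ext (K := K) ha hb (neg_ne_zero.2 (mul_ne_zero ha hb)) hd
  rw [Fin.sum_univ_four] at h
  simp only [Matrix.cons_val] at h
  have h' := congrArg i h
  simp only [map_add, map_mul, map_pow, map_neg, map_zero] at h'
  have hy0 : y ≠ 0 := by
    rintro rfl
    rw [zero_pow two_ne_zero, eq_comm, map_eq_zero] at hy
    exact he0 hy
  refine nm_of_iso4 h2 ((_root_.map_ne_zero i).2 ha) (x := y * i (x 3)) (y := i (x 0)) (z := i (x 1))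
    (w := i (x 2)) ?_ (by linear_combination -h' + i (x 3) ^ 2 * hy)
  by_contra! hc
  refine hx (funext fun j => ?_)
  have h3 := (mul_eq_zero.1 hc.1).resolve_left hy0
  simp only [map_eq_zero] at hc h3
  fin_cases j <;> simp [hc, h3]

variable {M : Type*} [Field M] [Algebra K M] [FiniteDimensional K M] [IsGalois K M]

lemma nm_fixedField {P Q : Subgroup Gal(M/K)} {n : ℕ} (hQ : Nat.card Q = 2 ^ n)
    (hP : Nat.card P = 2 ^ (n + 1)) (hQP : Q ≤ P) {a b : K} (ha : a ≠ 0) (hb : b ≠ 0) :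
    Nm (algebraMap K (fixedField Q) a) (algebraMap K (fixedField Q) b) := by
  have hind : (Q.subgroupOf P).index = 2 := by
    have := Subgroup.card_mul_index (Q.subgroupOf P)
    rw [Nat.card_congr (Subgroup.subgroupOfEquivOfLe hQP).toEquiv, hQ, hP, pow_succ] at this
    exact Nat.eq_of_mul_eq_mul_left (by positivity) this
  have hmul : ∀ {s t : Gal(M/K)}, s ∈ P → t ∈ P → (s * t ∈ Q ↔ (s ∈ Q ↔ t ∈ Q)) := by
    intro s t hs ht
    exact Subgroup.mul_mem_iff_of_index_two hind (a := ⟨s, hs⟩) (b := ⟨t, ht⟩)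
  obtain ⟨τ, hτ, hτQ⟩ : ∃ τ ∈ P, τ ∉ Q := by
    by_contra! hc
    have : Q = P := le_antisymm hQP hc
    rw [this, hP] at hQ
    have := Nat.pow_right_injective le_rfl hQ
    omega
  obtain ⟨z, hz, hτz⟩ : ∃ z ∈ fixedField Q, τ z ≠ z := by
    by_contra! hc
    rw [← fixingSubgroup_fixedField Q] at hτQ
    exact hτQ ((mem_fixingSubgroup_iff _ _).2 hc)
  rw [mem_fixedField_iff] at hz
  have hfix : ∀ s ∈ Q, s (τ z) = τ z := by
    intro s hs
    have h1 : τ⁻¹ * (s * τ) ∈ Q := by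
      rw [hmul (P.inv_mem hτ) (P.mul_mem (hQP hs) hτ), hmul (hQP hs) hτ]
      simp [hs, hτQ]
    have := congrArg τ (hz _ h1)
    rwa [← AlgEquiv.mul_apply, mul_inv_cancel_left] at this
  have hττ : τ (τ z) = z := hz (τ * τ) (by rw [hmul hτ hτ])
  set y := z - τ z with hy
  have hy0 : y ≠ 0 := fun h => hτz (sub_eq_zero.1 h).symm
  have hyτ : τ y = -y := by rw [hy, map_sub, hττ]; ring
  have hyQ : ∀ s ∈ Q, s y = y := fun s hs => by rw [hy, map_sub, hz s hs, hfix s hs]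
  have he : y ^ 2 ∈ fixedField P := by
    rw [mem_fixedField_iff]
    intro s hs
    by_cases hsQ : s ∈ Q
    · rw [map_pow, hyQ s hsQ]
    · have h1 : τ⁻¹ * s ∈ Q := by
        rw [hmul (P.inv_mem hτ) hs]; simp [hsQ, hτQ]
      have h2 := congrArg τ (hyQ _ h1)
      rw [← AlgEquiv.mul_apply, mul_inv_cancel_left, hyτ] at h2
      rw [map_pow, h2, neg_sq]
  have hle : fixedField P ≤ fixedField Q := by
    intro x hx
    rw [mem_fixedField_iff] at hx ⊢
    exact fun s hs => hx s (hQP hs)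
  refine nm_of_sq (K := K) (K' := fixedField P) (e := ⟨y ^ 2, he⟩) 
    (y := ⟨y, (mem_fixedField_iff _ _).2 hyQ⟩)
    (inclusion hle).toRingHom ((_root_.map_ne_zero (algebraMap K (fixedField P))).2 ha)
    ((_root_.map_ne_zero (algebraMap K (fixedField P))).2 hb) ?_ rfl
  · rintro ⟨⟨w, hw⟩, h⟩
    have h' : y ^ 2 = w * w := congrArg Subtype.val h
    rw [mem_fixedField_iff] at hw
    have h2 : (2 : M) ≠ 0 := by
      have h2K : (2 : K) ≠ 0 := two_ne_zero
      have := (_root_.map_ne_zero (algebraMap K M)).2 h2K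
      rwa [map_ofNat] at this
    have h3 : τ y = y := by
      rcases (sq_eq_sq_iff_eq_or_eq_neg.1 (h'.trans (pow_two w).symm)) with h | h
      · rw [h, hw τ hτ]
      · rw [h, map_neg, hw τ hτ]
    exact mul_ne_zero h2 hy0 (by linear_combination hyτ - h3)

/-- A quaternion algebra over a local field splits over every extension of even degree. -/
theorem nm_of_even_finrank (L : IntermediateField K M) (hL : 2 ∣ Module.finrank K L) {a b : K}
    (ha : a ≠ 0) (hb : b ≠ 0) : Nm (algebraMap K L a) (algebraMap K L b) := by
  obtain ⟨S⟩ : Nonempty (Sylow 2 L.fixingSubgroup) := inferInstance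
  set Q : Subgroup Gal(M/K) := (S : Subgroup L.fixingSubgroup).map L.fixingSubgroup.subtype with hQd
  have hQL : Q ≤ L.fixingSubgroup := Subgroup.map_subtype_le _
  have hrel : Q.relIndex L.fixingSubgroup = (S : Subgroup L.fixingSubgroup).index := by
    rw [Subgroup.relIndex, hQd, Subgroup.subgroupOf,
      Subgroup.comap_map_eq_self_of_injective (Subgroup.subtype_injective _)]
  have hodd : ¬ 2 ∣ Q.relIndex L.fixingSubgroup := by rw [hrel]; exact S.not_dvd_index
  obtain ⟨n, hn⟩ := IsPGroup.iff_card.1 (S.isPGroup'.map L.fixingSubgroup.subtype)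
  have hind := Subgroup.relIndex_mul_index hQL
  rw [finrank_eq_fixingSubgroup_index] at hL
  have hdvd : 2 ^ (n + 1) ∣ Nat.card Gal(M/K) := by
    rw [← Subgroup.card_mul_index Q, pow_succ, ← hind]
    exact mul_dvd_mul hn.symm.dvd (dvd_mul_of_dvd_right hL _)
  obtain ⟨P, hP, hQP⟩ := Sylow.exists_subgroup_card_pow_succ hdvd hn
  have hle : L ≤ fixedField Q := (le_iff_le Q L).2 hQL
  have hC := nm_fixedField hn hP hQP ha hb
  by_contra hN
  have hfin : Odd (Module.finrank L (extendScalars hle)) := by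
    rw [← relfinrank_eq_finrank_of_le, ← Nat.not_even_iff_odd, even_iff_two_dvd]
    have h1 := relfinrank_mul_relfinrank (bot_le (a := L)) hle
    rw [relfinrank_bot_left, relfinrank_bot_left, finrank_eq_fixingSubgroup_index,
      finrank_eq_fixingSubgroup_index, fixingSubgroup_fixedField, ← hind, mul_comm] at h1
    rwa [Nat.eq_of_mul_eq_mul_right (Nat.pos_of_ne_zero Subgroup.index_ne_zero_of_finite) h1]
  have : CharZero L := charZero_of_injective_algebraMap (algebraMap K L).injective
  exact not_nm_of_odd_finrank hfin ((_root_.map_ne_zero (algebraMap K L)).2 ha) hN hC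

/-- Over a local field, quaternion algebras split modulo irreducibles of even degree. -/
theorem splitMod_of_even {p : K[X]} (hp : Irreducible p) (hd : Even p.natDegree) {a b : K}
    (ha : a ≠ 0) (hb : b ≠ 0) : SplitMod a b p := by
  have : IsGalois K p.SplittingField := IsGalois.of_separable_splitting_field hp.separable
  have hs := SplittingField.splits p
  obtain ⟨α, hα⟩ := hs.exists_eval_eq_zero (by
    rw [degree_map]; exact (degree_pos_of_irreducible hp).ne')
  rw [eval_map_algebraMap] at hα
  have hmin := minpoly.eq_of_irreducible hp hα
  have hdeg : (minpoly K α).natDegree = p.natDegree := by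
    rw [← hmin, natDegree_mul_C (inv_ne_zero (leadingCoeff_ne_zero.2 hp.ne_zero))]
  have hαi : IsIntegral K α := Algebra.IsIntegral.isIntegral α
  have h := nm_of_even_finrank K⟮α⟯ (by
    rw [adjoin.finrank hαi, hdeg]; exact hd.two_dvd) ha hb
  have ht : Algebra.adjoin K {AdjoinSimple.gen K α} = ⊤ := by
    rw [← IntermediateField.adjoin_simple_toSubalgebra_of_isAlgebraic
      (Algebra.IsAlgebraic.isAlgebraic _), (Field.primitive_element_iff_minpoly_natDegree_eq K (AdjoinSimple.gen K α)).2
        (by rw [minpoly_gen, adjoin.finrank hαi])]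
    rfl
  have := splitMod_of_nm ht h
  rw [minpoly_gen] at this
  exact this.of_dvd (hmin ▸ dvd_mul_right _ _)

end
end Pourchet

namespace Pourchet
open Polynomial

section
variable {K : Type*} [Field K]

lemma finite_common {ι : Type*} {G : K[X]} (hG : G ≠ 0) (x : ℕ → ι → K[X])
    (h : ∀ p : K[X], Irreducible p → p ∣ G → ∀ n n', (∀ i, p ∣ x n i) → (∀ i, p ∣ x n' i) →
      n = n') :
    {n | ∃ p : K[X], Irreducible p ∧ p ∣ G ∧ ∀ i, p ∣ x n i}.Finite := by
  classical
  choose! P hP using fun n (hn : n ∈ {n | ∃ p : K[X], Irreducible p ∧ p ∣ G ∧ ∀ i, p ∣ x n i}) => hn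
  refine Set.Finite.of_injOn (f := fun n => normalize (P n))
    (t := ((UniqueFactorizationMonoid.normalizedFactors G).toFinset : Set K[X])) ?_ ?_
    (Finset.finite_toSet _)
  · intro n hn
    obtain ⟨h1, h2, -⟩ := hP n hn
    obtain ⟨q, hq, hpq⟩ := UniqueFactorizationMonoid.exists_mem_normalizedFactors_of_dvd hG h1 h2
    have := UniqueFactorizationMonoid.normalize_normalized_factor q hq
    simp only [Finset.mem_coe, Multiset.mem_toFinset]
    rwa [normalize_eq_normalize_iff_associated.2 hpq, this]
  · intro n hn n' hn' hnn
    have ha : Associated (P n) (P n') := normalize_eq_normalize_iff_associated.1 hnn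
    obtain ⟨h1, h2, h3⟩ := hP n hn
    exact h _ h1 h2 n n' h3 fun i => ha.dvd.trans ((hP n' hn').2.2 i)

lemma exists_unimodular {ι : Type*} [Fintype ι] {x : ι → K[X]}
    (h : ∀ p : K[X], Irreducible p → ∃ i, ¬ p ∣ x i) : ∃ u : ι → K[X], ∑ i, u i * x i = 1 := by
  have htop : (Ideal.span (Set.range x)) = ⊤ := by
    by_contra hne
    obtain ⟨I, hI, hle⟩ := Ideal.exists_le_maximal _ hne
    obtain ⟨p, rfl⟩ := (IsPrincipalIdealRing.principal I).principal
    have hp0 : p ≠ 0 := by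
      rintro rfl
      obtain ⟨i, hi⟩ := h X irreducible_X
      have := hle (Ideal.subset_span ⟨i, rfl⟩)
      rw [Submodule.span_zero_singleton, Submodule.mem_bot] at this
      simp [this] at hi
    have hp : Irreducible p :=
      ((Ideal.span_singleton_prime hp0).1 hI.isPrime).irreducible
    obtain ⟨i, hi⟩ := h p hp
    exact hi (Ideal.mem_span_singleton.1 (hle (Ideal.subset_span ⟨i, rfl⟩)))
  have h1 : (1 : K[X]) ∈ Ideal.span (Set.range x) := by rw [htop]; trivial
  rwa [Ideal.mem_span_range_iff_exists_fun] at h1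

/-- The pure part of the norm form of a quaternion algebra, up to sign. -/
def tau {R : Type*} [CommRing R] (a b : R) (w : Fin 3 → R) : R :=
  a * w 0 ^ 2 + b * w 1 ^ 2 - a * b * w 2 ^ 2

lemma exists_tau [CharZero K] {a b : K} (ha : a ≠ 0) (hb : b ≠ 0) {y s : K[X]}
    (hs : y ∣ s ^ 2 - C a) (hy' : y.natDegree ≠ 0) (r : K[X]) :
    ∃ w : Fin 3 → K[X], (∀ i, (w i).natDegree < y.natDegree) ∧ y ∣ r - tau (C a) (C b) w := by
  obtain ⟨a', ha'⟩ : ∃ c : K[X], C a * c = 1 :=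
    ⟨C a⁻¹, by rw [← map_mul, mul_inv_cancel₀ ha, map_one]⟩
  obtain ⟨b', hb'⟩ : ∃ c : K[X], C b * c = 1 :=
    ⟨C b⁻¹, by rw [← map_mul, mul_inv_cancel₀ hb, map_one]⟩
  obtain ⟨t, h2⟩ : ∃ c : K[X], 2 * c = 1 :=
    ⟨C (1 / 2), by rw [← C_ofNat, ← map_mul, mul_one_div_cancel two_ne_zero, map_one]⟩
  have h4 : 4 * t ^ 2 = 1 := by linear_combination (2 * t + 1) * h2
  let w : Fin 3 → K[X] := ![0, t * (1 + b' * r), t * a' * s * (b' * r - 1)]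
  have hw : y ∣ r - tau (C a) (C b) w := by
    obtain ⟨q, hq⟩ := hs
    refine ⟨C b * a' * t ^ 2 * (b' * r - 1) ^ 2 * q, ?_⟩
    simp only [tau, w, Matrix.cons_val]
    linear_combination C b * t ^ 2 * (b' * r - 1) ^ 2 * C a * a' ^ 2 * hq
      + C b * t ^ 2 * (b' * r - 1) ^ 2 * (C a * a' + 1 + a' * y * q) * ha'
      - C b * (b' * r) * h4 - r * hb'
  refine ⟨fun i => w i % y, fun i => natDegree_mod_lt _ hy', ?_⟩
  have hm : ∀ i, y ∣ w i - w i % y := fun i =>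
    ⟨w i / y, by linear_combination -EuclideanDomain.mod_add_div (w i) y⟩
  have : r - tau (C a) (C b) (fun i => w i % y) = (r - tau (C a) (C b) w) +
      (C a * (w 0 + w 0 % y) * (w 0 - w 0 % y) + C b * (w 1 + w 1 % y) * (w 1 - w 1 % y)
        - C a * C b * (w 2 + w 2 % y) * (w 2 - w 2 % y)) := by
    simp only [tau]; ring
  rw [this]
  exact dvd_add hw (dvd_sub (dvd_add (dvd_mul_of_dvd_right (hm 0) _)
    (dvd_mul_of_dvd_right (hm 1) _)) (dvd_mul_of_dvd_right (hm 2) _))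

lemma sub_natDegree_le {f g : K[X]} {n : ℕ} (hf : f.natDegree ≤ n) (hg : g.natDegree ≤ n) :
    (f - g).natDegree ≤ n :=
  (natDegree_sub_le_of_le hf hg).trans (max_self n).le

lemma natDegree_tau_le {a b : K} {w : Fin 3 → K[X]} {n : ℕ} (h : ∀ i, (w i).natDegree ≤ n) :
    (tau (C a) (C b) w).natDegree ≤ 2 * n := by
  have h1 : ∀ (c : K) (i : Fin 3), (C c * w i ^ 2).natDegree ≤ 2 * n := fun c i =>
    (natDegree_C_mul_le _ _).trans (natDegree_pow_le_of_le 2 (h i))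
  rw [tau, ← map_mul]
  exact sub_natDegree_le (natDegree_add_le_of_degree_le (h1 _ _) (h1 _ _)) (h1 _ _)

lemma exists_pure_data [CharZero K] {a b : K} (ha : a ≠ 0) (hb : b ≠ 0) {m j : ℕ}
    {F y z : K[X]} (hF : F ≠ 0) (hyz : F = y * z) (hd : y.natDegree + 2 * j = m) :
    ∃ (y' : K[X]) (w : Fin 3 → K[X]), y'.natDegree = 2 * j ∧ y' ≠ 0 ∧ (∃ i, w i ≠ 0) ∧
      (∀ i, (y * w i).natDegree ≤ m) ∧ y' ∣ z - y * tau (C a) (C b) w := by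
  by_cases hj : j = 0
  · subst hj
    refine ⟨1, ![1, 0, 0], by simp, one_ne_zero, ⟨0, by simp⟩, fun i => ?_, one_dvd _⟩
    fin_cases i <;> (simp; try omega)
  have hne : ∀ n n' : ℕ, n ≠ n' → a * ((n : K) + 1) ^ 2 - a * ((n' : K) + 1) ^ 2 ≠ 0 := by
    intro n n' hnn
    rw [← mul_sub]
    refine mul_ne_zero ha (sub_ne_zero.2 fun h => hnn ?_)
    have h' : (n + 1) ^ 2 = (n' + 1) ^ 2 := by exact_mod_cast h
    have := Nat.pow_left_injective two_ne_zero h'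
    omega
  have hfin := finite_common hF (fun (n : ℕ) (_ : Unit) => X ^ (2 * j) - C (a * ((n : K) + 1) ^ 2)) (by
    intro p hp _ n n' h h'
    by_contra hnn
    have := dvd_sub (h' ()) (h ())
    rw [sub_sub_sub_cancel_left, ← map_sub] at this
    exact hp.not_isUnit (isUnit_of_dvd_unit this (isUnit_C.2 (hne n n' hnn).isUnit)))
  obtain ⟨n, hn⟩ := hfin.exists_notMem
  set y' : K[X] := X ^ (2 * j) - C (a * ((n : K) + 1) ^ 2) with hy'
  have hdeg : y'.natDegree = 2 * j := natDegree_X_pow_sub_C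
  have hy'0 : y' ≠ 0 := by rintro h; rw [h, natDegree_zero] at hdeg; omega
  have hcop : IsCoprime F y' := by
    refine isCoprime_of_irreducible_dvd (fun h => hF h.1) fun p hp h1 h2 => ?_
    exact hn ⟨p, hp, h1, fun _ => h2⟩
  rw [hyz] at hcop
  obtain ⟨e, e', he⟩ := hcop.of_mul_left_left
  have hn0 : (n : K) + 1 ≠ 0 := by exact_mod_cast n.succ_ne_zero
  obtain ⟨w, hw, hdvd⟩ := exists_tau ha hb (y := y') (s := C ((n : K) + 1)⁻¹ * X ^ j)
    ⟨C ((n : K) + 1)⁻¹ ^ 2, by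
      have : C a = C ((n : K) + 1)⁻¹ ^ 2 * C (a * ((n : K) + 1) ^ 2) := by
        rw [← map_pow, ← map_mul]; congr 1; field_simp
      rw [this, hy']; ring⟩ (by omega) (e * z)
  have hdvd' : y' ∣ z - y * tau (C a) (C b) w := by
    have : z - y * tau (C a) (C b) w = y * (e * z - tau (C a) (C b) w) + y' * (e' * z) := by
      linear_combination -z * he
    rw [this]
    exact dvd_add (dvd_mul_of_dvd_right hdvd _) (dvd_mul_right _ _)
  refine ⟨y', w, hdeg, hy'0, ?_, fun i => ?_, hdvd'⟩
  · by_contra! hw0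
    have : tau (C a) (C b) w = 0 := by simp [tau, hw0]
    rw [this, mul_zero, sub_zero] at hdvd'
    have := natDegree_eq_zero_of_isUnit (hcop.of_mul_left_right.isUnit_of_dvd' hdvd' dvd_rfl)
    omega
  · refine natDegree_mul_le.trans ?_
    have := hw i
    omega

/-- A decomposition of `F` into a square and a primitive multiple of a quaternion norm. -/
def SquareNorm (a b : K) (F : K[X]) (m : ℕ) : Prop :=
  ∃ (g : K[X]) (l : K) (x u : Fin 4 → K[X]), g.natDegree ≤ m ∧ l ≠ 0 ∧
    C l * (F - g ^ 2) = nf (C a) (C b) x ∧ ∑ i, u i * x i = 1 ∧ (F - g ^ 2).coeff (2 * m) ≠ 0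

lemma not_sq_dvd {F p : K[X]} (hF : Squarefree F) (hp : Irreducible p) : ¬ p ^ 2 ∣ F := fun h =>
  hp.not_isUnit (hF p (by rwa [← pow_two]))

lemma squareNorm_of_factor [CharZero K] {a b : K} (ha : a ≠ 0) (hb : b ≠ 0) (hN : ¬ Nm a b)
    {m j : ℕ} {F y z : K[X]} (hF : Squarefree F) (hF0 : F ≠ 0) (hFm : F.natDegree = 2 * m)
    (hyz : F = y * z) (hd : y.natDegree + 2 * j = m) : SquareNorm a b F m := by
  obtain ⟨y', w, hdeg, hy'0, ⟨i₀, hi₀⟩, hdw, q, hq⟩ := exists_pure_data ha hb hF0 hyz hd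
  have hy0 : y ≠ 0 := by rintro rfl; simp [hyz] at hF0
  have htau : tau (C a) (C b) (fun i => y * w i) = y ^ 2 * tau (C a) (C b) w := by
    simp only [tau]; ring
  have hFq : F - tau (C a) (C b) (fun i => y * w i) = (y * y') * q := by
    rw [htau, hyz]; linear_combination y * hq
  set Y := y * y' with hY
  have hY0 : Y ≠ 0 := mul_ne_zero hy0 hy'0
  have hYm : Y.natDegree = m := by rw [hY, natDegree_mul hy0 hy'0]; omega
  have hqm : q.natDegree ≤ m := by
    by_cases hq0 : q = 0
    · simp [hq0]
    have h1 : (Y * q).natDegree ≤ 2 * m := by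
      rw [← hFq]
      exact sub_natDegree_le hFm.le (natDegree_tau_le hdw)
    rw [natDegree_mul hY0 hq0] at h1
    omega
  let x : ℕ → Fin 4 → K[X] := fun n => ![C (1 / 2) * (C ((n : K) + 1) * Y - C ((n : K) + 1)⁻¹ * q),
    y * w 0, y * w 1, y * w 2]
  have hx : ∀ n p, (∀ i, p ∣ x n i) → ∀ i, p ∣ y * w i := by
    intro n p h i
    fin_cases i
    exacts [h 1, h 2, h 3]
  have hC2 : (C (1 / 2) : K[X]) * 2 = 1 := by
    rw [← C_ofNat, ← map_mul, one_div_mul_cancel two_ne_zero, map_one]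
  have hn0 : ∀ n : ℕ, C ((n : K) + 1) * C ((n : K) + 1)⁻¹ = 1 := by
    intro n
    rw [← map_mul, mul_inv_cancel₀ (by exact_mod_cast n.succ_ne_zero), map_one]
  have hfin1 := finite_common (mul_ne_zero hy0 hi₀) x (by
    intro p hp _ n n' h h'
    by_contra hnn
    have e : ∀ n, (∀ i, p ∣ x n i) → p ∣ C ((n : K) + 1) ^ 2 * Y - q := by
      intro n h
      have : C ((n : K) + 1) ^ 2 * Y - q = 2 * C ((n : K) + 1) * x n 0 := by
        simp only [x, Matrix.cons_val]
        linear_combination -(C ((n : K) + 1) ^ 2 * Y - q) * hC2 + q * (C (1 / 2) * 2) * hn0 n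
      rw [this]
      exact dvd_mul_of_dvd_right (h 0) _
    have hpY : p ∣ Y := by
      have h1 := dvd_sub (e n h) (e n' h')
      have h2 : C ((n : K) + 1) ^ 2 * Y - q - (C ((n' : K) + 1) ^ 2 * Y - q) =
          C (((n : K) + 1) ^ 2 - ((n' : K) + 1) ^ 2) * Y := by
        rw [map_sub, map_pow, map_pow]; ring
      rw [h2] at h1
      refine (hp.prime.dvd_or_dvd h1).resolve_left fun h3 => ?_
      refine hp.not_isUnit (isUnit_of_dvd_unit h3 (isUnit_C.2 (IsUnit.mk0 _ ?_)))
      refine sub_ne_zero.2 fun h => hnn ?_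
      have h' : (n + 1) ^ 2 = (n' + 1) ^ 2 := by exact_mod_cast h
      have := Nat.pow_left_injective two_ne_zero h'
      omega
    have hpq : p ∣ q := by
      have := dvd_sub (dvd_mul_of_dvd_right hpY (C ((n : K) + 1) ^ 2)) (e n h)
      rwa [sub_sub_cancel] at this
    refine not_sq_dvd hF hp ?_
    have h1 : ∀ i, p ^ 2 ∣ (y * w i) ^ 2 := fun i => pow_dvd_pow_of_dvd (hx n p h i) 2
    rw [← sub_add_cancel F (tau (C a) (C b) fun i => y * w i), hFq, pow_two]
    refine dvd_add (mul_dvd_mul hpY hpq) ?_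
    rw [← pow_two, tau]
    exact dvd_sub (dvd_add (dvd_mul_of_dvd_right (h1 0) _) (dvd_mul_of_dvd_right (h1 1) _))
      (dvd_mul_of_dvd_right (h1 2) _))
  have hfin2 : {n : ℕ | (x n 0).coeff m = 0}.Finite := by
    refine Set.Subsingleton.finite fun n hn n' hn' => ?_
    have e : ∀ n : ℕ, (x n 0).coeff m = 0 → ((n : K) + 1) ^ 2 * Y.coeff m = q.coeff m := by
      intro n h
      have h0 : (n : K) + 1 ≠ 0 := by exact_mod_cast n.succ_ne_zero
      simp only [x, Matrix.cons_val, coeff_C_mul, coeff_sub] at h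
      field_simp at h
      linear_combination h
    have h1 := (e n hn).trans (e n' hn').symm
    rw [← hYm, coeff_natDegree, mul_left_inj' (leadingCoeff_ne_zero.2 hY0)] at h1
    have h' : (n + 1) ^ 2 = (n' + 1) ^ 2 := by exact_mod_cast h1
    have := Nat.pow_left_injective two_ne_zero h'
    omega
  obtain ⟨n, hn⟩ := (hfin1.union hfin2).exists_notMem
  rw [Set.mem_union, not_or] at hn
  obtain ⟨u, hu⟩ := exists_unimodular (x := x n) (by
    intro p hp
    by_contra! h
    exact hn.1 ⟨p, hp, hx n p h i₀, h⟩)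
  have hnf : F - (C (1 / 2) * (C ((n : K) + 1) * Y + C ((n : K) + 1)⁻¹ * q)) ^ 2 =
      - nf (C a) (C b) (x n) := by
    simp only [tau] at hFq
    simp only [nf, x, Matrix.cons_val]
    linear_combination hFq - 4 * C (1 / 2) ^ 2 * Y * q * hn0 n - Y * q * (2 * C (1 / 2) + 1) * hC2
  refine ⟨_, -1, x n, u, ?_, neg_ne_zero.2 one_ne_zero, by rw [hnf]; simp, hu, ?_⟩
  · refine (natDegree_C_mul_le _ _).trans (natDegree_add_le_of_degree_le ?_ ?_)
    · exact (natDegree_C_mul_le _ _).trans hYm.le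
    · exact (natDegree_C_mul_le _ _).trans hqm
  · rw [hnf, ← qf_quat, coeff_neg, neg_ne_zero, coeff_qf]
    · intro h0
      refine hN (nm_of_iso_quat two_ne_zero ha ⟨fun i => (x n i).coeff m, fun h => ?_, h0⟩)
      exact hn.2 (congrFun h 0)
    · intro i
      fin_cases i
      · refine (natDegree_C_mul_le _ _).trans (sub_natDegree_le ?_ ?_)
        · exact (natDegree_C_mul_le _ _).trans hYm.le
        · exact (natDegree_C_mul_le _ _).trans hqm
      exacts [hdw 0, hdw 1, hdw 2]

end

section
variable {K : Type*} [NontriviallyNormedField K] [IsUltrametricDist K] [ProperSpace K] [CharZero K]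

/-- Over a local field every squarefree polynomial of even degree is the sum of a square and of
a primitive multiple of a quaternion norm. -/
theorem exists_squareNorm {a b : K} (ha : a ≠ 0) (hb : b ≠ 0) (hN : ¬ Nm a b)
    {m : ℕ} {F : K[X]} (hF : Squarefree F) (hF0 : F ≠ 0) (hFm : F.natDegree = 2 * m) :
    SquareNorm a b F m := by
  rcases Nat.even_or_odd' m with ⟨j, rfl | rfl⟩
  · exact squareNorm_of_factor (y := 1) (z := F) (j := j) ha hb hN hF hF0 hFm (by simp) (by simp)
  by_cases h : ∃ p, Irreducible p ∧ p ∣ F ∧ Odd p.natDegree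
  · obtain ⟨p, hp, ⟨q, hpq⟩, ⟨l, hl⟩⟩ := h
    have hq0 : q ≠ 0 := by rintro rfl; simp [hpq] at hF0
    have hdeg := hFm
    rw [hpq, natDegree_mul hp.ne_zero hq0] at hdeg
    by_cases hlj : l ≤ j
    · exact squareNorm_of_factor (j := j - l) ha hb hN hF hF0 hFm hpq (by omega)
    · exact squareNorm_of_factor (j := l - j) ha hb hN hF hF0 hFm (hpq.trans (mul_comm _ _))
        (by omega)
  · push Not at h
    obtain ⟨c, d, x, hc, hd, hx⟩ := normRep_of_splitMod two_ne_zero ha hN hF0 fun p hp hpF =>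
      splitMod_of_even hp (Nat.not_odd_iff_even.1 (h p hp hpF)) ha hb
    rw [← qf_quat] at hx
    obtain ⟨g, hg⟩ := cassels_pfister two_ne_zero (quat_ne_zero ha hb) hd hx
    obtain ⟨u, hu⟩ := exists_unimodular (x := g) (by
      intro p hp
      by_contra! h
      refine not_sq_dvd hF hp ?_
      have h1 : p ^ 2 ∣ C c * F := by
        rw [hg, qf]
        exact Finset.dvd_sum fun i _ => dvd_mul_of_dvd_right (pow_dvd_pow_of_dvd (h i) 2) _
      exact (isUnit_C.2 hc.isUnit).dvd_mul_left.1 h1)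
    refine ⟨0, c, g, u, by simp, hc, by rw [← qf_quat, ← hg]; simp, hu, ?_⟩
    rw [zero_pow two_ne_zero, sub_zero, ← hFm, coeff_natDegree]
    exact leadingCoeff_ne_zero.2 hF0

end
end Pourchet

namespace Pourchet
open Polynomial

section
variable {F : Type*} [Field F] [CharZero F]

lemma exists_orthogonal_family {n : ℕ} {a e : Fin (n + 1) → F} (he : ∑ i, a i * e i * e i ≠ 0) :
    ∃ b : Fin n → Fin (n + 1) → F, (∀ j, ∑ i, a i * e i * b j i = 0) ∧
      (∀ j l, j ≠ l → ∑ i, a i * b j i * b l i = 0) ∧ (∀ j, b j ≠ 0) ∧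
      ∀ w, ∑ i, a i * e i * w i = 0 → ∃ y : Fin n → F, w = ∑ j, y j • b j := by
  let B : LinearMap.BilinForm F (Fin (n + 1) → F) := Matrix.toBilin' (Matrix.diagonal a)
  have hB : ∀ x y, B x y = ∑ i, a i * x i * y i := by
    intro x y
    simp only [B, Matrix.toBilin'_apply, Matrix.diagonal_apply, mul_ite, mul_zero, ite_mul,
      zero_mul, Finset.sum_ite_eq, Finset.mem_univ, if_true]
    exact Finset.sum_congr rfl fun i _ => by ring
  let W := B.orthogonal (Submodule.span F {e})
  have hW : ∀ w, w ∈ W ↔ ∑ i, a i * e i * w i = 0 := by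
    intro w
    rw [LinearMap.BilinForm.mem_orthogonal_iff, ← hB]
    refine ⟨fun h => h e (Submodule.mem_span_singleton_self e), fun h x hx => ?_⟩
    obtain ⟨c, rfl⟩ := Submodule.mem_span_singleton.1 hx
    rw [map_smul, LinearMap.smul_apply, h, smul_zero]
  have hdim : Module.finrank F W = n := by
    have h := Submodule.finrank_add_eq_of_isCompl
      (LinearMap.BilinForm.isCompl_span_singleton_orthogonal (B := B) (x := e) (by rwa [hB]))
    have he0 : e ≠ 0 := by rintro rfl; simp at he
    rw [finrank_span_singleton he0, Module.finrank_fin_fun] at h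
    change 1 + Module.finrank F W = _ at h
    omega
  have hsymm : LinearMap.IsSymm (B.restrict W) :=
    ⟨fun x y => by
      change B x y = B y x
      rw [hB, hB]
      exact Finset.sum_congr rfl fun i _ => by ring⟩
  have : Invertible (2 : F) := invertibleOfNonzero two_ne_zero
  obtain ⟨v, hv⟩ := LinearMap.BilinForm.exists_orthogonal_basis hsymm
  rw [LinearMap.isOrthoᵢ_def] at hv
  let v' := v.reindex (finCongr hdim)
  refine ⟨fun j => (v' j : Fin (n + 1) → F), fun j => (hW _).1 (v' j).2, fun j l hjl => ?_,
    fun j h => v'.ne_zero j (Subtype.ext h), fun w hw => ?_⟩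
  · rw [← hB]
    have := hv ((finCongr hdim).symm j) ((finCongr hdim).symm l) (by simpa using hjl)
    simpa [v'] using this
  · refine ⟨v'.repr ⟨w, (hW w).2 hw⟩, ?_⟩
    have := congrArg Subtype.val (v'.sum_repr ⟨w, (hW w).2 hw⟩)
    rw [Submodule.coe_sum] at this
    exact this.symm

lemma sum_sq_of_orthogonal {R : Type*} [CommRing R] {ι κ : Type*} [Fintype ι] [Fintype κ]
    [DecidableEq κ] {a : ι → R} {b : κ → ι → R} (h : ∀ j l, j ≠ l → ∑ i, a i * b j i * b l i = 0)
    (y : κ → R) :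
    ∑ i, a i * (∑ j, y j * b j i) ^ 2 = ∑ j, (∑ i, a i * b j i * b j i) * y j ^ 2 := by
  have h1 : ∀ i, a i * (∑ j, y j * b j i) ^ 2 =
      ∑ j, ∑ l, y j * y l * (a i * b j i * b l i) := by
    intro i
    rw [pow_two, Finset.sum_mul_sum, Finset.mul_sum]
    refine Finset.sum_congr rfl fun j _ => ?_
    rw [Finset.mul_sum]
    exact Finset.sum_congr rfl fun l _ => by ring
  simp only [h1]
  rw [Finset.sum_comm]
  refine Finset.sum_congr rfl fun j _ => ?_
  rw [Finset.sum_comm, Finset.sum_eq_single j]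
  · rw [← Finset.mul_sum]; ring
  · intro l _ hl
    rw [← Finset.mul_sum, h j l hl.symm, mul_zero]
  · simp

/-- A five-dimensional form representing its discriminant is the sum of its discriminant and a
multiple of the norm form of a quaternion algebra. -/
theorem exists_quat_decomposition {a e : Fin 5 → F} (ha : ∀ i, a i ≠ 0) (hi : ¬ Iso a)
    (he : ∑ i, a i * e i ^ 2 = ∏ i, a i) :
    ∃ c A B : F, c ≠ 0 ∧ A ≠ 0 ∧ B ≠ 0 ∧
      (∀ (G : F[X]) (x : Fin 4 → F[X]), ∃ z,
        qf a z = C (∏ i, a i) * G ^ 2 + C c * nf (C A) (C B) x) ∧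
      ∀ w : Fin 5 → F, ∑ i, a i * e i * w i = 0 →
        ∃ x, ∑ i, a i * w i ^ 2 = c * nf A B x := by
  have hδ : ∏ i, a i ≠ 0 := Finset.prod_ne_zero_iff.2 fun i _ => ha i
  have he' : ∑ i, a i * e i * e i = ∏ i, a i := by
    rw [← he]; exact Finset.sum_congr rfl fun i _ => by ring
  obtain ⟨b, hb1, hb2, hb0, hb3⟩ := exists_orthogonal_family (n := 4) (he'.symm ▸ hδ)
  let d : Fin 4 → F := fun j => ∑ i, a i * b j i * b j i
  have hd : ∀ j, d j ≠ 0 := fun j h => hi ⟨b j, hb0 j, by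
    rw [← h]; exact Finset.sum_congr rfl fun i _ => by ring⟩
  let P : Fin 5 → Fin 5 → F := Fin.cons e b
  have hP : ∀ j l, j ≠ l → ∑ i, a i * P j i * P l i = 0 := by
    intro j l hjl
    refine Fin.cases (fun hjl => ?_) (fun j hjl => ?_) j hjl
    · obtain ⟨l, rfl⟩ := Fin.exists_succ_eq.2 hjl.symm
      simpa [P] using hb1 l
    · revert hjl
      refine Fin.cases (fun _ => ?_) (fun l hjl => ?_) l
      · simp only [P, Fin.cons_zero, Fin.cons_succ]
        rw [← hb1 j]
        exact Finset.sum_congr rfl fun i _ => by ring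
      · simpa [P] using hb2 j l fun h => hjl (by rw [h])
  obtain ⟨s, hs⟩ : ∃ s, d 0 * d 1 * d 2 * d 3 = s ^ 2 := by
    refine ⟨(Matrix.of P).det, ?_⟩
    have h1 : Matrix.of P * Matrix.diagonal a * (Matrix.of P).transpose =
        Matrix.diagonal (Fin.cons (∏ i, a i) d) := by
      ext j l
      rw [Matrix.mul_apply, Matrix.diagonal_apply]
      simp only [Matrix.mul_diagonal, Matrix.of_apply, Matrix.transpose_apply]
      split_ifs with hjl
      · subst hjl
        refine Fin.cases ?_ (fun j => ?_) j
        · simp only [P, Fin.cons_zero]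
          rw [← he']
          exact Finset.sum_congr rfl fun i _ => by ring
        · simp only [P, Fin.cons_succ, d]
          exact Finset.sum_congr rfl fun i _ => by ring
      · rw [← hP j l hjl]
        exact Finset.sum_congr rfl fun i _ => by ring
    have h2 := congrArg Matrix.det h1
    rw [Matrix.det_mul, Matrix.det_mul, Matrix.det_transpose, Matrix.det_diagonal,
      Matrix.det_diagonal, Fin.prod_univ_succ (Fin.cons _ _), Fin.prod_univ_four] at h2
    simp only [Fin.cons_zero, Fin.cons_succ] at h2
    exact mul_left_cancel₀ hδ (by linear_combination -h2)
  have hs0 : s ≠ 0 := by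
    rintro rfl
    rw [zero_pow two_ne_zero] at hs
    simp [hd] at hs
  have h0 := hd 0
  have h1 := hd 1
  have h2 := hd 2
  refine ⟨d 0, -d 1 / d 0, -d 2 / d 0, h0, div_ne_zero (neg_ne_zero.2 h1) h0,
    div_ne_zero (neg_ne_zero.2 h2) h0, fun G x => ?_, fun w hw => ?_⟩
  · let y : Fin 5 → F[X] := ![G, x 0, x 1, x 2, C (d 1 * d 2 / s) * x 3]
    refine ⟨fun i => ∑ j, y j * C (P j i), ?_⟩
    rw [qf, sum_sq_of_orthogonal (fun j l hjl => ?_)]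
    · simp only [← map_mul, ← map_sum]
      rw [Fin.sum_univ_five]
      change C (∑ i, a i * e i * e i) * G ^ 2 + C (d 0) * x 0 ^ 2 + C (d 1) * x 1 ^ 2 +
        C (d 2) * x 2 ^ 2 + C (d 3) * (C (d 1 * d 2 / s) * x 3) ^ 2 = _
      have e1 : C (d 0) * C (-d 1 / d 0) = -C (d 1) := by
        rw [← map_mul, ← map_neg]; congr 1; field_simp
      have e2 : C (d 0) * C (-d 2 / d 0) = -C (d 2) := by
        rw [← map_mul, ← map_neg]; congr 1; field_simp
      have e3 : C (d 0) * (C (-d 1 / d 0) * C (-d 2 / d 0)) = C (d 3) * C (d 1 * d 2 / s) ^ 2 := by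
        rw [← map_mul, ← map_mul, ← map_pow, ← map_mul]
        congr 1
        field_simp
        linear_combination -hs
      rw [he', nf]
      linear_combination x 1 ^ 2 * e1 + x 2 ^ 2 * e2 - x 3 ^ 2 * e3
    · rw [← map_zero C, ← hP j l hjl, map_sum]
      simp
  · obtain ⟨y, rfl⟩ := hb3 w hw
    refine ⟨![y 0, y 1, y 2, s / (d 1 * d 2) * y 3], ?_⟩
    simp only [Finset.sum_apply, Pi.smul_apply, smul_eq_mul]
    rw [sum_sq_of_orthogonal hb2, Fin.sum_univ_four]
    change d 0 * _ + d 1 * _ + d 2 * _ + d 3 * _ = _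
    simp only [nf, Matrix.cons_val]
    field_simp
    linear_combination y 3 ^ 2 * hs

end
end Pourchet

namespace Pourchet
open Polynomial IsDedekindDomain NumberField

section
variable {K : Type*} [NormedField K] [IsUltrametricDist K] {T r s : ℝ} {P Q : K[X]}

/-- The Gauss norm of `P` with respect to the radius `T` is at most `r`. -/
def GaussLE (T r : ℝ) (P : K[X]) : Prop := ∀ l, ‖P.coeff l‖ * T ^ l ≤ r

lemma GaussLE.nonneg (h : GaussLE T r P) : 0 ≤ r :=
  le_trans (by simp) (h 0)

lemma GaussLE.mono (h : GaussLE T r P) (hrs : r ≤ s) : GaussLE T s P := fun l => (h l).trans hrs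

lemma GaussLE.add (hT : 0 ≤ T) (hP : GaussLE T r P) (hQ : GaussLE T r Q) : GaussLE T r (P + Q) := by
  intro l
  rw [coeff_add]
  rcases le_max_iff.1 (IsUltrametricDist.norm_add_le_max (P.coeff l) (Q.coeff l)) with h | h
  · exact (mul_le_mul_of_nonneg_right h (pow_nonneg hT l)).trans (hP l)
  · exact (mul_le_mul_of_nonneg_right h (pow_nonneg hT l)).trans (hQ l)

lemma GaussLE.neg (hP : GaussLE T r P) : GaussLE T r (-P) := by
  intro l
  rw [coeff_neg, norm_neg]; exact hP l

lemma GaussLE.sub (hT : 0 ≤ T) (hP : GaussLE T r P) (hQ : GaussLE T r Q) : GaussLE T r (P - Q) := by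
  rw [sub_eq_add_neg]; exact hP.add hT hQ.neg

lemma GaussLE.sum (hT : 0 ≤ T) (hr : 0 ≤ r) {ι : Type*} (t : Finset ι) {f : ι → K[X]}
    (h : ∀ i ∈ t, GaussLE T r (f i)) : GaussLE T r (∑ i ∈ t, f i) := by
  induction t using Finset.cons_induction with
  | empty => intro l; simpa
  | cons i t hi ih =>
    rw [Finset.sum_cons]
    exact (h i (by simp)).add hT (ih fun j hj => h j (by simp [hj]))

lemma GaussLE.mul (hT : 0 ≤ T) (hP : GaussLE T r P) (hQ : GaussLE T s Q) :
    GaussLE T (r * s) (P * Q) := by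
  intro l
  rw [coeff_mul]
  have hrs := mul_nonneg hP.nonneg hQ.nonneg
  rcases (pow_nonneg hT l).eq_or_lt with h0 | h0
  · rw [← h0, mul_zero]; exact hrs
  rw [← le_div_iff₀ h0]
  refine IsUltrametricDist.norm_sum_le_of_forall_le_of_nonneg (by positivity) fun ij hij => ?_
  have hij' : ij.1 + ij.2 = l := by simpa using hij
  rw [le_div_iff₀ h0, norm_mul, ← hij', pow_add]
  calc _ = (‖P.coeff ij.1‖ * T ^ ij.1) * (‖Q.coeff ij.2‖ * T ^ ij.2) := by ring
    _ ≤ _ := mul_le_mul (hP _) (hQ _) (by positivity) hP.nonneg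

lemma gaussLE_C {c : K} (hc : ‖c‖ ≤ r) : GaussLE T r (C c) := by
  intro l
  rw [coeff_C]
  split_ifs with h
  · simpa [h]
  · simpa using (norm_nonneg c).trans hc

lemma exists_gaussLE (hT : 0 ≤ T) (P : K[X]) : ∃ r, GaussLE T r P := by
  refine ⟨∑ l ∈ P.support, ‖P.coeff l‖ * T ^ l, fun l => ?_⟩
  by_cases hl : l ∈ P.support
  · exact Finset.single_le_sum (f := fun l => ‖P.coeff l‖ * T ^ l) (fun _ _ => by positivity) hl
  · rw [notMem_support_iff.1 hl, norm_zero, zero_mul]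
    exact Finset.sum_nonneg fun _ _ => by positivity

end

section
variable {k : Type*} [Field k] [NumberField k] (v : HeightOneSpectrum (𝓞 k))

lemma exists_gaussLE_map_sub {T e : ℝ} (hT : 0 < T) (he : 0 < e) (P : (v.adicCompletion k)[X]) :
    ∃ P' : k[X], GaussLE T e (P'.map (toComp v) - P) := by
  choose y hy using fun l => (denseRange_toComp v).exists_dist_lt (P.coeff l)
    (ε := e / T ^ l) (by positivity)
  refine ⟨∑ l ∈ Finset.range (P.natDegree + 1), monomial l (y l), fun l => ?_⟩
  rw [coeff_sub, coeff_map, finsetSum_coeff]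
  simp only [coeff_monomial, Finset.sum_ite_eq', Finset.mem_range]
  split_ifs with h
  · have := hy l
    rw [dist_eq_norm, norm_sub_rev, lt_div_iff₀ (by positivity)] at this
    exact this.le
  · rw [coeff_eq_zero_of_natDegree_lt (by omega)]
    simpa using he.le

lemma fabs_sum_le {ι : Type*} (t : Finset ι) {f : ι → k} {c : ℝ} (hc : 0 ≤ c)
    (h : ∀ i ∈ t, fabs v (f i) ≤ c) : fabs v (∑ i ∈ t, f i) ≤ c := by
  induction t using Finset.cons_induction with
  | empty => simpa
  | cons i t hi ih =>
    rw [Finset.sum_cons]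
    exact (fabs_add_le v _ _).trans (max_le (h i (by simp)) (ih fun j hj => h j (by simp [hj])))

lemma fabs_sum_lt {ι : Type*} (t : Finset ι) {f : ι → k} {c : ℝ} (hc : 0 < c)
    (h : ∀ i ∈ t, fabs v (f i) < c) : fabs v (∑ i ∈ t, f i) < c := by
  induction t using Finset.cons_induction with
  | empty => simpa
  | cons i t hi ih =>
    rw [Finset.sum_cons]
    exact (fabs_add_le v _ _).trans_lt (max_lt (h i (by simp)) (ih fun j hj => h j (by simp [hj])))

lemma exists_le_fabs (R : ℝ) : ∃ b : k, R ≤ fabs v b ∧ 1 < fabs v b := by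
  obtain ⟨p, hp0, hp⟩ := exists_int_fabs_lt v
  have h1 : 1 < fabs v ((p : k)⁻¹) := by
    rw [map_inv₀]; exact (one_lt_inv₀ ((fabs v).pos hp0)).2 hp
  obtain ⟨n, hn⟩ := pow_unbounded_of_one_lt R h1
  refine ⟨(p : k)⁻¹ ^ (n + 1), ?_, ?_⟩
  · rw [map_pow]
    exact hn.le.trans (pow_le_pow_right₀ h1.le n.le_succ)
  · rw [map_pow]
    exact one_lt_pow₀ h1 n.succ_ne_zero

end

section
variable {k L : Type*} [Field k] [NumberField k] [Field L] [NumberField L] (i : k →+* L)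
  (w : HeightOneSpectrum (𝓞 L))

lemma fabs_le_of_under {x y : k} (h : fabs (under i w) x ≤ fabs (under i w) y) :
    fabs w (i x) ≤ fabs w (i y) := by
  by_cases hy : y = 0
  · subst hy
    rw [map_zero] at h
    have : x = 0 := (AbsoluteValue.eq_zero _).1 (le_antisymm h (AbsoluteValue.nonneg _ _))
    simp [this]
  have h1 : fabs (under i w) (x / y) ≤ 1 := by
    rwa [map_div₀, div_le_one ((fabs _).pos hy)]
  rwa [← fabs_under_le, map_div₀, map_div₀, div_le_one] at h1
  exact (fabs w).pos ((_root_.map_ne_zero i).2 hy)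

lemma fabs_lt_of_under {x y : k} (h : fabs (under i w) x < fabs (under i w) y) :
    fabs w (i x) < fabs w (i y) := by
  have hy : y ≠ 0 := by
    rintro rfl; rw [map_zero] at h; exact h.not_ge (AbsoluteValue.nonneg _ _)
  have h1 : fabs (under i w) (x / y) < 1 := by
    rwa [map_div₀, div_lt_one ((fabs _).pos hy)]
  rwa [← fabs_under_lt, map_div₀, map_div₀, div_lt_one] at h1
  exact (fabs w).pos ((_root_.map_ne_zero i).2 hy)

lemma fabs_eval₂_le {τ b : k} {P : k[X]} {θ : L} (hθ : fabs w θ ≤ fabs w (i τ))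
    (hP : GaussLE (fabs (under i w) τ) (fabs (under i w) b) (P.map (toComp (under i w)))) :
    fabs w (eval₂ i θ P) ≤ fabs w (i b) := by
  rw [eval₂_eq_sum_range]
  refine fabs_sum_le w _ (AbsoluteValue.nonneg _ _) fun l _ => ?_
  have h := hP l
  rw [coeff_map, norm_toComp, ← map_pow, ← map_mul] at h
  refine le_trans ?_ (fabs_le_of_under i w h)
  simp only [map_mul, map_pow]
  gcongr

lemma fabs_root_le {τ : k} {h : k[X]} {N : ℕ} (hN : h.natDegree ≤ N) (h0 : h.coeff N ≠ 0)
    (hτ : 1 < fabs (under i w) τ)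
    (hh : ∀ l, fabs (under i w) (h.coeff l) ≤ fabs (under i w) (τ * h.coeff N)) {θ : L}
    (hθ : eval₂ i θ h = 0) : fabs w θ ≤ fabs w (i τ) := by
  by_contra! hc
  have h1 : 1 < fabs w (i τ) := (fabs_under_gt i w).2 hτ
  have hpos : 0 < fabs w (i (h.coeff N)) := (fabs w).pos ((_root_.map_ne_zero i).2 h0)
  have hsum := hθ
  rw [eval₂_eq_sum_range' i (Nat.lt_succ_of_le hN), Finset.sum_range_succ] at hsum
  have hlt : fabs w (∑ l ∈ Finset.range N, i (h.coeff l) * θ ^ l) <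
      fabs w (i (h.coeff N)) * fabs w θ ^ N := by
    refine fabs_sum_lt w _ (mul_pos hpos (pow_pos (by linarith) _)) fun l hl => ?_
    rw [map_mul, map_pow]
    have h2 := fabs_le_of_under i w (hh l)
    rw [map_mul, map_mul] at h2
    have hp : 0 < fabs w θ ^ l := pow_pos (by linarith) _
    calc _ ≤ fabs w (i τ) * fabs w (i (h.coeff N)) * fabs w θ ^ l := by gcongr
      _ < fabs w θ * fabs w (i (h.coeff N)) * fabs w θ ^ l := by gcongr
      _ = fabs w (i (h.coeff N)) * fabs w θ ^ (l + 1) := by ring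
      _ ≤ _ := by
        gcongr
        · linarith
        · exact Finset.mem_range.1 hl
  rw [eq_neg_of_add_eq_zero_left hsum, (fabs w).map_neg, map_mul, map_pow] at hlt
  exact lt_irrefl _ hlt

end

lemma eval₂_nf {R S : Type*} [CommRing R] [CommRing S] (i : R →+* S) (t : S) (a b : R)
    (x : Fin 4 → R[X]) : eval₂ i t (nf (C a) (C b) x) = nf (i a) (i b) fun j => eval₂ i t (x j) := by
  simp only [nf, eval₂_sub, eval₂_add, eval₂_mul, eval₂_pow, eval₂_C]

lemma map_nf {R S : Type*} [CommRing R] [CommRing S] (i : R →+* S) (a b : R)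
    (x : Fin 4 → R[X]) : (nf (C a) (C b) x).map i = nf (C (i a)) (C (i b)) fun j => (x j).map i := by
  simp only [nf, Polynomial.map_sub, Polynomial.map_add, Polynomial.map_mul, Polynomial.map_pow,
    Polynomial.map_C]

lemma nf_sub_nf {R : Type*} [CommRing R] (a b : R) (x y : Fin 4 → R) :
    nf a b x - nf a b y = ∑ j, quat a b j * ((x j - y j) * (x j + y j)) := by
  simp only [nf, quat, Fin.sum_univ_four, Matrix.cons_val]; ring

lemma quat_map {R S : Type*} [CommRing R] [CommRing S] (i : R →+* S) (a b : R) :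
    i ∘ quat a b = quat (i a) (i b) := by
  ext j; fin_cases j <;> simp [quat]

section
variable {k : Type*} [Field k] [NumberField k] {v : HeightOneSpectrum (𝓞 k)}

/-- A primitive representation of a polynomial by a quaternion norm, up to a small error, gives
isotropy of the norm form at the roots. -/
lemma locIso_of_approx {A B τ b c l : k} {h : k[X]} {x u : Fin 4 → k[X]}
    (hc1 : fabs v c < 1) (hcb : ∀ j, fabs v (c * b ^ 2) < fabs v (4 * quat A B j))
    (hu : ∀ j, GaussLE (fabs v τ) (fabs v b) ((u j).map (toComp v)))
    (h1 : GaussLE (fabs v τ) (fabs v c) ((C l * h - nf (C A) (C B) x).map (toComp v)))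
    (h2 : GaussLE (fabs v τ) (fabs v c) ((∑ j, u j * x j - 1).map (toComp v)))
    {L : Type*} [Field L] [NumberField L] (i : k →+* L) {w : HeightOneSpectrum (𝓞 L)}
    (hw : under i w = v) {θ : L} (hθ : eval₂ i θ h = 0) (hθτ : fabs w θ ≤ fabs w (i τ)) :
    LocIso w (i ∘ quat A B) := by
  subst hw
  have e1 := fabs_eval₂_le i w hθτ h1
  have e2 := fabs_eval₂_le i w hθτ h2
  have e3 := fun j => fabs_eval₂_le i w hθτ (hu j)
  rw [eval₂_sub, eval₂_mul, hθ, mul_zero, zero_sub, (fabs w).map_neg, eval₂_nf] at e1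
  have hc : fabs w (i c) < 1 := (fabs_under_lt i w).2 hc1
  rw [eval₂_sub, eval₂_finsetSum, eval₂_one] at e2
  simp only [eval₂_mul] at e2
  have hex : ∃ j, 1 ≤ fabs w (i b) * fabs w (eval₂ i θ (x j)) := by
    by_contra! hcon
    have h3 : fabs w (∑ j, eval₂ i θ (u j) * eval₂ i θ (x j)) < 1 := by
      refine fabs_sum_lt w _ one_pos fun j _ => ?_
      rw [map_mul]
      exact (mul_le_mul_of_nonneg_right (e3 j) (AbsoluteValue.nonneg _ _)).trans_lt (hcon j)
    have h4 := fabs_add_le w (∑ j, eval₂ i θ (u j) * eval₂ i θ (x j))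
      (-(∑ j, eval₂ i θ (u j) * eval₂ i θ (x j) - 1))
    rw [(fabs w).map_neg, neg_sub, add_sub_cancel, map_one] at h4
    exact (h4.trans_lt (max_lt h3 (e2.trans_lt hc))).false
  obtain ⟨j, hj⟩ := hex
  refine ⟨fun j => eval₂ i θ (x j), j, ?_⟩
  rw [quat_map, sum_quat]
  refine e1.trans_lt ?_
  have h5 := fabs_lt_of_under i w (hcb j)
  have h6 : i (quat A B j) = quat (i A) (i B) j := congrFun (quat_map i A B) j
  rw [map_mul i, map_mul i, map_ofNat, h6, map_mul, map_pow, map_pow] at h5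
  rw [map_mul, map_pow]
  set X := fabs w (eval₂ i θ (x j))
  set β := fabs w (i b)
  have hX : 0 ≤ X := AbsoluteValue.nonneg _ _
  have hβ : 0 ≤ β := AbsoluteValue.nonneg _ _
  have hX0 : 0 < X := by
    refine hX.lt_of_ne fun h => ?_
    rw [← h, mul_zero] at hj
    linarith
  have h7 : 1 ≤ β ^ 2 * X ^ 2 := by rw [← mul_pow]; exact one_le_pow₀ hj
  calc fabs w (i c) ≤ fabs w (i c) * (β ^ 2 * X ^ 2) :=
        le_mul_of_one_le_right (AbsoluteValue.nonneg _ _) h7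
    _ = fabs w (i c) * β ^ 2 * X ^ 2 := by ring
    _ < _ := mul_lt_mul_of_pos_right h5 (by positivity)

theorem SquareNorm.exists_nhd {A B : k} (hA : A ≠ 0) (hB : B ≠ 0) {m : ℕ}
    {F : (v.adicCompletion k)[X]} (hF : F.natDegree ≤ 2 * m)
    (hS : SquareNorm (toComp v A) (toComp v B) F m) :
    ∃ g : (v.adicCompletion k)[X], g.natDegree ≤ m ∧ ∃ e > 0, ∀ h : k[X], h.natDegree ≤ 2 * m →
      (∀ l ≤ 2 * m, ‖toComp v (h.coeff l) - (F - g ^ 2).coeff l‖ < e) →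
      h.coeff (2 * m) ≠ 0 ∧ ∀ (L : Type) [Field L] [NumberField L] (i : k →+* L)
        (w : HeightOneSpectrum (𝓞 L)) (θ : L), under i w = v → eval₂ i θ h = 0 →
        LocIso w (i ∘ quat A B) := by
  obtain ⟨g, l, x, u, hg, hl, hlx, hux, hlead⟩ := hS
  set H := F - g ^ 2 with hH
  refine ⟨g, hg, ?_⟩
  have hHd : H.natDegree ≤ 2 * m := sub_natDegree_le hF
    (natDegree_pow_le.trans (Nat.mul_le_mul_left _ hg))
  obtain ⟨r0, hr0⟩ := exists_gaussLE (T := 1) zero_le_one H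
  have hlead' : 0 < ‖H.coeff (2 * m)‖ := norm_pos_iff.2 hlead
  obtain ⟨τ, hτ, hτ1⟩ := exists_le_fabs v (r0 / ‖H.coeff (2 * m)‖)
  set T := fabs v τ with hT
  have hT0 : 0 ≤ T := by linarith
  choose rx hrx using fun j => exists_gaussLE hT0 (x j)
  choose ru hru using fun j => exists_gaussLE hT0 (u j)
  obtain ⟨rh, hrh⟩ := exists_gaussLE hT0 H
  obtain ⟨b, hb, hb1⟩ := exists_le_fabs v (∑ j, rx j + ∑ j, ru j + rh + ‖l‖ +
    ∑ j, fabs v (quat A B j))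
  set β := fabs v b with hβ
  have nx := fun j => (hrx j).nonneg
  have nu := fun j => (hru j).nonneg
  have nh := hrh.nonneg
  have sx := Finset.sum_nonneg fun j (_ : j ∈ Finset.univ) => nx j
  have su := Finset.sum_nonneg fun j (_ : j ∈ Finset.univ) => nu j
  have sq := Finset.sum_nonneg fun j (_ : j ∈ Finset.univ) => (fabs v).nonneg (quat A B j)
  have sl := norm_nonneg l
  have bx : ∀ j, GaussLE T β (x j) := fun j => (hrx j).mono <| by
    have := Finset.single_le_sum (fun j _ => nx j) (Finset.mem_univ j); linarith
  have bu : ∀ j, GaussLE T β (u j) := fun j => (hru j).mono <| by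
    have := Finset.single_le_sum (fun j _ => nu j) (Finset.mem_univ j); linarith
  have bq : ∀ j, fabs v (quat A B j) ≤ β := fun j => by
    have := Finset.single_le_sum (fun j _ => (fabs v).nonneg (quat A B j)) (Finset.mem_univ j)
    linarith
  have bh : GaussLE T β H := hrh.mono (by linarith)
  have bl : ‖l‖ ≤ β := by linarith
  have hq4 : ∀ j, 0 < fabs v (4 * quat A B j) := fun j =>
    (fabs v).pos (mul_ne_zero (by norm_num : (4 : k) ≠ 0) (quat_ne_zero hA hB j))
  obtain ⟨d, hd, hd1⟩ := exists_le_fabs v (∑ j, 2 * β ^ 2 / fabs v (4 * quat A B j))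
  have hβ0 : 0 < β := by linarith
  have hcb : ∀ j, fabs v (d⁻¹ * b ^ 2) < fabs v (4 * quat A B j) := fun j => by
    have h1 : 2 * β ^ 2 / fabs v (4 * quat A B j) ≤ fabs v d :=
      (Finset.single_le_sum (f := fun j => 2 * β ^ 2 / fabs v (4 * quat A B j))
        (fun j _ => div_nonneg (by positivity) (hq4 j).le) (Finset.mem_univ j)).trans hd
    rw [div_le_iff₀ (hq4 j)] at h1
    rw [map_mul, map_inv₀, map_pow, inv_mul_lt_iff₀ (by linarith)]
    have := pow_pos hβ0 2
    linarith
  set c := d⁻¹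
  have hc1 : fabs v c < 1 := by rw [map_inv₀]; exact inv_lt_one_of_one_lt₀ hd1
  have hc0 : 0 < fabs v c := by rw [map_inv₀]; exact inv_pos.2 (by linarith)
  set η := fabs v c / β ^ 2 with hη
  have hη0 : 0 < η := by positivity
  have hηb2 : β * η * β = fabs v c := by rw [hη]; field_simp
  have hη1 : η ≤ β := by
    rw [hη, div_le_iff₀ (by positivity)]
    nlinarith [one_le_pow₀ hb1.le (n := 3)]
  have hηb : η * β ≤ fabs v c := by nlinarith [mul_pos hη0 hβ0]
  choose x' hx' using fun j => exists_gaussLE_map_sub v (by linarith : 0 < T) hη0 (x j)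
  choose u' hu' using fun j => exists_gaussLE_map_sub v (by linarith : 0 < T) hη0 (u j)
  obtain ⟨l', hl'⟩ := (denseRange_toComp v).exists_dist_lt l hη0
  rw [dist_eq_norm, norm_sub_rev] at hl'
  have bx' : ∀ j, GaussLE T β ((x' j).map (toComp v)) := fun j => by
    have := ((hx' j).mono hη1).add hT0 (bx j)
    rwa [sub_add_cancel] at this
  have bu' : ∀ j, GaussLE T β ((u' j).map (toComp v)) := fun j => by
    have := ((hu' j).mono hη1).add hT0 (bu j)
    rwa [sub_add_cancel] at this
  have bl' : ‖toComp v l'‖ ≤ β := by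
    have := IsUltrametricDist.norm_add_le_max (toComp v l' - l) l
    rw [sub_add_cancel] at this
    exact this.trans (max_le (hl'.le.trans hη1) bl)
  have h2 : GaussLE T (fabs v c) ((∑ j, u' j * x' j - 1).map (toComp v)) := by
    have e : (∑ j, u' j * x' j - 1).map (toComp v) =
        ∑ j, (((u' j).map (toComp v) - u j) * (x' j).map (toComp v) +
          ((x' j).map (toComp v) - x j) * u j) := by
      rw [Polynomial.map_sub, Polynomial.map_sum, Polynomial.map_one, ← hux,
        ← Finset.sum_sub_distrib]
      refine Finset.sum_congr rfl fun j _ => ?_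
      rw [Polynomial.map_mul]; ring
    rw [e]
    exact GaussLE.sum hT0 hc0.le _ fun j _ =>
      (((hu' j).mul hT0 (bx' j)).mono hηb).add hT0 (((hx' j).mul hT0 (bu j)).mono hηb)
  have hTm : ∀ n, 1 ≤ T ^ n := fun n => one_le_pow₀ hτ1.le
  refine ⟨min (η / T ^ (2 * m)) ‖H.coeff (2 * m)‖, lt_min (by positivity) hlead',
    fun h hhd hh => ?_⟩
  have hhl : ‖toComp v (h.coeff (2 * m))‖ = ‖H.coeff (2 * m)‖ :=
    norm_eq_of_sub_lt ((hh _ le_rfl).trans_le (min_le_right _ _))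
  have hcoeff : h.coeff (2 * m) ≠ 0 := by
    intro h0
    rw [h0, map_zero, norm_zero] at hhl
    exact hlead'.ne hhl
  refine ⟨hcoeff, fun L _ _ i w θ hw hθ => ?_⟩
  have hdiff : GaussLE T η (h.map (toComp v) - H) := by
    intro n
    rw [coeff_sub, coeff_map]
    by_cases hn : n ≤ 2 * m
    · calc _ ≤ η / T ^ (2 * m) * T ^ n := by
            gcongr; exact ((hh n hn).trans_le (min_le_left _ _)).le
        _ ≤ η / T ^ (2 * m) * T ^ (2 * m) := by gcongr; exact hτ1.le
        _ = η := div_mul_cancel₀ _ (by have := hTm (2 * m); positivity)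
    · rw [coeff_eq_zero_of_natDegree_lt (by omega : h.natDegree < n),
        coeff_eq_zero_of_natDegree_lt (by omega : H.natDegree < n)]
      simpa using hη0.le
  have h1 : GaussLE T (fabs v c) ((C l' * h - nf (C A) (C B) x').map (toComp v)) := by
    have e : (C l' * h - nf (C A) (C B) x').map (toComp v) =
        C (toComp v l') * (h.map (toComp v) - H) + C (toComp v l' - l) * H -
          ∑ j, quat (C (toComp v A)) (C (toComp v B)) j *
            (((x' j).map (toComp v) - x j) * ((x' j).map (toComp v) + x j)) := by
      rw [← nf_sub_nf (C (toComp v A)) (C (toComp v B)) (fun j => (x' j).map (toComp v)) x, ← hlx,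
        Polynomial.map_sub, Polynomial.map_mul, map_C, map_nf, C_sub]
      ring
    rw [e]
    refine (GaussLE.add hT0 ?_ ?_).sub hT0 (GaussLE.sum hT0 hc0.le _ fun j _ => ?_)
    · refine ((gaussLE_C bl').mul hT0 hdiff).mono ?_
      rwa [mul_comm]
    · exact ((gaussLE_C hl'.le).mul hT0 bh).mono hηb
    · have e2 : quat (C (toComp v A)) (C (toComp v B)) j = C (toComp v (quat A B j)) := by
        rw [← quat_map C, ← quat_map (toComp v)]; rfl
      rw [e2]
      refine ((gaussLE_C (r := β) (by rw [norm_toComp]; exact bq j)).mul hT0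
        ((hx' j).mul hT0 ((bx' j).add hT0 (bx j)))).mono ?_
      rw [← mul_assoc, hηb2]
  have hroot : ∀ n, fabs v (h.coeff n) ≤ fabs v (τ * h.coeff (2 * m)) := by
    intro n
    rw [map_mul, ← norm_toComp, ← norm_toComp v (h.coeff (2 * m)), hhl]
    have hr := hr0 n
    rw [one_pow, mul_one] at hr
    rw [div_le_iff₀ hlead'] at hτ
    by_cases hn : n ≤ 2 * m
    · have := IsUltrametricDist.norm_add_le_max (toComp v (h.coeff n) - H.coeff n) (H.coeff n)
      rw [sub_add_cancel] at this
      refine this.trans (max_le ?_ (hr.trans hτ))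
      refine ((hh n hn).trans_le (min_le_right _ _)).le.trans ?_
      exact le_mul_of_one_le_left hlead'.le hτ1.le
    · rw [coeff_eq_zero_of_natDegree_lt (by omega : h.natDegree < n), map_zero, norm_zero]
      positivity
  refine locIso_of_approx hc1 hcb bu' h1 h2 i hw hθ ?_
  subst hw
  exact fabs_root_le i w hhd hcoeff hτ1 hroot hθ

end

end Pourchet

namespace Pourchet
open Polynomial

lemma abs_pow_le_one_add_sq_pow {l m : ℕ} (hl : l ≤ 2 * m) (x : ℝ) : |x| ^ l ≤ (1 + x ^ 2) ^ m := by
  rcases le_total |x| 1 with h | h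
  · exact (pow_le_one₀ (abs_nonneg x) h).trans (one_le_pow₀ (by nlinarith))
  · calc |x| ^ l ≤ |x| ^ (2 * m) := pow_le_pow_right₀ h hl
      _ = (x ^ 2) ^ m := by rw [pow_mul, sq_abs]
      _ ≤ _ := by gcongr; linarith

lemma abs_sum_coeff_le (m : ℕ) (c : ℕ → ℝ) (x : ℝ) :
    |∑ l ∈ Finset.range (2 * m + 1), c l * x ^ l| ≤
      (∑ l ∈ Finset.range (2 * m + 1), |c l|) * (1 + x ^ 2) ^ m := by
  rw [Finset.sum_mul]
  refine (Finset.abs_sum_le_sum_abs _ _).trans (Finset.sum_le_sum fun l hl => ?_)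
  rw [abs_mul, abs_pow]
  gcongr
  exact abs_pow_le_one_add_sq_pow (by simp at hl; omega) x

lemma eval_eq_sum {m : ℕ} {P : ℝ[X]} (hP : P.natDegree ≤ 2 * m) (x : ℝ) :
    P.eval x = ∑ l ∈ Finset.range (2 * m + 1), P.coeff l * x ^ l :=
  eval_eq_sum_range' (Nat.lt_succ_of_le hP) x

/-- `P` is bounded below by a positive multiple of `(1 + x²)^m`. -/
def StrictPos (m : ℕ) (P : ℝ[X]) : Prop := ∃ e > 0, ∀ x : ℝ, e * (1 + x ^ 2) ^ m ≤ P.eval x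

lemma StrictPos.pos {m : ℕ} {P : ℝ[X]} (h : StrictPos m P) (x : ℝ) : 0 < P.eval x := by
  obtain ⟨e, he, h⟩ := h
  exact lt_of_lt_of_le (by positivity) (h x)

lemma isOpen_strictPos {X : Type*} [TopologicalSpace X] {m : ℕ} {P : X → ℝ[X]}
    (hd : ∀ y, (P y).natDegree ≤ 2 * m) (hc : ∀ l, Continuous fun y => (P y).coeff l) :
    IsOpen {y | StrictPos m (P y)} := by
  rw [isOpen_iff_mem_nhds]
  rintro y ⟨e, he, hy⟩
  have hcont : Continuous fun z => ∑ l ∈ Finset.range (2 * m + 1),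
      |(P z).coeff l - (P y).coeff l| := by
    have := hc
    fun_prop
  have hev := hcont.continuousAt (x := y) |>.eventually_lt continuousAt_const
    (show _ < e / 2 by simpa using he)
  filter_upwards [hev] with z hz
  refine ⟨e / 2, half_pos he, fun x => ?_⟩
  have h1 := abs_sum_coeff_le m (fun l => (P z).coeff l - (P y).coeff l) x
  simp only [sub_mul, Finset.sum_sub_distrib] at h1
  rw [← eval_eq_sum (hd z), ← eval_eq_sum (hd y)] at h1
  have h2 := (abs_le.1 h1).1
  have h3 := hy x
  have h4 : 0 < (1 + x ^ 2) ^ m := by positivity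
  nlinarith

lemma strictPos_of_pos {m : ℕ} {P : ℝ[X]} (hd : P.natDegree = 2 * m) (hP : ∀ x, 0 < P.eval x) :
    StrictPos m P := by
  have hrev : ∀ t : ℝ, t ≠ 0 → P.eval t = P.reverse.eval t⁻¹ * t ^ (2 * m) := by
    intro t ht
    let _ := invertibleOfNonzero ht
    have := eval₂_reverse_mul_pow (RingHom.id ℝ) t P
    rw [invOf_eq_inv, hd] at this
    exact this.symm
  have hrev0 : ∀ t : ℝ, 0 ≤ P.reverse.eval t := by
    have hcl : IsClosed {t : ℝ | 0 ≤ P.reverse.eval t} := isClosed_le continuous_const (by fun_prop)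
    have hsub : ({0}ᶜ : Set ℝ) ⊆ {t : ℝ | 0 ≤ P.reverse.eval t} := by
      intro t ht
      have ht' : t ≠ 0 := ht
      have h1 := hrev t⁻¹ (inv_ne_zero ht')
      rw [inv_inv] at h1
      have h2 := hP t⁻¹
      have h3 : 0 < (t⁻¹) ^ (2 * m) := by
        rw [pow_mul]; positivity
      rw [h1] at h2
      exact (pos_of_mul_pos_left h2 h3.le).le
    intro t
    exact (hcl.closure_subset_iff.2 hsub) (dense_compl_singleton 0 t)
  have hrevpos : ∀ t : ℝ, 0 < P.reverse.eval t := by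
    intro t
    refine (hrev0 t).lt_of_ne fun h => ?_
    by_cases ht : t = 0
    · subst ht
      rw [← coeff_zero_eq_eval_zero, coeff_zero_reverse] at h
      have h1 := hP 0
      rw [leadingCoeff_eq_zero.1 h.symm, eval_zero] at h1
      exact h1.false
    · have h1 := hrev t⁻¹ (inv_ne_zero ht)
      rw [inv_inv, ← h, zero_mul] at h1
      exact (hP _).ne' h1
  have hcomp : IsCompact (Set.Icc (-1 : ℝ) 1) := isCompact_Icc
  obtain ⟨x1, -, h1⟩ := hcomp.exists_isMinOn ⟨0, by simp⟩ (f := fun x => P.eval x) (by fun_prop)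
  obtain ⟨x2, -, h2⟩ := hcomp.exists_isMinOn ⟨0, by simp⟩ (f := fun x => P.reverse.eval x)
    (by fun_prop)
  have p1 := hP x1
  have p2 := hrevpos x2
  refine ⟨min (P.eval x1) (P.reverse.eval x2) / 2 ^ m, by positivity, fun x => ?_⟩
  rw [div_mul_eq_mul_div, div_le_iff₀ (by positivity)]
  rcases le_total |x| 1 with h | h
  · have e1 : P.eval x1 ≤ P.eval x := h1 (abs_le.1 h)
    have e2 : (1 + x ^ 2) ^ m ≤ 2 ^ m := by
      gcongr
      have := (sq_le_one_iff_abs_le_one x).2 h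
      linarith
    exact mul_le_mul ((min_le_left _ _).trans e1) e2 (by positivity) (hP x).le
  · have hx0 : x ≠ 0 := by rintro rfl; simp at h; linarith
    have e1 : P.reverse.eval x2 ≤ P.reverse.eval x⁻¹ :=
      h2 (abs_le.1 (by rw [abs_inv]; exact inv_le_one_of_one_le₀ h))
    have e2 : (1 + x ^ 2) ^ m ≤ x ^ (2 * m) * 2 ^ m := by
      rw [pow_mul, ← mul_pow]
      gcongr
      have := (one_le_sq_iff_one_le_abs x).2 h
      linarith
    rw [hrev x hx0, mul_assoc]
    exact mul_le_mul ((min_le_right _ _).trans e1) e2 (by positivity) (hrevpos _).le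

section
variable {ι : Type*} [Fintype ι] [DecidableEq ι] {m : ℕ} {P : ℝ[X]} {β : ι → ℝ}

lemma exists_bound (hP : P.natDegree ≤ 2 * m) : ∃ M : ℝ, 0 ≤ M ∧ ∀ x, -(M * (1 + x ^ 2) ^ m) ≤ P.eval x := by
  refine ⟨∑ l ∈ Finset.range (2 * m + 1), |P.coeff l|, Finset.sum_nonneg fun _ _ => abs_nonneg _,
    fun x => ?_⟩
  rw [eval_eq_sum hP]
  exact (abs_le.1 (abs_sum_coeff_le m _ x)).1

lemma natDegree_one_add_sq_pow (j : ℕ) : (((1 : ℝ[X]) + X ^ 2) ^ j).natDegree ≤ 2 * j := by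
  rw [mul_comm]
  refine natDegree_pow_le_of_le _ ?_
  compute_degree

lemma sum_single_eval (j : ι) (g : ℝ[X]) (x : ℝ) :
    (qf β (Pi.single j g)).eval x = β j * g.eval x ^ 2 := by
  rw [qf, Finset.sum_eq_single j]
  · simp
  · intro i _ hi; simp [hi]
  · simp

lemma natDegree_single_le (j : ι) {g : ℝ[X]} (hg : g.natDegree ≤ m) (i : ι) :
    ((Pi.single j g : ι → ℝ[X]) i).natDegree ≤ m := by
  rcases eq_or_ne i j with rfl | h
  · simpa
  · simp [h]

lemma exists_strictPos_even (hP : P.natDegree ≤ 2 * m) (hm : Even m) {j : ι} (hj : 0 < β j) :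
    ∃ g : ι → ℝ[X], (∀ i, (g i).natDegree ≤ m) ∧ StrictPos m (P + qf β g) := by
  obtain ⟨n, rfl⟩ := hm
  obtain ⟨M, hM0, hM⟩ := exists_bound hP
  refine ⟨Pi.single j (C (Real.sqrt ((M + 1) / β j)) * (1 + X ^ 2) ^ n),
    natDegree_single_le j ?_, 1, one_pos, fun x => ?_⟩
  · exact natDegree_C_mul_le _ _ |>.trans ((natDegree_one_add_sq_pow n).trans (by omega))
  · rw [eval_add, sum_single_eval, eval_mul, eval_C, mul_pow, Real.sq_sqrt (by positivity),
      ← mul_assoc, mul_div_cancel₀ _ hj.ne']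
    simp only [eval_pow, eval_add, eval_one, eval_X]
    rw [← pow_mul, mul_two]
    have := hM x
    nlinarith

lemma exists_strictPos_two (hP : P.natDegree ≤ 2 * m) (hm : Odd m) {j j' : ι} (hjj : j ≠ j')
    (hj : 0 < β j) (hj' : 0 < β j') :
    ∃ g : ι → ℝ[X], (∀ i, (g i).natDegree ≤ m) ∧ StrictPos m (P + qf β g) := by
  obtain ⟨n, rfl⟩ := hm
  obtain ⟨M, hM0, hM⟩ := exists_bound hP
  have hd := natDegree_one_add_sq_pow n
  refine ⟨Pi.single j (C (Real.sqrt ((M + 1) / β j)) * (1 + X ^ 2) ^ n) +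
    Pi.single j' (C (Real.sqrt ((M + 1) / β j')) * (X * (1 + X ^ 2) ^ n)), fun i => ?_, 1, one_pos,
      fun x => ?_⟩
  · refine (natDegree_add_le _ _).trans (max_le (natDegree_single_le j ?_ i)
      (natDegree_single_le j' ?_ i))
    · exact natDegree_C_mul_le _ _ |>.trans (hd.trans (by omega))
    · refine natDegree_C_mul_le _ _ |>.trans (natDegree_mul_le.trans ?_)
      rw [natDegree_X]; omega
  · have e : ∀ g g' : ℝ[X], (qf β (Pi.single j g + Pi.single j' g')).eval x =
        β j * g.eval x ^ 2 + β j' * g'.eval x ^ 2 := by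
      intro g g'
      rw [← sum_single_eval, ← sum_single_eval, ← eval_add, qf, qf, qf, ← Finset.sum_add_distrib]
      congr 1
      refine Finset.sum_congr rfl fun i _ => ?_
      rcases eq_or_ne i j with rfl | h
      · simp [hjj]
      · simp [h]
    rw [eval_add, e, eval_mul, eval_C, eval_mul, eval_C, mul_pow, mul_pow,
      Real.sq_sqrt (by positivity), Real.sq_sqrt (by positivity),
      ← mul_assoc, ← mul_assoc, mul_div_cancel₀ _ hj.ne', mul_div_cancel₀ _ hj'.ne']
    simp only [eval_pow, eval_add, eval_one, eval_X, eval_mul]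
    have := hM x
    have h2 : (1 + x ^ 2) ^ (2 * n + 1) = ((1 + x ^ 2) ^ n) ^ 2 * (1 + x ^ 2) := by
      rw [pow_succ, mul_comm 2, pow_mul]
    nlinarith

lemma exists_strictPos_point (hP : P.natDegree ≤ 2 * m) (hm : Odd m) {j : ι}
    (hj : 0 < β j) {x₀ : ℝ} (hx : 0 < P.eval x₀) :
    ∃ g : ι → ℝ[X], (∀ i, (g i).natDegree ≤ m) ∧ StrictPos m (P + qf β g) := by
  obtain ⟨n, rfl⟩ := hm
  obtain ⟨M, hM0, hM⟩ := exists_bound hP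
  have hd := natDegree_one_add_sq_pow n
  obtain ⟨d, hd0, hdd⟩ := Metric.eventually_nhds_iff.1
    ((P.continuous.continuousAt (x := x₀)).eventually_const_lt (half_lt_self hx))
  set D := (1 + 2 * x₀ ^ 2) / d ^ 2 + 2 with hD
  have hD0 : 0 < D := by positivity
  set R := (1 + 2 * (d ^ 2 + x₀ ^ 2)) ^ (2 * n + 1) with hR
  have hR0 : 0 < R := by positivity
  refine ⟨Pi.single j (C (Real.sqrt ((M + 1) * D / β j)) * ((X - C x₀) * (1 + X ^ 2) ^ n)),
    natDegree_single_le j ?_, min 1 (P.eval x₀ / 2 / R), by positivity, fun x => ?_⟩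
  · refine natDegree_C_mul_le _ _ |>.trans (natDegree_mul_le.trans ?_)
    rw [natDegree_X_sub_C]; omega
  · rw [eval_add, sum_single_eval, eval_mul, eval_C, mul_pow, Real.sq_sqrt (by positivity),
      ← mul_assoc, mul_div_cancel₀ _ hj.ne']
    simp only [eval_pow, eval_add, eval_one, eval_X, eval_mul, eval_sub, eval_C]
    have h2 : (1 + x ^ 2) ^ (2 * n + 1) = ((1 + x ^ 2) ^ n) ^ 2 * (1 + x ^ 2) := by
      rw [pow_succ, mul_comm 2, pow_mul]
    have hW : 0 < (1 + x ^ 2) ^ (2 * n + 1) := by positivity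
    rcases lt_or_ge (dist x x₀) d with h | h
    · have h3 := hdd h
      have h4 : x ^ 2 ≤ 2 * (d ^ 2 + x₀ ^ 2) := by
        rw [Real.dist_eq] at h
        have : (x - x₀) ^ 2 ≤ d ^ 2 := by rw [← sq_abs]; gcongr
        nlinarith [sq_nonneg (x - 2 * x₀)]
      have h5 : (1 + x ^ 2) ^ (2 * n + 1) ≤ R := by rw [hR]; gcongr
      have h6 : min 1 (P.eval x₀ / 2 / R) * (1 + x ^ 2) ^ (2 * n + 1) ≤ P.eval x₀ / 2 := by
        calc _ ≤ P.eval x₀ / 2 / R * R := by gcongr; exact min_le_right _ _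
          _ = _ := div_mul_cancel₀ _ hR0.ne'
      have h7 : 0 ≤ (M + 1) * D * ((x - x₀) * (1 + x ^ 2) ^ n) ^ 2 := by positivity
      linarith
    · have h3 : d ^ 2 ≤ (x - x₀) ^ 2 := by
        rw [Real.dist_eq] at h
        rw [← sq_abs (x - x₀)]; gcongr
      have h4 : 1 + x ^ 2 ≤ D * (x - x₀) ^ 2 := by
        have : 1 + 2 * x₀ ^ 2 ≤ (1 + 2 * x₀ ^ 2) / d ^ 2 * (x - x₀) ^ 2 := by
          rw [div_mul_eq_mul_div, le_div_iff₀ (by positivity)]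
          gcongr
        rw [hD, add_mul]
        nlinarith [sq_nonneg (x - 2 * x₀)]
      have h5 : (M + 1) * (1 + x ^ 2) ^ (2 * n + 1) ≤
          (M + 1) * D * ((x - x₀) * (1 + x ^ 2) ^ n) ^ 2 := by
        rw [h2]
        calc (M + 1) * (((1 + x ^ 2) ^ n) ^ 2 * (1 + x ^ 2)) ≤
            (M + 1) * (((1 + x ^ 2) ^ n) ^ 2 * (D * (x - x₀) ^ 2)) := by gcongr
          _ = _ := by ring
      have h6 : min 1 (P.eval x₀ / 2 / R) * (1 + x ^ 2) ^ (2 * n + 1) ≤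
          1 * (1 + x ^ 2) ^ (2 * n + 1) := by gcongr; exact min_le_left _ _
      have := hM x
      linarith

theorem exists_strictPos (hP : P.natDegree ≤ 2 * m)
    (h : (P.natDegree = 2 * m ∧ ∀ x, 0 < P.eval x) ∨ ∃ j, 0 < β j ∧
      (Even m ∨ (∃ j', j ≠ j' ∧ 0 < β j') ∨ ∃ x₀, 0 < P.eval x₀)) :
    ∃ g : ι → ℝ[X], (∀ i, (g i).natDegree ≤ m) ∧ StrictPos m (P + qf β g) := by
  rcases h with ⟨h1, h2⟩ | ⟨j, hj, h⟩
  · exact ⟨0, by simp, by simpa [qf] using strictPos_of_pos h1 h2⟩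
  rcases Nat.even_or_odd m with hm | hm
  · exact exists_strictPos_even hP hm hj
  rcases h with h | ⟨j', hjj, hj'⟩ | ⟨x₀, hx₀⟩
  · exact absurd h (Nat.not_even_iff_odd.2 hm)
  · exact exists_strictPos_two hP hm hjj hj hj'
  · exact exists_strictPos_point hP hm hj hx₀

end

end Pourchet

namespace Pourchet
open Polynomial IsDedekindDomain NumberField

section
variable {k : Type*} [Field k] [NumberField k]

lemma finite_not_nm {A B : k} (hA : A ≠ 0) (hB : B ≠ 0) :
    {v : HeightOneSpectrum (𝓞 k) | ¬ Nm (toComp v A) (toComp v B)}.Finite := by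
  refine (((finite_fabs_ne_one (two_ne_zero (α := k))).union (finite_fabs_ne_one hA)).union
    (finite_fabs_ne_one hB)).subset fun v hv => ?_
  by_contra hc
  simp only [Set.mem_union, Set.mem_ofPred_eq, not_or, not_not] at hc
  obtain ⟨⟨h2, h3⟩, h4⟩ := hc
  refine hv ?_
  have h2' : ‖(2 : v.adicCompletion k)‖ = 1 := by rw [← h2, ← norm_toComp, map_ofNat]
  have h := nm_of_iso3 (two_ne_zero) one_ne_zero (neg_ne_zero.2 ((_root_.map_ne_zero (toComp v)).2 hA))
    (iso3_of_units h2' (norm_one) (b := -toComp v A) (c := -toComp v B)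
      (by rw [norm_neg, norm_toComp, h3]) (by rw [norm_neg, norm_toComp, h4]))
  simpa using h

lemma nm_real {a b : ℝ} (ha : a ≠ 0) (h : ¬ (a < 0 ∧ b < 0)) : Nm a b := by
  by_cases h1 : a < 0
  · have hb : 0 ≤ b := not_lt.1 fun h2 => h ⟨h1, h2⟩
    exact ⟨Real.sqrt b, 0, by rw [Real.sq_sqrt hb]; ring⟩
  · exact nm_of_isSquare two_ne_zero ha ⟨Real.sqrt a, (Real.mul_self_sqrt (not_lt.1 h1)).symm⟩ b

lemma nf_nonneg {a b : ℝ} (ha : a ≤ 0) (hb : b ≤ 0) (x : Fin 4 → ℝ) : 0 ≤ nf a b x := by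
  have h1 := mul_nonneg (neg_nonneg.2 ha) (sq_nonneg (x 1))
  have h2 := mul_nonneg (neg_nonneg.2 hb) (sq_nonneg (x 2))
  have h3 := mul_nonneg (mul_nonneg_of_nonpos_of_nonpos ha hb) (sq_nonneg (x 3))
  have h4 := sq_nonneg (x 0)
  simp only [nf]
  linarith

lemma nm_toComp_of_locIso {A B : k} (hA : A ≠ 0) {v : HeightOneSpectrum (𝓞 k)}
    (h : LocIso v (quat A B)) : Nm (toComp v A) (toComp v B) := by
  have := h.iso
  rw [quat_map] at this
  exact nm_of_iso_quat two_ne_zero ((_root_.map_ne_zero (toComp v)).2 hA) this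

/-- A nonzero element of a number field which has the right signs at the real places is
represented by the norm form of a quaternion algebra. -/
lemma exists_nf_eq {A B c : k} (hA : A ≠ 0) (hB : B ≠ 0) (hc : c ≠ 0) (hN : ¬ Nm A B)
    (hs : ∀ s : k →+* ℝ, s A < 0 → s B < 0 → 0 < s c) : ∃ x, nf A B x = c := by
  have hm : Iso fun o : Option (Fin 4) => o.elim (-c) (quat A B) := by
    refine meyer (by simp) (fun o => ?_) fun s => ?_
    · cases o with
      | none => simpa
      | some j => exact quat_ne_zero hA hB j
    have h1 : 0 < s ((some 0 : Option (Fin 4)).elim (-c) (quat A B)) := by simp [quat]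
    refine ⟨⟨_, h1⟩, ?_⟩
    by_cases h : s A < 0 ∧ s B < 0
    · exact ⟨none, by simpa using hs s h.1 h.2⟩
    have hA' : s A ≠ 0 := (_root_.map_ne_zero s).2 hA
    have hB' : s B ≠ 0 := (_root_.map_ne_zero s).2 hB
    by_cases h2 : s A < 0
    · refine ⟨some 2, ?_⟩
      have : 0 < s B := (not_lt.1 fun h3 => h ⟨h2, h3⟩).lt_of_ne' hB'
      simpa [quat]
    · refine ⟨some 1, ?_⟩
      have : 0 < s A := (not_lt.1 h2).lt_of_ne' hA'
      simpa [quat]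
  obtain ⟨x, hx, h⟩ := hm
  rw [Fintype.sum_option] at h
  simp only [Option.elim_none, Option.elim_some] at h
  have h0 : x none ≠ 0 := by
    intro h0
    refine hN (nm_of_iso_quat two_ne_zero hA ⟨fun j => x (some j), fun h1 => hx ?_, ?_⟩)
    · ext o
      cases o with
      | none => exact h0
      | some j => exact congrFun h1 j
    · simpa [h0] using h
  refine ⟨fun j => x (some j) / x none, ?_⟩
  rw [← sum_quat]
  have : ∀ j, quat A B j * (x (some j) / x none) ^ 2 = quat A B j * x (some j) ^ 2 / x none ^ 2 :=
    fun j => by rw [div_pow, mul_div_assoc]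
  simp only [this]
  rw [← Finset.sum_div, div_eq_iff (pow_ne_zero 2 h0)]
  linear_combination h

end

section
variable {k : Type} [Field k] [NumberField k]

/-- Local-global principle for splitting a quaternion algebra over the residue field of an
irreducible polynomial. -/
lemma splitMod_of_local {A B : k} (hA : A ≠ 0) (hB : B ≠ 0) {h : k[X]}
    (hf : ∀ v : HeightOneSpectrum (𝓞 k), ¬ Nm (toComp v A) (toComp v B) →
      ∀ (L : Type) [Field L] [NumberField L] (i : k →+* L)
        (w : HeightOneSpectrum (𝓞 L)) (θ : L), under i w = v → eval₂ i θ h = 0 →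
        LocIso w (i ∘ quat A B))
    (hr : ∀ s : k →+* ℝ, s A < 0 → s B < 0 → ∀ x, (h.map s).eval x ≠ 0) {p : k[X]}
    (hp : Irreducible p) (hph : p ∣ h) : SplitMod A B p := by
  have : Fact (Irreducible p) := ⟨hp⟩
  have : Module.Finite k (AdjoinRoot p) := (AdjoinRoot.powerBasis hp.ne_zero).finite
  have : CharZero (AdjoinRoot p) := charZero_of_injective_algebraMap (algebraMap k _).injective
  have : IsScalarTower ℚ k (AdjoinRoot p) := IsScalarTower.of_algebraMap_eq fun q => by simp
  have : NumberField (AdjoinRoot p) :=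
    { to_charZero := inferInstance
      to_finiteDimensional := Module.Finite.trans k (AdjoinRoot p) }
  set i : k →+* AdjoinRoot p := algebraMap k (AdjoinRoot p) with hi
  have hroot : eval₂ i (AdjoinRoot.root p) h = 0 := by
    obtain ⟨q, rfl⟩ := hph
    rw [eval₂_mul]
    rw [show eval₂ i (AdjoinRoot.root p) p = 0 from AdjoinRoot.eval₂_root p, zero_mul]
  have hA' : i A ≠ 0 := (_root_.map_ne_zero i).2 hA
  have hB' : i B ≠ 0 := (_root_.map_ne_zero i).2 hB
  have hN : Nm (i A) (i B) := by
    refine hasse_norm hA' hB' (fun w => ?_) fun s => ?_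
    · refine nm_toComp_of_locIso hA' ?_
      rw [← quat_map]
      by_cases hv : Nm (toComp (under i w) A) (toComp (under i w) B)
      · refine LocIso.above i (Iso.locIso (quat_ne_zero hA hB) ?_)
        rw [quat_map]
        exact iso_quat_of_nm hv
      · exact hf _ hv _ i w _ rfl hroot
    · refine nm_real ((_root_.map_ne_zero s).2 hA') fun hs => ?_
      refine hr (s.comp i) hs.1 hs.2 (s (AdjoinRoot.root p)) ?_
      rw [eval_map, ← hom_eval₂, hroot, map_zero]
  have := splitMod_of_nm (AdjoinRoot.adjoinRoot_eq_top (f := p)) hN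
  rw [AdjoinRoot.minpoly_root hp.ne_zero] at this
  exact this.of_dvd (dvd_mul_right _ _)

theorem exists_nf_poly {A B c : k} (hA : A ≠ 0) (hB : B ≠ 0) (hc : c ≠ 0) (hN : ¬ Nm A B)
    {h : k[X]} (h0 : h ≠ 0)
    (hf : ∀ v : HeightOneSpectrum (𝓞 k), ¬ Nm (toComp v A) (toComp v B) →
      ∀ (L : Type) [Field L] [NumberField L] (i : k →+* L)
        (w : HeightOneSpectrum (𝓞 L)) (θ : L), under i w = v → eval₂ i θ h = 0 →
        LocIso w (i ∘ quat A B))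
    (hr : ∀ s : k →+* ℝ, s A < 0 → s B < 0 → ∀ x, 0 < s c * (h.map s).eval x) :
    ∃ x, h = C c * nf (C A) (C B) x := by
  obtain ⟨l, d, x, hl, hd, hx⟩ := normRep_of_splitMod two_ne_zero hA hN h0 fun p hp hph =>
    splitMod_of_local hA hB hf (fun s h1 h2 y h3 => by
      have := hr s h1 h2 y; rw [h3, mul_zero] at this; exact this.false) hp hph
  obtain ⟨y, hy⟩ := exists_nf_eq (c := c * l) hA hB (mul_ne_zero hc hl) hN fun s hsA hsB => by
    obtain ⟨x₀, hx₀⟩ := exists_eval_ne_zero_of_natDegree_lt_card (d.map s)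
      ((Polynomial.map_ne_zero_iff s.injective).2 hd)
      (Cardinal.natCast_lt_aleph0.trans_le (Cardinal.aleph0_le_mk ℝ))
    have h1 := congrArg (eval₂ s x₀) hx
    simp only [eval₂_mul, eval₂_pow, eval₂_C, eval₂_nf] at h1
    simp only [← eval_map] at h1
    have h2 := nf_nonneg hsA.le hsB.le (fun j => eval x₀ ((x j).map s))
    rw [← h1] at h2
    have h3 := hr s hsA hsB x₀
    have h4 : 0 < (d.map s).eval x₀ ^ 2 := by positivity
    have h5 : 0 ≤ s l * (h.map s).eval x₀ := nonneg_of_mul_nonneg_left h2 h4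
    have h6 : s c * s l ≠ 0 := mul_ne_zero ((_root_.map_ne_zero s).2 hc) ((_root_.map_ne_zero s).2 hl)
    rw [map_mul]
    refine h6.symm.lt_of_le ?_
    by_contra! h7
    nlinarith [mul_nonneg h3.le h5, mul_self_pos.2 (show eval x₀ (h.map s) ≠ 0 by rintro h8; simp [h8] at h3)]
  obtain ⟨z, hz⟩ := exists_nf_mul (C A) (C B) (fun j => C (y j)) x
  have hy' : nf (C A) (C B) (fun j => C (y j)) = C (c * l) := by
    rw [← hy]; simp [nf]
  obtain ⟨g, hg⟩ := cassels_pfister (a := fun j => c * quat A B j) two_ne_zero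
    (fun j => mul_ne_zero hc (quat_ne_zero hA hB j)) (f := h) (d := C (c * l) * d) (n := z)
    (mul_ne_zero (by simpa using ⟨hc, hl⟩) hd) (by
      have e : qf (fun j => c * quat A B j) z = C c * nf (C A) (C B) z := by
        rw [← qf_quat, qf, qf, Finset.mul_sum]
        simp [mul_assoc]
      rw [e, ← hz, hy', ← hx, C_mul]; ring)
  refine ⟨g, ?_⟩
  rw [hg, ← qf_quat, qf, qf, Finset.mul_sum]
  simp [mul_assoc]

end

end Pourchet

namespace Pourchet
open Polynomial IsDedekindDomain NumberField

section
variable {R S : Type*} [CommRing R] [CommRing S] {m : ℕ}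

/-- The polynomial of degree at most `m` with given coefficients. -/
noncomputable def polyOf (y : Fin (m + 1) → R) : R[X] := ∑ j, C (y j) * X ^ (j : ℕ)

lemma natDegree_polyOf_le (y : Fin (m + 1) → R) : (polyOf y).natDegree ≤ m :=
  natDegree_sum_le_of_forall_le _ _ fun j _ => (natDegree_C_mul_X_pow_le _ _).trans (by omega)

lemma polyOf_coeff {g : R[X]} (hg : g.natDegree ≤ m) :
    polyOf (fun j : Fin (m + 1) => g.coeff j) = g := by
  rw [polyOf, Fin.sum_univ_eq_sum_range (fun j => C (g.coeff j) * X ^ j),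
    ← as_sum_range_C_mul_X_pow' g (Nat.lt_succ_of_le hg)]

lemma map_polyOf (s : R →+* S) (y : Fin (m + 1) → R) : (polyOf y).map s = polyOf (s ∘ y) := by
  simp [polyOf, Polynomial.map_sum]

end

section
variable {K E O : Type*} [Field K] [Field E] [Fintype O] {m : ℕ}

/-- The difference of `F` and the values of a diagonal form at polynomials of degree at most `m`
with given coefficients. -/
noncomputable def resid (F : K[X]) (α : O → K) (y : O × Fin (m + 1) → K) : K[X] :=
  F - qf α fun o => polyOf fun j => y (o, j)

lemma natDegree_resid_le {F : K[X]} (hF : F.natDegree ≤ 2 * m) (α : O → K)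
    (y : O × Fin (m + 1) → K) : (resid F α y).natDegree ≤ 2 * m :=
  sub_natDegree_le hF (natDegree_qf_le fun _ => natDegree_polyOf_le _)

lemma map_resid (s : K →+* E) (F : K[X]) (α : O → K) (y : O × Fin (m + 1) → K) :
    (resid F α y).map s = resid (F.map s) (s ∘ α) (s ∘ y) := by
  rw [resid, Polynomial.map_sub, qf_map, resid]
  simp only [map_polyOf]
  rfl

lemma resid_coeff (F : K[X]) (α : O → K) {g : O → K[X]} (hg : ∀ o, (g o).natDegree ≤ m) :
    resid F α (fun oj : O × Fin (m + 1) => (g oj.1).coeff oj.2) = F - qf α g := by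
  rw [resid]
  simp only [polyOf_coeff (hg _)]

lemma continuous_resid_coeff [TopologicalSpace K] [IsTopologicalRing K] (F : K[X]) (α : O → K)
    (l : ℕ) : Continuous fun y : O × Fin (m + 1) → K => (resid F α y).coeff l := by
  have h1 : ∀ (o : O) (n : ℕ), Continuous fun y : O × Fin (m + 1) → K =>
      (polyOf fun j => y (o, j)).coeff n := by
    intro o n
    simp only [polyOf, finsetSum_coeff, coeff_C_mul]
    fun_prop
  simp only [resid, coeff_sub, qf, finsetSum_coeff, pow_two, coeff_mul]
  fun_prop

end

section
variable {k : Type} [Field k] [NumberField k]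

theorem exists_eq_qf_add_nf {A B c : k} (hA : A ≠ 0) (hB : B ≠ 0) (hc : c ≠ 0) (hN : ¬ Nm A B)
    {m : ℕ} {F : k[X]} (hF : F.Separable) (hFm : F.natDegree = 2 * m)
    {O : Type} [Fintype O] [DecidableEq O] (α : O → k) {o : O} (ho : α o = 1)
    (hr : ∀ s : k →+* ℝ, s A < 0 → s B < 0 → ∃ g : O → ℝ[X], (∀ i, (g i).natDegree ≤ m) ∧
      StrictPos m (C (s c) * (F.map s - qf (s ∘ α) g))) :
    ∃ (g : O → k[X]) (x : Fin 4 → k[X]), F = qf α g + C c * nf (C A) (C B) x := by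
  classical
  have hfin : ∀ v : HeightOneSpectrum (𝓞 k), ∃ U : Set (O × Fin (m + 1) → v.adicCompletion k),
      IsOpen U ∧ U.Nonempty ∧ (¬ Nm (toComp v A) (toComp v B) → ∀ y : O × Fin (m + 1) → k,
        toComp v ∘ y ∈ U → (resid F α y).coeff (2 * m) ≠ 0 ∧
          ∀ (L : Type) [Field L] [NumberField L] (i : k →+* L)
            (w : HeightOneSpectrum (𝓞 L)) (θ : L), under i w = v → eval₂ i θ (resid F α y) = 0 →
            LocIso w (i ∘ quat A B)) := by
    intro v
    by_cases hv : Nm (toComp v A) (toComp v B)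
    · exact ⟨Set.univ, isOpen_univ, Set.univ_nonempty, fun h => absurd hv h⟩
    have hd : (F.map (toComp v)).natDegree = 2 * m := by rw [natDegree_map, hFm]
    obtain ⟨g, hg, e, he, h⟩ := (exists_squareNorm ((_root_.map_ne_zero (toComp v)).2 hA)
      ((_root_.map_ne_zero (toComp v)).2 hB) hv (hF.map (f := toComp v)).squarefree
      (hF.map (f := toComp v)).ne_zero hd).exists_nhd hA hB hd.le
    refine ⟨{y | ∀ l ∈ Finset.range (2 * m + 1), ‖(resid (F.map (toComp v)) (toComp v ∘ α) y).coeff l -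
      (F.map (toComp v) - g ^ 2).coeff l‖ < e}, ?_, ?_, fun _ y hy => ?_⟩
    · rw [Set.ofPred_forall]
      simp only [Set.ofPred_forall]
      refine isOpen_biInter_finset fun l _ => ?_
      have := continuous_resid_coeff (m := m) (F.map (toComp v)) (toComp v ∘ α) l
      exact isOpen_lt (by fun_prop) continuous_const
    · have hg' : ∀ i, ((Pi.single o g : O → (v.adicCompletion k)[X]) i).natDegree ≤ m := by
        intro i
        rcases eq_or_ne i o with rfl | hi
        · simpa
        · simp [hi]
      refine ⟨fun oj => ((Pi.single o g : O → (v.adicCompletion k)[X]) oj.1).coeff oj.2, fun l _ => ?_⟩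
      rw [resid_coeff _ _ hg', qf, Finset.sum_eq_single o]
      · simpa [ho]
      · intro i _ hi; simp [hi]
      · simp
    · refine h _ (natDegree_resid_le hFm.le α y) fun l hl => ?_
      have := hy l (by simp; omega)
      rwa [← map_resid, coeff_map] at this
  have hreal : ∀ s : k →+* ℝ, ∃ V : Set (O × Fin (m + 1) → ℝ), IsOpen V ∧ V.Nonempty ∧
      (s A < 0 → s B < 0 → ∀ y : O × Fin (m + 1) → k, s ∘ y ∈ V →
        ∀ x, 0 < s c * ((resid F α y).map s).eval x) := by
    intro s
    by_cases hs : s A < 0 ∧ s B < 0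
    · obtain ⟨g, hg, h⟩ := hr s hs.1 hs.2
      have hd : (F.map s).natDegree ≤ 2 * m := by rw [natDegree_map, hFm]
      refine ⟨{y | StrictPos m (C (s c) * resid (F.map s) (s ∘ α) y)}, ?_, ?_, fun _ _ y hy x => ?_⟩
      · refine isOpen_strictPos (fun y => (natDegree_C_mul_le _ _).trans
          (natDegree_resid_le hd _ y)) fun l => ?_
        have := continuous_resid_coeff (m := m) (F.map s) (s ∘ α) l
        simp only [coeff_C_mul]
        fun_prop
      · refine ⟨fun oj => (g oj.1).coeff oj.2, ?_⟩
        rw [Set.mem_ofPred_eq, resid_coeff _ _ hg]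
        exact h
      · have h1 : StrictPos m _ := hy
        rw [← map_resid] at h1
        have := h1.pos x
        rwa [eval_mul, eval_C] at this
    · exact ⟨Set.univ, isOpen_univ, Set.univ_nonempty, fun h1 h2 => absurd ⟨h1, h2⟩ hs⟩
  choose U hU hUne hUg using hfin
  choose V hV hVne hVg using hreal
  obtain ⟨y, hy1, hy2⟩ := weak_approx_open (finite_not_nm hA hB).toFinset U hU hUne V hV hVne
  have hy1' : ∀ v, ¬ Nm (toComp v A) (toComp v B) → toComp v ∘ y ∈ U v := fun v hv =>
    hy1 v (by simpa using hv)
  have h0 : resid F α y ≠ 0 := by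
    intro h0
    refine hN (hasse_norm hA hB (fun v => ?_) fun s => ?_)
    · by_contra hv
      exact (hUg v hv y (hy1' v hv)).1 (by rw [h0, coeff_zero])
    · refine nm_real ((_root_.map_ne_zero s).2 hA) fun hs => ?_
      have := hVg s hs.1 hs.2 y (hy2 s) 0
      simp [h0] at this
  obtain ⟨x, hx⟩ := exists_nf_poly hA hB hc hN h0 (fun v hv => (hUg v hv y (hy1' v hv)).2)
    fun s h1 h2 => hVg s h1 h2 y (hy2 s)
  exact ⟨_, x, by rw [← hx, resid, add_sub_cancel]⟩

end

end Pourchet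

namespace Pourchet
open Polynomial IsDedekindDomain NumberField

section signs
variable {k ι : Type*} [Field k] [Fintype ι] {a e : ι → k} {δ c A B : k} {s : k →+* ℝ}

lemma mul_nonneg_of_orthogonal (hA : s A < 0) (hB : s B < 0)
    (h3 : ∀ w : ι → k, ∑ i, a i * e i * w i = 0 → ∃ x, ∑ i, a i * w i ^ 2 = c * nf A B x)
    {w : ι → k} (hw : ∑ i, a i * e i * w i = 0) :
    0 ≤ s (δ * c) * s (δ * ∑ i, a i * w i ^ 2) := by
  obtain ⟨x, hx⟩ := h3 w hw
  have h := nf_nonneg hA.le hB.le (s ∘ x)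
  have hn : nf (s A) (s B) (s ∘ x) = s (nf A B x) := by simp [nf]
  rw [hn] at h
  rw [hx, ← map_mul, show δ * c * (δ * (c * nf A B x)) = (δ * c) ^ 2 * nf A B x by ring, map_mul,
    map_pow]
  positivity

lemma forall_pos_of_orthogonal (hδ : δ ≠ 0) (ha : ∀ i, a i ≠ 0) (he : ∑ i, a i * e i ^ 2 = δ)
    (hA : s A < 0) (hB : s B < 0)
    (h3 : ∀ w : ι → k, ∑ i, a i * e i * w i = 0 → ∃ x, ∑ i, a i * w i ^ 2 = c * nf A B x)
    (hc : 0 < s (δ * c)) (l : ι) : 0 < s (δ * a l) := by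
  classical
  let t := a l * e l / δ
  let w : ι → k := fun i => (if i = l then 1 else 0) - t * e i
  have hw : ∑ i, a i * e i * w i = 0 := by
    have : ∀ i, a i * e i * w i = (if i = l then a i * e i else 0) - t * (a i * e i ^ 2) := by
      intro i; simp only [w]; split_ifs <;> ring
    simp only [this, Finset.sum_sub_distrib, ← Finset.mul_sum, he]
    simp [t, hδ]
  have hw2 : ∑ i, a i * w i ^ 2 = a l - 2 * t * (a l * e l) + t ^ 2 * δ := by
    have : ∀ i, a i * w i ^ 2 = (if i = l then a i - 2 * t * (a i * e i) else 0)
        + t ^ 2 * (a i * e i ^ 2) := by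
      intro i; simp only [w]; split_ifs <;> ring
    simp only [this, Finset.sum_add_distrib, ← Finset.mul_sum, he]
    simp
  have h := mul_nonneg_of_orthogonal (δ := δ) hA hB h3 hw
  have h' : 0 ≤ s (δ * ∑ i, a i * w i ^ 2) := nonneg_of_mul_nonneg_right h hc
  have heq : δ * a l = δ * (∑ i, a i * w i ^ 2) + (a l * e l) ^ 2 := by
    rw [hw2]; simp only [t]; field_simp; ring
  refine lt_of_le_of_ne ?_ ((_root_.map_ne_zero s).2 (mul_ne_zero hδ (ha l))).symm
  rw [heq, map_add, map_pow]
  positivity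

lemma existsUnique_pos_of_orthogonal (hδ : δ ≠ 0) (ha : ∀ i, a i ≠ 0)
    (he : ∑ i, a i * e i ^ 2 = δ) (hA : s A < 0) (hB : s B < 0)
    (h3 : ∀ w : ι → k, ∑ i, a i * e i * w i = 0 → ∃ x, ∑ i, a i * w i ^ 2 = c * nf A B x)
    (hc : s (δ * c) < 0) : ∃ i, 0 < s (δ * a i) ∧ ∀ j, j ≠ i → s (δ * a j) < 0 := by
  classical
  have hδ' : s δ ≠ 0 := (_root_.map_ne_zero s).2 hδ
  have hE : ∃ i, 0 < s (δ * a i) := by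
    by_contra! hcon
    have h1 : s (δ * ∑ i, a i * e i ^ 2) ≤ 0 := by
      rw [Finset.mul_sum, map_sum]
      refine Finset.sum_nonpos fun i _ => ?_
      rw [← mul_assoc, map_mul, map_pow]
      exact mul_nonpos_of_nonpos_of_nonneg (hcon i) (sq_nonneg _)
    rw [he, map_mul] at h1
    exact absurd (mul_self_pos.2 hδ') (not_lt.2 h1)
  have key : ∀ w : ι → k, ∑ i, a i * e i * w i = 0 → s (δ * ∑ i, a i * w i ^ 2) ≤ 0 :=
    fun w hw => nonpos_of_mul_nonneg_right (mul_nonneg_of_orthogonal hA hB h3 hw) hc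
  have hz : ∀ i, 0 < s (δ * a i) → e i ≠ 0 := by
    intro i hi h0
    have := key (fun l => if l = i then 1 else 0) (by simp [h0])
    simp at this
    simp at hi
    linarith
  obtain ⟨i, hi⟩ := hE
  refine ⟨i, hi, fun j hj => ?_⟩
  by_contra hcon
  have hj' : 0 < s (δ * a j) := lt_of_le_of_ne (not_lt.1 hcon)
    ((_root_.map_ne_zero s).2 (mul_ne_zero hδ (ha j))).symm
  let w : ι → k := fun l => if l = i then a j * e j else if l = j then - (a i * e i) else 0
  have hwi : w i = a j * e j := by simp [w]
  have hwj : w j = - (a i * e i) := by simp [w, hj]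
  have hw0 : ∀ l, l ≠ i ∧ l ≠ j → w l = 0 := fun l hl => by simp [w, hl.1, hl.2]
  have h := key w (by
    rw [Fintype.sum_eq_add i j hj.symm fun l hl => by rw [hw0 l hl, mul_zero], hwi, hwj]; ring)
  rw [Fintype.sum_eq_add i j hj.symm fun l hl => by rw [hw0 l hl]; ring, hwi, hwj] at h
  have hpos : 0 < s (δ * a i) * s (δ * a j) * (s (δ * a j) * s (e j) ^ 2 + s (δ * a i) * s (e i) ^ 2) := by
    have := sq_pos_of_ne_zero ((_root_.map_ne_zero s).2 (hz i hi))
    positivity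
  have heq : s (δ * a i) * s (δ * a j) * (s (δ * a j) * s (e j) ^ 2 + s (δ * a i) * s (e i) ^ 2) =
      s δ ^ 2 * s (δ * (a i * (a j * e j) ^ 2 + a j * (- (a i * e i)) ^ 2)) := by
    simp only [map_mul, map_add, map_pow, map_neg]; ring
  rw [heq] at hpos
  exact absurd (pos_of_mul_pos_right hpos (sq_nonneg _)) (not_lt.2 h)

end signs

lemma pos_of_nonneg_of_separable {p : ℝ[X]} (hp : p.Separable) (h : ∀ x, 0 ≤ p.eval x) (x : ℝ) :
    0 < p.eval x := by
  refine lt_of_le_of_ne (h x) fun h0 => ?_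
  have hm : IsLocalMin (fun y => p.eval y) x :=
    Filter.Eventually.of_forall fun y => h0.symm.trans_le (h y)
  have hd := hm.hasDerivAt_eq_zero (p.hasDerivAt x)
  obtain ⟨u, v, huv⟩ := hp
  have := congrArg (eval x) huv
  simp [← h0, hd] at this

/-- Condition (B) of the theorem at a real place, for the form `⟨a i⟩` and the polynomial `f`,
up to strictness; it is invariant under simultaneous sign change. -/
def RealCond {ι : Type*} (m : ℕ) (a : ι → ℝ) (f : ℝ[X]) : Prop :=
  ((∀ i, 0 < a i) → ∀ x, 0 < f.eval x) ∧ ((∀ i, a i < 0) → ∀ x, f.eval x < 0) ∧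
    (Even m ∨ ((∀ i, a i < 0 → (∀ j, j ≠ i → 0 < a j) → ∃ x, 0 < f.eval x) ∧
      (∀ i, 0 < a i → (∀ j, j ≠ i → a j < 0) → ∃ x, f.eval x < 0)))

lemma RealCond.mul {ι : Type*} {m : ℕ} {a : ι → ℝ} {f : ℝ[X]} (h : RealCond m a f) {d : ℝ}
    (hd : d ≠ 0) : RealCond m (fun i => d * a i) (C d * f) := by
  obtain ⟨h1, h2, h3⟩ := h
  rcases hd.lt_or_gt with hd | hd
  · have hp : ∀ y, 0 < d * y ↔ y < 0 := fun y => ⟨fun h => by nlinarith, fun h => mul_pos_of_neg_of_neg hd h⟩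
    have hn : ∀ y, d * y < 0 ↔ 0 < y := fun y => ⟨fun h => by nlinarith, mul_neg_of_neg_of_pos hd⟩
    simp only [RealCond, eval_mul, eval_C, hp, hn]
    exact ⟨h2, h1, h3.imp_right And.symm⟩
  · have hn : ∀ y, d * y < 0 ↔ y < 0 := fun y => ⟨fun h => by nlinarith, mul_neg_of_pos_of_neg hd⟩
    simp only [RealCond, eval_mul, eval_C, mul_pos_iff_of_pos_left hd, hn]
    exact ⟨h1, h2, h3⟩

end Pourchet

namespace Pourchet
open Polynomial IsDedekindDomain NumberField

lemma exists_strictPos_of_realCond {ι κ : Type*} [Fintype κ] {m : ℕ} {a : ι → ℝ} {b : κ → ℝ}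
    {f : ℝ[X]} (hfm : f.natDegree = 2 * m) (h : RealCond m (Sum.elim a b) f)
    (hb : ∀ j, b j ≠ 0) {c : ℝ} (hc : c ≠ 0) (hpos : 0 < c → ∀ i, 0 < a i)
    (hneg : c < 0 → ∃ i, 0 < a i ∧ ∀ j, j ≠ i → a j < 0) :
    ∃ g : Option κ → ℝ[X], (∀ o, (g o).natDegree ≤ m) ∧
      StrictPos m (C c * (f - qf (fun o : Option κ => o.elim 1 b) g)) := by
  classical
  have hdeg : (C c * f).natDegree = 2 * m := by rw [natDegree_C_mul hc, hfm]
  have heq : ∀ g : Option κ → ℝ[X], C c * (f - qf (fun o : Option κ => o.elim 1 b) g) =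
      C c * f + qf (fun o : Option κ => - c * o.elim 1 b) g := by
    intro g
    have : qf (fun o : Option κ => - c * o.elim 1 b) g =
        - C c * qf (fun o : Option κ => o.elim 1 b) g := by
      rw [qf, qf, Finset.mul_sum]
      refine Finset.sum_congr rfl fun o _ => ?_
      rw [C_mul, C_neg, mul_assoc]
    rw [this]; ring
  simp only [heq]
  obtain ⟨h1, -, h3⟩ := h
  refine exists_strictPos hdeg.le ?_
  rcases hc.lt_or_gt with hc | hc
  · obtain ⟨i, hi, hi'⟩ := hneg hc
    refine Or.inr ⟨none, by simpa using hc, ?_⟩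
    by_cases hj : ∃ j, 0 < b j
    · obtain ⟨j, hj⟩ := hj
      exact Or.inr (Or.inl ⟨some j, by simp, mul_pos (neg_pos.2 hc) hj⟩)
    · push Not at hj
      refine h3.imp id fun h3 => Or.inr ?_
      obtain ⟨x, hx⟩ := h3.2 (.inl i) hi (by
        rintro (j | j) hji
        · exact hi' j fun h => hji (by rw [h])
        · exact lt_of_le_of_ne (hj j) (hb j))
      exact ⟨x, by simpa using mul_pos_of_neg_of_neg hc hx⟩
  · have ha := hpos hc
    by_cases hj : ∃ j, b j < 0
    · obtain ⟨j, hj⟩ := hj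
      refine Or.inr ⟨some j, mul_pos_of_neg_of_neg (neg_neg_of_pos hc) hj, h3.imp id fun h3 => ?_⟩
      by_cases hl : ∃ l, j ≠ l ∧ b l < 0
      · obtain ⟨l, hl, hl'⟩ := hl
        exact Or.inl ⟨some l, by simpa using hl, mul_pos_of_neg_of_neg (neg_neg_of_pos hc) hl'⟩
      · push Not at hl
        obtain ⟨x, hx⟩ := h3.1 (.inr j) hj (by
          rintro (i | l) hi
          · exact ha i
          · exact lt_of_le_of_ne (hl l fun h => hi (by rw [h])) (hb l).symm)
        exact Or.inr ⟨x, by simpa using mul_pos hc hx⟩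
    · push Not at hj
      refine Or.inl ⟨hdeg, fun x => ?_⟩
      rw [eval_mul, eval_C]
      refine mul_pos hc (h1 ?_ x)
      rintro (i | l)
      · exact ha i
      · exact lt_of_le_of_ne (hj l) (hb l).symm

variable {k : Type} [Field k] [NumberField k]

lemma exists_sum_eq_prod {a : Fin 5 → k} (ha : ∀ i, a i ≠ 0) (hi : ¬ Iso a) :
    ∃ e : Fin 5 → k, ∑ i, a i * e i ^ 2 = ∏ i, a i := by
  have hδ : ∏ i, a i ≠ 0 := Finset.prod_ne_zero_iff.2 fun i _ => ha i
  have hm : Iso fun o : Option (Fin 5) => o.elim (- ∏ i, a i) a := by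
    refine meyer (by simp) (fun o => ?_) fun s => ?_
    · cases o with
      | none => simpa using hδ
      | some j => exact ha j
    · have hne : ∀ i, s (a i) ≠ 0 := fun i => (_root_.map_ne_zero s).2 (ha i)
      by_cases hp : ∀ i, 0 < s (a i)
      · exact ⟨⟨some 0, hp 0⟩, none, by
          simpa [map_prod] using Finset.prod_pos fun i _ => hp i⟩
      · push Not at hp
        obtain ⟨j, hj⟩ := hp
        have hj := lt_of_le_of_ne hj (hne j)
        by_cases hn : ∃ i, 0 < s (a i)
        · obtain ⟨i, hi⟩ := hn
          exact ⟨⟨some i, hi⟩, some j, hj⟩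
        · push Not at hn
          have hn' : ∀ i, 0 < - s (a i) := fun i => neg_pos.2 (lt_of_le_of_ne (hn i) (hne i))
          refine ⟨⟨none, ?_⟩, some j, hj⟩
          have := Finset.prod_pos fun i (_ : i ∈ Finset.univ) => hn' i
          simpa [Finset.prod_neg, map_prod, Odd.neg_one_pow (n := 5) (by decide)] using this
  obtain ⟨x, hx, h⟩ := hm
  rw [Fintype.sum_option] at h
  simp only [Option.elim] at h
  have h0 : x none ≠ 0 := by
    intro h0
    refine hi ⟨fun i => x (some i), fun h' => hx ?_, by simpa [h0] using h⟩
    ext o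
    cases o with
    | none => exact h0
    | some i => exact congrFun h' i
  refine ⟨fun i => x (some i) / x none, ?_⟩
  simp only [div_pow, mul_div_assoc', ← Finset.sum_div]
  rw [div_eq_iff (pow_ne_zero 2 h0)]
  linear_combination h

lemma separable_C_mul {F : Type*} [Field F] {d : F} (hd : d ≠ 0) {f : F[X]} (hf : f.Separable) :
    (C d * f).Separable := by
  have hu : IsUnit (C d : F[X]) := isUnit_C.2 hd.isUnit
  rw [separable_def, derivative_C_mul]
  exact (isCoprime_mul_unit_left hu f _).2 hf

/-- The main representation theorem, for a form split as the sum of a quinary form and a form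
in the remaining variables. -/
theorem exists_qf_of_realCond {κ : Type} [Fintype κ] {a : Fin 5 → k} {b : κ → k}
    (ha : ∀ i, a i ≠ 0) (hb : ∀ i, b i ≠ 0) {m : ℕ} {f : k[X]} (hf : f.Separable)
    (hfm : f.natDegree = 2 * m)
    (hr : ∀ s : k →+* ℝ, RealCond m (s ∘ Sum.elim a b) (f.map s)) :
    ∃ g, f = qf (Sum.elim a b) g := by
  classical
  by_cases hi : Iso a
  · exact (hi.mono (b := Sum.elim a b) .inl Sum.inl_injective fun _ => rfl).universal two_ne_zero C
      (by rintro (i | i); exacts [ha i, hb i]) f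
  obtain ⟨e, he⟩ := exists_sum_eq_prod ha hi
  have hδ : ∏ i, a i ≠ 0 := Finset.prod_ne_zero_iff.2 fun i _ => ha i
  obtain ⟨c, A, B, hc, hA, hB, h2, h3⟩ := exists_quat_decomposition ha hi he
  set δ := ∏ i, a i
  by_cases hN : Nm A B
  · obtain ⟨x, hx⟩ := (iso_quat_of_nm hN).universal two_ne_zero C (quat_ne_zero hA hB) (C c⁻¹ * f)
    obtain ⟨z, hz⟩ := h2 0 x
    refine ⟨Sum.elim z 0, ?_⟩
    rw [qf, Fintype.sum_sum_type]
    simp only [Sum.elim_inl, Sum.elim_inr, Pi.zero_apply, ne_eq, OfNat.ofNat_ne_zero,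
      not_false_eq_true, zero_pow, mul_zero, Finset.sum_const_zero, add_zero]
    change f = qf a z
    rw [hz, ← qf_quat]
    change f = _ + C c * (∑ i, C (quat A B i) * x i ^ 2)
    rw [← hx, ← mul_assoc, ← C_mul, mul_inv_cancel₀ hc]
    simp
  have hu : IsUnit (C δ : k[X]) := isUnit_C.2 hδ.isUnit
  have hF : (C δ * f).Separable := separable_C_mul hδ hf
  obtain ⟨g, x, hg⟩ := exists_eq_qf_add_nf hA hB (mul_ne_zero hδ hc) hN (m := m) hF
    (by rw [natDegree_C_mul hδ, hfm]) (fun o : Option κ => o.elim 1 fun j => δ * b j) (o := none)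
    rfl fun s hsA hsB => by
      have hs := (hr s).mul ((_root_.map_ne_zero s).2 hδ)
      have hsum : (fun i => s δ * (s ∘ Sum.elim a b) i) =
          Sum.elim (fun i => s (δ * a i)) (fun i => s (δ * b i)) := by
        ext (i | i) <;> simp
      rw [hsum] at hs
      have := exists_strictPos_of_realCond (by
          rw [natDegree_C_mul ((_root_.map_ne_zero s).2 hδ), natDegree_map, hfm]) hs
        (fun j => (_root_.map_ne_zero s).2 (mul_ne_zero hδ (hb j)))
        ((_root_.map_ne_zero s).2 (mul_ne_zero hδ hc))
        (forall_pos_of_orthogonal hδ ha he hsA hsB h3)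
        (existsUnique_pos_of_orthogonal hδ ha he hsA hsB h3)
      have hα : s ∘ (fun o : Option κ => o.elim 1 fun j => δ * b j) =
          fun o : Option κ => o.elim 1 fun j => s (δ * b j) := by
        ext o; cases o <;> simp
      rwa [hα, Polynomial.map_mul, map_C]
  obtain ⟨z, hz⟩ := h2 (C δ⁻¹ * g none) x
  refine ⟨Sum.elim z fun j => g (some j), ?_⟩
  rw [qf, Fintype.sum_sum_type]
  simp only [Sum.elim_inl, Sum.elim_inr]
  change f = qf a z + _
  rw [hz]
  refine hu.mul_left_cancel ?_
  rw [hg, qf, Fintype.sum_option]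
  simp only [Option.elim, C_mul, map_one, mul_assoc, ← Finset.mul_sum]
  have hδ' : C δ * C δ⁻¹ = (1 : k[X]) := by rw [← C_mul, mul_inv_cancel₀ hδ, C_1]
  linear_combination - (C δ * C δ⁻¹ + 1) * (g none) ^ 2 * hδ'

lemma card_filter_eq_one {ι : Type*} [Fintype ι] {p : ι → Prop} [DecidablePred p] {i : ι}
    (hi : p i) (h : ∀ j, j ≠ i → ¬ p j) : (Finset.univ.filter p).card = 1 := by
  refine Finset.card_eq_one.2 ⟨i, Finset.ext fun j => ?_⟩
  simp only [Finset.mem_filter, Finset.mem_univ, true_and, Finset.mem_singleton]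
  exact ⟨fun hj => by_contra fun hji => h j hji hj, fun hj => hj ▸ hi⟩

theorem rep_of_conditions {ι : Type} [Fintype ι] (hι : 5 ≤ Fintype.card ι) {a : ι → k}
    (ha : ∀ i, a i ≠ 0) {f : k[X]} (hf : f.Separable)
    (h : (∀ σ : k →+* ℝ, (∃ i, 0 < σ (a i)) ∧ (∃ j, σ (a j) < 0)) ∨
        ((∀ σ : k →+* ℝ, (∀ i, 0 < σ (a i)) → ∀ x : ℝ, 0 ≤ (f.map σ).eval x) ∧
         (∀ σ : k →+* ℝ, (∀ i, σ (a i) < 0) → ∀ x : ℝ, (f.map σ).eval x ≤ 0) ∧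
         ((4 ∣ f.natDegree) ∨
           ((∀ σ : k →+* ℝ, (Finset.univ.filter fun i => σ (a i) < 0).card = 1 →
               ∃ x : ℝ, 0 < (f.map σ).eval x) ∧
            (∀ σ : k →+* ℝ, (Finset.univ.filter fun i => 0 < σ (a i)).card = 1 →
               ∃ x : ℝ, (f.map σ).eval x < 0))))) : ∃ g, f = qf a g := by
  by_cases hind : ∀ σ : k →+* ℝ, (∃ i, 0 < σ (a i)) ∧ (∃ j, σ (a j) < 0)
  · exact (meyer hι ha hind).universal two_ne_zero C ha f
  obtain ⟨h1, h2, h3⟩ := h.resolve_left hind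
  have hne : ∀ (σ : k →+* ℝ) i, σ (a i) ≠ 0 := fun σ i => (_root_.map_ne_zero σ).2 (ha i)
  have h1' : ∀ σ : k →+* ℝ, (∀ i, 0 < σ (a i)) → ∀ x : ℝ, 0 < (f.map σ).eval x :=
    fun σ hσ => pos_of_nonneg_of_separable hf.map (h1 σ hσ)
  have h2' : ∀ σ : k →+* ℝ, (∀ i, σ (a i) < 0) → ∀ x : ℝ, (f.map σ).eval x < 0 := by
    intro σ hσ x
    have := pos_of_nonneg_of_separable (separable_C_mul (neg_ne_zero.2 one_ne_zero) (hf.map (f := σ)))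
      (fun x => by simpa using h2 σ hσ x) x
    simpa using this
  have hev : Even f.natDegree := by
    push Not at hind
    obtain ⟨σ, hσ⟩ := hind
    rw [← natDegree_map σ]
    refine even_natDegree_of_no_root fun x => ?_
    by_cases hp : ∃ i, 0 < σ (a i)
    · exact (h1' σ (fun i => lt_of_le_of_ne (hσ hp i) (hne σ i).symm) x).ne'
    · push Not at hp
      exact (h2' σ (fun i => lt_of_le_of_ne (hp i) (hne σ i)) x).ne
  obtain ⟨m, hm⟩ := hev.two_dvd
  obtain ⟨n, hn⟩ := Nat.exists_eq_add_of_le hι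
  let e : Fin 5 ⊕ Fin n ≃ ι := Fintype.equivOfCardEq (by simp; omega)
  have hsum : Sum.elim (fun i => a (e (.inl i))) (fun i => a (e (.inr i))) = a ∘ e := by
    ext (i | i) <;> rfl
  obtain ⟨g, hg⟩ := exists_qf_of_realCond (a := fun i => a (e (.inl i)))
    (b := fun i => a (e (.inr i))) (fun _ => ha _) (fun _ => ha _) hf hm (by
      intro s
      rw [hsum]
      refine ⟨fun hs => h1' s fun i => ?_, fun hs => h2' s fun i => ?_, ?_⟩
      · simpa using hs (e.symm i)
      · simpa using hs (e.symm i)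
      · refine h3.imp (fun h4 => ?_) fun h4 => ⟨fun i hi hj => ?_, fun i hi hj => ?_⟩
        · rw [even_iff_two_dvd]; omega
        · refine h4.1 s (card_filter_eq_one (i := e i) hi fun j hji => not_lt.2 ?_)
          simpa using (hj (e.symm j) fun h => hji (by rw [← h, e.apply_symm_apply])).le
        · refine h4.2 s (card_filter_eq_one (i := e i) hi fun j hji => not_lt.2 ?_)
          simpa using (hj (e.symm j) fun h => hji (by rw [← h, e.apply_symm_apply])).le)
  rw [hsum] at hg
  refine ⟨g ∘ e.symm, hg.trans ?_⟩
  rw [qf, qf, ← e.sum_comp]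
  simp

end Pourchet

theorem pourchet_representation_ratFunc
    (k : Type) [Field k] [NumberField k]
    (r : ℕ) (hr : 5 ≤ r)
    (a : Fin r → k) (ha : ∀ i, a i ≠ 0)
    (f : Polynomial k) (hf : f.Separable) :
    [ -- (A) representation over k[t]
      (∃ g : Fin r → Polynomial k, f = ∑ i, Polynomial.C (a i) * g i ^ 2),
      -- (A') representation over k(t)
      (∃ g : Fin r → RatFunc k,
        algebraMap (Polynomial k) (RatFunc k) f =
          ∑ i, algebraMap (Polynomial k) (RatFunc k) (Polynomial.C (a i)) * g i ^ 2),
      -- (B)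
      ((∀ σ : k →+* ℝ, (∃ i, 0 < σ (a i)) ∧ (∃ j, σ (a j) < 0)) ∨
        ((∀ σ : k →+* ℝ, (∀ i, 0 < σ (a i)) → ∀ x : ℝ, 0 ≤ (f.map σ).eval x) ∧
         (∀ σ : k →+* ℝ, (∀ i, σ (a i) < 0) → ∀ x : ℝ, (f.map σ).eval x ≤ 0) ∧
         ((4 ∣ f.natDegree) ∨
           ((∀ σ : k →+* ℝ, (Finset.univ.filter fun i => σ (a i) < 0).card = 1 →
               ∃ x : ℝ, 0 < (f.map σ).eval x) ∧
            (∀ σ : k →+* ℝ, (Finset.univ.filter fun i => 0 < σ (a i)).card = 1 →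
               ∃ x : ℝ, (f.map σ).eval x < 0)))))].TFAE := by
  tfae_have 1 → 2 := fun ⟨g, hg⟩ =>
    ⟨fun i => algebraMap _ _ (g i), by rw [hg, map_sum]; simp only [map_mul, map_pow]⟩
  tfae_have 2 → 1 := fun ⟨g, hg⟩ => Pourchet.exists_qf_of_ratFunc two_ne_zero ha hg
  tfae_have 1 → 3 := fun ⟨g, hg⟩ => Pourchet.conditions_of_rep ha hf hg
  tfae_have 3 → 1 := fun h => Pourchet.rep_of_conditions (by simpa using hr) ha hf h
  tfae_finish
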